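/- Let F₂(n) denote the largest cardinality of a Sidon set contained in {1,2,…,n}. Then F₂(n) = n^{1/2} + O(n^{1/3}), i.e., there exists a constant C > 0 such that |F₂(n) − √n| ≤ C·n^{1/3} for all positive integers n. -/

import Mathlib

/-- A finite set `S` of positive integers is a Sidon set if all sums
`s_i + s_j` with `s_i ≤ s_j` are distinct. -/
def IsSidonSet (S : Finset ℕ) : Prop :=
  ∀ a ∈ S, ∀ b ∈ S, ∀ c ∈ S, ∀ d ∈ S,
    a ≤ b → c ≤ d → a + b = c + d → a = c ∧ b = d

/-- `F₂ n` is the largest cardinality of a Sidon set contained in `{1, 2, …, n}`. -/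
noncomputable def F2 (n : ℕ) : ℕ :=
  sSup {k : ℕ | ∃ S : Finset ℕ, S ⊆ Finset.Icc 1 n ∧ IsSidonSet S ∧ S.card = k}

lemma sidon_diff {S : Finset ℕ} (hS : IsSidonSet S) {a b c d : ℕ} (ha : a ∈ S) (hb : b ∈ S)
    (hc : c ∈ S) (hd : d ∈ S) (hne : a ≠ b) (h : a + d = c + b) : a = c ∧ b = d := by
  have key := hS
  rcases le_total a d with h1 | h1 <;> rcases le_total c b with h2 | h2
  · have := hS a ha d hd c hc b hb h1 h2 h; omega
  · have := hS a ha d hd b hb c hc h1 h2 (by omega); omega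
  · have := hS d hd a ha c hc b hb h1 h2 (by omega); omega
  · have := hS d hd a ha b hb c hc h1 h2 (by omega); omega

lemma sidon_windows (S : Finset ℕ) (n u : ℕ) (hSn : S ⊆ Finset.Icc 1 n) (hS : IsSidonSet S) :
    (S.card * u) ^ 2 ≤ (n + u) * (S.card * u + u ^ 2) := by
  classical
  set A : ℕ → Finset ℕ := fun m => S.filter (fun s => s ≤ m ∧ m < s + u) with hA
  have h1 : ∑ m ∈ Finset.range (n + u), (A m).card = S.card * u := by
    simp only [hA, Finset.card_filter]
    rw [Finset.sum_comm]
    rw [← smul_eq_mul, ← Finset.sum_const]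
    apply Finset.sum_congr rfl
    intro s hs
    have := Finset.mem_Icc.1 (hSn hs)
    rw [← Finset.card_filter]
    have : (Finset.range (n + u)).filter (fun m => s ≤ m ∧ m < s + u) = Finset.Ico s (s + u) := by
      ext m; simp only [Finset.mem_filter, Finset.mem_range, Finset.mem_Ico]; omega
    rw [this]; simp
  have h2 : ∑ m ∈ Finset.range (n + u), (A m).card ^ 2 ≤ S.card * u + u ^ 2 := by
    have e : ∀ m, (A m).card ^ 2 = (A m).card + (A m).offDiag.card := by
      intro m
      rw [Finset.offDiag_card]
      have : (A m).card ≤ (A m).card * (A m).card := Nat.le_mul_self _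
      rw [sq]; omega
    rw [Finset.sum_congr rfl (fun m _ => e m), Finset.sum_add_distrib, h1]
    gcongr
    rw [← Finset.card_sigma]
    have : u ^ 2 = (Finset.range u ×ˢ Finset.range u).card := by simp [sq]
    rw [this]
    apply Finset.card_le_card_of_injOn (fun x => (x.1 - x.2.1, x.1 - x.2.2))
    · rintro ⟨m, a, b⟩ h
      simp only [hA, Finset.coe_sigma, Set.mem_sigma_iff, Finset.mem_coe, Finset.mem_range, Finset.mem_offDiag, Finset.mem_filter, Finset.coe_product, Set.mem_prod] at h ⊢
      omega
    · rintro ⟨m, a, b⟩ h ⟨m', c, d⟩ h' heq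
      simp only [hA, Finset.coe_sigma, Set.mem_sigma_iff, Finset.mem_coe, Finset.mem_range, Finset.mem_offDiag, Finset.mem_filter, Prod.mk.injEq] at h h' heq
      have := sidon_diff hS h.2.1.1 h.2.2.1.1 h'.2.1.1 h'.2.2.1.1 h.2.2.2 (by omega)
      obtain ⟨rfl, rfl⟩ := this
      have : m = m' := by omega
      subst this; rfl
  calc (S.card * u) ^ 2 = (∑ m ∈ Finset.range (n + u), (A m).card) ^ 2 := by rw [h1]
    _ ≤ (Finset.range (n + u)).card * ∑ m ∈ Finset.range (n + u), (A m).card ^ 2 :=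
        sq_sum_le_card_mul_sum_sq
    _ ≤ _ := by rw [Finset.card_range]; gcongr

lemma sidon_upper (S : Finset ℕ) (n : ℕ) (hn : 0 < n) (hSn : S ⊆ Finset.Icc 1 n) (hS : IsSidonSet S) :
    (S.card : ℝ) ≤ Real.sqrt n + 3 * (n : ℝ) ^ ((1 : ℝ) / 3) := by
  set c : ℝ := (n : ℝ) ^ ((1 : ℝ) / 3) with hc
  have hn1 : (1 : ℝ) ≤ n := by exact_mod_cast hn
  have hc1 : 1 ≤ c := Real.one_le_rpow hn1 (by norm_num)
  have hc3 : c ^ 3 = n := by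
    rw [hc, ← Real.rpow_natCast, ← Real.rpow_mul (by positivity)]; norm_num
  set u : ℕ := ⌈c ^ 2⌉₊ with hu
  have hu1 : c ^ 2 ≤ u := Nat.le_ceil _
  have hu2 : (u : ℝ) ≤ 2 * c ^ 2 := by
    have := Nat.ceil_lt_add_one (a := c ^ 2) (by positivity)
    nlinarith
  have hup : (0 : ℝ) < u := by nlinarith
  set k : ℝ := (S.card : ℝ) with hk
  have hk0 : 0 ≤ k := by positivity
  have hw : (k * u) ^ 2 ≤ (n + u) * (k * u + u ^ 2) := by
    have h := sidon_windows S n u hSn hS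
    rw [hk]; exact_mod_cast h
  have hw2 : k ^ 2 * u ≤ (n + u) * (k + u) := by
    have : (k ^ 2 * u) * u ≤ ((n + u) * (k + u)) * u := by nlinarith
    exact le_of_mul_le_mul_right this hup
  -- n ≤ c*u
  have hnu : (n : ℝ) ≤ c * u := by rw [← hc3]; nlinarith
  have hw3 : k ^ 2 ≤ (c + 1) * k + n + u := by
    have : k ^ 2 * u ≤ ((c + 1) * k + n + u) * u := by
      have : (n : ℝ) * k ≤ c * u * k := by gcongr
      nlinarith
    exact le_of_mul_le_mul_right this hup
  set r := Real.sqrt n with hr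
  have hr2 : r ^ 2 = n := Real.sq_sqrt (by positivity)
  have hr0 : 0 ≤ r := Real.sqrt_nonneg _
  have hrc : c ≤ r := by
    apply Real.le_sqrt_of_sq_le
    rw [← hc3]; nlinarith [pow_pos (by linarith : 0 < c) 2]
  by_contra hcon
  push Not at hcon
  nlinarith [mul_nonneg hr0 (by linarith : 0 ≤ c)]

set_option linter.all false

section
lemma ruzsa (p n : ℕ) (hp : p.Prime) (hpn : p * p ≤ n) :
    ∃ S : Finset ℕ, S ⊆ Finset.Icc 1 n ∧ IsSidonSet S ∧ S.card = p - 1 := by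
  classical
  have := Fact.mk hp
  have hp2 := hp.two_le
  obtain ⟨g, hg⟩ := IsCyclic.exists_generator (α := (ZMod p)ˣ)
  have hord : orderOf g = p - 1 := by
    rw [orderOf_eq_card_of_forall_mem_zpowers hg, Nat.card_eq_fintype_card, ZMod.card_units]
  have co : Nat.Coprime (p - 1) p := by
    have := (Nat.coprime_self_sub_left (m := 1) (n := p) (by omega)).2 (by simp)
    exact this
  let a : ℕ → ℕ := fun i => (Nat.chineseRemainder co i ((g : ZMod p) ^ i).val : ℕ)
  have ha1 : ∀ i, a i ≡ i [MOD (p - 1)] := fun i => (Nat.chineseRemainder co i ((g : ZMod p) ^ i).val).2.1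
  have ha2 : ∀ i, ((a i : ℕ) : ZMod p) = (g : ZMod p) ^ i := by
    intro i
    have := (Nat.chineseRemainder co i ((g : ZMod p) ^ i).val).2.2
    have h := (ZMod.natCast_eq_natCast_iff _ _ _).2 this
    rw [ZMod.natCast_zmod_val] at h
    exact h
  have halt : ∀ i, a i < (p - 1) * p := fun i =>
    Nat.chineseRemainder_lt_mul co _ _ (by omega) (by omega)
  have hinj : ∀ i < p - 1, ∀ j < p - 1, a i = a j → i = j := by
    intro i hi j hj h
    have h1 := (ha1 i).symm.trans (h ▸ ha1 j)
    exact Nat.ModEq.eq_of_lt_of_lt h1 hi hj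
  refine ⟨(Finset.range (p - 1)).image (fun i => a i + 1), ?_, ?_, ?_⟩
  · intro x hx
    obtain ⟨i, _, rfl⟩ := Finset.mem_image.1 hx
    have := halt i
    have : (p - 1) * p ≤ p * p := Nat.mul_le_mul_right _ (by omega)
    simp only [Finset.mem_Icc]; omega
  · intro x hx y hy z hz w hw hxy hzw hs
    obtain ⟨i, hi, rfl⟩ := Finset.mem_image.1 hx
    obtain ⟨j, hj, rfl⟩ := Finset.mem_image.1 hy
    obtain ⟨k, hk, rfl⟩ := Finset.mem_image.1 hz
    obtain ⟨l, hl, rfl⟩ := Finset.mem_image.1 hw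
    rw [Finset.mem_range] at hi hj hk hl
    have hs' : a i + a j = a k + a l := by omega
    have hmod : i + j ≡ k + l [MOD (p - 1)] :=
      ((ha1 i).add (ha1 j)).symm.trans (hs' ▸ (ha1 k).add (ha1 l))
    have hprod : (g : ZMod p) ^ i * (g : ZMod p) ^ j = (g : ZMod p) ^ k * (g : ZMod p) ^ l := by
      rw [← pow_add, ← pow_add]
      have : g ^ (i + j) = g ^ (k + l) := by
        rw [pow_eq_pow_iff_modEq, hord]; exact hmod
      exact_mod_cast congrArg Units.val this
    have hsum : (g : ZMod p) ^ i + (g : ZMod p) ^ j = (g : ZMod p) ^ k + (g : ZMod p) ^ l := by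
      have := congrArg (Nat.cast : ℕ → ZMod p) hs'
      push_cast at this
      simpa only [ha2] using this
    have hz : ((g : ZMod p) ^ i - (g : ZMod p) ^ k) * ((g : ZMod p) ^ i - (g : ZMod p) ^ l) = 0 := by
      linear_combination (g : ZMod p) ^ i * hsum - hprod
    have hpow : ∀ m < p - 1, (g : ZMod p) ^ i = (g : ZMod p) ^ m → i = m := by
      intro m hm h
      have : g ^ i = g ^ m := by ext; push_cast; exact h
      rw [pow_eq_pow_iff_modEq, hord] at this
      exact Nat.ModEq.eq_of_lt_of_lt this hi hm
    rcases mul_eq_zero.1 hz with h | h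
    · have := hpow k hk (sub_eq_zero.1 h); subst this; omega
    · have := hpow l hl (sub_eq_zero.1 h); subst this; omega
  · rw [Finset.card_image_of_injOn, Finset.card_range]
    intro i hi j hj h
    simp only [Finset.coe_range, Set.mem_Iio] at hi hj
    exact hinj i hi j hj (by simpa using h)

lemma F2_bdd (n : ℕ) : BddAbove {k : ℕ | ∃ S : Finset ℕ, S ⊆ Finset.Icc 1 n ∧ IsSidonSet S ∧ S.card = k} := by
  refine ⟨n, ?_⟩
  rintro k ⟨S, hS, _, rfl⟩
  simpa using Finset.card_le_card hS

lemma F2_upper (n : ℕ) (hn : 0 < n) : (F2 n : ℝ) ≤ Real.sqrt n + 3 * (n : ℝ) ^ ((1 : ℝ) / 3) := by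
  have hne : {k : ℕ | ∃ S : Finset ℕ, S ⊆ Finset.Icc 1 n ∧ IsSidonSet S ∧ S.card = k}.Nonempty :=
    ⟨0, ∅, by simp, by intro a ha; simp at ha, by simp⟩
  obtain ⟨S, h1, h2, h3⟩ := Nat.sSup_mem hne (F2_bdd n)
  have := sidon_upper S n hn h1 h2
  rw [h3] at this; exact this

lemma F2_lower (p n : ℕ) (hp : p.Prime) (hpn : p * p ≤ n) : p - 1 ≤ F2 n :=
  le_csSup (F2_bdd n) (ruzsa p n hp hpn)

/-- The final deduction from short prime gaps. -/
lemma F2_of_gaps (C : ℝ) (X0 : ℝ) (h : ∀ x : ℝ, X0 ≤ x → ∃ p : ℕ, p.Prime ∧ |(p : ℝ) - x| ≤ C * x ^ ((2 : ℝ) / 3)) :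
    ∃ C : ℝ, 0 < C ∧ ∀ n : ℕ, 0 < n →
      |(F2 n : ℝ) - Real.sqrt n| ≤ C * (n : ℝ) ^ ((1 : ℝ) / 3) := by
  set C1 : ℝ := max C 1 with hC1
  have hC1' : 1 ≤ C1 := le_max_right _ _
  refine ⟨2 * C1 + 3 + 2 * |X0|, by positivity, ?_⟩
  intro n hn
  have hn1 : (1 : ℝ) ≤ n := by exact_mod_cast hn
  set c : ℝ := (n : ℝ) ^ ((1 : ℝ) / 3) with hc
  have hc1 : 1 ≤ c := Real.one_le_rpow hn1 (by norm_num)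
  set r := Real.sqrt n with hr
  have hr2 : r ^ 2 = n := Real.sq_sqrt (by positivity)
  have hr0 : 0 ≤ r := Real.sqrt_nonneg _
  have hrc : r ^ ((2 : ℝ) / 3) = c := by
    rw [hr, Real.sqrt_eq_rpow, ← Real.rpow_mul (by positivity), hc]; norm_num
  have hX := abs_nonneg X0
  have hup := F2_upper n hn
  rw [abs_le]; constructor
  swap
  · nlinarith
  by_cases hbig : |X0| ≤ r - C1 * c
  · obtain ⟨p, hp, hpx⟩ := h (r - C1 * c) ((le_abs_self _).trans hbig)
    have hle : (r - C1 * c) ^ ((2 : ℝ) / 3) ≤ c := by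
      refine (Real.rpow_le_rpow (hX.trans hbig) (?_ : _ ≤ r) (by norm_num)).trans hrc.le
      nlinarith
    have h0 : 0 ≤ (r - C1 * c) ^ ((2 : ℝ) / 3) := Real.rpow_nonneg (hX.trans hbig) _
    have h3 : C * (r - C1 * c) ^ ((2 : ℝ) / 3) ≤ C1 * c :=
      (mul_le_mul_of_nonneg_right (le_max_left _ _) h0).trans
        (mul_le_mul_of_nonneg_left hle (by linarith))
    have h4 := abs_le.1 (hpx.trans h3)
    have hpr : (p : ℝ) ≤ r := by linarith
    have hpp : p * p ≤ n := by
      have : (p : ℝ) * p ≤ n := by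
        rw [← hr2, sq]; exact mul_le_mul hpr hpr (by positivity) hr0
      exact_mod_cast this
    have h5 := F2_lower p n hp hpp
    have h6 : (p : ℝ) ≤ F2 n + 1 := by
      have : p ≤ F2 n + 1 := by omega
      exact_mod_cast this
    nlinarith
  · push Not at hbig
    have : (0 : ℝ) ≤ F2 n := by positivity
    nlinarith

end

section
/-- primes in `[w, z)` -/
noncomputable def pr (w z : ℝ) : Finset ℕ := (Finset.range ⌈z⌉₊).filter (fun p => p.Prime ∧ w ≤ (p : ℝ))

lemma mem_pr {w z : ℝ} {p : ℕ} : p ∈ pr w z ↔ p.Prime ∧ w ≤ p ∧ (p : ℝ) < z := by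
  simp only [pr, Finset.mem_filter, Finset.mem_range, Nat.lt_ceil]; tauto

lemma mertens1 (n : ℕ) (hn : 1 ≤ n) :
    ∑ p ∈ (Finset.Icc 1 n).filter Nat.Prime, Real.log p / p ≤ Real.log n + Real.log 4 := by
  classical
  set P := (Finset.Icc 1 n).filter Nat.Prime with hP
  have h1 : ∑ p ∈ P, Real.log p * (n / p : ℕ) ≤ n * Real.log n := by
    have e : ∀ p ∈ P, Real.log p * (n / p : ℕ) = ∑ m ∈ Finset.Icc 1 n, if p ∣ m then Real.log p else 0 := by
      intro p hp
      have : (n / p) = ((Finset.Ioc 0 n).filter (fun m => p ∣ m)).card := by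
        rw [Nat.Ioc_filter_dvd_card_eq_div]
      rw [this, ← Finset.sum_filter, Finset.sum_const, nsmul_eq_mul, mul_comm]
      rfl
    rw [Finset.sum_congr rfl e, Finset.sum_comm]
    calc _ ≤ ∑ m ∈ Finset.Icc 1 n, Real.log n := by
          apply Finset.sum_le_sum
          intro m hm
          rw [Finset.mem_Icc] at hm
          have hmpos : (0 : ℝ) < m := by exact_mod_cast hm.1
          rw [← Finset.sum_filter]
          calc ∑ p ∈ P.filter (fun p => p ∣ m), Real.log p ≤ ∑ p ∈ m.primeFactors, Real.log p := by
                apply Finset.sum_le_sum_of_subset_of_nonneg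
                · intro p hp
                  simp only [hP, Finset.mem_filter] at hp
                  exact Nat.mem_primeFactors.2 ⟨hp.1.2, hp.2, by omega⟩
                · intro p _ _; exact Real.log_natCast_nonneg p
            _ = Real.log (∏ p ∈ m.primeFactors, (p : ℝ)) := by
                rw [Real.log_prod]
                intro p hp
                exact_mod_cast (Nat.prime_of_mem_primeFactors hp).ne_zero
            _ ≤ Real.log m := by
                apply Real.log_le_log
                · apply Finset.prod_pos; intro p hp
                  exact_mod_cast (Nat.prime_of_mem_primeFactors hp).pos
                · rw [← Nat.cast_prod]
                  exact Nat.cast_le.2 (Nat.le_of_dvd (by omega) (Nat.prod_primeFactors_dvd m))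
            _ ≤ Real.log n := Real.log_le_log hmpos (by exact_mod_cast hm.2)
      _ = n * Real.log n := by simp
  have h2 : ∑ p ∈ P, Real.log p ≤ Real.log 4 * n := by
    have := Chebyshev.theta_le_log4_mul_x (x := (n : ℝ)) (by positivity)
    refine le_trans (le_of_eq ?_) this
    rw [Chebyshev.theta, Nat.floor_natCast]
    rfl
  have hnpos : (0 : ℝ) < n := by exact_mod_cast hn
  have h3 : (∑ p ∈ P, Real.log p / p) * n ≤ (Real.log n + Real.log 4) * n := by
    rw [Finset.sum_mul]
    calc _ ≤ ∑ p ∈ P, (Real.log p * (n / p : ℕ) + Real.log p) := by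
          apply Finset.sum_le_sum
          intro p hp
          have hpp : 0 < p := ((Finset.mem_filter.1 hp).2).pos
          have hpp' : (0 : ℝ) < p := by exact_mod_cast hpp
          have h4 : (n : ℝ) / p ≤ (n / p : ℕ) + 1 := by
            rw [← Nat.floor_div_eq_div (K := ℝ)]; exact (Nat.lt_floor_add_one _).le
          have h5 := Real.log_natCast_nonneg p
          calc Real.log p / p * n = Real.log p * (n / p) := by ring
            _ ≤ Real.log p * ((n / p : ℕ) + 1) := by gcongr
            _ = _ := by ring
      _ ≤ _ := by rw [Finset.sum_add_distrib]; linarith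
  exact le_of_mul_le_mul_right h3 hnpos

lemma sum_inv_pr_le {w z : ℝ} (hw : 1 < w) (hz : 1 ≤ z) :
    ∑ p ∈ pr w z, (1 : ℝ) / p ≤ (Real.log z + Real.log 4) / Real.log w := by
  have hlw : 0 < Real.log w := Real.log_pos hw
  rw [le_div_iff₀ hlw, Finset.sum_mul]
  have hn : 1 ≤ ⌊z⌋₊ := Nat.le_floor (by exact_mod_cast hz)
  calc _ ≤ ∑ p ∈ pr w z, Real.log p / p := by
        apply Finset.sum_le_sum
        intro p hp
        rw [mem_pr] at hp
        rw [one_div, inv_mul_eq_div]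
        gcongr
        exact hp.2.1
    _ ≤ ∑ p ∈ (Finset.Icc 1 ⌊z⌋₊).filter Nat.Prime, Real.log p / p := by
        apply Finset.sum_le_sum_of_subset_of_nonneg
        · intro p hp
          rw [mem_pr] at hp
          rw [Finset.mem_filter, Finset.mem_Icc]
          exact ⟨⟨hp.1.pos, Nat.le_floor hp.2.2.le⟩, hp.1⟩
        · intro p _ _; exact div_nonneg (Real.log_natCast_nonneg p) (by positivity)
    _ ≤ Real.log ⌊z⌋₊ + Real.log 4 := mertens1 _ hn
    _ ≤ _ := by
        gcongr
        exact Nat.floor_le (by linarith)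

/-- one block -/
lemma sum_inv_block {w : ℝ} (hw : Real.sqrt 2 ≤ w) : ∑ p ∈ pr w (w ^ 2), (1 : ℝ) / p ≤ 6 := by
  have h1 : 1 < w := lt_of_lt_of_le (by rw [Real.lt_sqrt] <;> norm_num) hw
  have hlw : 0 < Real.log w := Real.log_pos h1
  refine (sum_inv_pr_le h1 (by nlinarith)).trans ?_
  rw [div_le_iff₀ hlw, Real.log_pow]
  have : Real.log 4 = 4 * Real.log (Real.sqrt 2) := by
    rw [Real.log_sqrt (by norm_num), show (4 : ℝ) = 2 ^ 2 by norm_num, Real.log_pow]; push_cast; ring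
  have h2 : Real.log (Real.sqrt 2) ≤ Real.log w := Real.log_le_log (by positivity) hw
  push_cast; linarith

noncomputable def Vz (z : ℝ) : ℝ := ∏ p ∈ pr 0 z, (1 - 1 / (p : ℝ))

lemma Vz_pos (z : ℝ) : 0 < Vz z := by
  apply Finset.prod_pos
  intro p hp
  rw [mem_pr] at hp
  have : (2 : ℝ) ≤ p := by exact_mod_cast hp.1.two_le
  have : 1 / (p : ℝ) ≤ 1 / 2 := by gcongr
  linarith

lemma Vz_le {z : ℝ} (hz : 1 < z) : Vz z ≤ 1 / Real.log z := by
  have hlz := Real.log_pos hz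
  set N := ⌈z⌉₊ with hN
  let f : ℕ →* ℝ := (invMonoidWithZeroHom.toMonoidHom).comp (Nat.castRingHom ℝ).toMonoidHom
  have hf : ∀ n, f n = (n : ℝ)⁻¹ := fun n => rfl
  have hE := EulerProduct.summable_and_hasSum_smoothNumbers_prod_primesBelow_geometric (f := f) (by
    intro p hp
    rw [hf, norm_inv, Real.norm_natCast]
    exact inv_lt_one_of_one_lt₀ (by exact_mod_cast hp.one_lt)) N
  have hprod : ∏ p ∈ N.primesBelow, (1 - f p)⁻¹ = (Vz z)⁻¹ := by
    rw [Vz, ← Finset.prod_inv_distrib]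
    apply Finset.prod_congr
    · ext p; rw [mem_pr, Nat.mem_primesBelow, hN, Nat.lt_ceil]
      have : (0 : ℝ) ≤ p := by positivity
      tauto
    · intro p _; rw [hf, one_div]
  rw [hprod] at hE
  have hsum : Real.log z ≤ (Vz z)⁻¹ := by
    -- finite subset
    have hmem : ∀ n ∈ Finset.Icc 1 (N - 1), n ∈ N.smoothNumbers := by
      intro n hn
      rw [Finset.mem_Icc] at hn
      exact Nat.mem_smoothNumbers_of_lt (by omega) (by omega)
    have h1 := sum_le_hasSum (Finset.subtype (· ∈ N.smoothNumbers) (Finset.Icc 1 (N - 1)))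
      (fun i _ => by rw [hf]; positivity) hE.2
    have h2 : ∑ m ∈ Finset.subtype (· ∈ N.smoothNumbers) (Finset.Icc 1 (N - 1)), f m = ∑ n ∈ Finset.Icc 1 (N - 1), (n : ℝ)⁻¹ := by
      rw [Finset.sum_subtype_of_mem (f := fun n : ℕ => f n) hmem]
      simp [hf]
    have h3 : Real.log z ≤ ∑ n ∈ Finset.Icc 1 (N - 1), (n : ℝ)⁻¹ := by
      have := log_add_one_le_harmonic (N - 1)
      rw [harmonic_eq_sum_Icc] at this
      push_cast at this
      refine le_trans ?_ this
      apply Real.log_le_log (by linarith)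
      have hN1 : 1 ≤ N := Nat.one_le_iff_ne_zero.2 (by
        intro h; rw [hN, Nat.ceil_eq_zero] at h; linarith)
      rw [Nat.cast_sub hN1]
      have := Nat.le_ceil z
      push_cast; linarith
    linarith [h2 ▸ h1]
  rw [le_div_iff₀ hlz]
  have := Vz_pos z
  calc Vz z * Real.log z ≤ Vz z * (Vz z)⁻¹ := by gcongr
    _ = 1 := mul_inv_cancel₀ this.ne'

end

section
/-- elementary symmetric sums -/
noncomputable def esy (k : ℕ) (Q : Finset ℕ) (x : ℕ → ℝ) : ℝ := ∑ T ∈ Q.powersetCard k, ∏ p ∈ T, x p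
/-- truncated alternating sums -/
noncomputable def alt (k : ℕ) (Q : Finset ℕ) (x : ℕ → ℝ) : ℝ := ∑ j ∈ Finset.range (k + 1), (-1) ^ j * esy j Q x

lemma esy_zero (Q : Finset ℕ) (x : ℕ → ℝ) : esy 0 Q x = 1 := by simp [esy]

lemma esy_nonneg (k : ℕ) (Q : Finset ℕ) (x : ℕ → ℝ) (hx : ∀ p ∈ Q, 0 ≤ x p) : 0 ≤ esy k Q x := by
  apply Finset.sum_nonneg; intro T hT
  apply Finset.prod_nonneg; intro p hp
  exact hx p ((Finset.mem_powersetCard.1 hT).1 hp)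

lemma esy_succ_insert (k : ℕ) (Q : Finset ℕ) (p : ℕ) (hp : p ∉ Q) (x : ℕ → ℝ) :
    esy (k + 1) (insert p Q) x = esy (k + 1) Q x + x p * esy k Q x := by
  rw [esy, Finset.powersetCard_succ_insert hp, Finset.sum_union, esy, esy]
  · congr 1
    rw [Finset.sum_image, Finset.mul_sum]
    · apply Finset.sum_congr rfl
      intro T hT
      rw [Finset.prod_insert]
      exact fun h => hp ((Finset.mem_powersetCard.1 hT).1 h)
    · intro T hT T' hT' h
      have h1 : p ∉ T := fun h => hp ((Finset.mem_powersetCard.1 hT).1 h)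
      have h2 : p ∉ T' := fun h => hp ((Finset.mem_powersetCard.1 hT').1 h)
      rw [← Finset.erase_insert h1, ← Finset.erase_insert h2, h]
  · rw [Finset.disjoint_left]
    intro T hT hT'
    obtain ⟨T', _, rfl⟩ := Finset.mem_image.1 hT'
    exact hp ((Finset.mem_powersetCard.1 hT).1 (Finset.mem_insert_self _ _))

lemma alt_zero (Q : Finset ℕ) (x : ℕ → ℝ) : alt 0 Q x = 1 := by simp [alt, esy_zero]

lemma alt_succ (k : ℕ) (Q : Finset ℕ) (x : ℕ → ℝ) :
    alt (k + 1) Q x = alt k Q x + (-1) ^ (k + 1) * esy (k + 1) Q x := by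
  rw [alt, Finset.sum_range_succ]; rfl

lemma alt_succ_insert (k : ℕ) (Q : Finset ℕ) (p : ℕ) (hp : p ∉ Q) (x : ℕ → ℝ) :
    alt (k + 1) (insert p Q) x = alt (k + 1) Q x - x p * alt k Q x := by
  induction k with
  | zero => simp only [alt_succ, alt_zero, zero_add, pow_one]; rw [esy_succ_insert 0 Q p hp, esy_zero]; ring
  | succ k ih =>
    rw [alt_succ, ih, alt_succ (k + 1) Q, alt_succ k Q, esy_succ_insert _ Q p hp]; ring

lemma bonferroni (x : ℕ → ℝ) (Q : Finset ℕ) (hx : ∀ p ∈ Q, 0 ≤ x p ∧ x p ≤ 1) (k : ℕ) :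
    0 ≤ (-1) ^ k * (alt k Q x - ∏ p ∈ Q, (1 - x p)) ∧
    (-1) ^ k * (alt k Q x - ∏ p ∈ Q, (1 - x p)) ≤ esy (k + 1) Q x := by
  induction Q using Finset.induction_on generalizing k with
  | empty =>
    have h : ∀ k, esy (k + 1) ∅ x = 0 := by intro k; rw [esy, Finset.powersetCard_eq_empty.2 (by simp)]; simp
    have h2 : ∀ k, alt k ∅ x = 1 := by
      intro k; induction k with
      | zero => exact alt_zero _ _
      | succ k ih => rw [alt_succ, ih, h]; ring
    simp [h, h2]
  | insert p Q hp ih =>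
    have hxQ : ∀ p ∈ Q, 0 ≤ x p ∧ x p ≤ 1 := fun q hq => hx q (Finset.mem_insert_of_mem hq)
    have hxp := hx p (Finset.mem_insert_self _ _)
    have ih := ih hxQ
    have hpi0 : 0 ≤ ∏ p ∈ Q, (1 - x p) := Finset.prod_nonneg (fun q hq => by linarith [(hxQ q hq).2])
    have hpi1 : ∏ p ∈ Q, (1 - x p) ≤ 1 := Finset.prod_le_one (fun q hq => by linarith [(hxQ q hq).2]) (fun q hq => by linarith [(hxQ q hq).1])
    rw [Finset.prod_insert hp]
    rw [esy_succ_insert _ _ _ hp]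
    cases k with
    | zero =>
      have := ih 0
      rw [alt_zero] at this ⊢
      rw [esy_zero]
      simp only [pow_zero, one_mul, zero_add] at this ⊢
      constructor <;> nlinarith
    | succ k =>
      have h1 := ih (k + 1)
      have h2 := ih k
      rw [alt_succ_insert _ _ _ hp]
      have e : (-1 : ℝ) ^ (k + 1) * (alt (k + 1) Q x - x p * alt k Q x - (1 - x p) * ∏ p ∈ Q, (1 - x p))
        = (-1) ^ (k + 1) * (alt (k + 1) Q x - ∏ p ∈ Q, (1 - x p)) + x p * ((-1) ^ k * (alt k Q x - ∏ p ∈ Q, (1 - x p))) := by ring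
      rw [e]
      constructor
      · have := mul_nonneg hxp.1 h2.1; linarith [h1.1]
      · have := mul_le_mul_of_nonneg_left h2.2 hxp.1; linarith [h1.2]

lemma add_pow_ge (s y : ℝ) (hs : 0 ≤ s) (hy : 0 ≤ y) (n : ℕ) :
    s ^ (n + 1) + (n + 1) * (y * s ^ n) ≤ (s + y) ^ (n + 1) := by
  induction n with
  | zero => simp
  | succ n ih =>
    rw [pow_succ (s + y)]
    have h1 := mul_le_mul_of_nonneg_right ih (by linarith : 0 ≤ s + y)
    refine le_trans ?_ h1
    have : 0 ≤ (n + 1) * (y * s ^ n) * y := by positivity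
    push_cast
    rw [pow_succ s (n + 1), pow_succ s n] at *
    nlinarith

lemma esy_le (k : ℕ) (Q : Finset ℕ) (x : ℕ → ℝ) (hx : ∀ p ∈ Q, 0 ≤ x p) :
    esy k Q x ≤ (∑ p ∈ Q, x p) ^ k / (k.factorial : ℝ) := by
  induction Q using Finset.induction_on generalizing k with
  | empty =>
    cases k with
    | zero => simp [esy_zero]
    | succ k => rw [esy, Finset.powersetCard_eq_empty.2 (by simp)]; simp
  | insert p Q hp ih =>
    have hxQ : ∀ p ∈ Q, 0 ≤ x p := fun q hq => hx q (Finset.mem_insert_of_mem hq)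
    have hxp := hx p (Finset.mem_insert_self _ _)
    cases k with
    | zero => simp [esy_zero]
    | succ k =>
      rw [esy_succ_insert _ _ _ hp, Finset.sum_insert hp]
      have h1 := ih (k + 1) hxQ
      have h2 := mul_le_mul_of_nonneg_left (ih k hxQ) hxp
      have h3 := add_pow_ge (∑ p ∈ Q, x p) (x p) (Finset.sum_nonneg hxQ) hxp k
      have hf : (0 : ℝ) < k.factorial := by positivity
      rw [Nat.factorial_succ] at h1 ⊢
      push_cast at h1 ⊢
      set s := ∑ p ∈ Q, x p
      have e : s ^ (k + 1) / ((k + 1) * (k.factorial : ℝ)) + x p * (s ^ k / k.factorial) = (s ^ (k + 1) + (k + 1) * (x p * s ^ k)) / ((k + 1) * (k.factorial : ℝ)) := by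
        field_simp
      calc _ ≤ _ := add_le_add h1 h2
        _ = _ := e
        _ ≤ _ := by rw [add_comm (x p)]; gcongr

/-- Sieve-type functions. -/
def SRep (Q : Finset ℕ) (f : ℕ → ℝ) (D W M : ℝ) : Prop :=
  ∃ (ι : Type) (_ : Fintype ι) (d : ι → ℕ) (c : ι → ℝ),
    (∀ i, 1 ≤ d i ∧ (d i : ℝ) ≤ D ∧ ∀ p : ℕ, p.Prime → p ∣ d i → p ∈ Q) ∧
    (∀ n, f n = ∑ i, c i * (if d i ∣ n then 1 else 0)) ∧ (∑ i, |c i| ≤ W) ∧ (∑ i, c i / d i = M)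

lemma SRep.mono {Q Q' : Finset ℕ} {f : ℕ → ℝ} {D W M D' W' : ℝ} (h : SRep Q f D W M) (hQ : Q ⊆ Q') (hD : D ≤ D') (hW : W ≤ W') :
    SRep Q' f D' W' M := by
  obtain ⟨ι, _, d, c, h1, h2, h3, h4⟩ := h
  exact ⟨ι, _, d, c, fun i => ⟨(h1 i).1, (h1 i).2.1.trans hD, fun p hp hd => hQ ((h1 i).2.2 p hp hd)⟩, h2, h3.trans hW, h4⟩

lemma SRep.add {Q : Finset ℕ} {f g : ℕ → ℝ} {D W M W' M' : ℝ} (h : SRep Q f D W M) (h' : SRep Q g D W' M') :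
    SRep Q (fun n => f n + g n) D (W + W') (M + M') := by
  obtain ⟨ι, _, d, c, h1, h2, h3, h4⟩ := h
  obtain ⟨κ, _, d', c', h1', h2', h3', h4'⟩ := h'
  refine ⟨ι ⊕ κ, inferInstance, Sum.elim d d', Sum.elim c c', ?_, ?_, ?_, ?_⟩
  · rintro (i | i)
    · exact h1 i
    · exact h1' i
  · intro n; simp only [h2, h2', Fintype.sum_sum_type, Sum.elim_inl, Sum.elim_inr]; rfl
  · rw [Fintype.sum_sum_type]; simp only [Sum.elim_inl, Sum.elim_inr]; linarith
  · rw [Fintype.sum_sum_type]; simp only [Sum.elim_inl, Sum.elim_inr]; rw [h4, h4']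

lemma SRep.mul {Q Q' : Finset ℕ} {f g : ℕ → ℝ} {D W M D' W' M' : ℝ} (hW : 0 ≤ W) (hd : Disjoint Q Q') (h : SRep Q f D W M) (h' : SRep Q' g D' W' M') :
    SRep (Q ∪ Q') (fun n => f n * g n) (D * D') (W * W') (M * M') := by
  obtain ⟨ι, _, d, c, h1, h2, h3, h4⟩ := h
  obtain ⟨κ, _, d', c', h1', h2', h3', h4'⟩ := h'
  refine ⟨ι × κ, inferInstance, fun i => d i.1 * d' i.2, fun i => c i.1 * c' i.2, ?_, ?_, ?_, ?_⟩
  · rintro ⟨i, j⟩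
    refine ⟨Nat.mul_pos (h1 i).1 (h1' j).1, ?_, ?_⟩
    · push_cast
      exact mul_le_mul (h1 i).2.1 (h1' j).2.1 (by positivity) (le_trans (by positivity) (h1 i).2.1)
    · intro p hp hpd
      rcases (Nat.Prime.dvd_mul hp).1 hpd with h | h
      · exact Finset.mem_union_left _ ((h1 i).2.2 p hp h)
      · exact Finset.mem_union_right _ ((h1' j).2.2 p hp h)
  · intro n
    simp only
    rw [h2, h2', Finset.sum_mul_sum, Fintype.sum_prod_type]
    apply Finset.sum_congr rfl; intro i _
    apply Finset.sum_congr rfl; intro j _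
    have hco : Nat.Coprime (d i) (d' j) := by
      apply Nat.coprime_of_dvd
      intro p hp ha hb
      exact Finset.disjoint_left.1 hd ((h1 i).2.2 p hp ha) ((h1' j).2.2 p hp hb)
    have : (d i * d' j ∣ n) ↔ (d i ∣ n ∧ d' j ∣ n) :=
      ⟨fun h => ⟨(Dvd.intro _ rfl).trans h, (Dvd.intro_left _ rfl).trans h⟩, fun h => hco.mul_dvd_of_dvd_of_dvd h.1 h.2⟩
    by_cases ha : d i ∣ n <;> by_cases hb : d' j ∣ n <;> simp [this, ha, hb]
  · rw [Fintype.sum_prod_type]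
    simp only [abs_mul]
    rw [← Finset.sum_mul_sum]
    exact mul_le_mul h3 h3' (Finset.sum_nonneg fun _ _ => abs_nonneg _) hW
  · rw [Fintype.sum_prod_type, ← h4, ← h4', Finset.sum_mul_sum]
    apply Finset.sum_congr rfl; intro i _
    apply Finset.sum_congr rfl; intro j _
    push_cast; rw [div_mul_div_comm]

noncomputable def dv (n p : ℕ) : ℝ := if p ∣ n then 1 else 0

lemma srep_esy (Q : Finset ℕ) (hQ : ∀ p ∈ Q, p.Prime) (z : ℝ) (hz : 1 ≤ z) (hQz : ∀ p ∈ Q, (p : ℝ) ≤ z) (hc : (Q.card : ℝ) + 1 ≤ z) (k : ℕ) :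
    SRep Q (fun n => esy k Q (dv n)) (z ^ k) (Q.card ^ k) (esy k Q (fun p => 1 / (p : ℝ))) := by
  classical
  refine ⟨{T // T ∈ Q.powersetCard k}, inferInstance, fun T => ∏ p ∈ T.1, p, fun _ => 1, ?_, ?_, ?_, ?_⟩
  · rintro ⟨T, hT⟩
    obtain ⟨hT1, hT2⟩ := Finset.mem_powersetCard.1 hT
    refine ⟨Finset.prod_pos fun p hp => (hQ p (hT1 hp)).pos, ?_, ?_⟩
    · push_cast
      calc ∏ p ∈ T, (p : ℝ) ≤ ∏ p ∈ T, z := Finset.prod_le_prod (fun _ _ => by positivity) (fun p hp => hQz p (hT1 hp))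
        _ = z ^ k := by rw [Finset.prod_const, hT2]
    · intro p hp hd
      obtain ⟨q, hq, hpq⟩ := (Prime.dvd_finsetProd_iff hp.prime _).1 hd
      rw [(Nat.prime_dvd_prime_iff_eq hp (hQ q (hT1 hq))).1 hpq]; exact hT1 hq
  · intro n
    simp only [esy]
    rw [← Finset.sum_coe_sort]
    apply Finset.sum_congr rfl
    rintro ⟨T, hT⟩ _
    obtain ⟨hT1, hT2⟩ := Finset.mem_powersetCard.1 hT
    simp only [dv, one_mul]
    rw [Finset.prod_ite_zero]
    congr 1
    · apply propext
      constructor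
      · intro h
        exact Finset.prod_primes_dvd n (fun p hp => (hQ p (hT1 hp)).prime) h
      · intro h p hp; exact (Finset.dvd_prod_of_mem _ hp).trans h
    · simp
  · simp only [abs_one, Finset.sum_const, Finset.card_univ, Fintype.card_coe, Finset.card_powersetCard, nsmul_eq_mul, mul_one]
    exact_mod_cast Nat.choose_le_pow _ _
  · simp only [esy]
    rw [← Finset.sum_coe_sort (Finset.powersetCard k Q)]
    apply Finset.sum_congr rfl
    rintro ⟨T, hT⟩ _
    push_cast
    simp

lemma SRep.smul {Q : Finset ℕ} {f : ℕ → ℝ} {D W M : ℝ} (a : ℝ) (ha : |a| = 1) (h : SRep Q f D W M) :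
    SRep Q (fun n => a * f n) D W (a * M) := by
  obtain ⟨ι, _, d, c, h1, h2, h3, h4⟩ := h
  refine ⟨ι, inferInstance, d, fun i => a * c i, h1, ?_, ?_, ?_⟩
  · intro n; simp only [h2, Finset.mul_sum, mul_assoc]
  · simpa [abs_mul, ha] using h3
  · rw [← h4, Finset.mul_sum]; simp only [mul_div_assoc]

lemma srep_alt (Q : Finset ℕ) (hQ : ∀ p ∈ Q, p.Prime) (z : ℝ) (hz : 1 ≤ z) (hQz : ∀ p ∈ Q, (p : ℝ) ≤ z) (hc : (Q.card : ℝ) + 1 ≤ z) (k : ℕ) :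
    SRep Q (fun n => alt k Q (dv n)) (z ^ k) (z ^ k) (alt k Q (fun p => 1 / (p : ℝ))) := by
  have hc0 : (0 : ℝ) ≤ Q.card := by positivity
  suffices h : SRep Q (fun n => alt k Q (dv n)) (z ^ k) ((Q.card + 1) ^ k) (alt k Q (fun p => 1 / (p : ℝ))) from
    h.mono (le_refl _) le_rfl (by gcongr)
  induction k with
  | zero =>
    simp only [alt_zero]
    have := srep_esy Q hQ z hz hQz hc 0
    simpa [esy_zero] using this
  | succ k ih =>
    simp only [alt_succ]
    refine SRep.mono ((ih.mono le_rfl (by gcongr; omega) le_rfl : SRep Q _ (z ^ (k + 1)) _ _).add ((srep_esy Q hQ z hz hQz hc (k + 1)).smul ((-1) ^ (k + 1)) (by simp))) le_rfl le_rfl ?_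
    rw [pow_succ ((Q.card : ℝ) + 1) k, pow_succ (Q.card : ℝ) k]
    have : (Q.card : ℝ) ^ k ≤ ((Q.card : ℝ) + 1) ^ k := by gcongr; linarith
    nlinarith

end

section
/-- indicator of `z`-rough numbers -/
noncomputable def rho (z : ℝ) (n : ℕ) : ℝ := ∏ p ∈ pr 0 z, (1 - dv n p)

lemma pr_card (w z : ℝ) (hz : 1 ≤ z) : ((pr w z).card : ℝ) + 1 ≤ z := by
  have h : (pr w z) ⊆ Finset.Ico 2 ⌈z⌉₊ := by
    intro p hp
    rw [mem_pr] at hp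
    rw [Finset.mem_Ico]; exact ⟨hp.1.two_le, Nat.lt_ceil.2 hp.2.2⟩
  have h2 := Finset.card_le_card h
  rw [Nat.card_Ico] at h2
  have h3 := Nat.ceil_lt_add_one (a := z) (by linarith)
  by_cases h4 : 2 ≤ ⌈z⌉₊
  · have h5 : (pr w z).card + 2 ≤ ⌈z⌉₊ := by omega
    have h6 : ((pr w z).card : ℝ) + 2 ≤ ⌈z⌉₊ := by exact_mod_cast h5
    linarith
  · have h5 : (pr w z).card = 0 := by omega
    rw [h5]; simpa using hz

lemma pr_split (w z : ℝ) (h0 : 0 ≤ w) (hwz : w ≤ z) : pr 0 z = pr 0 w ∪ pr w z ∧ Disjoint (pr 0 w) (pr w z) := by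
  constructor
  · ext p
    simp only [Finset.mem_union, mem_pr]
    constructor
    · rintro ⟨h1, h2, h3⟩
      rcases lt_or_ge (p : ℝ) w with h | h
      · exact Or.inl ⟨h1, h2, h⟩
      · exact Or.inr ⟨h1, h, h3⟩
    · rintro (⟨h1, h2, h3⟩ | ⟨h1, h2, h3⟩)
      · exact ⟨h1, h2, by linarith⟩
      · exact ⟨h1, by linarith, h3⟩
  · rw [Finset.disjoint_left]
    intro p h1 h2
    rw [mem_pr] at h1 h2; linarith [h1.2.2, h2.2.1]

lemma dv_01 (n p : ℕ) : 0 ≤ dv n p ∧ dv n p ≤ 1 := by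
  unfold dv; split_ifs <;> norm_num

lemma pr_empty {z : ℝ} (hz : z ≤ 2) : pr 0 z = ∅ := by
  rw [Finset.eq_empty_iff_forall_notMem]
  intro p hp
  rw [mem_pr] at hp
  have : (2 : ℝ) ≤ p := by exact_mod_cast hp.1.two_le
  linarith [hp.2.2]

lemma block_prod_lower {w : ℝ} (hw : Real.sqrt 2 ≤ w) :
    Real.exp (-12) ≤ ∏ p ∈ pr w (w ^ 2), (1 - 1 / (p : ℝ)) := by
  have h := sum_inv_block hw
  calc Real.exp (-12) ≤ Real.exp (∑ p ∈ pr w (w ^ 2), (-2) * (1 / (p : ℝ))) := by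
        rw [← Finset.mul_sum]; apply Real.exp_le_exp.2; linarith
    _ = ∏ p ∈ pr w (w ^ 2), Real.exp ((-2) * (1 / (p : ℝ))) := Real.exp_sum _ _
    _ ≤ _ := by
      apply Finset.prod_le_prod
      · intro _ _; positivity
      · intro p hp
        rw [mem_pr] at hp
        have h2 : (2 : ℝ) ≤ p := by exact_mod_cast hp.1.two_le
        have h3 : 1 / (p : ℝ) ≤ 1 / 2 := by gcongr
        have h4 : 0 < 1 / (p : ℝ) := by positivity
        set y := 1 / (p : ℝ)
        have h5 : 1 + 2 * y ≤ Real.exp (2 * y) := by linarith [Real.add_one_le_exp (2 * y)]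
        rw [show -2 * y = -(2 * y) by ring, Real.exp_neg]
        rw [inv_le_iff_one_le_mul₀ (by positivity)]
        nlinarith

lemma exists_b0 : ∃ b0 : ℕ, ∀ b ≥ b0, (6 : ℝ) ^ (2 * b + 1) / ((2 * b + 1).factorial : ℝ) ≤ (1 / 4) ^ b / 10 * Real.exp (-12) := by
  have h := FloorSemiring.tendsto_pow_div_factorial_atTop (12 : ℝ)
  have h2 : ∀ᶠ n in Filter.atTop, (12 : ℝ) ^ n / (n.factorial : ℝ) < Real.exp (-12) / 10 :=
    h.eventually (gt_mem_nhds (by positivity))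
  obtain ⟨N, hN⟩ := Filter.eventually_atTop.1 h2
  refine ⟨N, fun b hb => ?_⟩
  have h3 := hN (2 * b + 1) (by omega)
  have e : (12 : ℝ) ^ (2 * b + 1) = 6 ^ (2 * b + 1) * (2 * 4 ^ b) := by
    rw [show (12 : ℝ) = 6 * 2 by norm_num, mul_pow, pow_succ 2 (2 * b), pow_mul 2]; norm_num; ring
  rw [e] at h3
  have h4 : (0 : ℝ) < 4 ^ b := by positivity
  rw [one_div, inv_pow]
  have h5 : 6 ^ (2 * b + 1) * (2 * 4 ^ b) / ((2 * b + 1).factorial : ℝ) = (6 ^ (2 * b + 1) / ((2 * b + 1).factorial : ℝ)) * 4 ^ b * 2 := by ring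
  rw [h5] at h3
  set X := (6 : ℝ) ^ (2 * b + 1) / ((2 * b + 1).factorial : ℝ) with hX
  have hX0 : 0 < X := by positivity
  have : X * 4 ^ b ≤ Real.exp (-12) / 10 := by nlinarith [mul_pos hX0 h4]
  calc X = X * 4 ^ b * (4 ^ b)⁻¹ := by field_simp
    _ ≤ Real.exp (-12) / 10 * (4 ^ b)⁻¹ := by gcongr
    _ = _ := by ring

/-- Fundamental lemma of the sieve (Brun–Hooley form). -/
theorem FL : ∃ b0 : ℕ, ∀ b ≥ b0, ∀ z : ℝ, 1 ≤ z → ∃ (U E : ℕ → ℝ) (MU ME : ℝ),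
    SRep (pr 0 z) U (z ^ (4 * b + 4)) (z ^ (4 * b + 4)) MU ∧ SRep (pr 0 z) E (z ^ (4 * b + 6)) (z ^ (4 * b + 6)) ME ∧
    (∀ n, 0 ≤ rho z n ∧ rho z n ≤ U n ∧ U n - rho z n ≤ E n) ∧ 0 ≤ MU ∧ 0 ≤ ME ∧
    MU ≤ (1 + (1 / 2) ^ b) * Vz z ∧ ME ≤ (1 / 2) ^ b * Vz z := by
  obtain ⟨b0, hb0⟩ := exists_b0
  refine ⟨b0, ?_⟩
  suffices H : ∀ j : ℕ, ∀ b ≥ b0, ∀ z : ℝ, 1 ≤ z → z ≤ 2 ^ (2 ^ j) → ∃ (U E : ℕ → ℝ) (MU ME : ℝ),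
    SRep (pr 0 z) U (z ^ (4 * b + 4)) (z ^ (4 * b + 4)) MU ∧ SRep (pr 0 z) E (z ^ (4 * b + 6)) (z ^ (4 * b + 6)) ME ∧
    (∀ n, 0 ≤ rho z n ∧ rho z n ≤ U n ∧ U n - rho z n ≤ E n) ∧ 0 ≤ MU ∧ 0 ≤ ME ∧
    MU ≤ (1 + (1 / 2) ^ b) * Vz z ∧ ME ≤ (1 / 2) ^ b * Vz z by
    intro b hb z hz
    refine H ⌈z⌉₊ b hb z hz ?_
    calc z ≤ ⌈z⌉₊ := Nat.le_ceil z
      _ ≤ 2 ^ (2 ^ ⌈z⌉₊) := by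
        have h1 : ⌈z⌉₊ < 2 ^ ⌈z⌉₊ := Nat.lt_two_pow_self
        have h2 : 2 ^ ⌈z⌉₊ < 2 ^ (2 ^ ⌈z⌉₊) := Nat.lt_two_pow_self
        exact_mod_cast (h1.trans h2).le
  have base : ∀ b : ℕ, ∀ z : ℝ, 1 ≤ z → z ≤ 2 → ∃ (U E : ℕ → ℝ) (MU ME : ℝ),
    SRep (pr 0 z) U (z ^ (4 * b + 4)) (z ^ (4 * b + 4)) MU ∧ SRep (pr 0 z) E (z ^ (4 * b + 6)) (z ^ (4 * b + 6)) ME ∧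
    (∀ n, 0 ≤ rho z n ∧ rho z n ≤ U n ∧ U n - rho z n ≤ E n) ∧ 0 ≤ MU ∧ 0 ≤ ME ∧
    MU ≤ (1 + (1 / 2) ^ b) * Vz z ∧ ME ≤ (1 / 2) ^ b * Vz z := by
    intro b z hz hz2
    have he := pr_empty hz2
    have hV : Vz z = 1 := by rw [Vz, he]; simp
    have hr : ∀ n, rho z n = 1 := by intro n; rw [rho, he]; simp
    refine ⟨fun _ => 1, fun _ => 0, 1, 0, ?_, ?_, ?_, by norm_num, le_rfl, ?_, ?_⟩
    · refine ⟨Unit, inferInstance, fun _ => 1, fun _ => 1, ?_, ?_, ?_, ?_⟩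
      · intro _
        refine ⟨le_rfl, by simpa using one_le_pow₀ hz, fun p hp h => ?_⟩
        exact absurd (Nat.dvd_one.1 h) hp.one_lt.ne'
      · intro n; simp
      · simpa using one_le_pow₀ hz
      · simp
    · refine ⟨Empty, inferInstance, fun _ => 1, fun _ => 1, ?_, ?_, ?_, ?_⟩
      · rintro ⟨⟩
      · intro n; simp
      · simp; positivity
      · simp
    · intro n; rw [hr]; norm_num
    · rw [hV]; have : (0 : ℝ) < (1 / 2) ^ b := by positivity
      linarith
    · rw [hV]; positivity
  intro j
  induction j with
  | zero => intro b _ z hz hz2; exact base b z hz (by simpa using hz2)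
  | succ j ih =>
    intro b hb z hz hzj
    rcases le_or_gt z 2 with hz2 | hz2
    · exact base b z hz hz2
    set w := Real.sqrt z with hw
    have hww : w ^ 2 = z := Real.sq_sqrt (by linarith)
    have hw2 : Real.sqrt 2 ≤ w := Real.sqrt_le_sqrt hz2.le
    have hw1 : 1 ≤ w := by rw [hw, Real.one_le_sqrt]; exact hz
    have hwj : w ≤ 2 ^ (2 ^ j) := by
      rw [hw, Real.sqrt_le_left (by positivity), ← pow_mul]
      rw [pow_succ] at hzj; exact hzj
    have hwz : w ≤ z := by nlinarith
    obtain ⟨U', E', MU', ME', hU, hE, hUE, hMU0, hME0, hMU, hME⟩ := ih (b + 1) (by omega) w hw1 hwj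
    obtain ⟨hsplit, hdisj⟩ := pr_split w z (by linarith) hwz
    set Q := pr w z with hQ
    have hQp : ∀ p ∈ Q, p.Prime := fun p hp => (mem_pr.1 hp).1
    have hQz : ∀ p ∈ Q, (p : ℝ) ≤ z := fun p hp => (mem_pr.1 hp).2.2.le
    have hQc := pr_card w z hz
    set v := ∏ p ∈ Q, (1 - 1 / (p : ℝ)) with hv
    have hvlow : Real.exp (-12) ≤ v := by
      have := block_prod_lower hw2; rwa [hww] at this
    have hv0 : 0 < v := (Real.exp_pos _).trans_le hvlow
    have hVz : Vz z = Vz w * v := by rw [Vz, hsplit, Finset.prod_union hdisj]; rfl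
    have hVw := Vz_pos w
    set x : ℕ → ℝ := fun p => 1 / (p : ℝ) with hx
    have hx01 : ∀ p ∈ Q, 0 ≤ x p ∧ x p ≤ 1 := by
      intro p hp
      have : (1 : ℝ) ≤ p := by exact_mod_cast (hQp p hp).one_lt.le
      simp only [hx]
      exact ⟨by positivity, by rw [div_le_one (by linarith)]; exact this⟩
    have hbon := bonferroni x Q hx01 (2 * b)
    rw [pow_mul] at hbon
    norm_num at hbon
    have hes0 : 0 ≤ esy (2 * b + 1) Q x := esy_nonneg _ _ _ (fun p hp => (hx01 p hp).1)
    set τ : ℝ := (1 / 4) ^ b / 10 with hτ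
    have hτ0 : 0 < τ := by positivity
    have hes : esy (2 * b + 1) Q x ≤ τ * v := by
      refine (esy_le _ _ _ (fun p hp => (hx01 p hp).1)).trans ?_
      have h6 : ∑ p ∈ Q, x p ≤ 6 := by have := sum_inv_block hw2; rwa [hww] at this
      have h0 : 0 ≤ ∑ p ∈ Q, x p := Finset.sum_nonneg fun p hp => (hx01 p hp).1
      calc _ ≤ (6 : ℝ) ^ (2 * b + 1) / ((2 * b + 1).factorial : ℝ) := by gcongr
        _ ≤ τ * Real.exp (-12) := hb0 b hb
        _ ≤ τ * v := by gcongr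
    have hMu_low : v ≤ alt (2 * b) Q x := by linarith [hbon.1]
    have hMu_up : alt (2 * b) Q x ≤ v * (1 + τ) := by linarith [hbon.2]
    have ru := srep_alt Q hQp z hz hQz hQc (2 * b)
    have rt := (srep_esy Q hQp z hz hQz hQc (2 * b + 1)).mono le_rfl le_rfl (W' := z ^ (2 * b + 1)) (by
      gcongr; linarith)
    have hpu : ∀ n, 0 ≤ ∏ p ∈ Q, (1 - dv n p) ∧ ∏ p ∈ Q, (1 - dv n p) ≤ alt (2 * b) Q (dv n) ∧
        alt (2 * b) Q (dv n) - ∏ p ∈ Q, (1 - dv n p) ≤ esy (2 * b + 1) Q (dv n) := by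
      intro n
      have h := bonferroni (dv n) Q (fun p _ => dv_01 n p) (2 * b)
      rw [pow_mul] at h
      norm_num at h
      exact ⟨Finset.prod_nonneg fun p _ => by linarith [(dv_01 n p).2], h.1, by linarith [h.2]⟩
    have hrho : ∀ n, rho z n = rho w n * ∏ p ∈ Q, (1 - dv n p) := by
      intro n; rw [rho, hsplit, Finset.prod_union hdisj]; rfl
    refine ⟨fun n => U' n * alt (2 * b) Q (dv n), fun n => E' n * alt (2 * b) Q (dv n) + U' n * esy (2 * b + 1) Q (dv n),
      MU' * alt (2 * b) Q x, ME' * alt (2 * b) Q x + MU' * esy (2 * b + 1) Q x, ?_, ?_, ?_, ?_, ?_, ?_, ?_⟩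
    · have h := SRep.mul (by positivity) hdisj hU ru
      rw [← hsplit] at h
      have e : w ^ (4 * (b + 1) + 4) * z ^ (2 * b) = z ^ (4 * b + 4) := by
        rw [show 4 * (b + 1) + 4 = 2 * (2 * b + 4) by ring, pow_mul, hww, ← pow_add]; congr 1; ring
      rw [e] at h; exact h
    · have h1 := SRep.mul (by positivity) hdisj hE ru
      have h2 := SRep.mul (by positivity) hdisj hU rt
      rw [← hsplit] at h1 h2
      have e1 : w ^ (4 * (b + 1) + 6) * z ^ (2 * b) = z ^ (4 * b + 5) := by
        rw [show 4 * (b + 1) + 6 = 2 * (2 * b + 5) by ring, pow_mul, hww, ← pow_add]; congr 1; ring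
      have e2 : w ^ (4 * (b + 1) + 4) * z ^ (2 * b + 1) = z ^ (4 * b + 5) := by
        rw [show 4 * (b + 1) + 4 = 2 * (2 * b + 4) by ring, pow_mul, hww, ← pow_add]; congr 1; ring
      rw [e1] at h1; rw [e2] at h2
      refine (h1.add h2).mono le_rfl ?_ ?_
      · gcongr <;> omega
      · rw [pow_succ z (4 * b + 5)]; have : 0 < z ^ (4 * b + 5) := by positivity
        nlinarith
    · intro n
      obtain ⟨p1, p2, p3⟩ := hUE n
      obtain ⟨q1, q2, q3⟩ := hpu n
      rw [hrho]
      refine ⟨mul_nonneg p1 q1, mul_le_mul p2 q2 q1 (p1.trans p2), ?_⟩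
      set a := ∏ p ∈ Q, (1 - dv n p)
      set u := alt (2 * b) Q (dv n)
      set t := esy (2 * b + 1) Q (dv n)
      have r1 : (U' n - rho w n) * u ≤ E' n * u := mul_le_mul_of_nonneg_right p3 (q1.trans q2)
      have r2 : rho w n * (u - a) ≤ rho w n * t := mul_le_mul_of_nonneg_left q3 p1
      have r3 : rho w n * t ≤ U' n * t := mul_le_mul_of_nonneg_right p2 (by linarith)
      nlinarith
    · exact mul_nonneg hMU0 (hv0.le.trans hMu_low)
    · exact add_nonneg (mul_nonneg hME0 (hv0.le.trans hMu_low)) (mul_nonneg hMU0 hes0)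
    all_goals
      have hy0 : (0 : ℝ) < (1 / 2) ^ b := by positivity
      have hy1 : ((1 : ℝ) / 2) ^ b ≤ 1 := pow_le_one₀ (by norm_num) (by norm_num)
      have hτy : τ = ((1 / 2) ^ b) ^ 2 / 10 := by
        rw [hτ, ← pow_mul, mul_comm, pow_mul]; norm_num
      rw [pow_succ] at hMU hME
      rw [hVz]
      set y : ℝ := (1 / 2) ^ b
    · calc MU' * alt (2 * b) Q x ≤ ((1 + y * (1 / 2)) * Vz w) * (v * (1 + τ)) := by
            apply mul_le_mul hMU hMu_up (hv0.le.trans hMu_low); positivity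
        _ = ((1 + y * (1 / 2)) * (1 + τ)) * (Vz w * v) := by ring
        _ ≤ (1 + y) * (Vz w * v) := by
            gcongr; rw [hτy]; nlinarith [mul_pos hy0 hy0]
    · calc ME' * alt (2 * b) Q x + MU' * esy (2 * b + 1) Q x ≤ (y * (1 / 2) * Vz w) * (v * (1 + τ)) + ((1 + y * (1 / 2)) * Vz w) * (τ * v) := by
            apply add_le_add
            · apply mul_le_mul hME hMu_up (hv0.le.trans hMu_low); positivity
            · apply mul_le_mul hMU hes hes0; positivity
        _ = (y * (1 / 2) * (1 + τ) + (1 + y * (1 / 2)) * τ) * (Vz w * v) := by ring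
        _ ≤ y * (Vz w * v) := by
            gcongr; rw [hτy]; nlinarith [mul_pos hy0 hy0]

end

section
open Finset

def IsPh : ℕ → ℝ → (ℕ → ℝ) → Prop
  | 0, A, f => ∀ n, f n = A
  | (k+1), A, f => ∀ h : ℕ, IsPh k (h * A) (fun n => f (n + h) - f n)

lemma isPh_poly (k : ℕ) : ∀ p : Polynomial ℝ, p.natDegree ≤ k →
    IsPh k (k.factorial * p.coeff k) (fun n => p.eval (n:ℝ)) := by
  induction k with
  | zero =>
    intro p hp n
    rw [Polynomial.eq_C_of_natDegree_le_zero hp]; simp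
  | succ k ih =>
    intro p hp h
    have hh : ∀ j, k ≤ j → (Polynomial.taylor (h:ℝ) p).coeff j = p.coeff j + (j+1) * h * p.coeff (j+1) := by
      intro j hj
      rw [Polynomial.taylor_coeff]
      have hd : (Polynomial.hasseDeriv j p).natDegree ≤ 1 := by
        refine (Polynomial.natDegree_hasseDeriv_le p j).trans (by omega)
      rw [Polynomial.eval_eq_sum_range' (n := 2) (by omega)]
      simp [Finset.sum_range_succ, Polynomial.hasseDeriv_coeff]
      rw [show 1 + j = j + 1 by ring, Nat.choose_succ_self_right]; push_cast; ring
    have := ih (Polynomial.taylor (h:ℝ) p - p) (by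
      rw [Polynomial.natDegree_le_iff_coeff_eq_zero]
      intro N hN
      rw [Polynomial.coeff_sub, hh N (by omega), Polynomial.coeff_eq_zero_of_natDegree_lt (n := N+1) (by omega)]
      ring)
    rw [Polynomial.coeff_sub, hh k le_rfl] at this
    convert this using 1
    · rw [Nat.factorial_succ]; push_cast; ring
    · funext n; simp [Polynomial.taylor_eval]

lemma vdc_ineq (a : ℕ → ℂ) (ha : ∀ j, ‖a j‖ ≤ 1) (n : ℕ) :
    ‖∑ j ∈ range n, a j‖^2 ≤ n + 2 * ∑ h ∈ Ico 1 n, ‖∑ j ∈ range (n-h), a (j+h) * (starRingEnd ℂ) (a j)‖ := by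
  have key : ∀ n : ℕ, ‖∑ j ∈ range n, a j‖^2 = ∑ j ∈ range n, ‖a j‖^2 
      + 2 * (∑ i ∈ range n, ∑ j ∈ range i, a i * (starRingEnd ℂ) (a j)).re := by
    intro n
    induction n with
    | zero => simp
    | succ n ih =>
      rw [sum_range_succ, sum_range_succ, sum_range_succ _ n, Complex.add_re, mul_add]
      rw [← Finset.mul_sum, ← map_sum]
      have : ‖∑ j ∈ range n, a j + a n‖^2 = ‖∑ j ∈ range n, a j‖^2 + ‖a n‖^2 + 2 * (a n * (starRingEnd ℂ) (∑ j ∈ range n, a j)).re := by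
        simp only [← Complex.normSq_eq_norm_sq, Complex.normSq_apply, Complex.add_re, Complex.add_im, Complex.mul_re, Complex.conj_re, Complex.conj_im]
        ring
      rw [this, ih]; ring
  have re : ∑ i ∈ range n, ∑ j ∈ range i, a i * (starRingEnd ℂ) (a j)
      = ∑ h ∈ Ico 1 n, ∑ j ∈ range (n-h), a (j+h) * (starRingEnd ℂ) (a j) := by
    rw [Finset.sum_sigma', Finset.sum_sigma']
    refine Finset.sum_bij' (fun x _ => ⟨x.1 - x.2, x.2⟩) (fun x _ => ⟨x.2 + x.1, x.2⟩) ?_ ?_ ?_ ?_ ?_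
    · rintro ⟨i, j⟩ h; simp at h ⊢; omega
    · rintro ⟨i, j⟩ h; simp at h ⊢; omega
    · rintro ⟨i, j⟩ h; simp at h ⊢; omega
    · rintro ⟨i, j⟩ h; simp at h ⊢
    · rintro ⟨i, j⟩ h; simp only [mem_sigma, mem_range] at h ⊢
      rw [show j + (i - j) = i by omega]
  rw [key, re]
  gcongr
  · calc ∑ j ∈ range n, ‖a j‖^2 ≤ ∑ j ∈ range n, 1 := by
          gcongr with j _; exact pow_le_one₀ (norm_nonneg _) (ha j)
      _ = n := by simp
  · exact (Complex.re_le_norm _).trans (norm_sum_le _ _)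

noncomputable def ee (x : ℝ) : ℂ := Complex.exp (x * Complex.I)
lemma norm_ee (x : ℝ) : ‖ee x‖ = 1 := Complex.norm_exp_ofReal_mul_I x
lemma ee_add (x y : ℝ) : ee (x + y) = ee x * ee y := by
  unfold ee; rw [← Complex.exp_add]; push_cast; ring_nf
lemma ee_sub (x y : ℝ) : ee (x - y) = ee x * (starRingEnd ℂ) (ee y) := by
  unfold ee; rw [← Complex.exp_conj, ← Complex.exp_add]; simp; ring_nf

lemma norm_one_sub_ee (A : ℝ) (h : |A| ≤ 1) : |A| / 2 ≤ ‖ee A - 1‖ := by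
  have h1 := Complex.norm_exp_sub_one_sub_id_le (x := A * Complex.I) (by simpa using h)
  have h2 : ‖(A:ℂ) * Complex.I‖ = |A| := by simp
  rw [h2] at h1
  have h3 : |A| = ‖(A:ℂ)*Complex.I‖ := h2.symm
  have : |A| ≤ ‖ee A - 1‖ + |A|^2 := by
    calc |A| = ‖(ee A - 1) - (ee A - 1 - A*Complex.I)‖ := by rw [h3]; congr 1; ring
      _ ≤ _ := (norm_sub_le _ _).trans (by unfold ee; gcongr)
  by_cases hs : |A| ≤ 1/2
  · nlinarith [abs_nonneg A]
  · -- use real/imag part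
    have : |Real.sin A| ≤ ‖ee A - 1‖ := by
      have := Complex.abs_im_le_norm (ee A - 1)
      simpa [ee, Complex.exp_ofReal_mul_I_im] using this
    have h4 : 2 / Real.pi * |A| ≤ |Real.sin A| := Real.mul_abs_le_abs_sin (by linarith [Real.pi_gt_three])
    have h5 : 1/2 ≤ 2 / Real.pi := by
      rw [div_le_div_iff₀ (by norm_num) Real.pi_pos]; linarith [Real.pi_le_four]
    nlinarith [abs_nonneg A]

lemma weyl (k : ℕ) : ∀ ν > (0:ℝ), ∃ κ C : ℝ, 0 < κ ∧ 0 < C ∧ ∀ (Q : ℝ) (f : ℕ → ℝ) (A : ℝ), 1 ≤ Q →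
    IsPh (k+1) A f → Q ^ (-((k:ℝ)+1) + ν) ≤ |A| → |A| ≤ Q ^ (-(k:ℝ)) →
    ∀ m : ℕ, (m:ℝ) ≤ Q → ‖∑ j ∈ range m, ee (f j)‖ ≤ C * Q ^ (1 - κ) := by
  induction k with
  | zero =>
    intro ν hν
    refine ⟨ν, 4, hν, by norm_num, ?_⟩
    intro Q f A hQ hf h1 h2 m hm
    have hQ0 : 0 < Q := by linarith
    have hA : |A| ≤ 1 := by simpa using h2
    have hA0 : 0 < |A| := lt_of_lt_of_le (by positivity) h1
    have hfj : ∀ j, ee (f j) = ee (f 0) * ee A ^ j := by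
      intro j
      have := hf j 0
      simp at this
      rw [show f j = f 0 + j * A by linarith, ee_add]
      congr 1
      unfold ee; rw [← Complex.exp_nat_mul]; push_cast; ring_nf
    have hn := norm_one_sub_ee A hA
    have hne : ee A - 1 ≠ 0 := by
      intro h; rw [h, norm_zero] at hn; linarith
    rw [Finset.sum_congr rfl (fun j _ => hfj j), ← Finset.mul_sum, norm_mul, norm_ee, one_mul, geom_sum_eq (sub_ne_zero.mp hne), norm_div]
    have h5 : ‖ee A ^ m - 1‖ ≤ 2 := by
      refine (norm_sub_le _ _).trans ?_
      rw [norm_pow, norm_ee]; norm_num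
    calc ‖ee A ^ m - 1‖ / ‖ee A - 1‖ ≤ 2 / (|A|/2) := by gcongr
      _ = 4 * |A|⁻¹ := by field_simp; ring
      _ ≤ 4 * (Q ^ (-(((0:ℕ):ℝ)+1) + ν))⁻¹ := by gcongr
      _ = 4 * Q ^ (1-ν) := by
          rw [← Real.rpow_neg hQ0.le]; congr 2; push_cast; ring
  | succ k ih =>
    intro ν hν
    obtain ⟨κ, C, hκ, hC, H⟩ := ih (ν/2) (by linarith)
    set κ' := min (min κ (ν/2)) 1 with hκ'
    have hk1 : κ' ≤ κ := (min_le_left _ _).trans (min_le_left _ _)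
    have hk2 : κ' ≤ ν/2 := (min_le_left _ _).trans (min_le_right _ _)
    have hk3 : κ' ≤ 1 := min_le_right _ _
    have hk0 : 0 < κ' := by positivity
    refine ⟨κ'/2, 3 + 2*C, by linarith, by linarith, ?_⟩
    intro Q f A hQ hf h1 h2 m hm
    have hQ0 : 0 < Q := by linarith
    have hv := vdc_ineq (fun j => ee (f j)) (fun j => (norm_ee _).le) m
    have hb : ∀ h ∈ Ico 1 m, ‖∑ j ∈ range (m-h), ee (f (j+h)) * (starRingEnd ℂ) (ee (f j))‖ ≤
        C * Q^(1-κ) + (if (h:ℝ) < Q^(1-ν/2) then Q else 0) := by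
      intro h hh
      simp at hh
      have hhQ : (h:ℝ) ≤ Q := le_trans (by exact_mod_cast hh.2.le) hm
      have hmh : ((m-h:ℕ):ℝ) ≤ Q := le_trans (by exact_mod_cast Nat.sub_le _ _) hm
      split_ifs with hc
      · have : ‖∑ j ∈ range (m-h), ee (f (j+h)) * (starRingEnd ℂ) (ee (f j))‖ ≤ ∑ j ∈ range (m-h), 1 := by
          refine (norm_sum_le _ _).trans (Finset.sum_le_sum fun j _ => ?_)
          rw [← ee_sub, norm_ee]
        simp at this
        have : 0 ≤ C * Q^(1-κ) := by positivity
        linarith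
      · rw [add_zero]
        push Not at hc
        simp_rw [← ee_sub]
        refine H Q (fun j => f (j+h) - f j) (h*A) hQ (hf h) ?_ ?_ _ hmh
        · rw [abs_mul, Nat.abs_cast]
          calc Q ^ (-((k:ℝ)+1) + ν/2) = Q^(1-ν/2) * Q ^ (-(((k+1:ℕ):ℝ)+1) + ν) := by
                rw [← Real.rpow_add hQ0]; push_cast; ring_nf
            _ ≤ h * |A| := by gcongr
        · rw [abs_mul, Nat.abs_cast]
          calc (h:ℝ) * |A| ≤ Q^(1:ℝ) * Q ^ (-((k+1:ℕ):ℝ)) := by rw [Real.rpow_one]; gcongr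
            _ = _ := by rw [← Real.rpow_add hQ0]; push_cast; ring_nf
    have hc : ∑ h ∈ Ico 1 m, (if (h:ℝ) < Q^(1-ν/2) then Q else 0) ≤ Q^(1-ν/2) * Q := by
      rw [← Finset.sum_filter, Finset.sum_const, nsmul_eq_mul]
      gcongr
      have : (filter (fun h:ℕ => (h:ℝ) < Q^(1-ν/2)) (Ico 1 m)) ⊆ Icc 1 ⌊Q^(1-ν/2)⌋₊ := by
        intro h hh; simp at hh ⊢; exact ⟨hh.1.1, Nat.le_floor hh.2.le⟩
      have := Finset.card_le_card this
      simp at this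
      exact (Nat.cast_le.mpr this).trans (Nat.floor_le (by positivity))
    have hs : ∑ h ∈ Ico 1 m, ‖∑ j ∈ range (m-h), ee (f (j+h)) * (starRingEnd ℂ) (ee (f j))‖ ≤ Q * (C * Q^(1-κ)) + Q^(1-ν/2) * Q := by
      refine (Finset.sum_le_sum hb).trans ?_
      rw [Finset.sum_add_distrib]
      gcongr
      rw [Finset.sum_const, nsmul_eq_mul]
      gcongr
      simp
      exact le_trans (by exact_mod_cast Nat.sub_le _ _) hm
    have hmon : ∀ y, κ' ≤ y → Q * Q^(1-y) ≤ Q^(2-κ') := by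
      intro y hy
      nth_rw 1 [← Real.rpow_one Q]
      rw [← Real.rpow_add hQ0]
      exact Real.rpow_le_rpow_of_exponent_le hQ (by linarith)
    have hm1 := hmon _ hk1
    have hm2 := hmon _ hk2
    have hm3 := hmon _ hk3
    simp at hm3
    have hfin : ‖∑ j ∈ range m, ee (f j)‖^2 ≤ ((3+2*C) * Q^(1-κ'/2))^2 := by
      have e1 : (Q^(1-κ'/2))^2 = Q^(2-κ') := by
        rw [← Real.rpow_natCast, ← Real.rpow_mul hQ0.le]; push_cast; ring_nf
      rw [mul_pow, e1]
      have hX : 0 ≤ Q^(2-κ') := by positivity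
      calc _ ≤ _ := hv
        _ ≤ Q + 2 * (Q * (C * Q^(1-κ)) + Q^(1-ν/2) * Q) := by gcongr
        _ ≤ Q^(2-κ') + 2*(C * Q^(2-κ') + Q^(2-κ')) := by nlinarith
        _ = (3 + 2*C) * Q^(2-κ') := by ring
        _ ≤ _ := by gcongr; nlinarith
    exact le_of_sq_le_sq hfin (by positivity)

end

section
open Finset

lemma norm_ee_sub_le (x y : ℝ) : ‖ee x - ee y‖ ≤ |x - y| := by
  have : ee x - ee y = ee y * (ee (x - y) - 1) := by rw [mul_sub, ← ee_add]; ring_nf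
  rw [this, norm_mul, norm_ee, one_mul]
  unfold ee
  rw [mul_comm]; exact Real.norm_exp_I_mul_ofReal_sub_one_le

lemma weyl_seg (k : ℕ) : ∀ ν > (0:ℝ), ∃ κ C : ℝ, 0 < κ ∧ 0 < C ∧ ∀ (Q : ℝ) (n0 : ℕ) (t : ℝ), 1 ≤ Q → 0 < t → 2 * Q ≤ n0 →
    Q ^ (-((k:ℝ)+1) + ν) ≤ k.factorial * t / n0^(k+1) → k.factorial * t / n0^(k+1) ≤ Q ^ (-(k:ℝ)) →
    ∀ m : ℕ, (m:ℝ) ≤ Q → ‖∑ j ∈ range m, ee (t * Real.log (n0 + j))‖ ≤ C * Q ^ (1 - κ) + 2 * Q * t * (Q / n0)^(k+2) := by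
  intro ν hν
  obtain ⟨κ, C, hκ, hC, H⟩ := weyl k ν hν
  refine ⟨κ, C, hκ, hC, ?_⟩
  intro Q n0 t hQ ht hn h1 h2 m hm
  have hn0 : (0:ℝ) < n0 := by linarith
  set P : Polynomial ℝ := Polynomial.C (t * Real.log n0) - ∑ i ∈ range (k+1), Polynomial.C (t * (-1/(n0:ℝ))^(i+1)/(i+1)) * Polynomial.X^(i+1) with hP
  have hdeg : P.natDegree ≤ k+1 := by
    refine (Polynomial.natDegree_sub_le _ _).trans (max_le (by rw [Polynomial.natDegree_C]; omega) ?_)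
    refine Polynomial.natDegree_sum_le_of_forall_le _ _ ?_
    intro i hi
    refine (Polynomial.natDegree_C_mul_X_pow_le _ _).trans ?_
    simp at hi; omega
  have hcoeff : P.coeff (k+1) = - (t * (-1/(n0:ℝ))^(k+1)/(k+1)) := by
    simp only [hP, Polynomial.coeff_sub, Polynomial.finset_sum_coeff, Polynomial.coeff_C_mul, Polynomial.coeff_X_pow, Polynomial.coeff_C]
    simp
  have hph := isPh_poly (k+1) P hdeg
  have hA : |((k+1).factorial : ℝ) * P.coeff (k+1)| = k.factorial * t / n0^(k+1) := by
    rw [hcoeff, abs_mul, abs_neg, abs_div, abs_mul, abs_pow, abs_div, abs_neg, abs_one, abs_of_pos ht, abs_of_pos hn0, Nat.factorial_succ, abs_of_pos (by positivity : (0:ℝ) < (k:ℝ)+1), Nat.abs_cast]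
    rw [div_pow, one_pow]; push_cast; field_simp
  have hw := H Q _ _ hQ hph (by rw [hA]; exact h1) (by rw [hA]; exact h2) m hm
  have herr : ∀ j ∈ range m, ‖ee (t * Real.log (n0 + j)) - ee (P.eval (j:ℝ))‖ ≤ 2 * t * (Q / n0)^(k+2) := by
    intro j hj
    simp at hj
    have hjQ : (j:ℝ) ≤ Q := le_trans (by exact_mod_cast hj.le) hm
    have hj0 : (0:ℝ) ≤ j := Nat.cast_nonneg _
    have hx : |-((j:ℝ)/n0)| ≤ Q/n0 := by
      rw [abs_neg, abs_of_nonneg (by positivity)]; gcongr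
    have hQn : Q / n0 ≤ 1/2 := by rw [div_le_iff₀ hn0]; linarith
    have hl := Real.abs_log_sub_add_sum_range_le (x := -((j:ℝ)/n0)) (by linarith) (k+1)
    refine (norm_ee_sub_le _ _).trans ?_
    have e : t * Real.log (n0 + j) - P.eval (j:ℝ) = t * ((∑ i ∈ range (k+1), (-((j:ℝ)/n0)) ^ (i + 1) / (i + 1)) + Real.log (1 - (-((j:ℝ)/n0)))) := by
      have : Real.log (n0 + j) = Real.log n0 + Real.log (1 - (-((j:ℝ)/n0))) := by
        rw [← Real.log_mul hn0.ne' (by have := div_nonneg hj0 hn0.le; linarith)]; congr 1; field_simp; ring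
      rw [this]
      simp only [hP, Polynomial.eval_sub, Polynomial.eval_C, Polynomial.eval_finset_sum, Polynomial.eval_mul, Polynomial.eval_pow, Polynomial.eval_X]
      rw [mul_add t (∑ i ∈ _, _), Finset.mul_sum, mul_add]
      have : ∀ i ∈ range (k+1), t * ((-((j:ℝ)/n0)) ^ (i + 1) / (i + 1)) = t * (-1/(n0:ℝ))^(i+1)/(i+1) * j^(i+1) := by
        intro i _
        rw [show -((j:ℝ)/n0) = (-1/n0) * j by ring, mul_pow]; ring
      rw [Finset.sum_congr rfl this]; ring
    rw [e, abs_mul, abs_of_pos ht]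
    calc t * _ ≤ t * (|-((j:ℝ)/n0)| ^ (k+1+1) / (1 - |-((j:ℝ)/n0)|)) := by gcongr
      _ ≤ t * ((Q/n0)^(k+1+1) / (1/2)) := by gcongr; linarith
      _ = _ := by ring
  calc ‖∑ j ∈ range m, ee (t * Real.log (n0 + j))‖ = ‖∑ j ∈ range m, ee (P.eval (j:ℝ)) + ∑ j ∈ range m, (ee (t * Real.log (n0 + j)) - ee (P.eval (j:ℝ)))‖ := by
        rw [← Finset.sum_add_distrib]; congr 1; apply Finset.sum_congr rfl; intros; ring
    _ ≤ C * Q ^ (1 - κ) + ∑ j ∈ range m, 2 * t * (Q / n0)^(k+2) := 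
        (norm_add_le _ _).trans (add_le_add hw ((norm_sum_le _ _).trans (Finset.sum_le_sum herr)))
    _ ≤ _ := by
        rw [Finset.sum_const, card_range, nsmul_eq_mul]
        have : (m:ℝ) * (2 * t * (Q / n0)^(k+2)) ≤ Q * (2 * t * (Q / n0)^(k+2)) := by gcongr
        linarith

lemma chop (a : ℕ → ℂ) (N q : ℕ) (B : ℝ) (hq : 0 < q) (hB : 0 ≤ B)
    (h : ∀ n0, N ≤ n0 → n0 ≤ 2*N → ∀ m ≤ q, ‖∑ j ∈ range m, a (n0 + j)‖ ≤ B) :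
    ∀ m ≤ N, ‖∑ j ∈ range m, a (N + j)‖ ≤ (m / q + 1 : ℝ) * B := by
  intro m
  induction m using Nat.strong_induction_on with
  | _ m ih =>
    intro hm
    by_cases hmq : m ≤ q
    · refine (h N le_rfl (by omega) m hmq).trans ?_
      have : (0:ℝ) ≤ m / q := by positivity
      nlinarith
    · push Not at hmq
      have e : m = (m - q) + q := by omega
      have i1 := ih (m-q) (by omega) (by omega)
      have i2 := h (N + (m-q)) (by omega) (by omega) q le_rfl
      rw [e, Finset.sum_range_add]
      simp_rw [← add_assoc] at i2 ⊢
      refine (norm_add_le _ _).trans ((add_le_add i1 i2).trans (le_of_eq ?_))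
      have : (q:ℝ) ≠ 0 := by positivity
      push_cast
      field_simp

lemma trivial_ee (g : ℕ → ℝ) (m : ℕ) : ‖∑ j ∈ range m, ee (g j)‖ ≤ m := by
  refine (norm_sum_le _ _).trans ?_
  simp [norm_ee]

set_option maxHeartbeats 1000000 in
lemma blockK (k : ℕ) (hk : 1 ≤ k) : ∃ κ C : ℝ, 0 < κ ∧ 0 < C ∧ ∀ (N : ℕ) (u : ℝ), 2 ≤ N → (k:ℝ) - 1/2 ≤ u → u ≤ k + 1/2 → 3/4 ≤ u →
    ∀ m ≤ N, ‖∑ j ∈ range m, ee ((N:ℝ)^u * Real.log (N + j))‖ ≤ C * (N:ℝ)^(1-κ) := by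
  obtain ⟨κ0, C0, hκ0, hC0, H⟩ := weyl_seg k (1/8) (by norm_num)
  -- constants
  have hk1 : (1:ℝ) ≤ k := by exact_mod_cast hk
  set κ1 := min κ0 (1/10) with hκ1
  have hκ1p : 0 < κ1 := by positivity
  have hκ1a : κ1 ≤ κ0 := min_le_left _ _
  have hκ1b : κ1 ≤ 1/10 := min_le_right _ _
  obtain ⟨Q0, hQ0, hQ01, hQ02, hQ03⟩ : ∃ Q0 : ℝ, 1 ≤ Q0 ∧ (∀ Q ≥ Q0, (2:ℝ)^(k+1) ≤ Q^((1:ℝ)/8)) ∧ (∀ Q ≥ Q0, (k.factorial:ℝ) ≤ Q^((3:ℝ)/4)) ∧ (∀ Q ≥ Q0, (2:ℝ) ≤ Q^((1:ℝ)/4)) := by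
    have a1 := (tendsto_rpow_atTop (show (0:ℝ) < 1/8 by norm_num)).eventually_ge_atTop ((2:ℝ)^(k+1))
    have a2 := (tendsto_rpow_atTop (show (0:ℝ) < 3/4 by norm_num)).eventually_ge_atTop (k.factorial:ℝ)
    have a3 := (tendsto_rpow_atTop (show (0:ℝ) < 1/4 by norm_num)).eventually_ge_atTop (2:ℝ)
    obtain ⟨Q0, h⟩ := Filter.eventually_atTop.mp (a1.and (a2.and a3))
    refine ⟨max 1 Q0, le_max_left _ _, ?_, ?_, ?_⟩ <;> intro Q hQ <;> have := h Q ((le_max_right _ _).trans hQ)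
    · exact this.1
    · exact this.2.1
    · exact this.2.2
  set κ := κ1 / (2*(k+1)) with hκ
  have hκp : 0 < κ := by positivity
  set C := max (3*(C0+2)) Q0 with hC
  refine ⟨κ, C, hκp, by positivity, ?_⟩
  intro N u hN hu1 hu2 hu3 m hm
  have hNR : (2:ℝ) ≤ N := by exact_mod_cast hN
  have hN0 : (0:ℝ) < N := by linarith
  have hN1 : (1:ℝ) ≤ N := by linarith
  set q := ((k:ℝ)+1-u)/(k+3/4) with hq
  have hqk : q * (k+3/4) = k+1-u := by rw [hq]; field_simp
  have hq1 : 1/(2*((k:ℝ)+1)) ≤ q := by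
    rw [hq, div_le_div_iff₀ (by positivity) (by positivity)]; nlinarith
  have hq0 : 0 < q := lt_of_lt_of_le (by positivity) hq1
  have hq2 : q ≤ 18/25 := by
    rw [hq, div_le_iff₀ (by positivity)]
    rcases Nat.lt_or_ge k 2 with h | h
    · have : k = 1 := by omega
      subst this; norm_num; linarith
    · have : (2:ℝ) ≤ k := by exact_mod_cast h
      nlinarith
  set Q := (N:ℝ)^q with hQ
  have hQpos : 0 < Q := by positivity
  have hQ1 : 1 ≤ Q := Real.one_le_rpow hN1 hq0.le
  have hκq : κ ≤ κ1 * q := by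
    rw [hκ, div_eq_mul_inv, ← one_div]; gcongr
  have hNk : (N:ℝ)^(1-κ1*q) ≤ (N:ℝ)^(1-κ) := Real.rpow_le_rpow_of_exponent_le hN1 (by linarith)
  have hQκ : (N:ℝ) * Q^(-κ1) = (N:ℝ)^(1-κ1*q) := by
    rw [hQ, ← Real.rpow_mul hN0.le]; nth_rw 1 [← Real.rpow_one (N:ℝ)]; rw [← Real.rpow_add hN0]; ring_nf
  by_cases hQQ : Q0 ≤ Q
  swap
  · push Not at hQQ
    refine (trivial_ee _ _).trans ?_
    have : (N:ℝ) ≤ Q0 * (N * Q^(-κ1)) := by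
      have : (1:ℝ) ≤ Q0 * Q^(-κ1) := by
        calc (1:ℝ) = Q^(0:ℝ) := by simp
          _ ≤ Q^(1-κ1) := Real.rpow_le_rpow_of_exponent_le hQ1 (by linarith)
          _ = Q * Q^(-κ1) := by rw [sub_eq_add_neg, Real.rpow_add hQpos, Real.rpow_one]
          _ ≤ _ := by gcongr
      nlinarith
    calc (m:ℝ) ≤ N := by exact_mod_cast hm
      _ ≤ Q0 * (N * Q^(-κ1)) := this
      _ ≤ C * (N:ℝ)^(1-κ) := by rw [hQκ]; gcongr; exact le_max_right _ _
  -- main case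
  set t := (N:ℝ)^u with ht
  have htpos : 0 < t := by positivity
  have htQ : t * (Q/N)^(k+1) = Q^((1:ℝ)/4) := by
    have e1 : Q/N = (N:ℝ)^(q-1) := by rw [Real.rpow_sub hN0, Real.rpow_one]
    rw [e1, ← Real.rpow_natCast, ← Real.rpow_mul hN0.le, ht, ← Real.rpow_add hN0, hQ, ← Real.rpow_mul hN0.le]
    congr 1; push_cast; nlinarith
  have hQN : 2 * Q ≤ N := by
    have h1 : Q * Q^((1:ℝ)/4) ≤ N := by
      rw [← Real.rpow_one_add' hQpos.le (by norm_num), hQ, ← Real.rpow_mul hN0.le]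
      nth_rw 2 [← Real.rpow_one (N:ℝ)]
      exact Real.rpow_le_rpow_of_exponent_le hN1 (by linarith)
    have := hQ03 Q hQQ
    nlinarith
  set B := C0 * Q^(1-κ0) + 2 * Q * t * (Q/N)^(k+2) with hB
  have hBle : B ≤ (C0+2) * Q * Q^(-κ1) := by
    have e1 : Q^(1-κ0) ≤ Q * Q^(-κ1) := by
      rw [show Q * Q^(-κ1) = Q^(1-κ1) by rw [sub_eq_add_neg, Real.rpow_add hQpos, Real.rpow_one]]
      exact Real.rpow_le_rpow_of_exponent_le hQ1 (by linarith)
    have e2 : t * (Q/N)^(k+2) ≤ Q^(-κ1) := by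
      rw [pow_succ, ← mul_assoc, htQ]
      have : Q^((1:ℝ)/4) * (Q/N) = (N:ℝ)^(5/4*q-1) := by
        rw [show Q/N = (N:ℝ)^(q-1) by rw [Real.rpow_sub hN0, Real.rpow_one], hQ, ← Real.rpow_mul hN0.le, ← Real.rpow_add hN0]; ring_nf
      rw [this, hQ, ← Real.rpow_mul hN0.le]
      apply Real.rpow_le_rpow_of_exponent_le hN1
      nlinarith
    rw [hB]
    calc _ ≤ C0 * (Q * Q^(-κ1)) + 2 * Q * Q^(-κ1) := by rw [mul_assoc (2*Q)]; gcongr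
      _ = _ := by ring
  have hqf : 0 < ⌊Q⌋₊ := Nat.floor_pos.mpr hQ1
  have hqf2 : Q / 2 ≤ ⌊Q⌋₊ := by
    have := Nat.lt_floor_add_one Q
    have h1 : (1:ℝ) ≤ ⌊Q⌋₊ := by exact_mod_cast hqf
    linarith
  have hch := chop (fun n => ee (t * Real.log n)) N ⌊Q⌋₊ B hqf (by positivity) (by
    intro n0 hn1 hn2 m' hm'
    have hn1R : (N:ℝ) ≤ n0 := by exact_mod_cast hn1
    have hn2R : (n0:ℝ) ≤ 2 * N := by exact_mod_cast hn2
    have hn0p : (0:ℝ) < n0 := by linarith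
    have hm'Q : (m':ℝ) ≤ Q := le_trans (by exact_mod_cast hm') (Nat.floor_le hQpos.le)
    have hA : Q^(k+1) * (k.factorial * t / n0^(k+1)) = k.factorial * (t * (Q/n0)^(k+1)) := by
      rw [div_pow]; ring
    have hup : t * (Q/n0)^(k+1) ≤ Q^((1:ℝ)/4) := by
      rw [← htQ]; gcongr
    have hlo : Q^((1:ℝ)/4) / 2^(k+1) ≤ t * (Q/n0)^(k+1) := by
      rw [← htQ, mul_div_assoc, ← div_pow]
      have : Q/N/2 ≤ Q/n0 := by rw [div_div]; gcongr; linarith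
      gcongr
    have := H Q n0 t hQ1 htpos (by linarith) (by
      have hfac : (1:ℝ) ≤ k.factorial := by exact_mod_cast Nat.one_le_iff_ne_zero.mpr (Nat.factorial_ne_zero k)
      have : Q^((1:ℝ)/8) ≤ k.factorial * (t * (Q/n0)^(k+1)) := by
        have h8 := hQ01 Q hQQ
        have e : Q^((1:ℝ)/4) = Q^((1:ℝ)/8) * Q^((1:ℝ)/8) := by rw [← Real.rpow_add hQpos]; norm_num
        have : Q^((1:ℝ)/8) ≤ Q^((1:ℝ)/4) / 2^(k+1) := by
          rw [le_div_iff₀ (by positivity), e]; gcongr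
        have h9 : 0 ≤ t * (Q/n0)^(k+1) := by positivity
        nlinarith
      rw [← hA] at this
      rw [show -((k:ℝ)+1)+1/8 = 1/8 - ((k+1:ℕ):ℝ) by push_cast; ring, Real.rpow_sub hQpos, Real.rpow_natCast, div_le_iff₀ (by positivity)]
      linarith) (by
      have : k.factorial * (t * (Q/n0)^(k+1)) ≤ Q := by
        have h8 := hQ02 Q hQQ
        calc k.factorial * (t * (Q/n0)^(k+1)) ≤ Q^((3:ℝ)/4) * Q^((1:ℝ)/4) := by gcongr
          _ = Q := by rw [← Real.rpow_add hQpos]; norm_num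
      rw [← hA] at this
      rw [show -(k:ℝ) = 1 - ((k+1:ℕ):ℝ) by push_cast; ring, Real.rpow_sub hQpos, Real.rpow_natCast, Real.rpow_one, le_div_iff₀ (by positivity)]
      linarith) m' hm'Q
    push_cast
    refine this.trans ?_
    rw [hB]
    gcongr) m hm
  push_cast at hch
  refine hch.trans ?_
  calc ((m:ℝ)/⌊Q⌋₊ + 1) * B ≤ (N/(Q/2) + N/Q) * ((C0+2) * Q * Q^(-κ1)) := by
        gcongr
        · rw [le_div_iff₀ hQpos]; linarith
    _ = 3 * (C0+2) * (N * Q^(-κ1)) := by field_simp; ring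
    _ ≤ C * (N:ℝ)^(1-κ) := by
        rw [hQκ]; gcongr; exact le_max_left _ _

/-- (A*) -/
lemma astar (ε : ℝ) (hε : 0 < ε) : ∃ κ C : ℝ, 0 < κ ∧ 0 < C ∧ ∀ (N : ℕ) (t : ℝ), 1 ≤ N → 1 ≤ t → t^ε ≤ N → (N:ℝ) ≤ t^((4:ℝ)/3) → 
    ∀ m ≤ N, ‖∑ j ∈ range m, ee (t * Real.log (N + j))‖ ≤ C * (N:ℝ)^(1-κ) := by
  have hall : ∀ k0 : ℕ, ∃ κ C : ℝ, 0 < κ ∧ 0 < C ∧ ∀ k, 1 ≤ k → k ≤ k0 → ∀ (N : ℕ) (u : ℝ), 2 ≤ N → (k:ℝ) - 1/2 ≤ u → u ≤ k + 1/2 → 3/4 ≤ u →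
    ∀ m ≤ N, ‖∑ j ∈ range m, ee ((N:ℝ)^u * Real.log (N + j))‖ ≤ C * (N:ℝ)^(1-κ) := by
    intro k0
    induction k0 with
    | zero => exact ⟨1, 1, one_pos, one_pos, by intro k h1 h2; omega⟩
    | succ k0 ih =>
      obtain ⟨κ, C, hκ, hC, H⟩ := ih
      obtain ⟨κ', C', hκ', hC', H'⟩ := blockK (k0+1) (by omega)
      refine ⟨min κ κ', max C C', by positivity, by positivity, ?_⟩
      intro k h1 h2 N u hN hu1 hu2 hu3 m hm
      have hN1 : (1:ℝ) ≤ N := by exact_mod_cast (by omega : 1 ≤ N)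
      rcases Nat.lt_or_ge k (k0+1) with h | h
      · refine (H k h1 (by omega) N u hN hu1 hu2 hu3 m hm).trans ?_
        gcongr
        · exact le_max_left _ _
        · exact min_le_left _ _
      · have : k = k0+1 := by omega
        subst this
        refine (H' N u hN hu1 hu2 hu3 m hm).trans ?_
        gcongr
        · exact le_max_right _ _
        · exact min_le_right _ _
  obtain ⟨κ, C, hκ, hC, H⟩ := hall (⌈1/ε⌉₊ + 1)
  refine ⟨κ, max C 1, hκ, by positivity, ?_⟩
  intro N t hN ht h1 h2 m hm
  rcases Nat.lt_or_ge N 2 with hN2 | hN2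
  · have : N = 1 := by omega
    subst this
    refine (trivial_ee _ _).trans ?_
    simp
    right; exact_mod_cast hm
  have hNR : (2:ℝ) ≤ N := by exact_mod_cast hN2
  have hlN : 0 < Real.log N := Real.log_pos (by linarith)
  have ht0 : 0 < t := by linarith
  set u := Real.log t / Real.log N with hu
  have htu : (N:ℝ)^u = t := by
    rw [Real.rpow_def_of_pos (by linarith), hu, mul_div_cancel₀ _ hlN.ne', Real.exp_log ht0]
  have hlog1 : ε * Real.log t ≤ Real.log N := by
    rw [← Real.log_rpow ht0]; exact Real.log_le_log (by positivity) h1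
  have hlog2 : Real.log N ≤ 4/3 * Real.log t := by
    rw [← Real.log_rpow ht0]; exact Real.log_le_log (by linarith) h2
  have hu3 : 3/4 ≤ u := by rw [hu, le_div_iff₀ hlN]; linarith
  have hu4 : u ≤ 1/ε := by rw [hu, div_le_div_iff₀ hlN hε]; linarith
  have hce := Nat.le_ceil (u - 1/2)
  have hce2 := Nat.ceil_lt_add_one (show 0 ≤ u - 1/2 by linarith)
  have := H ⌈u - 1/2⌉₊ (Nat.one_le_iff_ne_zero.mpr (by
      have : 0 < ⌈u - 1/2⌉₊ := Nat.ceil_pos.mpr (by linarith)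
      omega)) (by
      have : ⌈u-1/2⌉₊ ≤ ⌈1/ε⌉₊ := Nat.ceil_mono (by linarith)
      omega) N u hN2 (by linarith) (by linarith) hu3 m hm
  rw [htu] at this
  refine this.trans ?_
  gcongr
  exact le_max_left _ _

end

section
open Finset Complex

noncomputable def zt (n : ℕ) (s : ℂ) : ℂ :=
  ((n+1:ℝ):ℂ)^(-s) - (((n+2:ℝ):ℂ)^(1-s) - ((n+1:ℝ):ℂ)^(1-s))/(1-s)

lemma cpow_sub_le (a x : ℝ) (ha : 0 < a) (hx : a ≤ x) (s : ℂ) (hs : -1 ≤ s.re) :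
    ‖(x:ℂ)^(-s) - (a:ℂ)^(-s)‖ ≤ ‖s‖ * a^(-s.re-1) * (x - a) := by
  have := (convex_Ici a).norm_image_sub_le_of_norm_hasDerivWithin_le (f := fun y : ℝ => (y:ℂ)^(-s)) 
    (f' := fun y : ℝ => -s * (y:ℂ)^(-s-1)) (C := ‖s‖ * a^(-s.re-1)) (x := a) (y := x) ?_ ?_ (by simp) hx
  · rwa [Real.norm_eq_abs, abs_of_nonneg (by linarith)] at this
  · intro y hy
    have hy0 : 0 < y := lt_of_lt_of_le ha hy
    have h1 : HasDerivAt (fun z : ℂ => z^(-s)) (-s * (y:ℂ)^(-s-1)) (y:ℂ) := by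
      have := (hasDerivAt_id (y:ℂ)).cpow_const (c := -s) (Or.inl (by simpa using hy0))
      simpa using this
    exact h1.comp_ofReal.hasDerivWithinAt
  · intro y hy
    have hy0 : 0 < y := lt_of_lt_of_le ha hy
    rw [norm_mul, norm_neg, norm_cpow_eq_rpow_re_of_pos hy0]
    gcongr
    simp
    exact Real.rpow_le_rpow_of_nonpos ha hy (by linarith)

lemma zt_bound (n : ℕ) (s : ℂ) (hs : -1 ≤ s.re) (hs1 : s ≠ 1) : ‖zt n s‖ ≤ ‖s‖ * (n+1:ℝ)^(-s.re-1) := by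
  have hn : (0:ℝ) < n + 1 := by positivity
  have hint := integral_cpow (a := (n+1:ℝ)) (b := (n+2:ℝ)) (r := -s) (Or.inr ⟨by
    intro h; apply hs1; linear_combination -h, by
    rw [Set.uIcc_of_le (by linarith)]; simp; intro h; linarith⟩)
  have e : zt n s = -∫ x in (n+1:ℝ)..(n+2:ℝ), ((x:ℂ)^(-s) - ((n+1:ℝ):ℂ)^(-s)) := by
    rw [intervalIntegral.integral_sub, hint]
    · simp only [intervalIntegral.integral_const, zt]
      rw [show -s + 1 = 1 - s by ring, show (n:ℝ)+2 - (n+1) = 1 by ring]; simp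
    · refine intervalIntegral.intervalIntegrable_cpow (Or.inr ?_)
      rw [Set.uIcc_of_le (by linarith)]; simp; intro h; linarith
    · simp
  rw [e, norm_neg]
  have := intervalIntegral.norm_integral_le_of_norm_le_const (a := (n+1:ℝ)) (b := (n+2:ℝ)) (f := fun x : ℝ => ((x:ℂ)^(-s) - ((n+1:ℝ):ℂ)^(-s))) (C := ‖s‖ * (n+1:ℝ)^(-s.re-1)) ?_
  · rwa [show (n:ℝ)+2 - (n+1) = 1 by ring, abs_one, mul_one] at this
  · intro x hx
    rw [Set.uIoc_of_le (by linarith)] at hx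
    refine (cpow_sub_le _ x hn hx.1.le s hs).trans ?_
    have : x - (n+1) ≤ 1 := by linarith [hx.2]
    calc _ ≤ ‖s‖ * (n+1:ℝ)^(-s.re-1) * 1 := by gcongr
      _ = _ := mul_one _

lemma zt_sum (s : ℂ) (N : ℕ) : ∑ n ∈ range N, zt n s = ∑ n ∈ range N, ((n+1:ℝ):ℂ)^(-s) - (((N+1:ℝ):ℂ)^(1-s) - 1)/(1-s) := by
  induction N with
  | zero => simp
  | succ N ih =>
    rw [sum_range_succ, ih, sum_range_succ, zt]; push_cast; ring_nf

lemma summable_zt (s : ℂ) (hs : 0 < s.re) (hs1 : s ≠ 1) : Summable (fun n => zt n s) := by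
  refine Summable.of_norm_bounded (g := fun n : ℕ => ‖s‖ * (n+1:ℝ)^(-s.re-1)) ?_ (fun n => zt_bound n s (by linarith) hs1)
  refine Summable.mul_left _ ?_
  have := (summable_nat_add_iff 1).mpr (Real.summable_nat_rpow (p := -s.re-1) |>.mpr (by linarith))
  simpa using this

lemma zeta_eq_gt (s : ℂ) (hs : 1 < s.re) : riemannZeta s = ∑' n, zt n s + 1/(s-1) := by
  have hs1 : s ≠ 1 := by rintro rfl; simp at hs
  have h1 : Filter.Tendsto (fun N => ∑ n ∈ range N, zt n s) Filter.atTop (nhds (∑' n, zt n s)) :=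
    (summable_zt s (by linarith) hs1).hasSum.tendsto_sum_nat
  have h2 : Filter.Tendsto (fun N:ℕ => ∑ n ∈ range N, ((n+1:ℝ):ℂ)^(-s)) Filter.atTop (nhds (riemannZeta s)) := by
    rw [zeta_eq_tsum_one_div_nat_add_one_cpow hs]
    have hsum : Summable (fun n : ℕ => 1 / ((n:ℂ) + 1)^s) := by
      have := (summable_nat_add_iff 1).mpr (Complex.summable_one_div_nat_cpow.mpr hs)
      simpa using this
    convert hsum.hasSum.tendsto_sum_nat using 2 with N
    apply Finset.sum_congr rfl; intro n _
    rw [cpow_neg, one_div]; push_cast; rfl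
  have h3 : Filter.Tendsto (fun N:ℕ => ((N+1:ℝ):ℂ)^(1-s)) Filter.atTop (nhds 0) := by
    rw [tendsto_zero_iff_norm_tendsto_zero]
    have : ∀ N : ℕ, ‖((N+1:ℝ):ℂ)^(1-s)‖ = ((N:ℝ)+1)^(-(s.re-1)) := by
      intro N
      rw [norm_cpow_eq_rpow_re_of_pos (by positivity)]; simp
    simp_rw [this]
    have h := tendsto_rpow_neg_atTop (y := s.re-1) (by linarith)
    exact h.comp (Filter.tendsto_atTop_add_const_right _ _ tendsto_natCast_atTop_atTop)
  have h4 : Filter.Tendsto (fun N => ∑ n ∈ range N, zt n s) Filter.atTop (nhds (riemannZeta s - (0 - 1)/(1-s))) := by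
    simp_rw [zt_sum]
    exact h2.sub ((h3.sub_const 1).div_const _)
  rw [tendsto_nhds_unique h1 h4]
  have : 1 - s ≠ 0 := sub_ne_zero.mpr hs1.symm
  have : s - 1 ≠ 0 := sub_ne_zero.mpr hs1
  field_simp; ring

lemma zeta_eq (s : ℂ) (hs : 0 < s.re) (ht : 0 < s.im) : riemannZeta s = ∑' n, zt n s + 1/(s-1) := by
  set δ := s.re / 2 with hδ
  set B := ‖s‖ + 5 + s.im with hB
  set U : Set ℂ := {w | δ < w.re} ∩ ({w | 0 < w.im} ∩ Metric.ball 0 B) with hU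
  have hUo : IsOpen U := (isOpen_lt continuous_const continuous_re).inter ((isOpen_lt continuous_const continuous_im).inter Metric.isOpen_ball)
  have hUc : Convex ℝ U := (convex_halfSpace_re_gt δ).inter ((convex_halfSpace_im_gt 0).inter (convex_ball 0 B))
  have hne : ∀ w ∈ U, w ≠ 1 := by
    rintro w hw rfl
    simp [hU] at hw
  have hF : DifferentiableOn ℂ (fun w => ∑' n, zt n w) U := by
    refine differentiableOn_tsum_of_summable_norm (u := fun n : ℕ => B * (n+1:ℝ)^(-δ-1)) ?_ ?_ hUo ?_
    · refine Summable.mul_left _ ?_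
      have := (summable_nat_add_iff 1).mpr (Real.summable_nat_rpow (p := -δ-1) |>.mpr (by linarith))
      simpa using this
    · intro n w hw
      have h1 : 1 - w ≠ 0 := sub_ne_zero.mpr (hne w hw).symm
      have a1 : ((n+1:ℝ):ℂ) ≠ 0 := by exact_mod_cast (by positivity : (n+1:ℝ) ≠ 0)
      have a2 : ((n+2:ℝ):ℂ) ≠ 0 := by exact_mod_cast (by positivity : (n+2:ℝ) ≠ 0)
      apply DifferentiableAt.differentiableWithinAt
      unfold zt
      refine DifferentiableAt.sub (DifferentiableAt.const_cpow (by fun_prop) (Or.inl a1)) (DifferentiableAt.div (DifferentiableAt.sub (DifferentiableAt.const_cpow (by fun_prop) (Or.inl a2)) (DifferentiableAt.const_cpow (by fun_prop) (Or.inl a1))) (by fun_prop) h1)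
    · intro n w hw
      have hw1 : δ < w.re := hw.1
      have hw3 : ‖w‖ < B := by simpa using hw.2.2
      refine (zt_bound n w (by linarith) (hne w hw)).trans ?_
      gcongr
      · simp
  have hG : AnalyticOnNhd ℂ (fun w => ∑' n, zt n w + 1/(w-1)) U := by
    refine DifferentiableOn.analyticOnNhd ?_ hUo
    refine hF.add (fun w hw => ?_)
    apply DifferentiableAt.differentiableWithinAt
    exact DifferentiableAt.div (by fun_prop) (by fun_prop) (sub_ne_zero.mpr (hne w hw))
  have hZ : AnalyticOnNhd ℂ riemannZeta U := by
    refine DifferentiableOn.analyticOnNhd (fun w hw => ?_) hUo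
    exact (differentiableAt_riemannZeta (hne w hw)).differentiableWithinAt
  have hz0 : (⟨2 + s.re, s.im⟩ : ℂ) ∈ U := by
    refine ⟨?_, ht, ?_⟩
    · show δ < 2 + s.re; linarith
    · simp only [Metric.mem_ball, dist_zero_right]
      have : (⟨2 + s.re, s.im⟩ : ℂ) = 2 + s := by apply Complex.ext <;> simp
      rw [this]
      have := norm_add_le (2:ℂ) s
      simp at this
      linarith
  have hsU : s ∈ U := by
    refine ⟨by show δ < s.re; linarith, ht, ?_⟩
    simp only [Metric.mem_ball, dist_zero_right]; linarith
  refine hZ.eqOn_of_preconnected_of_eventuallyEq hG hUc.isPreconnected hz0 ?_ hsU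
  have : ∀ᶠ w in nhds (⟨2 + s.re, s.im⟩ : ℂ), 1 < w.re := 
    (isOpen_lt continuous_const continuous_re).mem_nhds (by show (1:ℝ) < 2 + s.re; linarith)
  filter_upwards [this] with w hw
  exact zeta_eq_gt w hw

lemma tail_le (N : ℕ) (hN : 1 ≤ N) (σ : ℝ) (hσ : 0 < σ) : ∑' n : ℕ, ((n + N : ℕ) + 1 : ℝ)^(-σ-1) ≤ (N:ℝ)^(-σ) / σ := by
  have hs : ∀ M : ℕ, ∑ n ∈ range M, ((n + N : ℕ) + 1 : ℝ)^(-σ-1) ≤ ((N:ℝ)^(-σ) - ((M + N : ℕ):ℝ)^(-σ))/ σ := by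
    intro M
    induction M with
    | zero => simp
    | succ M ih =>
      rw [sum_range_succ]
      have hMN : (0:ℝ) < ((M+N:ℕ):ℝ) := by exact_mod_cast (by omega)
      have : ((M + N : ℕ) + 1 : ℝ)^(-σ-1) ≤ (((M + N : ℕ):ℝ)^(-σ) - ((M + 1 + N : ℕ):ℝ)^(-σ))/ σ := by
        set y := ((M+N:ℕ):ℝ) with hy
        have e : ((M+1+N:ℕ):ℝ) = y + 1 := by rw [hy]; push_cast; ring
        rw [e, le_div_iff₀ hσ]
        -- mean value
        obtain ⟨c, hc, hc2⟩ := exists_hasDerivAt_eq_slope (fun x:ℝ => x^(-σ)) (fun x => (-σ) * x^(-σ-1)) (show y < y+1 by linarith)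
          (by
            apply ContinuousOn.rpow_const continuousOn_id
            intro x hx; left; simp at hx ⊢; linarith [hx.1])
          (by
            intro x hx
            exact Real.hasDerivAt_rpow_const (Or.inl (by linarith [hx.1])))
        simp at hc2
        have : (y+1)^(-σ-1) ≤ c^(-σ-1) := Real.rpow_le_rpow_of_nonpos (by linarith [hc.1]) hc.2.le (by linarith)
        nlinarith
      have h2 := add_le_add ih this
      refine h2.trans (le_of_eq ?_)
      ring
  refine Real.tsum_le_of_sum_range_le (fun n => by positivity) (fun M => (hs M).trans ?_)
  gcongr
  simp; positivity

lemma zeta_approx (s : ℂ) (hs : 0 < s.re) (ht : 0 < s.im) (N : ℕ) (hN : 1 ≤ N) :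
    ‖riemannZeta s - ∑ n ∈ range N, ((n+1:ℝ):ℂ)^(-s)‖ ≤ (N+1:ℝ)^(1-s.re) / s.im + ‖s‖ * ((N:ℝ)^(-s.re) / s.re) := by
  have hs1 : s ≠ 1 := by rintro rfl; simp at ht
  have h1 : 1 - s ≠ 0 := sub_ne_zero.mpr hs1.symm
  have h2 : s - 1 ≠ 0 := sub_ne_zero.mpr hs1
  have hS := summable_zt s hs hs1
  have e : riemannZeta s - ∑ n ∈ range N, ((n+1:ℝ):ℂ)^(-s) = ((N+1:ℝ):ℂ)^(1-s)/(s-1) + ∑' n, zt (n+N) s := by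
    rw [zeta_eq s hs ht, ← hS.sum_add_tsum_nat_add N, zt_sum]
    field_simp; ring
  rw [e]
  refine (norm_add_le _ _).trans (add_le_add ?_ ?_)
  · rw [norm_div, norm_cpow_eq_rpow_re_of_pos (by positivity)]
    have : s.im ≤ ‖s-1‖ := by
      have := abs_im_le_norm (s-1)
      simp at this; exact (le_abs_self _).trans this
    simp only [sub_re, one_re]
    gcongr
  · have hsum : Summable (fun n : ℕ => ((n + N : ℕ) + 1 : ℝ)^(-s.re-1)) := by
      have := (summable_nat_add_iff (N+1)).mpr (Real.summable_nat_rpow (p := -s.re-1) |>.mpr (by linarith))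
      refine this.congr (fun n => ?_); push_cast; ring_nf
    calc ‖∑' n, zt (n+N) s‖ ≤ ∑' n : ℕ, ‖s‖ * ((n + N : ℕ) + 1 : ℝ)^(-s.re-1) := by
          refine tsum_of_norm_bounded (hsum.mul_left _).hasSum (fun n => ?_)
          exact zt_bound (n+N) s (by linarith) hs1
      _ = ‖s‖ * ∑' n : ℕ, ((n + N : ℕ) + 1 : ℝ)^(-s.re-1) := tsum_mul_left
      _ ≤ _ := by gcongr; exact tail_le N hN _ hs

end

section
open Finset Complex

lemma abel_ineq (w : ℕ → ℝ) (b : ℕ → ℂ) (B : ℝ) (hw : Antitone w) (hw0 : ∀ n, 0 ≤ w n)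
    (m : ℕ) (hB : ∀ k ≤ m, ‖∑ j ∈ range k, b j‖ ≤ B) : ‖∑ j ∈ range m, (w j : ℂ) * b j‖ ≤ w 0 * B := by
  have key : ∀ k ≤ m, ‖∑ j ∈ range k, (w j : ℂ) * b j - w k * ∑ j ∈ range k, b j‖ ≤ (w 0 - w k) * B := by
    intro k
    induction k with
    | zero => intro _; simp
    | succ k ih =>
      intro hk
      have h1 := ih (by omega)
      have h2 := hB (k+1) hk
      have e : ∑ j ∈ range (k+1), (w j : ℂ) * b j - w (k+1) * ∑ j ∈ range (k+1), b j = 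
         (∑ j ∈ range k, (w j : ℂ) * b j - w k * ∑ j ∈ range k, b j) + ((w k - w (k+1) : ℝ):ℂ) * ∑ j ∈ range (k+1), b j := by
        rw [sum_range_succ, sum_range_succ]; push_cast; ring
      rw [e]
      refine (norm_add_le _ _).trans ?_
      have hd : 0 ≤ w k - w (k+1) := sub_nonneg.mpr (hw (Nat.le_succ k))
      rw [norm_mul, norm_real, Real.norm_eq_abs, abs_of_nonneg hd]
      nlinarith
  have h1 := key m le_rfl
  have h2 := hB m le_rfl
  calc ‖∑ j ∈ range m, (w j : ℂ) * b j‖ = ‖(∑ j ∈ range m, (w j : ℂ) * b j - w m * ∑ j ∈ range m, b j) + w m * ∑ j ∈ range m, b j‖ := by ring_nf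
    _ ≤ (w 0 - w m) * B + w m * B := by
      refine (norm_add_le _ _).trans (add_le_add h1 ?_)
      rw [norm_mul, norm_real, Real.norm_eq_abs, abs_of_nonneg (hw0 m)]
      exact mul_le_mul_of_nonneg_left h2 (hw0 m)
    _ = _ := by ring

lemma cpow_eq_ee (x : ℝ) (hx : 0 < x) (s : ℂ) : (x:ℂ)^(-s) = ((x^(-s.re):ℝ):ℂ) * (starRingEnd ℂ) (ee (s.im * Real.log x)) := by
  rw [cpow_def_of_ne_zero (by exact_mod_cast hx.ne'), ee, ← exp_conj, Real.rpow_def_of_pos hx, ofReal_exp, ← exp_add, ← ofReal_log hx.le]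
  congr 1
  apply Complex.ext <;> simp
  ring

lemma block_cpow (ε : ℝ) (hε : 0 < ε) : ∃ κ C : ℝ, 0 < κ ∧ κ ≤ 1/10 ∧ 0 < C ∧ ∀ (N : ℕ) (s : ℂ), 1 ≤ N → 1 ≤ s.im → s.im^ε ≤ N → (N:ℝ) ≤ s.im^((4:ℝ)/3) → 
    1 - κ ≤ s.re → ∀ m ≤ N, ‖∑ j ∈ range m, ((N + j:ℝ):ℂ)^(-s)‖ ≤ C := by
  obtain ⟨κ, C, hκ, hC, H⟩ := astar ε hε
  refine ⟨min κ (1/10), C, by positivity, min_le_right _ _, hC, ?_⟩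
  intro N s hN ht h1 h2 hs m hm
  have hN0 : (0:ℝ) < N := by exact_mod_cast hN
  have hN1 : (1:ℝ) ≤ N := by exact_mod_cast hN
  have hsr : 1 - κ ≤ s.re := by linarith [min_le_left κ (1/10)]
  have hsr0 : 0 ≤ s.re := by linarith [min_le_right κ (1/10)]
  have e : ∀ j ∈ range m, ((N + j:ℝ):ℂ)^(-s) = (((N+j:ℝ)^(-s.re):ℝ):ℂ) * (starRingEnd ℂ) (ee (s.im * Real.log (N+j))) := 
    fun j _ => cpow_eq_ee _ (by positivity) s
  rw [Finset.sum_congr rfl e]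
  refine (abel_ineq (fun j => (N+j:ℝ)^(-s.re)) (fun j => (starRingEnd ℂ) (ee (s.im * Real.log (N+j)))) (C * (N:ℝ)^(1-κ)) ?_ ?_ m ?_).trans ?_
  · intro a b hab
    exact Real.rpow_le_rpow_of_nonpos (by positivity) (by gcongr) (by linarith)
  · intro n; positivity
  · intro k hk
    rw [← map_sum, RCLike.norm_conj]
    exact H N s.im hN ht h1 h2 k (by omega)
  · simp only [CharP.cast_eq_zero, add_zero]
    calc (N:ℝ)^(-s.re) * (C * (N:ℝ)^(1-κ)) = C * (N:ℝ)^(1-κ-s.re) := by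
          rw [mul_left_comm, ← Real.rpow_add hN0]; ring_nf
      _ ≤ C * 1 := by gcongr; exact Real.rpow_le_one_of_one_le_of_nonpos hN1 (by linarith)
      _ = C := mul_one _

lemma sum_first (N : ℕ) (hN : 1 ≤ N) (κ : ℝ) (hκ : 0 ≤ κ) (s : ℂ) (hs : 1 - κ ≤ s.re) :
    ‖∑ n ∈ range (N-1), ((n+1:ℝ):ℂ)^(-s)‖ ≤ (N:ℝ)^κ * (1 + Real.log N) := by
  have hN0 : (0:ℝ) < N := by exact_mod_cast hN
  refine (norm_sum_le _ _).trans ?_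
  have h1 : ∀ n ∈ range (N-1), ‖((n+1:ℝ):ℂ)^(-s)‖ ≤ (N:ℝ)^κ * ((n:ℝ)+1)⁻¹ := by
    intro n hn
    simp at hn
    rw [norm_cpow_eq_rpow_re_of_pos (by positivity), neg_re]
    have hn1 : (1:ℝ) ≤ n + 1 := by simp
    have hnN : (n:ℝ) + 1 ≤ N := by exact_mod_cast (by omega : n + 1 ≤ N)
    calc ((n:ℝ)+1)^(-s.re) ≤ ((n:ℝ)+1)^(κ + -1) := Real.rpow_le_rpow_of_exponent_le hn1 (by linarith)
      _ = ((n:ℝ)+1)^κ * ((n:ℝ)+1)⁻¹ := by rw [Real.rpow_add (by positivity), Real.rpow_neg_one]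
      _ ≤ _ := by gcongr
  refine (Finset.sum_le_sum h1).trans ?_
  rw [← Finset.mul_sum]
  gcongr
  have h2 : ∑ n ∈ range (N-1), ((n:ℝ)+1)⁻¹ ≤ ∑ n ∈ range N, ((n:ℝ)+1)⁻¹ := 
    Finset.sum_le_sum_of_subset_of_nonneg (by intro x; simp; omega) (fun _ _ _ => by positivity)
  have := harmonic_le_one_add_log N
  rw [harmonic] at this
  push_cast at this
  linarith

set_option maxHeartbeats 1000000 in
lemma zeta_up (ε : ℝ) (hε : 0 < ε) (hε1 : ε ≤ 1) : ∃ κ T0 : ℝ, 0 < κ ∧ κ ≤ 1/10 ∧ 3 ≤ T0 ∧ ∀ s : ℂ, T0 ≤ s.im → 1 - κ ≤ s.re → s.re ≤ 3 → ‖riemannZeta s‖ ≤ Real.exp (2 * ε * κ * Real.log s.im) := by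
  obtain ⟨κ, C, hκ, hκ1, hC, H⟩ := block_cpow ε hε
  -- eventual domination
  have hdom : ∃ T0 : ℝ, 3 ≤ T0 ∧ ∀ t ≥ T0, (4 + 4*C + 22) * (1 + Real.log t) ≤ t^(ε*κ) := by
    have h1 : (fun t : ℝ => (4 + 4*C + 22) * (1 + Real.log t)) =o[Filter.atTop] (fun t : ℝ => t^(ε*κ)) := by
      apply Asymptotics.IsLittleO.const_mul_left
      refine Asymptotics.IsLittleO.add ?_ (isLittleO_log_rpow_atTop (by positivity))
      refine (Asymptotics.isLittleO_const_left.mpr (Or.inr ?_))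
      exact Filter.tendsto_abs_atTop_atTop.comp (tendsto_rpow_atTop (by positivity))
    have h2 := h1.bound (show (0:ℝ) < 1 by norm_num)
    obtain ⟨T, hT⟩ := Filter.eventually_atTop.mp h2
    refine ⟨max 3 T, le_max_left _ _, fun t ht => ?_⟩
    have h3 := hT t ((le_max_right _ _).trans ht)
    have ht0 : 0 < t := by linarith [(le_max_left 3 T).trans ht]
    rw [one_mul, Real.norm_eq_abs, Real.norm_eq_abs, abs_of_nonneg (by positivity : 0 ≤ t^(ε*κ))] at h3
    exact (le_abs_self _).trans h3
  obtain ⟨T0, hT03, hT0⟩ := hdom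
  refine ⟨κ, T0, hκ, hκ1, hT03, ?_⟩
  intro s ht hs1 hs3
  set t := s.im with htdef
  have ht3 : 3 ≤ t := by linarith
  have ht0 : 0 < t := by linarith
  have hlt : 1 ≤ Real.log t := by
    rw [Real.le_log_iff_exp_le ht0]; linarith [Real.exp_one_lt_d9]
  set N0 := ⌈t^ε⌉₊ with hN0
  have htε1 : 1 < t^ε := Real.one_lt_rpow (by linarith) hε
  have hN02 : 2 ≤ N0 := by
    have := Nat.le_ceil (t^ε)
    have : (1:ℝ) < N0 := lt_of_lt_of_le htε1 this
    exact_mod_cast this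
  have hN0up : (N0:ℝ) ≤ 2 * t^ε := by
    have := Nat.ceil_lt_add_one (show 0 ≤ t^ε by positivity)
    linarith
  -- blocks
  have hblk : ∀ J : ℕ, (∀ j < J, ((N0 * 2^j : ℕ):ℝ) ≤ t^((4:ℝ)/3)) → ‖∑ n ∈ range (N0 * 2^J - 1), ((n+1:ℝ):ℂ)^(-s)‖ ≤ (N0:ℝ)^κ * (1 + Real.log N0) + J * C := by
    intro J
    induction J with
    | zero => intro _; simpa using sum_first N0 (by omega) κ hκ.le s hs1
    | succ J ih =>
      intro hJ
      have i1 := ih (fun j hj => hJ j (by omega))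
      have hpow : 1 ≤ 2^J := Nat.one_le_two_pow
      have hle : N0 ≤ N0 * 2^J := Nat.le_mul_of_pos_right _ (by omega)
      have i2 := H (N0*2^J) s (by omega) (by linarith) ((Nat.le_ceil _).trans (by exact_mod_cast hle)) (hJ J (by omega)) hs1 (N0*2^J) le_rfl
      have e : N0 * 2^(J+1) - 1 = (N0*2^J - 1) + N0*2^J := by rw [pow_succ, ← mul_assoc]; omega
      rw [e, Finset.sum_range_add]
      have e2 : ∀ j ∈ range (N0*2^J), ((((N0*2^J-1+j:ℕ):ℝ)+1:ℝ):ℂ)^(-s) = ((((N0*2^J:ℕ):ℝ) + j:ℝ):ℂ)^(-s) := by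
        intro j _
        congr 2
        have e3 : N0*2^J-1+j+1 = N0*2^J+j := by omega
        exact_mod_cast e3
      rw [Finset.sum_congr rfl e2]
      refine (norm_add_le _ _).trans ((add_le_add i1 i2).trans (le_of_eq ?_))
      push_cast; ring
  -- choose J
  have htt : (1:ℝ) ≤ t^((4:ℝ)/3) := Real.one_le_rpow (by linarith) (by norm_num)
  have hex : ∃ J : ℕ, t^((4:ℝ)/3) < ((N0 * 2^J : ℕ):ℝ) := by
    obtain ⟨J, hJ⟩ := pow_unbounded_of_one_lt (t^((4:ℝ)/3)) (show (1:ℝ) < 2 by norm_num)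
    refine ⟨J, hJ.trans_le ?_⟩
    push_cast
    have : (1:ℝ) ≤ N0 := by exact_mod_cast (by omega : 1 ≤ N0)
    have : (0:ℝ) < 2^J := by positivity
    nlinarith
  set J := Nat.find hex with hJdef
  have hJ1 : t^((4:ℝ)/3) < ((N0 * 2^J : ℕ):ℝ) := Nat.find_spec hex
  have hJ2 : ∀ j < J, ((N0 * 2^j : ℕ):ℝ) ≤ t^((4:ℝ)/3) := fun j hj => not_lt.mp (Nat.find_min hex hj)
  have hNup : ((N0 * 2^J : ℕ):ℝ) ≤ 2 * t^((4:ℝ)/3) := by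
    rcases Nat.eq_zero_or_pos J with h | h
    · rw [h]; push_cast; simp
      refine hN0up.trans ?_
      gcongr
      · linarith
      · linarith
    · have := hJ2 (J-1) (by omega)
      have e : N0 * 2^J = 2 * (N0 * 2^(J-1)) := by
        obtain ⟨i, hi⟩ : ∃ i, J = i + 1 := ⟨J-1, by omega⟩
        rw [hi, pow_succ]; simp; ring
      rw [e]; push_cast at this ⊢; linarith
  have hJle : (J:ℝ) ≤ 4 * Real.log t := by
    rcases Nat.eq_zero_or_pos J with h | h
    · rw [h]; simp; linarith
    · have := hJ2 (J-1) (by omega)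
      have h2 : (2:ℝ)^J ≤ t^((4:ℝ)/3) := by
        refine le_trans ?_ this
        push_cast
        obtain ⟨i, hi⟩ : ∃ i, J = i + 1 := ⟨J-1, by omega⟩
        rw [hi, pow_succ]; simp
        have : (2:ℝ) ≤ N0 := by exact_mod_cast hN02
        have : (0:ℝ) < 2^i := by positivity
        nlinarith
      have h3 := Real.log_le_log (by positivity) h2
      rw [Real.log_pow, Real.log_rpow ht0] at h3
      have := Real.log_two_gt_d9
      have hJ0 : (0:ℝ) ≤ J := by positivity
      nlinarith
  have hsr : 9/10 ≤ s.re := by linarith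
  have hmain := hblk J hJ2
  set N := N0 * 2^J - 1 with hNdef
  have hN02J : 2 ≤ N0 * 2^J := hN02.trans (Nat.le_mul_of_pos_right _ (by positivity))
  have hNp1 : ((N:ℝ)+1) = ((N0*2^J:ℕ):ℝ) := by
    rw [hNdef]; rw [Nat.cast_sub (by omega)]; push_cast; ring
  have hN1 : 1 ≤ N := by omega
  have hN1R : (1:ℝ) ≤ N := by exact_mod_cast hN1
  have hap := zeta_approx s (by linarith) (by linarith) N hN1
  have htail1 : (N+1:ℝ)^(1-s.re) / s.im ≤ 2 := by
    rw [div_le_iff₀ (by linarith), hNp1]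
    calc (((N0*2^J:ℕ):ℝ))^(1-s.re) ≤ (((N0*2^J:ℕ):ℝ))^((1:ℝ)/10) := 
          Real.rpow_le_rpow_of_exponent_le (by linarith) (by linarith)
      _ ≤ (2 * t^((4:ℝ)/3))^((1:ℝ)/10) := by gcongr
      _ = 2^((1:ℝ)/10) * t^((4:ℝ)/30) := by
          rw [Real.mul_rpow (by norm_num) (by positivity), ← Real.rpow_mul ht0.le]; norm_num
      _ ≤ 2^(1:ℝ) * t^(1:ℝ) := by gcongr <;> first | linarith | norm_num
      _ = 2 * t := by simp
  have htail2 : ‖s‖ * ((N:ℝ)^(-s.re) / s.re) ≤ 20 := by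
    have a1 : ‖s‖ ≤ 2 * t := by
      have := Complex.norm_le_abs_re_add_abs_im s
      rw [abs_of_nonneg (by linarith : 0 ≤ s.re), abs_of_nonneg (by linarith : 0 ≤ s.im)] at this
      linarith
    have a2 : t^((4:ℝ)/3) / 2 ≤ N := by linarith
    have a3 : (N:ℝ)^(-s.re) ≤ 4 * t⁻¹ := by
      calc (N:ℝ)^(-s.re) ≤ (N:ℝ)^(-(9/10:ℝ)) := Real.rpow_le_rpow_of_exponent_le hN1R (by linarith)
        _ ≤ (t^((4:ℝ)/3) / 2)^(-(9/10:ℝ)) := Real.rpow_le_rpow_of_nonpos (by positivity) a2 (by norm_num)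
        _ = t^(-(12/10:ℝ)) * 2^(9/10:ℝ) := by
            rw [Real.div_rpow (by positivity) (by norm_num), ← Real.rpow_mul ht0.le, Real.rpow_neg (by norm_num : (0:ℝ) ≤ 2), div_inv_eq_mul]; norm_num
        _ ≤ t^(-1:ℝ) * 2^(1:ℝ) := by gcongr <;> first | linarith | norm_num
        _ ≤ 4 * t⁻¹ := by rw [Real.rpow_neg_one]; have : 0 < t⁻¹ := by positivity
                          norm_num; linarith
    have a4 : (N:ℝ)^(-s.re) / s.re ≤ (4 * t⁻¹) / (9/10) := by gcongr
    calc ‖s‖ * ((N:ℝ)^(-s.re) / s.re) ≤ (2*t) * ((4 * t⁻¹) / (9/10)) := by gcongr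
      _ = 80/9 := by field_simp; norm_num
      _ ≤ 20 := by norm_num
  have hfirst : (N0:ℝ)^κ * (1 + Real.log N0) ≤ 4 * (1 + Real.log t) * t^(ε*κ) := by
    have b1 : (N0:ℝ)^κ ≤ 2 * t^(ε*κ) := by
      calc (N0:ℝ)^κ ≤ (2 * t^ε)^κ := by gcongr
        _ = 2^κ * t^(ε*κ) := by rw [Real.mul_rpow (by norm_num) (by positivity), ← Real.rpow_mul ht0.le]
        _ ≤ 2^(1:ℝ) * t^(ε*κ) := by gcongr <;> linarith
        _ = _ := by simp
    have b2 : Real.log N0 ≤ 1 + Real.log t := by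
      calc Real.log N0 ≤ Real.log (2 * t^ε) := Real.log_le_log (by positivity) hN0up
        _ = Real.log 2 + ε * Real.log t := by rw [Real.log_mul (by norm_num) (by positivity), Real.log_rpow ht0]
        _ ≤ 1 + Real.log t := by nlinarith [Real.log_two_lt_d9]
    have b3 : 0 ≤ Real.log N0 := Real.log_natCast_nonneg _
    calc _ ≤ (2 * t^(ε*κ)) * (1 + (1 + Real.log t)) := by gcongr
      _ ≤ (2 * t^(ε*κ)) * (2 * (1 + Real.log t)) := by gcongr; linarith
      _ = _ := by ring
  have hX1 : 1 ≤ t^(ε*κ) := Real.one_le_rpow (by linarith) (by positivity)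
  have htot : ‖riemannZeta s‖ ≤ (4 + 4*C + 22) * (1 + Real.log t) * t^(ε*κ) := by
    have : ‖riemannZeta s‖ ≤ ‖riemannZeta s - ∑ n ∈ range N, ((n+1:ℝ):ℂ)^(-s)‖ + ‖∑ n ∈ range N, ((n+1:ℝ):ℂ)^(-s)‖ := by
      have := norm_add_le (riemannZeta s - ∑ n ∈ range N, ((n+1:ℝ):ℂ)^(-s)) (∑ n ∈ range N, ((n+1:ℝ):ℂ)^(-s))
      simpa using this
    have c1 : (J:ℝ) * C + 22 ≤ (4*C+22) * (1 + Real.log t) := by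
      have c0 : (J:ℝ) * C ≤ (4 * Real.log t) * C := mul_le_mul_of_nonneg_right hJle hC.le
      linarith
    have c2 : (4*C+22) * (1 + Real.log t) * 1 ≤ (4*C+22) * (1 + Real.log t) * t^(ε*κ) := by gcongr
    calc ‖riemannZeta s‖ ≤ (2 + 20) + ((N0:ℝ)^κ * (1 + Real.log N0) + J * C) := by linarith
      _ ≤ _ := by linarith
  have hfin := hT0 t ht
  calc ‖riemannZeta s‖ ≤ _ := htot
    _ ≤ t^(ε*κ) * t^(ε*κ) := by gcongr
    _ = _ := by rw [← Real.rpow_add ht0, Real.rpow_def_of_pos ht0]; ring_nf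

end

section
open Finset Complex Metric Topology

lemma factor_zeros (K : Set ℂ) (f : ℂ → ℂ) (hf : AnalyticOnNhd ℂ f K) (hnz : ∀ z ∈ K, ¬ ∀ᶠ w in 𝓝 z, f w = 0)
    (S : Finset ℂ) (hS : (S : Set ℂ) ⊆ K) : ∃ (m : ℂ → ℕ) (g : ℂ → ℂ), AnalyticOnNhd ℂ g K ∧
      (∀ z, f z = (∏ ρ ∈ S, (z - ρ)^(m ρ)) * g z) ∧ ∀ ρ ∈ S, g ρ ≠ 0 := by
  classical
  induction S using Finset.induction_on with
  | empty => exact ⟨fun _ => 0, f, hf, by simp, by simp⟩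
  | insert ρ0 S hρ ih =>
    obtain ⟨m, g, hg, hfg, hgS⟩ := ih (fun z hz => hS (by simp at hz ⊢; exact Or.inr hz))
    have hρK : ρ0 ∈ K := hS (by simp)
    have hga := hg ρ0 hρK
    have hne : ¬ ∀ᶠ w in 𝓝 ρ0, g w = 0 := fun h => hnz ρ0 hρK (h.mono fun w hw => by rw [hfg, hw, mul_zero])
    obtain ⟨n, h, hh, hh0, hev⟩ := hga.exists_eventuallyEq_pow_smul_nonzero_iff.mpr hne
    simp only [smul_eq_mul] at hev
    set g' : ℂ → ℂ := fun z => if z = ρ0 then h ρ0 else g z / (z - ρ0)^n with hg'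
    refine ⟨Function.update m ρ0 n, g', ?_, ?_, ?_⟩
    · intro z hz
      by_cases hzz : z = ρ0
      · subst hzz
        refine hh.congr ?_
        filter_upwards [hev] with w hw
        simp only [hg']
        split_ifs with h1
        · rw [h1]
        · rw [hw]; field_simp [sub_ne_zero.mpr h1]
      · have : AnalyticAt ℂ (fun z => g z / (z - ρ0)^n) z :=
          (hg z hz).div ((analyticAt_id.sub analyticAt_const).pow n) (pow_ne_zero _ (sub_ne_zero.mpr hzz))
        refine this.congr ?_
        filter_upwards [isOpen_ne.mem_nhds hzz] with w hw
        simp only [hg', if_neg hw]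
    · intro z
      rw [Finset.prod_insert hρ, Function.update_self]
      have e : ∏ x ∈ S, (z - x)^(Function.update m ρ0 n x) = ∏ x ∈ S, (z-x)^(m x) :=
        Finset.prod_congr rfl fun x hx => by rw [Function.update_of_ne (by rintro rfl; exact hρ hx)]
      rw [e, hfg z]
      have : g z = (z-ρ0)^n * g' z := by
        by_cases hzz : z = ρ0
        · subst hzz; simp only [hg', if_true]; exact hev.self_of_nhds
        · simp only [hg', if_neg hzz]; field_simp [sub_ne_zero.mpr hzz]
      rw [this]; ring
    · intro ρ hρ'
      simp only [hg']
      split_ifs with h1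
      · exact hh0
      · have hρS : ρ ∈ S := by simpa [h1] using hρ'
        exact div_ne_zero (hgS ρ hρS) (pow_ne_zero _ (sub_ne_zero.mpr h1))

lemma log_deriv_nonvanish (c : ℂ) (R M : ℝ) (hR : 0 < R) (hM : 0 < M) (g : ℂ → ℂ) (hg : DifferentiableOn ℂ g (ball c R))
    (hg0 : ∀ z ∈ ball c R, g z ≠ 0) (hgM : ∀ z ∈ ball c R, ‖g z‖ ≤ Real.exp M * ‖g c‖) (z : ℂ) (hz : dist z c ≤ R/2) :
    ‖deriv g z / g z‖ ≤ 24 * M / R := by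
  have hc : c ∈ ball c R := mem_ball_self hR
  have hd : DifferentiableOn ℂ (fun z => deriv g z / g z) (ball c R) :=
    (hg.deriv isOpen_ball).div hg hg0
  obtain ⟨h, hhc, hh⟩ := (hd.isExactOn_ball).with_val_at c 0
  have hconst : ∀ z ∈ ball c R, g z * Complex.exp (- h z) = g c := by
    intro z hz
    have hder : ∀ w ∈ ball c R, HasDerivAt (fun w => g w * Complex.exp (- h w)) 0 w := by
      intro w hw
      have h1 := ((hg w hw).differentiableAt (isOpen_ball.mem_nhds hw)).hasDerivAt
      have h2 := (hh w hw).neg.cexp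
      have h5 := hg0 w hw
      have h6 : g w * (deriv g w / g w) = deriv g w := by field_simp
      refine (h1.mul h2).congr_deriv ?_
      simp only [Pi.neg_apply]
      linear_combination (-Complex.exp (-h w)) * h6
    have := isOpen_ball.is_const_of_deriv_eq_zero (convex_ball c R).isPreconnected
      (fun w hw => (hder w hw).differentiableAt.differentiableWithinAt) (fun w hw => (hder w hw).deriv) hz hc
    simpa [hhc] using this
  have hre : ∀ z ∈ ball c R, (h z).re ≤ M := by
    intro z hz
    have h1 := hconst z hz
    have h2 : g z = g c * Complex.exp (h z) := by
      rw [← h1, mul_assoc, ← Complex.exp_add]; simp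
    have h3 := hgM z hz
    rw [h2, norm_mul, Complex.norm_exp, mul_comm] at h3
    have : 0 < ‖g c‖ := norm_pos_iff.mpr (hg0 c hc)
    exact Real.exp_le_exp.mp (le_of_mul_le_mul_right h3 this)
  have hbc : ∀ w, dist w c ≤ 3*R/4 → ‖h w‖ ≤ 6 * M := by
    intro w hw
    have hwn : ‖w - c‖ ≤ 3*R/4 := by rwa [dist_eq_norm] at hw
    have := Complex.borelCaratheodory_zero (f := fun w => h (c + w)) (z := w - c) (R := R) hM ?_ ?_ hR ?_ (by simpa using hhc)
    · simp only [add_sub_cancel] at this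
      refine this.trans ?_
      rw [div_le_iff₀ (by linarith)]
      nlinarith
    · intro x hx
      have hx' : c + x ∈ ball c R := by simpa [dist_eq_norm] using hx
      exact ((hh _ hx').differentiableAt.comp x (by fun_prop)).differentiableWithinAt
    · intro x hx
      exact hre _ (by simpa [dist_eq_norm] using hx)
    · simp; linarith
  have hzb : z ∈ ball c R := by simp; linarith
  rw [← (hh z hzb).deriv]
  have := Complex.norm_deriv_le_of_forall_mem_sphere_norm_le (f := h) (c := z) (R := R/4) (C := 6*M) (by linarith) ?_ ?_
  · refine this.trans (le_of_eq ?_); field_simp; ring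
  · apply DifferentiableOn.diffContOnCl
    rw [closure_ball _ (by linarith)]
    intro w hw
    refine (hh w ?_).differentiableAt.differentiableWithinAt
    simp at hw ⊢
    linarith [dist_triangle w z c]
  · intro w hw
    apply hbc
    have hw' : dist w z = R/4 := hw
    linarith [dist_triangle w z c]

lemma landau (c : ℂ) (R M : ℝ) (hR : 0 < R) (hM : 0 < M) (f : ℂ → ℂ) (hf : AnalyticOnNhd ℂ f (closedBall c R)) (hc : f c ≠ 0)
    (hfM : ∀ z ∈ closedBall c R, ‖f z‖ ≤ Real.exp M * ‖f c‖) : ∃ (S : Finset ℂ) (m : ℂ → ℕ),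
      (∀ ρ ∈ S, f ρ = 0 ∧ 1 ≤ m ρ ∧ dist ρ c ≤ R/2) ∧ (∀ ρ, dist ρ c ≤ R/2 → f ρ = 0 → ρ ∈ S) ∧
      ∀ z, dist z c ≤ R/4 → f z ≠ 0 → ‖deriv f z / f z - ∑ ρ ∈ S, (m ρ : ℂ) / (z - ρ)‖ ≤ 48 * M / R := by
  classical
  have hcK : c ∈ closedBall c R := mem_closedBall_self hR.le
  have hpre : IsPreconnected (closedBall c R) := (convex_closedBall c R).isPreconnected
  have hnz : ∀ z ∈ closedBall c R, ¬ ∀ᶠ w in 𝓝 z, f w = 0 := by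
    intro z hz h
    exact hc (hf.eqOn_zero_of_preconnected_of_eventuallyEq_zero hpre hz h hcK)
  have hfin : (closedBall c (R/2) ∩ f ⁻¹' {0}).Finite := by
    by_contra hinf
    have hcomp : IsCompact (closedBall c (R/2)) := isCompact_closedBall c (R/2)
    obtain ⟨x, hx, hacc⟩ := Set.Infinite.exists_accPt_of_subset_isCompact hinf hcomp Set.inter_subset_left
    have hxK : x ∈ closedBall c R := closedBall_subset_closedBall (by linarith) hx
    rw [accPt_iff_frequently_nhdsNE] at hacc
    have h2 : ∃ᶠ z in 𝓝[≠] x, f z = 0 := hacc.mono fun y hy => by simpa using hy.2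
    exact hc (hf.eqOn_zero_of_preconnected_of_frequently_eq_zero hpre hxK h2 hcK)
  set S := hfin.toFinset with hSdef
  have hSmem : ∀ ρ, ρ ∈ S ↔ dist ρ c ≤ R/2 ∧ f ρ = 0 := by
    intro ρ; rw [hSdef, Set.Finite.mem_toFinset]; simp
  obtain ⟨m, g, hg, hfg, hgS⟩ := factor_zeros (closedBall c R) f hf hnz S (by
    intro z hz; have := (hSmem z).mp hz; simp; linarith [this.1])
  have hm : ∀ ρ ∈ S, 1 ≤ m ρ := by
    intro ρ hρ
    by_contra h
    have h0 : m ρ = 0 := by omega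
    have h1 := hfg ρ
    rw [((hSmem ρ).mp hρ).2] at h1
    rcases mul_eq_zero.mp h1.symm with h2 | h2
    · obtain ⟨a, ha, h3⟩ := Finset.prod_eq_zero_iff.mp h2
      have : m a ≠ 0 := fun h => by rw [h] at h3; simp at h3
      have h4 := pow_eq_zero_iff this |>.mp h3
      rw [sub_eq_zero.mp h4] at h0; exact this h0
    · exact hgS ρ hρ h2
  have hg0 : ∀ z ∈ closedBall c (R/2), g z ≠ 0 := by
    intro z hz h
    have hfz : f z = 0 := by rw [hfg, h, mul_zero]
    exact hgS z ((hSmem z).mpr ⟨hz, hfz⟩) h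
  have hgc : g c ≠ 0 := hg0 c (by simp; linarith)
  have hgM : ∀ z ∈ closedBall c R, ‖g z‖ ≤ Real.exp M * ‖g c‖ := by
    intro z hz
    have hcl : closedBall c R = closure (ball c R) := (closure_ball c hR.ne').symm
    refine Complex.norm_le_of_forall_mem_frontier_norm_le (U := ball c R) isBounded_ball ?_ ?_ (by rwa [← hcl])
    · apply DifferentiableOn.diffContOnCl
      rw [← hcl]; exact hg.differentiableOn
    · intro w hw
      rw [frontier_ball c hR.ne'] at hw
      have hwd : dist w c = R := hw
      have h1 := hfM w (by simp [hwd])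
      rw [hfg w, hfg c, norm_mul, norm_mul, norm_prod, norm_prod] at h1
      have hPc : 0 < ∏ ρ ∈ S, ‖(c - ρ)^(m ρ)‖ := by
        apply Finset.prod_pos
        intro ρ hρ
        rw [norm_pos_iff]
        apply pow_ne_zero
        rw [sub_ne_zero]; rintro rfl
        exact hc ((hSmem c).mp hρ).2
      have hPw : ∏ ρ ∈ S, ‖(c - ρ)^(m ρ)‖ ≤ ∏ ρ ∈ S, ‖(w - ρ)^(m ρ)‖ := by
        apply Finset.prod_le_prod (fun _ _ => norm_nonneg _)
        intro ρ hρ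
        rw [norm_pow, norm_pow]
        gcongr
        have := ((hSmem ρ).mp hρ).1
        rw [← dist_eq_norm, ← dist_eq_norm, dist_comm c ρ]
        linarith [dist_triangle w ρ c]
      have h2 : (∏ ρ ∈ S, ‖(c - ρ)^(m ρ)‖) * ‖g w‖ ≤ (∏ ρ ∈ S, ‖(c - ρ)^(m ρ)‖) * (Real.exp M * ‖g c‖) := by
        calc _ ≤ (∏ ρ ∈ S, ‖(w - ρ)^(m ρ)‖) * ‖g w‖ := by gcongr
          _ ≤ _ := h1
          _ = _ := by ring
      exact le_of_mul_le_mul_left h2 hPc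
  refine ⟨S, m, fun ρ hρ => ⟨((hSmem ρ).mp hρ).2, hm ρ hρ, ((hSmem ρ).mp hρ).1⟩, fun ρ h1 h2 => (hSmem ρ).mpr ⟨h1, h2⟩, ?_⟩
  intro z hz hfz
  have hsub : ball c (R/2) ⊆ closedBall c R := fun w hw => by simp at hw ⊢; linarith
  have hld := log_deriv_nonvanish c (R/2) M (by linarith) hM g (hg.differentiableOn.mono hsub)
    (fun w hw => hg0 w (ball_subset_closedBall hw)) (fun w hw => hgM w (hsub hw)) z (by linarith)
  have hzρ : ∀ ρ ∈ S, z - ρ ≠ 0 := by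
    intro ρ hρ h
    rw [sub_eq_zero.mp h] at hfz; exact hfz ((hSmem ρ).mp hρ).2
  have hgz : DifferentiableAt ℂ g z := (hg z (by simp; linarith)).differentiableAt
  have hgz0 : g z ≠ 0 := hg0 z (by simp; linarith)
  have e : deriv f z / f z = ∑ ρ ∈ S, (m ρ : ℂ) / (z - ρ) + deriv g z / g z := by
    have e1 : f = fun z => (∏ ρ ∈ S, (z - ρ)^(m ρ)) * g z := funext hfg
    change logDeriv f z = _ + logDeriv g z
    rw [e1, logDeriv_mul z (Finset.prod_ne_zero_iff.mpr fun ρ hρ => pow_ne_zero _ (hzρ ρ hρ)) hgz0 (by fun_prop) hgz]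
    congr 1
    rw [logDeriv_prod (s := S) (f := fun ρ z => (z-ρ)^(m ρ)) (x := z) (fun ρ hρ => pow_ne_zero _ (hzρ ρ hρ)) (fun ρ hρ => by fun_prop)]
    apply Finset.sum_congr rfl
    intro ρ hρ
    rw [logDeriv_fun_pow (by fun_prop)]
    simp [logDeriv_apply, div_eq_mul_inv]
  rw [e, add_sub_cancel_left]
  refine hld.trans (le_of_eq ?_)
  field_simp; ring

end

section
open Finset Complex Metric Topology
open ArithmeticFunction (vonMangoldt)

lemma conj_ee (x : ℝ) : (starRingEnd ℂ) (ee x) = ee (-x) := by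
  rw [ee, ee, ← exp_conj]; congr 1; simp
lemma ee_zero : ee 0 = 1 := by simp [ee]
lemma ee_re (x : ℝ) : (ee x).re = Real.cos x := by rw [ee, Complex.exp_ofReal_mul_I_re]

noncomputable def vmt (σ : ℝ) (n : ℕ) : ℝ := vonMangoldt n * (n:ℝ)^(-σ)
noncomputable def LV (σ t : ℝ) : ℂ := ∑' n : ℕ, ((vmt σ n : ℝ) : ℂ) * ee (-(t * Real.log n))
noncomputable def VM (σ : ℝ) : ℝ := ∑' n : ℕ, vmt σ n

lemma vmt_nonneg (σ : ℝ) (n : ℕ) : 0 ≤ vmt σ n :=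
  mul_nonneg ArithmeticFunction.vonMangoldt_nonneg (by positivity)

lemma lterm_eq (σ t : ℝ) (n : ℕ) : LSeries.term (fun n => (vonMangoldt n : ℂ)) (σ + t * I) n = ((vmt σ n : ℝ) : ℂ) * ee (-(t * Real.log n)) := by
  rcases Nat.eq_zero_or_pos n with h | h
  · subst h; simp [vmt]
  · rw [LSeries.term_of_ne_zero h.ne', vmt]
    have := cpow_eq_ee n (by exact_mod_cast h) (σ + t * I)
    rw [conj_ee] at this
    rw [div_eq_mul_inv, ← cpow_neg]
    simp only [ofReal_natCast] at this
    rw [this]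
    simp; ring

lemma vmt_summable {σ : ℝ} (hσ : 1 < σ) : Summable (vmt σ) := by
  have h := ArithmeticFunction.LSeriesSummable_vonMangoldt (s := σ + (0:ℝ) * I) (by simpa using hσ)
  have h2 := h.norm
  refine h2.congr fun n => ?_
  rw [lterm_eq]; rw [norm_mul, norm_ee, mul_one, norm_real, Real.norm_of_nonneg (vmt_nonneg _ _)]

lemma LV_summable {σ : ℝ} (hσ : 1 < σ) (t : ℝ) : Summable fun n : ℕ => ((vmt σ n : ℝ) : ℂ) * ee (-(t * Real.log n)) := by
  apply Summable.of_norm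
  refine (vmt_summable hσ).congr fun n => ?_
  rw [norm_mul, norm_ee, mul_one, norm_real, Real.norm_of_nonneg (vmt_nonneg _ _)]

lemma LV_eq {σ : ℝ} (hσ : 1 < σ) (t : ℝ) : LV σ t = -(deriv riemannZeta (σ + t * I) / riemannZeta (σ + t*I)) := by
  rw [← neg_div, ← ArithmeticFunction.LSeries_vonMangoldt_eq_deriv_riemannZeta_div (by simpa using hσ)]
  exact (tsum_congr fun n => lterm_eq σ t n).symm

lemma norm_LV_le {σ : ℝ} (hσ : 1 < σ) (t : ℝ) : ‖LV σ t‖ ≤ VM σ := by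
  refine tsum_of_norm_bounded (vmt_summable hσ).hasSum fun n => ?_
  rw [norm_mul, norm_ee, mul_one, norm_real, Real.norm_of_nonneg (vmt_nonneg _ _)]

lemma LV_zero (σ : ℝ) : LV σ 0 = (VM σ : ℂ) := by
  simp [LV, VM, ee_zero, Complex.ofReal_tsum]

lemma LV_neg (σ t : ℝ) : LV σ (-t) = (starRingEnd ℂ) (LV σ t) := by
  rw [LV, LV, Complex.conj_tsum]
  apply tsum_congr; intro n
  rw [map_mul, conj_ee, conj_ofReal]; congr 2; ring

lemma VM_anti {σ σ' : ℝ} (hσ : 1 < σ) (h : σ ≤ σ') : VM σ' ≤ VM σ := by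
  refine Summable.tsum_le_tsum (fun n => ?_) (vmt_summable (by linarith)) (vmt_summable hσ)
  rcases Nat.eq_zero_or_pos n with h0 | h0
  · subst h0; simp [vmt]
  · exact mul_le_mul_of_nonneg_left (Real.rpow_le_rpow_of_exponent_le (by exact_mod_cast h0) (by linarith)) ArithmeticFunction.vonMangoldt_nonneg

lemma three_four_one {σ : ℝ} (hσ : 1 < σ) (t : ℝ) : 0 ≤ 3 * VM σ + 4 * (LV σ t).re + (LV σ (2*t)).re := by
  have e : ∀ t, (LV σ t).re = ∑' n : ℕ, vmt σ n * Real.cos (t * Real.log n) := by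
    intro t
    rw [LV, Complex.re_tsum (LV_summable hσ t)]
    apply tsum_congr; intro n
    rw [re_ofReal_mul, ee_re, Real.cos_neg]
  have s : ∀ t, Summable fun n : ℕ => vmt σ n * Real.cos (t * Real.log n) := by
    intro t
    refine (Complex.hasSum_re (LV_summable hσ t).hasSum).summable.congr fun n => ?_
    rw [re_ofReal_mul, ee_re, Real.cos_neg]
  rw [e, e, VM, ← tsum_mul_left, ← tsum_mul_left, ← Summable.tsum_add ((vmt_summable hσ).mul_left 3) ((s t).mul_left 4),
    ← Summable.tsum_add (((vmt_summable hσ).mul_left 3).add ((s t).mul_left 4)) (s (2*t))]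
  apply tsum_nonneg; intro n
  have : Real.cos (2 * t * Real.log n) = 2 * Real.cos (t * Real.log n)^2 - 1 := by
    rw [mul_assoc, Real.cos_two_mul]
  rw [this]
  have := vmt_nonneg σ n
  have h2 : 0 ≤ vmt σ n * (2 * (1 + Real.cos (t * Real.log n))^2) := by positivity
  nlinarith

lemma LV_small (T : ℝ) : ∃ C : ℝ, 0 < C ∧ ∀ σ t : ℝ, 1 < σ → σ ≤ 2 → |t| ≤ T → ‖LV σ t - 1 / ((σ - 1 : ℝ) + t * I)‖ ≤ C := by
  have hz1 : ∀ s : ℂ, 1 ≤ s.re → riemannZeta₁ s ≠ 0 := by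
    intro s hs
    by_cases h : s = 1
    · rw [h]; simp
    · intro h0
      have := riemannZeta_eq_inv_sub_mul h
      rw [h0, mul_zero] at this
      exact riemannZeta_ne_zero_of_one_le_re hs this
  have hK : IsCompact (Set.Icc (1:ℝ) 2 ×ℂ Set.Icc (-T) T) := isCompact_Icc.reProdIm isCompact_Icc
  have hcont : ContinuousOn (fun s => deriv riemannZeta₁ s / riemannZeta₁ s) (Set.Icc (1:ℝ) 2 ×ℂ Set.Icc (-T) T) := by
    apply ContinuousOn.div
    · exact ((differentiable_riemannZeta₁.contDiff (n := 1)).continuous_deriv le_rfl).continuousOn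
    · exact differentiable_riemannZeta₁.continuous.continuousOn
    · intro s hs; exact hz1 s hs.1.1
  obtain ⟨C, hC⟩ := hK.exists_bound_of_continuousOn hcont
  refine ⟨max C 1, by positivity, ?_⟩
  intro σ t h1 h2 ht
  set s : ℂ := σ + t * I with hs
  have hsre : s.re = σ := by simp [hs]
  have hsim : s.im = t := by simp [hs]
  have hs1 : s ≠ 1 := by intro h; rw [h] at hsre; simp at hsre; linarith
  have := hC s (by rw [Complex.mem_reProdIm, hsre, hsim]; exact ⟨⟨h1.le, h2⟩, abs_le.mp ht⟩)
  refine le_trans (le_of_eq ?_) (this.trans (le_max_left _ _))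
  rw [LV_eq h1, ← hs]
  have hd : deriv riemannZeta s = -((s-1)^2)⁻¹ * riemannZeta₁ s + (s-1)⁻¹ * deriv riemannZeta₁ s := by
    have hev : riemannZeta =ᶠ[𝓝 s] fun s => (s-1)⁻¹ * riemannZeta₁ s := by
      filter_upwards [isOpen_ne.mem_nhds hs1] with w hw using riemannZeta_eq_inv_sub_mul hw
    rw [hev.deriv_eq]
    have hsub : s - 1 ≠ 0 := sub_ne_zero.mpr hs1
    have h3 : HasDerivAt (fun s : ℂ => (s-1)⁻¹) (-1/(s-1)^2) s := ((hasDerivAt_id s).sub_const 1).fun_inv hsub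
    rw [(h3.fun_mul (differentiable_riemannZeta₁ s).hasDerivAt).deriv]
    ring
  have e : ((σ - 1 : ℝ):ℂ) + t * I = s - 1 := by rw [hs]; push_cast; ring
  rw [e, hd, riemannZeta_eq_inv_sub_mul hs1]
  have hsub : s - 1 ≠ 0 := sub_ne_zero.mpr hs1
  have := hz1 s (by linarith)
  rw [← norm_neg]; congr 1
  field_simp; ring

lemma VM_bound : ∃ C : ℝ, 0 < C ∧ ∀ σ : ℝ, 1 < σ → σ ≤ 2 → |VM σ - 1/(σ-1)| ≤ C := by
  obtain ⟨C, hC, h⟩ := LV_small 0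
  refine ⟨C, hC, fun σ h1 h2 => ?_⟩
  have := h σ 0 h1 h2 (by simp)
  rw [LV_zero] at this
  rw [← Real.norm_eq_abs, ← norm_real]
  convert this using 2
  push_cast; simp

lemma zeta_lower {σ : ℝ} (hσ : 1 < σ) : ∃ c : ℝ, 0 < c ∧ ∀ t : ℝ, c ≤ ‖riemannZeta (σ + t * I)‖ := by
  have hs := ArithmeticFunction.LSeriesSummable_moebius_iff (s := (σ:ℂ)) |>.mpr (by simpa using hσ)
  set B := ∑' n, ‖LSeries.term (fun n => ((ArithmeticFunction.moebius n : ℤ):ℂ)) (σ:ℂ) n‖ with hB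
  refine ⟨1 / (B + 1), by positivity, fun t => ?_⟩
  have h1 : 1 < (σ + t * I : ℂ).re := by simpa using hσ
  have h2 : riemannZeta (σ + t * I) * LSeries (fun n => ((ArithmeticFunction.moebius n : ℤ):ℂ)) (σ + t*I) = 1 := by
    rw [← ArithmeticFunction.LSeries_zeta_eq_riemannZeta h1]
    exact ArithmeticFunction.LSeries_zeta_mul_Lseries_moebius h1
  have h3 : ‖LSeries (fun n => ((ArithmeticFunction.moebius n : ℤ):ℂ)) (σ + t*I)‖ ≤ B := by
    refine tsum_of_norm_bounded hs.norm.hasSum fun n => ?_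
    rw [LSeries.norm_term_eq, LSeries.norm_term_eq]; simp
  have h4 := congrArg norm h2
  rw [norm_mul, norm_one] at h4
  rw [div_le_iff₀ (by positivity), ← h4]
  gcongr; linarith

end

section
open Finset Complex Metric Topology

lemma ev_log (a b : ℝ) (ha : 0 < a) : ∃ T : ℝ, 3 ≤ T ∧ ∀ t ≥ T, b ≤ a * Real.log t := by
  have h : Filter.Tendsto (fun t => a * Real.log t) Filter.atTop Filter.atTop := Real.tendsto_log_atTop.const_mul_atTop ha
  obtain ⟨T, hT⟩ := Filter.eventually_atTop.mp (h.eventually_ge_atTop b)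
  exact ⟨max 3 T, le_max_left _ _, fun t ht => hT t ((le_max_right _ _).trans ht)⟩

lemma local_formula (ε : ℝ) (hε : 0 < ε) (hε1 : ε ≤ 1) : ∃ κ T : ℝ, 0 < κ ∧ κ ≤ 1/10 ∧ 3 ≤ T ∧ ∀ t ≥ T, ∃ (S : Finset ℂ) (m : ℂ → ℕ),
    (∀ ρ ∈ S, riemannZeta ρ = 0 ∧ 1 ≤ m ρ ∧ |ρ.im - t| ≤ 1 ∧ ρ.re < 1 ∧ 1 - 2*κ/5 ≤ ρ.re) ∧
    (∀ ρ : ℂ, ρ.im = t → 1 - 2*κ/5 ≤ ρ.re → riemannZeta ρ = 0 → ρ ∈ S) ∧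
    ∀ η : ℝ, 0 < η → η ≤ κ/4 → ‖LV (1+η) t + ∑ ρ ∈ S, (m ρ : ℂ) / (((1+η:ℝ) + t * I : ℂ) - ρ)‖ ≤ 240 * ε * Real.log t := by
  obtain ⟨κ, T0, hκ, hκ1, hT03, H⟩ := zeta_up ε hε hε1
  obtain ⟨c0, hc0, hlow⟩ := zeta_lower (σ := 1 + κ/10) (by linarith)
  obtain ⟨T1, hT13, hT1⟩ := ev_log (ε * κ) (-Real.log c0) (by positivity)
  refine ⟨κ, max (T0+1) T1, hκ, hκ1, hT13.trans (le_max_right _ _), ?_⟩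
  intro t ht
  have htT0 : T0 + 1 ≤ t := (le_max_left _ _).trans ht
  have htT1 := hT1 t ((le_max_right _ _).trans ht)
  have ht0 : 0 < t := by linarith
  have hlt : 1 ≤ Real.log t := by
    rw [Real.le_log_iff_exp_le ht0]; linarith [Real.exp_one_lt_d9]
  set c : ℂ := ((1 + κ/10 : ℝ):ℂ) + t * I with hc
  have hcre : c.re = 1 + κ/10 := by simp [hc]
  have hcim : c.im = t := by simp [hc]
  have hball : ∀ r, ∀ z ∈ closedBall c r, |z.re - (1+κ/10)| ≤ r ∧ |z.im - t| ≤ r := by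
    intro r z hz
    rw [mem_closedBall, dist_eq_norm] at hz
    have h1 := (Complex.abs_re_le_norm (z - c)).trans hz
    have h2 := (Complex.abs_im_le_norm (z - c)).trans hz
    rw [sub_re, hcre] at h1; rw [sub_im, hcim] at h2
    exact ⟨h1, h2⟩
  have han : AnalyticOnNhd ℂ riemannZeta (closedBall c κ) := by
    intro z hz
    have hz1 : z ≠ 1 := by
      rintro rfl
      have := (hball κ 1 hz).2
      simp at this; rw [abs_of_pos ht0] at this; linarith
    exact differentiableOn_riemannZeta.analyticAt (isOpen_compl_singleton.mem_nhds hz1)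
  have hzc := hlow t
  rw [← hc] at hzc
  have hcne : riemannZeta c ≠ 0 := by
    intro h; rw [h, norm_zero] at hzc; linarith
  have hlogt1 : Real.log (t + κ) ≤ 2 * Real.log t := by
    rw [← Real.log_rpow ht0]
    apply Real.log_le_log (by linarith)
    rw [show (2:ℝ) = ((2:ℕ):ℝ) by norm_num, Real.rpow_natCast]; nlinarith
  have hup : ∀ z ∈ closedBall c κ, ‖riemannZeta z‖ ≤ Real.exp (5 * ε * κ * Real.log t) * ‖riemannZeta c‖ := by
    intro z hz
    obtain ⟨h1, h2⟩ := hball κ z hz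
    rw [abs_le] at h1 h2
    have h3 := H z (by linarith) (by linarith) (by linarith)
    have h4 : Real.log z.im ≤ 2 * Real.log t := (Real.log_le_log (by linarith) (by linarith)).trans hlogt1
    calc ‖riemannZeta z‖ ≤ Real.exp (2 * ε * κ * Real.log z.im) := h3
      _ ≤ Real.exp (5 * ε * κ * Real.log t + Real.log c0) := by
          apply Real.exp_le_exp.mpr
          have : 2 * ε * κ * Real.log z.im ≤ 2 * ε * κ * (2 * Real.log t) := by gcongr
          linarith
      _ = Real.exp (5 * ε * κ * Real.log t) * c0 := by rw [Real.exp_add, Real.exp_log hc0]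
      _ ≤ _ := by gcongr
  obtain ⟨S, m, hS1, hS2, hS3⟩ := landau c κ (5 * ε * κ * Real.log t) hκ (by positivity) riemannZeta han hcne hup
  refine ⟨S, m, ?_, ?_, ?_⟩
  · intro ρ hρ
    obtain ⟨h1, h2, h3⟩ := hS1 ρ hρ
    obtain ⟨h4, h5⟩ := hball (κ/2) ρ h3
    refine ⟨h1, h2, by linarith, ?_, by linarith [(abs_le.mp h4).1]⟩
    by_contra h
    exact riemannZeta_ne_zero_of_one_le_re (not_lt.mp h) h1
  · intro ρ h1 h2 h3
    refine hS2 ρ ?_ h3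
    have h4 : ρ.re < 1 := by
      by_contra h
      exact riemannZeta_ne_zero_of_one_le_re (not_lt.mp h) h3
    have e : ρ - c = ((ρ.re - (1+κ/10) : ℝ):ℂ) := by
      apply Complex.ext <;> simp [hcre, hcim, h1]
    rw [dist_eq_norm, e, norm_real, Real.norm_eq_abs, abs_le]
    constructor <;> linarith
  · intro η hη hη2
    set z : ℂ := ((1+η:ℝ):ℂ) + t * I with hz
    have hd : dist z c ≤ κ/4 := by
      have e : z - c = ((η - κ/10 : ℝ):ℂ) := by rw [hz, hc]; push_cast; ring
      rw [dist_eq_norm, e, norm_real, Real.norm_eq_abs, abs_le]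
      constructor <;> linarith
    have hne : riemannZeta z ≠ 0 := riemannZeta_ne_zero_of_one_le_re (by simp [hz]; linarith)
    have := hS3 z hd hne
    rw [LV_eq (by linarith), ← hz]
    rw [← norm_neg]
    refine le_trans (le_of_eq ?_) (this.trans (le_of_eq ?_))
    · congr 1; ring
    · field_simp; ring

lemma re_inv_sum_nonneg (S : Finset ℂ) (m : ℂ → ℕ) (z : ℂ) (h : ∀ ρ ∈ S, ρ.re < z.re) :
    ∀ ρ ∈ S, 0 ≤ ((m ρ : ℂ) / (z - ρ)).re := by
  intro ρ hρ
  rw [div_eq_mul_inv, ← ofReal_natCast, re_ofReal_mul, inv_re]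
  have := h ρ hρ
  apply mul_nonneg (by positivity)
  apply div_nonneg _ (normSq_nonneg _)
  rw [sub_re]; linarith

lemma LV_large : ∃ C : ℝ, 0 < C ∧ ∀ ε : ℝ, 0 < ε → ε ≤ 1 → ∃ T : ℝ, 3 ≤ T ∧ ∀ t ≥ T, ∀ σ : ℝ, 1 < σ → σ ≤ 2 → ‖LV σ t‖ ≤ C * ε * Real.log t := by
  obtain ⟨C0, hC0, hVM⟩ := VM_bound
  refine ⟨100000, by norm_num, ?_⟩
  intro ε hε hε1
  obtain ⟨κ, T, hκ, hκ1, hT3, H⟩ := local_formula ε hε hε1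
  obtain ⟨T1, hT13, hT1⟩ := ev_log ε (3*C0 + VM (1+κ/4)) hε
  obtain ⟨T2, hT23, hT2⟩ := ev_log 1 8 one_pos
  obtain ⟨T3, hT33, hT3'⟩ := ev_log (3360*ε) (4/κ) (by positivity)
  set Tm := max (max T T1) (max T2 T3) with hTm
  have hVM0 : 0 ≤ VM (1+κ/4) := tsum_nonneg fun n => vmt_nonneg _ _
  have key : ∀ t ≥ Tm, 3 ≤ t ∧ T ≤ t ∧ 3*C0 + VM (1+κ/4) ≤ ε * Real.log t ∧ 8 ≤ Real.log t ∧ 4/κ ≤ 3360 * ε * Real.log t := by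
    intro t ht
    have a1 : T ≤ t := ((le_max_left _ _).trans (le_max_left _ _)).trans ht
    have a2 : T1 ≤ t := ((le_max_right _ _).trans (le_max_left _ _)).trans ht
    have a3 : T2 ≤ t := ((le_max_left _ _).trans (le_max_right _ _)).trans ht
    have a4 : T3 ≤ t := ((le_max_right _ _).trans (le_max_right _ _)).trans ht
    exact ⟨by linarith, a1, hT1 t a2, by linarith [hT2 t a3], hT3' t a4⟩
  have hVMη : ∀ t ≥ Tm, VM (1 + 1/(3360*ε*Real.log t)) ≤ 3360*ε*Real.log t + C0 := by
    intro t ht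
    obtain ⟨k1, k2, k3, k4, k5⟩ := key t ht
    have hp : 0 < 3360*ε*Real.log t := by positivity
    have hle : 1/(3360*ε*Real.log t) ≤ κ/4 := by
      rw [div_le_iff₀ hp]; rw [div_le_iff₀ hκ] at k5; linarith
    have := (abs_le.mp (hVM (1 + 1/(3360*ε*Real.log t)) (by linarith [show 0 < 1/(3360*ε*Real.log t) by positivity]) (by linarith))).2
    rw [add_sub_cancel_left, one_div_one_div] at this; linarith
  -- zero-free region
  have hzf : ∀ ρ : ℂ, Tm ≤ ρ.im → 1 - 2*κ/5 ≤ ρ.re → riemannZeta ρ = 0 → 1 / (7 * (3360 * ε * Real.log ρ.im)) ≤ 1 - ρ.re := by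
    intro ρ ht hre hz
    set t := ρ.im with htd
    obtain ⟨k1, k2, k3, k4, k5⟩ := key t ht
    set X := 3360 * ε * Real.log t with hX
    have hp : 0 < X := by positivity
    have hle : 1/X ≤ κ/4 := by
      rw [div_le_iff₀ hp]; rw [div_le_iff₀ hκ] at k5; linarith
    have hη : 0 < 1/X := by positivity
    obtain ⟨S, m, hS1, hS2, hS3⟩ := H t k2
    obtain ⟨S', m', hS1', hS2', hS3'⟩ := H (2*t) (by linarith)
    have h34 := three_four_one (σ := 1 + 1/X) (by linarith) t
    have f1 := hS3 (1/X) hη hle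
    have f2 := hS3' (1/X) hη hle
    have g1 := (Complex.re_le_norm _).trans f1
    have g2 := (Complex.re_le_norm _).trans f2
    rw [add_re, Complex.re_sum] at g1 g2
    have n2 : 0 ≤ ∑ ρ ∈ S', ((m' ρ : ℂ) / ((((1+1/X:ℝ):ℂ) + ((2*t:ℝ):ℂ) * I) - ρ)).re := by
      apply Finset.sum_nonneg
      apply re_inv_sum_nonneg
      intro ρ hρ
      have := (hS1' ρ hρ).2.2.2.1
      simp only [add_re, ofReal_re, mul_re, ofReal_im, I_re, I_im]; linarith
    have hρS : ρ ∈ S := hS2 ρ rfl hre hz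
    obtain ⟨_, hm1, _, hρ1, _⟩ := hS1 ρ hρS
    have n1 : 1 / (1 + 1/X - ρ.re) ≤ ∑ ρ ∈ S, ((m ρ : ℂ) / ((((1+1/X:ℝ):ℂ) + (t:ℂ) * I) - ρ)).re := by
      refine le_trans ?_ (Finset.single_le_sum (re_inv_sum_nonneg S m _ ?_) hρS)
      · have e : (((1+1/X:ℝ):ℂ) + (t:ℂ) * I) - ρ = ((1 + 1/X - ρ.re : ℝ):ℂ) := by
          apply Complex.ext <;> simp [htd]
        rw [e, ← ofReal_natCast, ← ofReal_div, ofReal_re]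
        have : (1:ℝ) ≤ m ρ := by exact_mod_cast hm1
        have : 0 < 1 + 1/X - ρ.re := by linarith
        gcongr
      · intro ρ hρ
        have := (hS1 ρ hρ).2.2.2.1
        simp only [add_re, ofReal_re, mul_re, ofReal_im, I_re, I_im]; linarith
    have hVX := hVMη t ht
    have hl2 : Real.log (2*t) ≤ 2 * Real.log t := by
      rw [Real.log_mul (by norm_num) (by linarith)]
      linarith [Real.log_two_lt_d9]
    have hl3 : 240 * ε * Real.log (2*t) ≤ 240 * ε * (2 * Real.log t) := by gcongr
    have hfin : 4 * (1 / (1 + 1/X - ρ.re)) ≤ 7/2 * X := by linarith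
    have hpos : 0 < 1 + 1/X - ρ.re := by linarith
    rw [mul_one_div, div_le_iff₀ hpos] at hfin
    have e2 : X * (1/X) = 1 := by field_simp
    rw [div_le_iff₀ (by positivity)]
    nlinarith
  refine ⟨Tm + 1, by linarith [(key Tm le_rfl).1], ?_⟩
  intro t ht σ hσ1 hσ2
  obtain ⟨k1, k2, k3, k4, k5⟩ := key t (by linarith)
  set X := 3360 * ε * Real.log t with hX
  have hp : 0 < X := by positivity
  have hle : 1/X ≤ κ/4 := by
    rw [div_le_iff₀ hp]; rw [div_le_iff₀ hκ] at k5; linarith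
  have hη : 0 < 1/X := by positivity
  have hVX := hVMη t (by linarith)
  have hl0 : 0 < ε * Real.log t := by positivity
  rcases le_or_gt (1 + 1/X) σ with hc | hc
  · refine (norm_LV_le hσ1 t).trans ((VM_anti (by linarith) hc).trans (hVX.trans ?_))
    linarith
  · obtain ⟨S, m, hS1, hS2, hS3⟩ := H t k2
    have f1 := hS3 (1/X) hη hle
    have f2 := hS3 (σ - 1) (by linarith) (by linarith)
    rw [add_sub_cancel] at f2
    set s1 : ℂ := ((1+1/X:ℝ):ℂ) + (t:ℂ) * I with hs1
    set z : ℂ := (σ:ℂ) + (t:ℂ) * I with hz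
    have hs1re : s1.re = 1 + 1/X := by simp [hs1]
    have hzre : z.re = σ := by simp [hz]
    have hnn := re_inv_sum_nonneg S m s1 (fun ρ hρ => by rw [hs1re]; linarith [(hS1 ρ hρ).2.2.2.1])
    have hdiff : ∀ ρ ∈ S, ‖(m ρ : ℂ) / (z - ρ) - (m ρ : ℂ) / (s1 - ρ)‖ ≤ 9 * ((m ρ : ℂ) / (s1 - ρ)).re := by
      intro ρ hρ
      obtain ⟨r1, r2, r3, r4, r5⟩ := hS1 ρ hρ
      rw [abs_le] at r3
      have hz1 := hzf ρ (by linarith) r5 r1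
      have hlog : Real.log ρ.im ≤ 8/7 * Real.log t := by
        have : Real.log ρ.im ≤ Real.log (2 * t) := Real.log_le_log (by linarith) (by linarith)
        rw [Real.log_mul (by norm_num) (by linarith)] at this
        have h3 := Real.log_two_lt_d9
        linarith
      have hlogpos : 0 < Real.log ρ.im := Real.log_pos (by linarith)
      have hge : 1/(8*X) ≤ 1 - ρ.re := by
        refine le_trans ?_ hz1
        apply one_div_le_one_div_of_le (by positivity)
        rw [hX]; nlinarith
      have e8 : 1/(8*X) = 1/X/8 := by field_simp
      have hzρ : 1/X/8 ≤ ‖z - ρ‖ := by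
        refine le_trans ?_ ((le_abs_self _).trans (Complex.abs_re_le_norm _))
        rw [sub_re, hzre]; linarith
      have hzs : ‖s1 - z‖ ≤ 1/X := by
        have : s1 - z = ((1 + 1/X - σ : ℝ):ℂ) := by rw [hs1, hz]; push_cast; ring
        rw [this, norm_real, Real.norm_of_nonneg (by linarith)]; linarith
      have hs9 : ‖s1 - ρ‖ ≤ 9 * ‖z - ρ‖ := by
        have : s1 - ρ = (s1 - z) + (z - ρ) := by ring
        rw [this]; refine (norm_add_le _ _).trans ?_; linarith
      have hzp : 0 < ‖z - ρ‖ := by linarith [show 0 < 1/X/8 by positivity]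
      have hrep : 1/X ≤ (s1 - ρ).re := by rw [sub_re, hs1re]; linarith
      have hsp : 0 < ‖s1 - ρ‖ := lt_of_lt_of_le hη (hrep.trans ((le_abs_self _).trans (Complex.abs_re_le_norm _)))
      have n1 : z - ρ ≠ 0 := norm_pos_iff.mp hzp
      have n2 : s1 - ρ ≠ 0 := norm_pos_iff.mp hsp
      have e : (m ρ : ℂ) / (z - ρ) - (m ρ : ℂ) / (s1 - ρ) = (m ρ : ℂ) * ((s1 - z) / ((z-ρ) * (s1 - ρ))) := by
        field_simp; ring
      rw [e, norm_mul, norm_div, norm_mul, Complex.norm_natCast, div_eq_mul_inv (m ρ : ℂ), ← ofReal_natCast, re_ofReal_mul, inv_re, normSq_eq_norm_sq]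
      have : ‖s1 - z‖ / (‖z - ρ‖ * ‖s1 - ρ‖) ≤ 9 * ((s1 - ρ).re / ‖s1 - ρ‖^2) := by
        rw [← mul_div_assoc, div_le_div_iff₀ (by positivity) (by positivity)]
        calc ‖s1 - z‖ * ‖s1-ρ‖^2 ≤ (s1 - ρ).re * (‖s1 - ρ‖ * (9 * ‖z - ρ‖)) := by
              rw [sq]; gcongr; exacts [by linarith, hzs.trans hrep]
          _ = _ := by ring
      calc (m ρ : ℝ) * (‖s1 - z‖ / (‖z - ρ‖ * ‖s1 - ρ‖)) ≤ (m ρ : ℝ) * (9 * ((s1 - ρ).re / ‖s1 - ρ‖^2)) := by gcongr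
        _ = _ := by ring
    have hsumd : ‖∑ ρ ∈ S, (m ρ : ℂ) / (z - ρ) - ∑ ρ ∈ S, (m ρ : ℂ) / (s1 - ρ)‖ ≤ 9 * (∑ ρ ∈ S, (m ρ : ℂ) / (s1 - ρ)).re := by
      rw [← Finset.sum_sub_distrib, Complex.re_sum, Finset.mul_sum]
      exact (norm_sum_le _ _).trans (Finset.sum_le_sum hdiff)
    have hLs1 : ‖LV (1+1/X) t‖ ≤ X + C0 := (norm_LV_le (by linarith) t).trans hVX
    have hsre : (∑ ρ ∈ S, (m ρ : ℂ) / (s1 - ρ)).re ≤ 240 * ε * Real.log t + (X + C0) := by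
      have := (Complex.re_le_norm _).trans f1
      rw [add_re] at this
      have h2 := (abs_le.mp ((Complex.abs_re_le_norm _).trans hLs1)).1
      linarith
    have e : LV σ t = (LV σ t + ∑ ρ ∈ S, (m ρ : ℂ) / (z - ρ)) - (∑ ρ ∈ S, (m ρ : ℂ) / (z - ρ) - ∑ ρ ∈ S, (m ρ : ℂ) / (s1 - ρ))
        - (LV (1+1/X) t + ∑ ρ ∈ S, (m ρ : ℂ) / (s1 - ρ)) + LV (1+1/X) t := by ring
    rw [e]
    refine (norm_add_le _ _).trans ?_
    have q1 := norm_sub_le ((LV σ t + ∑ ρ ∈ S, (m ρ : ℂ) / (z - ρ)) - (∑ ρ ∈ S, (m ρ : ℂ) / (z - ρ) - ∑ ρ ∈ S, (m ρ : ℂ) / (s1 - ρ))) (LV (1+1/X) t + ∑ ρ ∈ S, (m ρ : ℂ) / (s1 - ρ))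
    have q2 := norm_sub_le (LV σ t + ∑ ρ ∈ S, (m ρ : ℂ) / (z - ρ)) (∑ ρ ∈ S, (m ρ : ℂ) / (z - ρ) - ∑ ρ ∈ S, (m ρ : ℂ) / (s1 - ρ))
    linarith

/-- Lemma H -/
lemma lemH (e : ℝ) (he : 0 < e) : ∃ K L0 : ℝ, 1 ≤ K ∧ 1 ≤ L0 ∧ ∀ L ≥ L0, ∀ t : ℝ, K / L ≤ |t| → |t| ≤ Real.exp (2*L) →
    ∀ c : ℝ, 0 < c → c ≤ L → ‖LV (1 + c/L) t‖ ≤ e * L := by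
  obtain ⟨C, hC, H⟩ := LV_large
  obtain ⟨T, hT3, HT⟩ := H (min 1 (e/(2*C))) (by positivity) (min_le_left _ _)
  obtain ⟨C2, hC2, H2⟩ := LV_small T
  refine ⟨max 1 (2/e), max 1 (2*C2/e), le_max_left _ _, le_max_left _ _, ?_⟩
  intro L hL t ht1 ht2 c hc hcL
  have hL1 : 1 ≤ L := (le_max_left _ _).trans hL
  have hL2 : 2*C2/e ≤ L := (le_max_right _ _).trans hL
  have hL0 : 0 < L := by linarith
  have hcL0 : 0 < c/L := by positivity
  have hcL1 : c/L ≤ 1 := by rw [div_le_one hL0]; exact hcL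
  have habs : ‖LV (1 + c/L) t‖ = ‖LV (1+c/L) |t|‖ := by
    rcases abs_choice t with h | h
    · rw [h]
    · rw [h, LV_neg, RCLike.norm_conj]
  rw [habs]
  set u := |t| with hu
  have hK0 : 0 < max 1 (2/e) := by positivity
  have hu0 : 0 < u := lt_of_lt_of_le (by positivity) ht1
  rcases le_or_gt T u with h | h
  · have := HT u h (1+c/L) (by linarith) (by linarith)
    refine this.trans ?_
    have hlog : Real.log u ≤ 2 * L := by
      rw [Real.log_le_iff_le_exp hu0]; exact ht2
    have hlog0 : 0 ≤ Real.log u := Real.log_nonneg (by linarith)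
    calc C * min 1 (e/(2*C)) * Real.log u ≤ C * (e/(2*C)) * (2*L) := by gcongr; exact min_le_right _ _
      _ = e * L := by field_simp
  · have h3 := H2 (1+c/L) u (by linarith) (by linarith) (by rw [abs_of_pos hu0]; exact h.le)
    have h4 : ‖(1:ℂ) / (((1 + c/L - 1:ℝ):ℂ) + u * I)‖ ≤ L * e/2 := by
      rw [norm_div, norm_one, div_le_iff₀ (by
        rw [norm_pos_iff]; intro h0; have := congrArg Complex.im h0; simp at this; exact hu0.ne' this)]
      have h5 : u ≤ ‖((1 + c/L - 1:ℝ):ℂ) + u * I‖ := by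
        refine le_trans ?_ ((le_abs_self _).trans (Complex.abs_im_le_norm _)); simp
      have h6 : (2/e) / L ≤ u := le_trans (by gcongr; exact le_max_right _ _) ht1
      have h7 : 1 ≤ L * e / 2 * u := by
        calc (1:ℝ) = L * e/2 * ((2/e)/L) := by field_simp
          _ ≤ _ := by gcongr
      exact h7.trans (by gcongr)
    have h8 : C2 ≤ L * e / 2 := by rw [div_le_iff₀ he] at hL2; linarith
    have := norm_add_le (LV (1+c/L) u - 1 / (((1 + c/L - 1:ℝ):ℂ) + u * I)) (1 / (((1 + c/L - 1:ℝ):ℂ) + u * I))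
    rw [sub_add_cancel] at this
    linarith

end

section
open Finset

noncomputable def trap (a1 a2 b2 b1 u : ℝ) : ℝ := max 0 (min 1 (min ((u - a1)/(a2-a1)) ((b1-u)/(b1-b2))))

lemma trap_nonneg (a1 a2 b2 b1 u : ℝ) : 0 ≤ trap a1 a2 b2 b1 u := le_max_left _ _
lemma trap_le_one (a1 a2 b2 b1 u : ℝ) : trap a1 a2 b2 b1 u ≤ 1 := max_le (by norm_num) (min_le_left _ _)
lemma trap_eq_one {a1 a2 b2 b1 u : ℝ} (h1 : a1 < a2) (h3 : b2 < b1) (hu : a2 ≤ u) (hu' : u ≤ b2) : trap a1 a2 b2 b1 u = 1 := by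
  have : 1 ≤ (u - a1)/(a2-a1) := by rw [le_div_iff₀ (by linarith)]; linarith
  have : 1 ≤ (b1 - u)/(b1-b2) := by rw [le_div_iff₀ (by linarith)]; linarith
  unfold trap
  rw [min_eq_left (le_min (by assumption) (by assumption))]; norm_num
lemma trap_eq_zero {a1 a2 b2 b1 u : ℝ} (h1 : a1 < a2) (h3 : b2 < b1) (hu : u ≤ a1 ∨ b1 ≤ u) : trap a1 a2 b2 b1 u = 0 := by
  unfold trap
  apply max_eq_left
  rcases hu with h | h
  · exact (min_le_right _ _).trans ((min_le_left _ _).trans (div_nonpos_of_nonpos_of_nonneg (by linarith) (by linarith)))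
  · exact (min_le_right _ _).trans ((min_le_right _ _).trans (div_nonpos_of_nonpos_of_nonneg (by linarith) (by linarith)))
lemma trap_cont (a1 a2 b2 b1 : ℝ) : Continuous (trap a1 a2 b2 b1) := by
  unfold trap
  fun_prop

lemma int_loglog {a b : ℝ} (ha : 0 < a) (hab : a ≤ b) : ∫ w in (Real.exp (-b))..(Real.exp (-a)), 1/(w * (-Real.log w)) = Real.log (b/a) := by
  have hle : Real.exp (-b) ≤ Real.exp (-a) := Real.exp_le_exp.mpr (by linarith)
  have hmem : ∀ w ∈ Set.uIcc (Real.exp (-b)) (Real.exp (-a)), 0 < w ∧ a ≤ -Real.log w := by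
    intro w hw
    rw [Set.uIcc_of_le hle] at hw
    have hw0 : 0 < w := (Real.exp_pos _).trans_le hw.1
    refine ⟨hw0, ?_⟩
    have := Real.log_le_log hw0 hw.2
    rw [Real.log_exp] at this; linarith
  have hder : ∀ w ∈ Set.uIcc (Real.exp (-b)) (Real.exp (-a)), HasDerivAt (fun w => -Real.log (-Real.log w)) (1/(w * (-Real.log w))) w := by
    intro w hw
    obtain ⟨h1, h2⟩ := hmem w hw
    have h2' : HasDerivAt (fun w => -Real.log w) (-w⁻¹) w := (Real.hasDerivAt_log h1.ne').neg
    have h3 := (h2'.log (by linarith : 0 < -Real.log w).ne').fun_neg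
    refine h3.congr_deriv ?_
    have : Real.log w ≠ 0 := by intro h; rw [h] at h2; linarith
    field_simp
  rw [intervalIntegral.integral_eq_sub_of_hasDerivAt hder]
  · simp only [Real.log_exp, neg_neg]
    rw [Real.log_div (by linarith) (by linarith)]; ring
  · apply ContinuousOn.intervalIntegrable
    intro w hw
    obtain ⟨h1, h2⟩ := hmem w hw
    apply ContinuousAt.continuousWithinAt
    have : Real.log w ≠ 0 := by intro h; rw [h] at h2; linarith
    have : w * (-Real.log w) ≠ 0 := mul_ne_zero h1.ne' (neg_ne_zero.mpr this)
    fun_prop (disch := first | assumption | exact h1.ne')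

lemma kar_poly {a1 a2 b2 b1 δ : ℝ} (h0 : 0 < a1) (h1 : a1 < a2) (h2 : a2 < b2) (h3 : b2 < b1) (hδ : 0 < δ) :
    ∃ P : Polynomial ℝ, (∀ u : ℝ, 0 ≤ u → |Real.exp (-u) * P.eval (Real.exp (-u)) - trap a1 a2 b2 b1 u / u| ≤ δ * Real.exp (-u)) ∧
      Real.log (b2/a2) - δ ≤ ∫ w in (0:ℝ)..1, P.eval w ∧ ∫ w in (0:ℝ)..1, P.eval w ≤ Real.log (b1/a1) + δ := by
  set c := Real.exp (-b1) with hc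
  have hc0 : 0 < c := Real.exp_pos _
  set v : ℝ → ℝ := fun w => max w c with hv
  have hv0 : ∀ w, 0 < v w := fun w => hc0.trans_le (le_max_right _ _)
  set h : ℝ → ℝ := fun w => trap a1 a2 b2 b1 (-Real.log (v w)) / (max (-Real.log (v w)) a1) / v w with hh
  have hcont : Continuous h := by
    have c1 : Continuous v := by fun_prop
    have c2 : Continuous fun w => Real.log (v w) := c1.log fun w => (hv0 w).ne'
    have c3 : Continuous fun w => trap a1 a2 b2 b1 (-Real.log (v w)) := (trap_cont _ _ _ _).comp c2.neg
    refine (c3.div (c2.neg.max continuous_const) fun w => ?_).div c1 fun w => (hv0 w).ne'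
    exact (h0.trans_le (le_max_right _ _)).ne'
  have hval : ∀ u, 0 ≤ u → h (Real.exp (-u)) = trap a1 a2 b2 b1 u / u / Real.exp (-u) := by
    intro u hu
    simp only [hh, hv]
    rcases le_or_gt u b1 with hb | hb
    · have : max (Real.exp (-u)) c = Real.exp (-u) := max_eq_left (Real.exp_le_exp.mpr (by linarith))
      rw [this, Real.log_exp, neg_neg]
      rcases le_or_gt u a1 with ha | ha
      · rw [trap_eq_zero h1 h3 (Or.inl ha)]; simp
      · rw [max_eq_left ha.le]
    · have : max (Real.exp (-u)) c = c := max_eq_right (Real.exp_le_exp.mpr (by linarith))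
      rw [this, hc, Real.log_exp, neg_neg, trap_eq_zero h1 h3 (Or.inr le_rfl), trap_eq_zero h1 h3 (Or.inr hb.le)]
      simp
  have hnn : ∀ w, 0 ≤ h w := fun w => by
    have := trap_nonneg a1 a2 b2 b1 (-Real.log (v w))
    have := hv0 w
    have : 0 < max (-Real.log (v w)) a1 := h0.trans_le (le_max_right _ _)
    simp only [hh]; positivity
  obtain ⟨P, hP⟩ := exists_polynomial_near_of_continuousOn 0 1 h hcont.continuousOn δ hδ
  have hint : ∀ a b, IntervalIntegrable h MeasureTheory.volume a b := fun a b => hcont.intervalIntegrable a b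
  have hPint : ∀ a b, IntervalIntegrable (fun w => P.eval w) MeasureTheory.volume a b := fun a b => P.continuous.intervalIntegrable a b
  have hloc : ∀ w, 0 < w → h w = trap a1 a2 b2 b1 (-Real.log w) / (-Real.log w) / w ∨ 1 < w := by
    intro w hw
    rcases le_or_gt w 1 with h1 | h1
    · left
      have := hval (-Real.log w) (by have := Real.log_nonpos hw.le h1; linarith)
      rwa [neg_neg, Real.exp_log hw] at this
    · right; exact h1
  refine ⟨P, ?_, ?_, ?_⟩
  · intro u hu
    have h4 := hP (Real.exp (-u)) ⟨(Real.exp_pos _).le, by rw [Real.exp_le_one_iff]; linarith⟩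
    rw [hval u hu] at h4
    have hp := Real.exp_pos (-u)
    have e : Real.exp (-u) * P.eval (Real.exp (-u)) - trap a1 a2 b2 b1 u / u = Real.exp (-u) * (P.eval (Real.exp (-u)) - trap a1 a2 b2 b1 u / u / Real.exp (-u)) := by
      field_simp
    rw [e, abs_mul, abs_of_pos hp, mul_comm δ]
    gcongr
  · have i1 : ∫ w in (0:ℝ)..1, h w - δ ≤ ∫ w in (0:ℝ)..1, P.eval w := by
      apply intervalIntegral.integral_mono_on (by norm_num) ((hint 0 1).sub (by simp)) (hPint 0 1)
      intro w hw
      have := (abs_lt.mp (hP w hw)).1; linarith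
    rw [intervalIntegral.integral_sub (hint 0 1) (by simp)] at i1
    simp at i1
    have hle : Real.exp (-b2) ≤ Real.exp (-a2) := Real.exp_le_exp.mpr (by linarith)
    have hle1 : Real.exp (-a2) ≤ 1 := by rw [Real.exp_le_one_iff]; linarith
    have i2 : ∫ w in (Real.exp (-b2))..(Real.exp (-a2)), h w ≤ ∫ w in (0:ℝ)..1, h w :=
      intervalIntegral.integral_mono_interval (Real.exp_pos _).le hle hle1 (Filter.Eventually.of_forall hnn) (hint _ _)
    have i3 : ∫ w in (Real.exp (-b2))..(Real.exp (-a2)), h w = Real.log (b2/a2) := by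
      rw [← int_loglog (by linarith : 0 < a2) h2.le]
      apply intervalIntegral.integral_congr
      intro w hw
      rw [Set.uIcc_of_le hle] at hw
      have hw0 : 0 < w := (Real.exp_pos _).trans_le hw.1
      rcases hloc w hw0 with h5 | h5
      · have g1 := Real.log_le_log hw0 hw.2
        have g2 := Real.log_le_log (Real.exp_pos _) hw.1
        rw [Real.log_exp] at g1 g2
        simp only []
        rw [h5, trap_eq_one h1 h3 (by linarith) (by linarith), div_div, mul_comm w]
      · linarith [hw.2]
    linarith
  · have i1 : ∫ w in (0:ℝ)..1, P.eval w ≤ ∫ w in (0:ℝ)..1, h w + δ := by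
      apply intervalIntegral.integral_mono_on (by norm_num) (hPint 0 1) ((hint 0 1).add (by simp))
      intro w hw
      have := (abs_lt.mp (hP w hw)).2; linarith
    rw [intervalIntegral.integral_add (hint 0 1) (by simp)] at i1
    simp at i1
    have hle : Real.exp (-b1) ≤ Real.exp (-a1) := Real.exp_le_exp.mpr (by linarith)
    have hle1 : Real.exp (-a1) ≤ 1 := by rw [Real.exp_le_one_iff]; linarith
    have z1 : ∫ w in (0:ℝ)..(Real.exp (-b1)), h w = 0 := by
      rw [intervalIntegral.integral_congr (g := fun _ => (0:ℝ))]
      · simp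
      · intro w hw
        rw [Set.uIcc_of_le (Real.exp_pos _).le] at hw
        simp only [hh, hv]
        rw [max_eq_right hw.2, Real.log_exp, neg_neg, trap_eq_zero h1 h3 (Or.inr le_rfl)]; simp
    have z2 : ∫ w in (Real.exp (-a1))..1, h w = 0 := by
      rw [intervalIntegral.integral_congr (g := fun _ => (0:ℝ))]
      · simp
      · intro w hw
        rw [Set.uIcc_of_le hle1] at hw
        have hw0 : 0 < w := (Real.exp_pos _).trans_le hw.1
        rcases hloc w hw0 with h5 | h5
        · have g2 := Real.log_le_log (Real.exp_pos _) hw.1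
          rw [Real.log_exp] at g2
          simp only []
          rw [h5, trap_eq_zero h1 h3 (Or.inl (by linarith))]; simp
        · linarith [hw.2]
    have i2 : ∫ w in (0:ℝ)..1, h w = ∫ w in (Real.exp (-b1))..(Real.exp (-a1)), h w := by
      rw [← intervalIntegral.integral_add_adjacent_intervals (hint 0 (Real.exp (-b1))) (hint _ 1),
        ← intervalIntegral.integral_add_adjacent_intervals (hint (Real.exp (-b1)) (Real.exp (-a1))) (hint _ 1), z1, z2]; ring
    have i3 : ∫ w in (Real.exp (-b1))..(Real.exp (-a1)), h w ≤ Real.log (b1/a1) := by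
      rw [← int_loglog h0 (by linarith : a1 ≤ b1)]
      apply intervalIntegral.integral_mono_on hle (hint _ _)
      · by_contra hni
        have := intervalIntegral.integral_undef hni
        rw [int_loglog h0 (by linarith)] at this
        have := Real.log_pos (show 1 < b1/a1 by rw [one_lt_div h0]; linarith)
        linarith
      · intro w hw
        have hw0 : 0 < w := (Real.exp_pos _).trans_le hw.1
        rcases hloc w hw0 with h5 | h5
        · have g1 := Real.log_le_log hw0 hw.2
          rw [Real.log_exp] at g1
          rw [h5, div_div, mul_comm w]
          have : 0 < -Real.log w * w := mul_pos (by linarith) hw0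
          gcongr
          exact trap_le_one _ _ _ _ _
        · linarith [hw.2]
    linarith

lemma kar_exists {a b δ : ℝ} (ha : 0 < a) (hab : a < b) (hδ : 0 < δ) : ∃ ξ : ℝ, 0 < ξ ∧ ξ < a ∧ ξ < (b - a)/4 ∧
    Real.log ((b+ξ)/(a-ξ)) ≤ Real.log (b/a) + δ ∧ Real.log (b/a) - δ ≤ Real.log ((b-2*ξ)/(a+2*ξ)) := by
  have c1 : Filter.Tendsto (fun ξ : ℝ => Real.log ((b+ξ)/(a-ξ))) (nhds 0) (nhds (Real.log (b/a))) := by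
    have : ContinuousAt (fun ξ : ℝ => Real.log ((b+ξ)/(a-ξ))) 0 := by
      apply ContinuousAt.log
      · apply ContinuousAt.div (by fun_prop) (by fun_prop); simp; exact ha.ne'
      · simp; constructor <;> linarith
    simpa [ContinuousAt] using this
  have c2 : Filter.Tendsto (fun ξ : ℝ => Real.log ((b-2*ξ)/(a+2*ξ))) (nhds 0) (nhds (Real.log (b/a))) := by
    have : ContinuousAt (fun ξ : ℝ => Real.log ((b-2*ξ)/(a+2*ξ))) 0 := by
      apply ContinuousAt.log
      · apply ContinuousAt.div (by fun_prop) (by fun_prop); simp; exact ha.ne'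
      · simp; constructor <;> linarith
    simpa [ContinuousAt] using this
  have e1 := c1.eventually_lt_const (show Real.log (b/a) < Real.log (b/a) + δ by linarith)
  have e2 := c2.eventually_const_lt (show Real.log (b/a) - δ < Real.log (b/a) by linarith)
  have e3 : ∀ᶠ ξ in nhdsWithin (0:ℝ) (Set.Ioi 0), ξ < a := (gt_mem_nhds ha).filter_mono nhdsWithin_le_nhds
  have e4 : ∀ᶠ ξ in nhdsWithin (0:ℝ) (Set.Ioi 0), ξ < (b-a)/4 := (gt_mem_nhds (by linarith)).filter_mono nhdsWithin_le_nhds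
  obtain ⟨ξ, h1, h2, h3, h4, h5⟩ := (((e1.filter_mono nhdsWithin_le_nhds).and ((e2.filter_mono nhdsWithin_le_nhds).and (e3.and (e4.and self_mem_nhdsWithin)))).exists (f := nhdsWithin (0:ℝ) (Set.Ioi 0)))
  exact ⟨ξ, h5, h3, h4, h1.le, h2.le⟩

lemma int_poly_add (P : Polynomial ℝ) (c : ℝ) : ∫ w in (0:ℝ)..1, (P + Polynomial.C c).eval w = (∫ w in (0:ℝ)..1, P.eval w) + c := by
  simp only [Polynomial.eval_add, Polynomial.eval_C]
  rw [intervalIntegral.integral_add (P.continuous.intervalIntegrable _ _) (by simp)]; simp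

lemma karU {a b δ : ℝ} (ha : 0 < a) (hab : a < b) (hδ : 0 < δ) : ∃ P : Polynomial ℝ,
    (∀ u, 0 ≤ u → 0 ≤ Real.exp (-u) * P.eval (Real.exp (-u))) ∧ (∀ u, a ≤ u → u ≤ b → 1/u ≤ Real.exp (-u) * P.eval (Real.exp (-u))) ∧
    ∫ w in (0:ℝ)..1, P.eval w ≤ Real.log (b/a) + δ := by
  obtain ⟨ξ, h1, h2, h3, h4, h5⟩ := kar_exists ha hab (show 0 < δ/3 by linarith)
  obtain ⟨P, p1, p2, p3⟩ := kar_poly (a1 := a - ξ) (a2 := a) (b2 := b) (b1 := b+ξ) (δ := δ/3) (by linarith) (by linarith) hab (by linarith) (by linarith)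
  refine ⟨P + Polynomial.C (δ/3), ?_, ?_, ?_⟩
  · intro u hu
    have := (abs_le.mp (p1 u hu)).1
    have h6 : 0 ≤ trap (a-ξ) a b (b+ξ) u / u := div_nonneg (trap_nonneg _ _ _ _ _) hu
    simp only [Polynomial.eval_add, Polynomial.eval_C]; linarith
  · intro u hu hu'
    have := (abs_le.mp (p1 u (by linarith))).1
    rw [trap_eq_one (by linarith) (by linarith) hu hu'] at this
    simp only [Polynomial.eval_add, Polynomial.eval_C]; linarith
  · rw [int_poly_add]; linarith

lemma karL {a b δ : ℝ} (ha : 0 < a) (hab : a < b) (hδ : 0 < δ) : ∃ P : Polynomial ℝ,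
    (∀ u, 0 ≤ u → (u ≤ a ∨ b ≤ u) → Real.exp (-u) * P.eval (Real.exp (-u)) ≤ 0) ∧ (∀ u, a ≤ u → Real.exp (-u) * P.eval (Real.exp (-u)) ≤ 1/u) ∧
    Real.log (b/a) - δ ≤ ∫ w in (0:ℝ)..1, P.eval w := by
  obtain ⟨ξ, h1, h2, h3, h4, h5⟩ := kar_exists ha hab (show 0 < δ/3 by linarith)
  obtain ⟨P, p1, p2, p3⟩ := kar_poly (a1 := a) (a2 := a+2*ξ) (b2 := b-2*ξ) (b1 := b) (δ := δ/3) (by linarith) (by linarith) (by linarith) (by linarith) (by linarith)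
  refine ⟨P + Polynomial.C (-(δ/3)), ?_, ?_, ?_⟩
  · intro u hu hu'
    have := (abs_le.mp (p1 u hu)).2
    rw [trap_eq_zero (by linarith) (by linarith) hu'] at this
    simp only [Polynomial.eval_add, Polynomial.eval_C]
    rw [zero_div] at this; linarith
  · intro u hu
    have := (abs_le.mp (p1 u (by linarith))).2
    have h6 : trap a (a+2*ξ) (b-2*ξ) b u / u ≤ 1/u := by
      have : 0 < u := by linarith
      gcongr; exact trap_le_one _ _ _ _ _
    simp only [Polynomial.eval_add, Polynomial.eval_C]; linarith
  · rw [int_poly_add]; linarith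

end

section
open Finset

noncomputable def KP (P : Polynomial ℝ) (L : ℝ) (n : ℕ) : ℝ := (1/L) * ∑ k ∈ range (P.natDegree+1), P.coeff k * vmt (1+((k:ℝ)+1)/L) n

lemma KP_eq (P : Polynomial ℝ) {L : ℝ} (hL : 0 < L) (n : ℕ) : KP P L n = ArithmeticFunction.vonMangoldt n / (n * L) * (Real.exp (-(Real.log n / L)) * P.eval (Real.exp (-(Real.log n / L)))) := by
  rcases Nat.eq_zero_or_pos n with h | h
  · subst h; simp [KP, vmt]
  have hn : (0:ℝ) < n := by exact_mod_cast h
  have key : ∀ k : ℕ, (n:ℝ)^(-(1+((k:ℝ)+1)/L)) = (1/n) * (Real.exp (-(Real.log n / L)) * Real.exp (-(Real.log n / L))^k) := by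
    intro k
    rw [Real.rpow_def_of_pos hn, ← Real.exp_nat_mul, ← Real.exp_add]
    have : 1/(n:ℝ) = Real.exp (-Real.log n) := by rw [Real.exp_neg, Real.exp_log hn]; simp
    rw [this, ← Real.exp_add]; congr 1; field_simp; ring
  unfold KP vmt
  rw [Polynomial.eval_eq_sum_range, mul_sum, mul_sum, mul_sum]
  refine sum_congr rfl fun k _ => ?_
  rw [key]; field_simp

lemma KP_summable (P : Polynomial ℝ) {L : ℝ} (hL : 0 < L) : Summable (KP P L) := by
  unfold KP
  apply Summable.mul_left
  apply summable_sum
  intro k _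
  exact (vmt_summable (lt_add_of_pos_right 1 (by positivity))).mul_left _

lemma KP_tsum (P : Polynomial ℝ) {L : ℝ} (hL : 0 < L) : ∑' n, KP P L n = (1/L) * ∑ k ∈ range (P.natDegree+1), P.coeff k * VM (1+((k:ℝ)+1)/L) := by
  have hs : ∀ k : ℕ, Summable (vmt (1+((k:ℝ)+1)/L)) := fun k => vmt_summable (lt_add_of_pos_right 1 (by positivity))
  unfold KP
  rw [tsum_mul_left, Summable.tsum_finsetSum (fun k _ => (hs k).mul_left _)]
  congr 1
  refine sum_congr rfl fun k _ => ?_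
  rw [tsum_mul_left]; rfl

lemma KP_tsum_ee (P : Polynomial ℝ) {L : ℝ} (hL : 0 < L) (t : ℝ) : ∑' n, ((KP P L n : ℝ):ℂ) * ee (-(t * Real.log n)) = ((1/L : ℝ):ℂ) * ∑ k ∈ range (P.natDegree+1), ((P.coeff k : ℝ):ℂ) * LV (1+((k:ℝ)+1)/L) t := by
  have hs : ∀ k : ℕ, Summable (fun n : ℕ => ((vmt (1+((k:ℝ)+1)/L) n : ℝ) : ℂ) * ee (-(t * Real.log n))) := fun k => LV_summable (lt_add_of_pos_right 1 (by positivity)) t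
  have : ∀ n : ℕ, ((KP P L n : ℝ):ℂ) * ee (-(t * Real.log n)) = ((1/L : ℝ):ℂ) * ∑ k ∈ range (P.natDegree+1), ((P.coeff k : ℝ):ℂ) * (((vmt (1+((k:ℝ)+1)/L) n : ℝ) : ℂ) * ee (-(t * Real.log n))) := by
    intro n
    rw [KP, Complex.ofReal_mul, Complex.ofReal_sum, mul_assoc, sum_mul]
    congr 1
    refine sum_congr rfl fun k _ => ?_
    push_cast; ring
  rw [tsum_congr this, tsum_mul_left, Summable.tsum_finsetSum (fun k _ => (hs k).mul_left _)]
  congr 1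
  refine sum_congr rfl fun k _ => ?_
  rw [tsum_mul_left]; rfl

lemma int_poly (P : Polynomial ℝ) : ∫ w in (0:ℝ)..1, P.eval w = ∑ k ∈ range (P.natDegree+1), P.coeff k / ((k:ℝ)+1) := by
  simp_rw [Polynomial.eval_eq_sum_range]
  rw [intervalIntegral.integral_finset_sum (fun k _ => by apply Continuous.intervalIntegrable; fun_prop)]
  refine sum_congr rfl fun k _ => ?_
  rw [intervalIntegral.integral_const_mul, integral_pow]; simp; ring

lemma KP_lim (P : Polynomial ℝ) {δ : ℝ} (hδ : 0 < δ) : ∃ L0, 1 ≤ L0 ∧ ∀ L, L0 ≤ L → |∑' n, KP P L n - ∫ w in (0:ℝ)..1, P.eval w| ≤ δ := by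
  obtain ⟨C, hC, h⟩ := VM_bound
  set S := ∑ k ∈ range (P.natDegree+1), |P.coeff k| with hS
  have hS0 : 0 ≤ S := sum_nonneg fun _ _ => abs_nonneg _
  refine ⟨1 + (P.natDegree+1) + S*C/δ, ?_, fun L hL => ?_⟩
  · have : 0 ≤ S*C/δ := by positivity
    have : (0:ℝ) ≤ P.natDegree := Nat.cast_nonneg _
    linarith
  have h1 : 0 ≤ S*C/δ := by positivity
  have h2 : (0:ℝ) ≤ P.natDegree := Nat.cast_nonneg _
  have hL0 : 0 < L := by linarith
  rw [KP_tsum P hL0, int_poly, mul_sum, ← sum_sub_distrib]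
  calc _ ≤ ∑ k ∈ range (P.natDegree+1), |P.coeff k| * (C/L) := by
        refine (abs_sum_le_sum_abs _ _).trans (sum_le_sum fun k hk => ?_)
        have hk' : (k:ℝ) ≤ P.natDegree := by exact_mod_cast Nat.lt_succ_iff.mp (mem_range.mp hk)
        have hk0 : (0:ℝ) ≤ k := Nat.cast_nonneg _
        have hk3 : ((k:ℝ)+1)/L ≤ 1 := by rw [div_le_one hL0]; linarith
        have hk2 : 1 + ((k:ℝ)+1)/L ≤ 2 := by linarith
        have := h (1+((k:ℝ)+1)/L) (lt_add_of_pos_right 1 (by positivity)) hk2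
        have e : 1 / L * (P.coeff k * VM (1+((k:ℝ)+1)/L)) - P.coeff k / ((k:ℝ)+1) = P.coeff k * ((VM (1+((k:ℝ)+1)/L) - 1/((1+((k:ℝ)+1)/L) - 1)) / L) := by
          rw [add_sub_cancel_left]; field_simp
        rw [e, abs_mul, abs_div, abs_of_pos hL0]
        gcongr
    _ = S * C / L := by rw [← sum_mul]; ring
    _ ≤ δ := by
        rw [div_le_iff₀ hL0]
        have : S*C/δ ≤ L := by linarith
        rw [div_le_iff₀ hδ] at this; linarith

lemma KP_osc (P : Polynomial ℝ) {δ : ℝ} (hδ : 0 < δ) : ∃ K L0, 1 ≤ K ∧ 1 ≤ L0 ∧ ∀ L, L0 ≤ L → ∀ t, K/L ≤ |t| → |t| ≤ Real.exp (2*L) → ‖∑' n, ((KP P L n : ℝ):ℂ) * ee (-(t * Real.log n))‖ ≤ δ := by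
  set S := ∑ k ∈ range (P.natDegree+1), |P.coeff k| with hS
  have hS0 : 0 ≤ S := sum_nonneg fun _ _ => abs_nonneg _
  obtain ⟨K, L0, hK, hL0, h⟩ := lemH (δ/(S+1)) (by positivity)
  refine ⟨K, L0 + (P.natDegree+1), hK, ?_, fun L hL t ht ht' => ?_⟩
  · have h2 : (0:ℝ) ≤ P.natDegree := Nat.cast_nonneg _
    linarith
  have h2 : (0:ℝ) ≤ P.natDegree := Nat.cast_nonneg _
  have hLp : 0 < L := by linarith
  rw [KP_tsum_ee P hLp, norm_mul, Complex.norm_real, Real.norm_of_nonneg (by positivity)]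
  have : ‖∑ k ∈ range (P.natDegree+1), ((P.coeff k : ℝ):ℂ) * LV (1+((k:ℝ)+1)/L) t‖ ≤ S * (δ/(S+1)*L) := by
    rw [hS, sum_mul]
    refine (norm_sum_le _ _).trans (sum_le_sum fun k hk => ?_)
    have hk' : (k:ℝ) ≤ P.natDegree := by exact_mod_cast Nat.lt_succ_iff.mp (mem_range.mp hk)
    rw [norm_mul, Complex.norm_real, Real.norm_eq_abs]
    exact mul_le_mul_of_nonneg_left (h L (by linarith) t ht ht' _ (by positivity) (by linarith)) (abs_nonneg _)
  calc _ ≤ 1/L * (S * (δ/(S+1)*L)) := by gcongr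
    _ = S/(S+1) * δ := by field_simp
    _ ≤ 1 * δ := by gcongr; rw [div_le_one (by positivity)]; linarith
    _ = δ := one_mul _

lemma np_summable : ∃ B : ℝ, 0 ≤ B ∧ HasSum (fun n : ℕ => (if n.Prime then 0 else ArithmeticFunction.vonMangoldt n) / (n:ℝ)) B := by
  have h := ArithmeticFunction.vonMangoldt.summable_residueClass_non_primes_div (q := 1) (a := (0 : ZMod 1))
  have h2 : Summable (fun n : ℕ => (if n.Prime then 0 else ArithmeticFunction.vonMangoldt n) / (n:ℝ)) := by
    refine h.congr fun n => ?_
    have : ArithmeticFunction.vonMangoldt.residueClass (0 : ZMod 1) n = ArithmeticFunction.vonMangoldt n := by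
      simp [ArithmeticFunction.vonMangoldt.residueClass, Set.indicator]
      intro h; exact absurd (Subsingleton.elim _ _) h
    rw [this]
  refine ⟨_, ?_, h2.hasSum⟩
  apply tsum_nonneg; intro n
  have := ArithmeticFunction.vonMangoldt_nonneg (n := n)
  split_ifs <;> positivity

noncomputable def phi (w z : ℝ) (n : ℕ) : ℝ := if n ∈ pr w z then 1/(n:ℝ) else 0

lemma phi_hasSum (w z : ℝ) : HasSum (phi w z) (∑ p ∈ pr w z, 1/(p:ℝ)) := by
  have : ∑ p ∈ pr w z, 1/(p:ℝ) = ∑ p ∈ pr w z, phi w z p := sum_congr rfl fun p hp => by simp [phi, hp]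
  rw [this]
  exact hasSum_sum_of_ne_finset_zero fun n hn => by simp [phi, hn]

lemma phi_hasSum_ee (w z t : ℝ) : HasSum (fun n : ℕ => ((phi w z n : ℝ):ℂ) * ee (-(t * Real.log n))) (∑ p ∈ pr w z, ((1/(p:ℝ) : ℝ):ℂ) * ee (-(t * Real.log p))) := by
  have : ∑ p ∈ pr w z, ((1/(p:ℝ) : ℝ):ℂ) * ee (-(t * Real.log p)) = ∑ p ∈ pr w z, ((phi w z p : ℝ):ℂ) * ee (-(t * Real.log p)) := sum_congr rfl fun p hp => by simp [phi, hp]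
  rw [this]
  exact hasSum_sum_of_ne_finset_zero fun n hn => by simp [phi, hn]

lemma mem_pr_log {a b L : ℝ} (hL : 0 < L) {n : ℕ} : n ∈ pr (Real.exp (a*L)) (Real.exp (b*L)) ↔ n.Prime ∧ a ≤ Real.log n / L ∧ Real.log n / L < b := by
  rw [mem_pr]
  constructor
  · rintro ⟨h1, h2, h3⟩
    have hn : (0:ℝ) < n := by exact_mod_cast h1.pos
    refine ⟨h1, ?_, ?_⟩
    · rw [le_div_iff₀ hL, Real.le_log_iff_exp_le hn]; exact h2
    · rw [div_lt_iff₀ hL, Real.log_lt_iff_lt_exp hn]; exact h3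
  · rintro ⟨h1, h2, h3⟩
    have hn : (0:ℝ) < n := by exact_mod_cast h1.pos
    refine ⟨h1, ?_, ?_⟩
    · rw [← Real.le_log_iff_exp_le hn, ← le_div_iff₀ hL]; exact h2
    · rw [← Real.log_lt_iff_lt_exp hn, ← div_lt_iff₀ hL]; exact h3

/-- both bounds at once -/
lemma prime_sums {a b δ : ℝ} (ha : 0 < a) (hab : a < b) (hδ : 0 < δ) : ∃ K L0 : ℝ, 1 ≤ K ∧ 1 ≤ L0 ∧ ∀ L, L0 ≤ L →
    |∑ p ∈ pr (Real.exp (a*L)) (Real.exp (b*L)), 1/(p:ℝ) - Real.log (b/a)| ≤ δ ∧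
    ∀ t, K/L ≤ |t| → |t| ≤ Real.exp (2*L) → ‖∑ p ∈ pr (Real.exp (a*L)) (Real.exp (b*L)), ((1/(p:ℝ) : ℝ):ℂ) * ee (-(t * Real.log p))‖ ≤ δ := by
  set e := δ/10 with he
  have he0 : 0 < e := by positivity
  obtain ⟨P, p1, p2, p3⟩ := karU ha hab he0
  obtain ⟨Q, q1, q2, q3⟩ := karL ha hab he0
  obtain ⟨L1, l1, hP⟩ := KP_lim P he0
  obtain ⟨L2, l2, hQ⟩ := KP_lim Q he0
  obtain ⟨K, L3, hK, l3, hO⟩ := KP_osc P he0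
  obtain ⟨B, hB0, hB⟩ := np_summable
  refine ⟨K, L1+L2+L3+B/(a*e), hK, ?_, fun L hL => ?_⟩
  · have : 0 ≤ B/(a*e) := by positivity
    linarith
  have hBe : 0 ≤ B/(a*e) := by positivity
  have hL0 : 0 < L := by linarith
  set w := Real.exp (a*L)
  set z := Real.exp (b*L)
  have hU : ∀ n, phi w z n ≤ KP P L n := by
    intro n
    rw [KP_eq P hL0]
    have hn1 : 0 ≤ Real.log n / L := div_nonneg (Real.log_natCast_nonneg n) hL0.le
    have hpre : 0 ≤ ArithmeticFunction.vonMangoldt n / (n * L) := div_nonneg ArithmeticFunction.vonMangoldt_nonneg (by positivity)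
    by_cases hm : n ∈ pr w z
    · have hm' := (mem_pr_log hL0).mp hm
      have hp := hm'.1
      have hn : (0:ℝ) < n := by exact_mod_cast hp.pos
      have hlog : 0 < Real.log n := Real.log_pos (by exact_mod_cast hp.one_lt)
      have := mul_le_mul_of_nonneg_left (p2 _ hm'.2.1 hm'.2.2.le) hpre
      refine le_trans (le_of_eq ?_) this
      rw [ArithmeticFunction.vonMangoldt_apply_prime hp]
      simp only [phi, hm, if_true]; field_simp
    · simp only [phi, hm, if_false]
      exact mul_nonneg hpre (p1 _ hn1)
  have hLw : ∀ n, KP Q L n ≤ phi w z n + (1/(a*L)) * ((if n.Prime then 0 else ArithmeticFunction.vonMangoldt n) / (n:ℝ)) := by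
    intro n
    rw [KP_eq Q hL0]
    have hn1 : 0 ≤ Real.log n / L := div_nonneg (Real.log_natCast_nonneg n) hL0.le
    have hpre : 0 ≤ ArithmeticFunction.vonMangoldt n / (n * L) := div_nonneg ArithmeticFunction.vonMangoldt_nonneg (by positivity)
    have hphi : 0 ≤ phi w z n := by unfold phi; split_ifs <;> positivity
    have hnp : 0 ≤ (1/(a*L)) * ((if n.Prime then 0 else ArithmeticFunction.vonMangoldt n) / (n:ℝ)) := by
      have := ArithmeticFunction.vonMangoldt_nonneg (n := n)
      split_ifs <;> positivity
    by_cases hu : Real.log n / L ≤ a ∨ b ≤ Real.log n / L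
    · have := mul_nonneg_of_nonpos_of_nonpos (neg_nonpos.mpr hpre) (q1 _ hn1 hu)
      linarith
    · rw [not_or, not_le, not_le] at hu
      have h2 := mul_le_mul_of_nonneg_left (q2 _ hu.1.le) hpre
      refine h2.trans ?_
      by_cases hp : n.Prime
      · have hm : n ∈ pr w z := (mem_pr_log hL0).mpr ⟨hp, hu.1.le, hu.2⟩
        have hn : (0:ℝ) < n := by exact_mod_cast hp.pos
        have hlog : 0 < Real.log n := Real.log_pos (by exact_mod_cast hp.one_lt)
        rw [ArithmeticFunction.vonMangoldt_apply_prime hp]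
        simp only [phi, hm, if_true, hp]
        apply le_of_eq; field_simp; ring
      · simp only [hp, if_false]
        have : 1/(Real.log n / L) ≤ 1/a := one_div_le_one_div_of_le ha hu.1.le
        have := mul_le_mul_of_nonneg_left this hpre
        calc _ ≤ _ := this
          _ = (1/(a*L)) * (ArithmeticFunction.vonMangoldt n / (n:ℝ)) := by
            rw [div_mul_div_comm, div_mul_div_comm]; congr 1 <;> ring
          _ ≤ _ := by linarith
  have hphi := phi_hasSum w z
  have sP := (KP_summable P hL0).hasSum
  have sQ := (KP_summable Q hL0).hasSum
  have u1 := hasSum_le hU hphi sP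
  have u2 := hasSum_le hLw sQ (hphi.add (hB.mul_left (1/(a*L))))
  have b1 : 1/(a*L)*B ≤ e := by
    have : B/(a*e) ≤ L := by linarith
    rw [div_le_iff₀ (by positivity)] at this
    rw [one_div, inv_mul_le_iff₀ (by positivity)]; linarith
  have v1 := abs_le.mp (hP L (by linarith))
  have v2 := abs_le.mp (hQ L (by linarith))
  refine ⟨?_, fun t ht ht' => ?_⟩
  · rw [abs_le]; constructor <;> linarith
  · have o := hO L (by linarith) t ht ht'
    have hsumc : Summable fun n : ℕ => ((KP P L n : ℝ):ℂ) * ee (-(t * Real.log n)) := by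
      apply Summable.of_norm
      refine (KP_summable P hL0).abs.congr fun n => ?_
      rw [norm_mul, norm_ee, mul_one, Complex.norm_real, Real.norm_eq_abs]
    have hd := hsumc.hasSum.sub (phi_hasSum_ee w z t)
    have hn := tsum_of_norm_bounded (sP.sub hphi) (f := fun n : ℕ => ((KP P L n : ℝ):ℂ) * ee (-(t * Real.log n)) - ((phi w z n : ℝ):ℂ) * ee (-(t * Real.log n))) (by
      intro n
      rw [← sub_mul, norm_mul, norm_ee, mul_one, ← Complex.ofReal_sub, Complex.norm_real, Real.norm_of_nonneg (by linarith [hU n])])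
    rw [hd.tsum_eq] at hn
    have tri := norm_sub_norm_le (∑ p ∈ pr w z, ((1/(p:ℝ) : ℝ):ℂ) * ee (-(t * Real.log p))) (∑' n, ((KP P L n : ℝ):ℂ) * ee (-(t * Real.log n)))
    rw [norm_sub_rev] at tri
    linarith

end

section
open Finset

noncomputable def kk (v : ℝ) : ℝ := max 0 (1 - |v|)
noncomputable def Wk (l v : ℝ) : ℝ := kk (v / l) / l

lemma kk_nonneg (v : ℝ) : 0 ≤ kk v := le_max_left _ _
lemma kk_le_one (v : ℝ) : kk v ≤ 1 := max_le (by norm_num) (by linarith [abs_nonneg v])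
lemma kk_zero {v : ℝ} (h : 1 ≤ |v|) : kk v = 0 := max_eq_left (by linarith)
lemma kk_eq {v : ℝ} (h : |v| ≤ 1) : kk v = 1 - |v| := max_eq_right (by linarith)
lemma kk_cont : Continuous kk := by unfold kk; fun_prop
lemma kk_lip (a b : ℝ) : |kk a - kk b| ≤ |a - b| := by
  unfold kk
  rw [max_comm 0, max_comm 0]
  refine (abs_max_sub_max_le_abs _ _ 0).trans ?_
  rw [show 1 - |a| - (1 - |b|) = |b| - |a| by ring]
  rw [abs_sub_comm a b]
  exact abs_abs_sub_abs_le _ _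
lemma Wk_nonneg {l : ℝ} (hl : 0 < l) (v : ℝ) : 0 ≤ Wk l v := div_nonneg (kk_nonneg _) hl.le
lemma Wk_le {l : ℝ} (hl : 0 < l) (v : ℝ) : Wk l v ≤ 1/l := div_le_div_of_nonneg_right (kk_le_one _) hl.le
lemma Wk_zero {l v : ℝ} (hl : 0 < l) (h : l ≤ |v|) : Wk l v = 0 := by
  unfold Wk; rw [kk_zero, zero_div]
  rw [abs_div, abs_of_pos hl, le_div_iff₀ hl]; linarith
lemma Wk_cont (l : ℝ) : Continuous (Wk l) := by
  have := kk_cont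
  unfold Wk; fun_prop
lemma Wk_lip {l : ℝ} (hl : 0 < l) (a b : ℝ) : |Wk l a - Wk l b| ≤ |a - b| / l^2 := by
  unfold Wk
  rw [← sub_div, abs_div, abs_of_pos hl]
  have := kk_lip (a/l) (b/l)
  rw [← sub_div, abs_div, abs_of_pos hl] at this
  calc _ ≤ |a-b|/l/l := by gcongr
    _ = _ := by field_simp

lemma int_kk {a b : ℝ} (ha : a ≤ -1) (hb : 1 ≤ b) : ∫ v in a..b, kk v = 1 := by
  have hi : ∀ a b : ℝ, IntervalIntegrable kk MeasureTheory.volume a b := fun a b => kk_cont.intervalIntegrable a b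
  rw [← intervalIntegral.integral_add_adjacent_intervals (hi a (-1)) (hi (-1) b), ← intervalIntegral.integral_add_adjacent_intervals (hi (-1) 0) (hi 0 b),
    ← intervalIntegral.integral_add_adjacent_intervals (hi 0 1) (hi 1 b)]
  have e1 : ∫ v in a..(-1), kk v = 0 := by
    rw [intervalIntegral.integral_congr (g := fun _ => (0:ℝ))]
    · simp
    · intro v hv
      rw [Set.uIcc_of_le ha] at hv
      exact kk_zero (by rw [abs_of_nonpos (by linarith [hv.2])]; linarith [hv.2])
  have e2 : ∫ v in (1:ℝ)..b, kk v = 0 := by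
    rw [intervalIntegral.integral_congr (g := fun _ => (0:ℝ))]
    · simp
    · intro v hv
      rw [Set.uIcc_of_le hb] at hv
      exact kk_zero (by rw [abs_of_nonneg (by linarith [hv.1])]; linarith [hv.1])
  have e3 : ∫ v in (-1:ℝ)..0, kk v = 1/2 := by
    rw [intervalIntegral.integral_congr (g := fun v => 1 + v)]
    · rw [intervalIntegral.integral_add (by simp) (by simp)]; simp; norm_num
    · intro v hv
      rw [Set.uIcc_of_le (by norm_num)] at hv
      have : |v| = -v := abs_of_nonpos hv.2
      show kk v = 1 + v
      rw [kk_eq (by rw [this]; linarith [hv.1]), this]; ring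
  have e4 : ∫ v in (0:ℝ)..1, kk v = 1/2 := by
    rw [intervalIntegral.integral_congr (g := fun v => 1 - v)]
    · rw [intervalIntegral.integral_sub (by simp) (by simp)]; simp; norm_num
    · intro v hv
      rw [Set.uIcc_of_le (by norm_num)] at hv
      have : |v| = v := abs_of_nonneg hv.1
      show kk v = 1 - v
      rw [kk_eq (by rw [this]; linarith [hv.2]), this]
  rw [e1, e2, e3, e4]; norm_num

lemma int_Wk {l a b : ℝ} (hl : 0 < l) (ha : a ≤ -l) (hb : l ≤ b) : ∫ v in a..b, Wk l v = 1 := by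
  unfold Wk
  rw [intervalIntegral.integral_div, intervalIntegral.integral_comp_div _ hl.ne', int_kk]
  · simp [hl.ne']
  · rw [div_le_iff₀ hl]; linarith
  · rw [le_div_iff₀ hl]; linarith

noncomputable def fW (l y u : ℝ) : ℝ := 1/u * Wk l (Real.log u - y)

lemma fW_cont {l y a b : ℝ} (ha : 0 < a) (hb : 0 < b) : ContinuousOn (fW l y) (Set.uIcc a b) := by
  intro u hu
  have hu0 : 0 < u := (lt_min ha hb).trans_le hu.1
  apply ContinuousAt.continuousWithinAt
  have h := (Wk_cont l).continuousAt (x := Real.log u - y)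
  unfold fW
  refine ContinuousAt.mul ?_ (ContinuousAt.comp (f := fun u => Real.log u - y) h ?_) <;> fun_prop (disch := exact hu0.ne')

lemma int_fW {l y b : ℝ} (hl : 0 < l) (hy : l ≤ y) (hb1 : 1 ≤ b) (hb : Real.exp (y + l) ≤ b) : ∫ u in (1:ℝ)..b, fW l y u = 1 := by
  have hb0 : 0 < b := by linarith
  have hpos : ∀ u ∈ Set.uIcc 1 b, 0 < u := fun u hu => (lt_min one_pos hb0).trans_le hu.1
  have := intervalIntegral.integral_comp_mul_deriv'' (a := 1) (b := b) (f := fun u => Real.log u - y) (f' := fun u => u⁻¹) (g := Wk l) ?_ ?_ ?_ ?_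
  · simp only [Function.comp, Real.log_one] at this
    rw [int_Wk hl (by linarith) (by
      have := Real.log_le_log (Real.exp_pos _) hb
      rw [Real.log_exp] at this; linarith)] at this
    refine Eq.trans ?_ this
    apply intervalIntegral.integral_congr
    intro u hu
    simp only [fW]; ring
  · intro u hu
    have := hpos u hu
    apply ContinuousAt.continuousWithinAt
    fun_prop (disch := exact this.ne')
  · intro u hu
    have : 0 < u := hpos u (Set.Ioo_subset_Icc_self hu)
    exact ((Real.hasDerivAt_log this.ne').sub_const y).hasDerivWithinAt
  · intro u hu
    have := hpos u hu
    apply ContinuousAt.continuousWithinAt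
    fun_prop (disch := exact this.ne')
  · exact (Wk_cont l).continuousOn

lemma fW_lip {l y e u : ℝ} (hl : 0 < l) (he : 0 < e) (h1 : e ≤ u) (h2 : u ≤ e + 1) : |fW l y e - fW l y u| ≤ 1/e^2 * (1/l + 1/l^2) := by
  have hu : 0 < u := by linarith
  unfold fW
  have e0 : 1/e * Wk l (Real.log e - y) - 1/u * Wk l (Real.log u - y) = (1/e - 1/u) * Wk l (Real.log e - y) + 1/u * (Wk l (Real.log e - y) - Wk l (Real.log u - y)) := by ring
  rw [e0]
  have k1 : |1/e - 1/u| ≤ 1/e^2 := by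
    rw [abs_of_nonneg (by rw [sub_nonneg]; exact one_div_le_one_div_of_le he h1), div_sub_div _ _ he.ne' hu.ne', div_le_div_iff₀ (by positivity) (by positivity)]
    nlinarith [mul_pos he hu, mul_pos he he]
  have k2 : |Real.log e - Real.log u| ≤ 1/e := by
    rw [abs_sub_comm, abs_of_nonneg (by rw [sub_nonneg]; exact Real.log_le_log he h1), ← Real.log_div hu.ne' he.ne']
    refine (Real.log_le_sub_one_of_pos (by positivity)).trans ?_
    rw [div_sub_one he.ne']; gcongr; linarith
  have k3 := Wk_lip hl (Real.log e - y) (Real.log u - y)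
  rw [sub_sub_sub_cancel_right] at k3
  calc _ ≤ |1/e - 1/u| * |Wk l (Real.log e - y)| + |1/u| * |Wk l (Real.log e - y) - Wk l (Real.log u - y)| := by
        refine (abs_add_le _ _).trans ?_
        rw [abs_mul, abs_mul]
    _ ≤ 1/e^2 * (1/l) + 1/e * ((1/e)/l^2) := by
        rw [abs_of_nonneg (Wk_nonneg hl _), abs_of_nonneg (show 0 ≤ 1/u by positivity)]
        have k4 := k3.trans (show |Real.log e - Real.log u| / l^2 ≤ (1/e)/l^2 by gcongr)
        have k5 := Wk_le hl (Real.log e - y)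
        have k6 := Wk_nonneg hl (Real.log e - y)
        gcongr
    _ = _ := by field_simp

lemma riem {l y : ℝ} {N : ℕ} (hl : 0 < l) (hy : 16 * Real.exp (4*l) ≤ l * Real.exp y) (hN : Real.exp (y+l) ≤ N + 1) :
    |∑ e ∈ Icc 1 N, 1/(e:ℝ) * Wk l (Real.log e - y) - 1| ≤ 16 * Real.exp (4*l) / (l * Real.exp y) := by
  set Y := Real.exp y with hY
  set q := Real.exp l with hq
  have hq0 : 0 < q := Real.exp_pos _
  have hY0 : 0 < Y := Real.exp_pos _
  have hql : l + 1 ≤ q := Real.add_one_le_exp l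
  have h4 : Real.exp (4*l) = q^4 := by rw [hq, ← Real.exp_nat_mul]; norm_num
  rw [h4] at hy ⊢
  have hq1 : 1 ≤ q := by linarith
  have hYq : 16 * q^3 ≤ Y := by
    have : 16*q^4 ≤ q * Y := hy.trans (by gcongr; linarith)
    have h : q * (16*q^3) ≤ q * Y := by linarith [this, show q * (16*q^3) = 16*q^4 by ring]
    exact le_of_mul_le_mul_left h hq0
  have hYq1 : 16 * q ≤ Y := by nlinarith [pow_le_pow_left₀ zero_le_one hq1 2, mul_le_mul_of_nonneg_left (one_le_pow₀ hq1 : 1 ≤ q^2) hq0.le]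
  have hly : l ≤ y := by
    rw [← Real.exp_le_exp]; linarith
  have hN' : Y * q ≤ N + 1 := by rw [hY, hq, ← Real.exp_add]; exact hN
  set B := 4 * q^2/Y^2 * (1/l+1/l^2) with hB
  have hB0 : 0 ≤ B := by positivity
  have hint : ∑ e ∈ Icc 1 N, ∫ u in (e:ℝ)..((e:ℝ)+1), fW l y u = 1 := by
    have := intervalIntegral.sum_integral_adjacent_intervals_Ico (f := fW l y) (μ := MeasureTheory.volume) (a := fun k : ℕ => (k:ℝ)) (m := 1) (n := N+1) (by omega) (by
      intro k hk
      have : (0:ℝ) < k := by exact_mod_cast (Set.mem_Ico.mp hk).1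
      apply ContinuousOn.intervalIntegrable
      exact fW_cont this (by push_cast; linarith))
    rw [show Icc 1 N = Ico 1 (N+1) by ext; simp]
    push_cast at this
    rw [this, int_fW hl hly (by have := Nat.cast_nonneg (α := ℝ) N; linarith) hN]
  have hone : ∀ e ∈ Icc 1 N, |fW l y e - ∫ u in (e:ℝ)..((e:ℝ)+1), fW l y u| ≤ if Y/q - 1 ≤ e ∧ (e:ℝ) ≤ Y*q then B else 0 := by
    intro e he
    have he1 : (1:ℝ) ≤ e := by exact_mod_cast (mem_Icc.mp he).1
    have he0 : (0:ℝ) < e := by linarith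
    have eq : fW l y e - ∫ u in (e:ℝ)..((e:ℝ)+1), fW l y u = ∫ u in (e:ℝ)..((e:ℝ)+1), (fW l y e - fW l y u) := by
      rw [intervalIntegral.integral_sub (by simp) ((fW_cont he0 (by linarith)).intervalIntegrable)]
      simp
    rw [eq]
    have key : ∀ C, (∀ u ∈ Set.uIoc (e:ℝ) ((e:ℝ)+1), ‖fW l y e - fW l y u‖ ≤ C) → |∫ u in (e:ℝ)..((e:ℝ)+1), (fW l y e - fW l y u)| ≤ C := by
      intro C h
      have := intervalIntegral.norm_integral_le_of_norm_le_const h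
      rw [add_sub_cancel_left, abs_one, mul_one] at this
      exact this
    apply key
    intro u hu
    rw [Set.uIoc_of_le (by linarith)] at hu
    have hu0 : 0 < u := by linarith [hu.1]
    rw [Real.norm_eq_abs]
    split_ifs with hc
    · refine (fW_lip hl he0 hu.1.le hu.2).trans ?_
      rw [hB]
      gcongr ?_ * _
      have h8 : 2 ≤ Y/q := by rw [le_div_iff₀ hq0]; linarith
      have h9 : Y/(2*q) ≤ e := by
        have : Y/(2*q) = Y/q/2 := by field_simp
        rw [this]; linarith [hc.1]
      rw [div_le_div_iff₀ (by positivity) (by positivity)]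
      rw [div_le_iff₀ (by positivity)] at h9
      have := pow_le_pow_left₀ hY0.le h9 2
      nlinarith [this]
    · have z : ∀ v : ℝ, 0 < v → (v ≤ Y/q ∨ Y*q ≤ v) → fW l y v = 0 := by
        intro v hv h
        unfold fW
        rw [Wk_zero hl, mul_zero]
        rcases h with h | h
        · have := Real.log_le_log hv h
          rw [Real.log_div hY0.ne' hq0.ne', hY, hq, Real.log_exp, Real.log_exp] at this
          rw [abs_of_nonpos (by linarith)]; linarith
        · have := Real.log_le_log (by positivity) h
          rw [Real.log_mul hY0.ne' hq0.ne', hY, hq, Real.log_exp, Real.log_exp] at this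
          rw [abs_of_nonneg (by linarith)]; linarith
      rw [not_and_or, not_le, not_le] at hc
      rcases hc with hc | hc
      · rw [z e he0 (Or.inl (by linarith)), z u hu0 (Or.inl (by linarith [hu.2]))]; simp
      · rw [z e he0 (Or.inr hc.le), z u hu0 (Or.inr (by linarith [hu.1]))]; simp
  have hcard : ((((Icc 1 N).filter (fun e : ℕ => Y/q - 1 ≤ e ∧ (e:ℝ) ≤ Y*q)).card : ℕ) : ℝ) ≤ Y*q - Y/q + 2 := by
    have hsub : (Icc 1 N).filter (fun e : ℕ => Y/q - 1 ≤ e ∧ (e:ℝ) ≤ Y*q) ⊆ Icc ⌈Y/q - 1⌉₊ ⌊Y*q⌋₊ := by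
      intro e he
      rw [mem_filter] at he
      rw [mem_Icc]
      exact ⟨Nat.ceil_le.mpr he.2.1, Nat.le_floor he.2.2⟩
    have h1 := card_le_card hsub
    rw [Nat.card_Icc] at h1
    have h2 : ⌈Y/q - 1⌉₊ ≤ ⌊Y*q⌋₊ + 1 := by
      rw [Nat.ceil_le]; push_cast
      have h5 : Y/q ≤ Y * q := by rw [div_le_iff₀ hq0]; nlinarith [mul_le_mul_of_nonneg_left (one_le_pow₀ hq1 : 1 ≤ q^2) hY0.le]
      have := Nat.lt_floor_add_one (Y*q); linarith
    have h3 : ((((Icc 1 N).filter (fun e : ℕ => Y/q - 1 ≤ e ∧ (e:ℝ) ≤ Y*q)).card : ℕ) : ℝ) ≤ ((⌊Y*q⌋₊ + 1 - ⌈Y/q-1⌉₊ : ℕ) : ℝ) := by exact_mod_cast h1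
    rw [Nat.cast_sub h2] at h3
    push_cast at h3
    have := Nat.floor_le (show 0 ≤ Y*q by positivity)
    have := Nat.le_ceil (Y/q-1)
    linarith
  have hqd : q - 1/q ≤ 2*l*q := by
    have : 1 - 2*l ≤ Real.exp (-(2*l)) := by have := Real.add_one_le_exp (-(2*l)); linarith
    have e2 : Real.exp (-(2*l)) = 1/q^2 := by rw [hq, ← Real.exp_nat_mul, Real.exp_neg]; simp
    rw [e2] at this
    have h5 := mul_le_mul_of_nonneg_right this hq0.le
    have e3 : 1/q^2*q = 1/q := by field_simp
    rw [e3] at h5; linarith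
  calc |∑ e ∈ Icc 1 N, 1/(e:ℝ) * Wk l (Real.log e - y) - 1| = |∑ e ∈ Icc 1 N, (fW l y e - ∫ u in (e:ℝ)..((e:ℝ)+1), fW l y u)| := by
        rw [sum_sub_distrib, hint]; rfl
    _ ≤ ∑ e ∈ Icc 1 N, if Y/q - 1 ≤ e ∧ (e:ℝ) ≤ Y*q then B else 0 := (abs_sum_le_sum_abs _ _).trans (sum_le_sum hone)
    _ = (((Icc 1 N).filter (fun e : ℕ => Y/q - 1 ≤ e ∧ (e:ℝ) ≤ Y*q)).card : ℝ) * B := by rw [← sum_filter, sum_const, nsmul_eq_mul]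
    _ ≤ (Y*(2*l*q) + 2) * B := by
        gcongr
        have : Y*q - Y/q = Y*(q-1/q) := by ring
        nlinarith [mul_le_mul_of_nonneg_left hqd hY0.le]
    _ ≤ (4*(l*Y)*q) * B := by
        gcongr
        have : 1 ≤ l * Y * q := by nlinarith [one_le_pow₀ hq1 (n := 4)]
        linarith
    _ = 16 * q^3 * (l+1)/(l*Y) := by rw [hB]; field_simp; ring
    _ ≤ 16*q^3*q/(l*Y) := by gcongr
    _ = _ := by ring_nf

noncomputable def SS (N : ℕ) (l y : ℝ) (f : ℕ → ℝ) : ℝ := ∑ n ∈ Icc 1 N, f n * (1/(n:ℝ) * Wk l (Real.log n - y))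

lemma sum_mult (N d : ℕ) (hd : 1 ≤ d) (F : ℕ → ℝ) : ∑ n ∈ Icc 1 N, (if d ∣ n then 1 else 0) * F n = ∑ e ∈ Icc 1 (N/d), F (d*e) := by
  simp only [ite_mul, one_mul, zero_mul]
  rw [← sum_filter]
  symm
  refine sum_nbij (fun e => d*e) ?_ ?_ ?_ (fun _ _ => rfl)
  · intro e he
    rw [mem_Icc] at he
    rw [mem_filter, mem_Icc]
    refine ⟨⟨Nat.mul_pos hd he.1, ?_⟩, Dvd.intro _ rfl⟩
    exact (Nat.mul_le_mul_left d he.2).trans (Nat.mul_div_le N d)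
  · intro a _ b _ h
    exact Nat.eq_of_mul_eq_mul_left hd h
  · intro n hn
    rw [mem_coe, mem_filter, mem_Icc] at hn
    obtain ⟨⟨h1, h2⟩, e, rfl⟩ := hn
    refine ⟨e, ?_, rfl⟩
    rw [mem_coe, mem_Icc]
    exact ⟨Nat.pos_of_mul_pos_left h1, (Nat.le_div_iff_mul_le hd).mpr (by rw [mul_comm]; exact h2)⟩

lemma exp_div_le' {N d : ℕ} {y l : ℝ} (hd : 1 ≤ d) (hN : Real.exp (y+l) ≤ N) : Real.exp (y - Real.log d + l) ≤ ((N/d : ℕ):ℝ) + 1 := by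
  have hd0 : (0:ℝ) < d := by exact_mod_cast hd
  rw [show y - Real.log d + l = (y+l) - Real.log d by ring, Real.exp_sub, Real.exp_log hd0, div_le_iff₀ hd0]
  have : N < (N/d + 1)*d := by rw [mul_comm]; exact Nat.lt_mul_div_succ N hd
  have h2 : N ≤ (N/d+1)*d := this.le
  have : (N:ℝ) ≤ (((N/d:ℕ):ℝ)+1)*d := by exact_mod_cast h2
  linarith

lemma SS_dvd {N d : ℕ} {l y : ℝ} (hd : 1 ≤ d) (g : ℕ → ℝ) : ∑ n ∈ Icc 1 N, (if d ∣ n then 1 else 0) * (g n * (1/(n:ℝ) * Wk l (Real.log n - y))) = (1/(d:ℝ)) * SS (N/d) l (y - Real.log d) (fun e => g (d*e)) := by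
  rw [sum_mult N d hd, SS, mul_sum]
  refine sum_congr rfl fun e he => ?_
  have hd0 : (0:ℝ) < d := by exact_mod_cast hd
  have he0 : (0:ℝ) < e := by exact_mod_cast (mem_Icc.mp he).1
  push_cast
  rw [Real.log_mul hd0.ne' he0.ne', show Real.log d + Real.log e - y = Real.log e - (y - Real.log d) by ring]
  field_simp

lemma riem_srep {Q : Finset ℕ} {f : ℕ → ℝ} {D W M l y : ℝ} {N : ℕ} (h : SRep Q f D W M) (hl : 0 < l) (hy : 16 * Real.exp (4*l) * D ≤ l * Real.exp y)
    (hN : Real.exp (y+l) ≤ N) : |SS N l y f - M| ≤ W * (16 * Real.exp (4*l) / (l * Real.exp y)) := by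
  obtain ⟨ι, _, d, c, h1, h2, h3, h4⟩ := h
  have e : SS N l y f = ∑ i, c i * ((1/(d i:ℝ)) * SS (N/d i) l (y - Real.log (d i)) (fun _ => 1)) := by
    unfold SS
    simp_rw [h2, sum_mul]
    rw [sum_comm]
    refine sum_congr rfl fun i _ => ?_
    have := SS_dvd (N := N) (l := l) (y := y) (h1 i).1 (fun _ => 1)
    unfold SS at this
    rw [← this, mul_sum]
    refine sum_congr rfl fun n _ => ?_
    ring
  rw [e, ← h4, ← sum_sub_distrib]
  calc _ ≤ ∑ i, |c i| * (16 * Real.exp (4*l) / (l * Real.exp y)) := by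
        refine (abs_sum_le_sum_abs _ _).trans (sum_le_sum fun i _ => ?_)
        obtain ⟨hd1, hd2, -⟩ := h1 i
        have hd0 : (0:ℝ) < d i := by exact_mod_cast hd1
        have hex : Real.exp (y - Real.log (d i)) = Real.exp y / d i := by rw [Real.exp_sub, Real.exp_log hd0]
        have := riem (N := N/d i) (y := y - Real.log (d i)) hl (by
          rw [hex, ← mul_div_assoc, le_div_iff₀ hd0]
          exact le_trans (by gcongr) hy) (exp_div_le' hd1 hN)
        rw [show c i * ((1/(d i:ℝ)) * SS (N/d i) l (y - Real.log (d i)) (fun _ => 1)) - c i / d i = c i * ((1/d i) * (SS (N/d i) l (y - Real.log (d i)) (fun _ => 1) - 1)) by ring,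
          abs_mul, abs_mul, abs_of_pos (show 0 < 1/(d i:ℝ) by positivity)]
        gcongr
        have e2 : SS (N/d i) l (y - Real.log (d i)) (fun _ => 1) = ∑ e ∈ Icc 1 (N/d i), 1/(e:ℝ) * Wk l (Real.log e - (y - Real.log (d i))) := by simp [SS]
        rw [e2]
        calc _ ≤ 1/(d i:ℝ) * _ := mul_le_mul_of_nonneg_left this (by positivity)
          _ = _ := by rw [hex]; field_simp
    _ ≤ _ := by rw [← sum_mul]; gcongr

lemma SS_mono {N : ℕ} {l y : ℝ} (hl : 0 < l) {f g : ℕ → ℝ} (h : ∀ n ∈ Icc 1 N, |Real.log n - y| < l → f n ≤ g n) : SS N l y f ≤ SS N l y g := by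
  refine sum_le_sum fun n hn => ?_
  by_cases h1 : |Real.log n - y| < l
  · exact mul_le_mul_of_nonneg_right (h n hn h1) (mul_nonneg (by positivity) (Wk_nonneg hl _))
  · rw [Wk_zero hl (not_lt.mp h1)]; simp

lemma SS_sub (N : ℕ) (l y : ℝ) (f g : ℕ → ℝ) : SS N l y (fun n => f n - g n) = SS N l y f - SS N l y g := by
  unfold SS; rw [← sum_sub_distrib]; exact sum_congr rfl fun n _ => by ring
lemma SS_add (N : ℕ) (l y : ℝ) (f g : ℕ → ℝ) : SS N l y (fun n => f n + g n) = SS N l y f + SS N l y g := by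
  unfold SS; rw [← sum_add_distrib]; exact sum_congr rfl fun n _ => by ring
lemma SS_smul (N : ℕ) (l y c : ℝ) (f : ℕ → ℝ) : SS N l y (fun n => c * f n) = c * SS N l y f := by
  unfold SS; rw [mul_sum]; exact sum_congr rfl fun n _ => by ring

lemma US : ∃ c0 : ℕ, ∀ (z l y : ℝ) (N : ℕ), 2 ≤ z → 0 < l → 16 * Real.exp (4*l) * z^c0 ≤ l * Real.exp y → Real.exp (y+l) ≤ N → SS N l y (rho z) ≤ 3 / Real.log z := by
  obtain ⟨b0, hb0⟩ := FL
  refine ⟨4*b0+4 + (4*b0+5), fun z l y N hz hl hy hN => ?_⟩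
  obtain ⟨U, E, MU, ME, h1, -, h3, h4, -, h5, -⟩ := hb0 b0 le_rfl z (by linarith)
  have hz1 : 1 ≤ z := by linarith
  have hlz : 0 < Real.log z := Real.log_pos (by linarith)
  have hD : z^(4*b0+4) ≤ z^(4*b0+4 + (4*b0+5)) := pow_le_pow_right₀ hz1 (by omega)
  have r := riem_srep h1 hl (le_trans (by gcongr) hy) hN
  have m := SS_mono (N := N) (y := y) hl (f := rho z) (g := U) (fun n _ _ => (h3 n).2.1)
  have e1 : z^(4*b0+4) * (16 * Real.exp (4*l) / (l * Real.exp y)) ≤ 1/z := by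
    rw [← mul_div_assoc, div_le_div_iff₀ (by positivity) (by linarith)]
    calc z^(4*b0+4) * (16 * Real.exp (4*l)) * z = 16 * Real.exp (4*l) * z^(4*b0+5) := by ring
      _ ≤ 16 * Real.exp (4*l) * z^(4*b0+4 + (4*b0+5)) := mul_le_mul_of_nonneg_left (pow_le_pow_right₀ hz1 (by omega)) (by positivity)
      _ ≤ 1 * (l * Real.exp y) := by linarith
  have e2 : 1/z ≤ 1/Real.log z := one_div_le_one_div_of_le hlz (by have := Real.log_le_sub_one_of_pos (show 0 < z by linarith); linarith)
  have e3 : MU ≤ 2 * (1/Real.log z) := by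
    refine h5.trans ?_
    have hv := Vz_le (z := z) (by linarith)
    have hv0 := Vz_pos z
    have : (1:ℝ) + (1/2)^b0 ≤ 2 := by
      have : (1/2:ℝ)^b0 ≤ 1 := pow_le_one₀ (by norm_num) (by norm_num)
      linarith
    gcongr
  have := (abs_le.mp r).2
  have e4 : 3/Real.log z = 3 * (1/Real.log z) := by ring
  rw [e4]; linarith

end

section
open Finset MeasureTheory
open scoped FourierTransform

noncomputable def kh (x : ℝ) : ℝ := Real.sinc (Real.pi * x)^2

lemma kh_nonneg (x : ℝ) : 0 ≤ kh x := sq_nonneg _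
lemma kh_le_one (x : ℝ) : kh x ≤ 1 := by
  unfold kh
  rw [sq_le_one_iff_abs_le_one]; exact Real.abs_sinc_le_one _
lemma kh_cont : Continuous kh := by
  unfold kh
  exact (Real.continuous_sinc.comp (continuous_const.mul continuous_id)).pow 2
lemma kh_le_inv {x : ℝ} (hx : x ≠ 0) : kh x ≤ 1/x^2 := by
  unfold kh
  have : Real.pi * x ≠ 0 := mul_ne_zero Real.pi_ne_zero hx
  rw [Real.sinc_of_ne_zero this, div_pow]
  have h1 : Real.sin (Real.pi * x)^2 ≤ 1 := Real.sin_sq_le_one _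
  have h2 : x^2 ≤ (Real.pi*x)^2 := by
    rw [mul_pow]
    have : 1 ≤ Real.pi^2 := by nlinarith [Real.pi_gt_three]
    nlinarith [sq_nonneg x]
  have h3 : 0 < x^2 := by positivity
  gcongr
lemma kh_le_two (x : ℝ) : kh x ≤ 2 * (1 + x^2)⁻¹ := by
  rw [← div_eq_mul_inv]
  rw [le_div_iff₀ (by positivity)]
  rcases eq_or_ne x 0 with h | h
  · subst h; have := kh_le_one 0; linarith
  · have h1 := kh_le_one x
    have h2 := kh_le_inv h
    rw [le_div_iff₀ (by positivity)] at h2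
    nlinarith
lemma kh_integrable : Integrable kh := by
  refine (integrable_inv_one_add_sq.const_mul 2).mono' kh_cont.aestronglyMeasurable (Filter.Eventually.of_forall fun x => ?_)
  rw [Real.norm_of_nonneg (kh_nonneg x)]
  exact kh_le_two x
lemma one_sub_kh (x : ℝ) : 1 - kh x ≤ 10 * x^2 := by
  have hpi : Real.pi^2 ≤ 10 := by nlinarith [Real.pi_lt_d2, Real.pi_gt_three]
  have key : ∀ y : ℝ, 0 ≤ y → 1 - Real.sinc y^2 ≤ y^2 := by
    intro y hy
    rcases eq_or_lt_of_le hy with h | h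
    · subst h; simp
    · rcases le_or_gt y 1 with h1 | h1
      · rw [Real.sinc_of_ne_zero h.ne']
        have := (Real.sin_gt_sub_cube h).le
        have h2 : 1 - y^2/4 ≤ Real.sin y / y := by
          rw [le_div_iff₀ h]; nlinarith
        have h3 : 0 ≤ 1 - y^2/4 := by nlinarith
        have := pow_le_pow_left₀ h3 h2 2
        nlinarith [sq_nonneg (y^2)]
      · nlinarith [sq_nonneg (Real.sinc y)]
  have := key |Real.pi * x| (abs_nonneg _)
  have e : Real.sinc |Real.pi * x| ^2 = Real.sinc (Real.pi * x)^2 := by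
    rcases abs_choice (Real.pi * x) with h | h <;> rw [h]
    rw [Real.sinc_neg]
  rw [e, sq_abs] at this
  unfold kh
  nlinarith [sq_nonneg x]

lemma kk_integrable : Integrable (fun v => (kk v : ℂ)) := by
  have : Integrable kk := by
    have hc : HasCompactSupport kk := by
      apply HasCompactSupport.intro (isCompact_Icc (a := (-1:ℝ)) (b := 1))
      intro v hv
      apply kk_zero
      by_contra h
      exact hv (abs_le.mp (not_le.mp h).le)
    exact kk_cont.integrable_of_hasCompactSupport hc
  exact this.ofReal

lemma int_aux1 (a : ℂ) (ha : a ≠ 0) : ∫ v in (0:ℝ)..1, ((1 - v : ℝ):ℂ) * Complex.exp (a * v) = Complex.exp a / a^2 - (1/a + 1/a^2) := by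
  have hd : ∀ v ∈ Set.uIcc (0:ℝ) 1, HasDerivAt (fun v : ℝ => ((1 - (v:ℂ))/a + 1/a^2) * Complex.exp (a * v)) (((1 - v : ℝ):ℂ) * Complex.exp (a * v)) v := by
    intro v _
    have h1 : HasDerivAt (fun w : ℂ => ((1 - w)/a + 1/a^2) * Complex.exp (a * w)) ((-1/a) * Complex.exp (a*v) + ((1 - (v:ℂ))/a + 1/a^2) * (Complex.exp (a*v) * (a * 1))) (v:ℂ) :=
      ((((hasDerivAt_id (v:ℂ)).const_sub 1).div_const a).add_const _).mul (((hasDerivAt_id (v:ℂ)).const_mul a).cexp)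
    refine h1.comp_ofReal.congr_deriv ?_
    push_cast; field_simp; ring
  rw [intervalIntegral.integral_eq_sub_of_hasDerivAt hd (by apply Continuous.intervalIntegrable; fun_prop)]
  simp; ring

lemma int_aux2 (a : ℂ) (ha : a ≠ 0) : ∫ v in (-1:ℝ)..0, ((1 + v : ℝ):ℂ) * Complex.exp (a * v) = Complex.exp (-a) / a^2 + (1/a - 1/a^2) := by
  have hd : ∀ v ∈ Set.uIcc (-1:ℝ) 0, HasDerivAt (fun v : ℝ => ((1 + (v:ℂ))/a - 1/a^2) * Complex.exp (a * v)) (((1 + v : ℝ):ℂ) * Complex.exp (a * v)) v := by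
    intro v _
    have h1 : HasDerivAt (fun w : ℂ => ((1 + w)/a - 1/a^2) * Complex.exp (a * w)) ((1/a) * Complex.exp (a*v) + ((1 + (v:ℂ))/a - 1/a^2) * (Complex.exp (a*v) * (a * 1))) (v:ℂ) :=
      ((((hasDerivAt_id (v:ℂ)).const_add 1).div_const a).sub_const _).mul (((hasDerivAt_id (v:ℂ)).const_mul a).cexp)
    refine h1.comp_ofReal.congr_deriv ?_
    push_cast; field_simp; ring
  rw [intervalIntegral.integral_eq_sub_of_hasDerivAt hd (by apply Continuous.intervalIntegrable; fun_prop)]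
  simp; ring

lemma fourier_kk (x : ℝ) : 𝓕 (fun v : ℝ => (kk v : ℂ)) x = (kh x : ℂ) := by
  rw [Real.fourier_real_eq_integral_exp_smul]
  have hsupp : ∀ v : ℝ, v ∉ Set.Ioc (-1:ℝ) 1 → Complex.exp (((-2 * Real.pi * v * x : ℝ):ℂ) * Complex.I) • (kk v : ℂ) = 0 := by
    intro v hv
    have : kk v = 0 := by
      apply kk_zero
      by_contra h
      have h' := abs_lt.mp (not_le.mp h)
      exact hv ⟨h'.1, h'.2.le⟩
    rw [this]; simp
  rw [← setIntegral_eq_integral_of_forall_compl_eq_zero (s := Set.Ioc (-1:ℝ) 1) hsupp,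
    ← intervalIntegral.integral_of_le (by norm_num)]
  rcases eq_or_ne x 0 with h0 | h0
  · subst h0
    have := int_kk (a := -1) (b := 1) le_rfl le_rfl
    simp only [mul_zero, Complex.ofReal_zero, zero_mul, Complex.exp_zero, one_smul]
    rw [intervalIntegral.integral_ofReal, this]; simp [kh]
  · set a : ℂ := ((-2*Real.pi*x : ℝ):ℂ) * Complex.I with ha
    have ha0 : a ≠ 0 := by
      rw [ha]
      refine mul_ne_zero ?_ Complex.I_ne_zero
      rw [Complex.ofReal_ne_zero]
      exact mul_ne_zero (mul_ne_zero (by norm_num) Real.pi_ne_zero) h0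
    have hc : Continuous (fun v : ℝ => Complex.exp (((-2 * Real.pi * v * x : ℝ):ℂ) * Complex.I) • (kk v : ℂ)) := by
      have := kk_cont
      fun_prop
    rw [← intervalIntegral.integral_add_adjacent_intervals (hc.intervalIntegrable (-1) 0) (hc.intervalIntegrable 0 1)]
    have e1 : ∫ v in (-1:ℝ)..0, Complex.exp (((-2 * Real.pi * v * x : ℝ):ℂ) * Complex.I) • (kk v : ℂ) = ∫ v in (-1:ℝ)..0, ((1 + v : ℝ):ℂ) * Complex.exp (a * v) := by
      apply intervalIntegral.integral_congr
      intro v hv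
      rw [Set.uIcc_of_le (by norm_num)] at hv
      have h2 : |v| = -v := abs_of_nonpos hv.2
      have h3 : kk v = 1 + v := by rw [kk_eq (by rw [h2]; linarith [hv.1]), h2]; ring
      simp only [h3, smul_eq_mul]
      rw [mul_comm]; congr 2; rw [ha]; push_cast; ring
    have e2 : ∫ v in (0:ℝ)..1, Complex.exp (((-2 * Real.pi * v * x : ℝ):ℂ) * Complex.I) • (kk v : ℂ) = ∫ v in (0:ℝ)..1, ((1 - v : ℝ):ℂ) * Complex.exp (a * v) := by
      apply intervalIntegral.integral_congr
      intro v hv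
      rw [Set.uIcc_of_le (by norm_num)] at hv
      have h2 : |v| = v := abs_of_nonneg hv.1
      have h3 : kk v = 1 - v := by rw [kk_eq (by rw [h2]; linarith [hv.2]), h2]
      simp only [h3, smul_eq_mul]
      rw [mul_comm]; congr 2; rw [ha]; push_cast; ring
    rw [e1, e2, int_aux1 a ha0, int_aux2 a ha0]
    have hcos : Complex.exp a + Complex.exp (-a) = ((2 * Real.cos (2*Real.pi*x) : ℝ):ℂ) := by
      rw [Complex.ofReal_mul, Complex.ofReal_cos, Complex.cos, ha]
      push_cast
      rw [show -2 * (Real.pi:ℂ) * x * Complex.I = -(2*Real.pi*x) * Complex.I by ring, show -(-(2*(Real.pi:ℂ)*x) * Complex.I) = (2*Real.pi*x)*Complex.I by ring]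
      ring
    have ha2 : a^2 = ((-(4*Real.pi^2*x^2) : ℝ):ℂ) := by
      rw [ha, mul_pow, Complex.I_sq]; push_cast; ring
    have hs : Complex.exp (-a) / a^2 + (1/a - 1/a^2) + (Complex.exp a / a^2 - (1/a + 1/a^2)) = ((Complex.exp a + Complex.exp (-a)) - 2)/a^2 := by ring
    rw [hs, hcos, ha2]
    norm_cast
    unfold kh
    rw [Real.sinc_of_ne_zero (mul_ne_zero Real.pi_ne_zero h0), show 2*Real.pi*x = 2*(Real.pi*x) by ring, Real.cos_two_mul, Real.cos_sq']
    have := Real.pi_ne_zero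
    field_simp; ring

lemma kk_inv (v : ℝ) : (kk v : ℂ) = ∫ x : ℝ, (kh x : ℂ) * ee (2*Real.pi*v*x) := by
  have hF : 𝓕 (fun v : ℝ => (kk v : ℂ)) = fun x => (kh x : ℂ) := funext fourier_kk
  have h := kk_integrable.fourierInv_fourier_eq (v := v) (by rw [hF]; exact kh_integrable.ofReal) ((Complex.continuous_ofReal.comp kk_cont).continuousAt)
  rw [hF] at h
  rw [← h, Real.fourierInv_eq']
  congr 1; ext x
  rw [smul_eq_mul, mul_comm]
  congr 2
  simp; ring

lemma Wk_inv {l : ℝ} (hl : 0 < l) (v : ℝ) : (Wk l v : ℂ) = ∫ x : ℝ, (kh (l*x) : ℂ) * ee (2*Real.pi*v*x) := by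
  have := Measure.integral_comp_mul_left (fun x : ℝ => (kh x : ℂ) * ee (2*Real.pi*(v/l)*x)) l
  rw [← kk_inv] at this
  unfold Wk
  have e : ∀ x : ℝ, ee (2*Real.pi*(v/l)*(l*x)) = ee (2*Real.pi*v*x) := by intro x; congr 1; field_simp
  simp only [e] at this
  rw [this, abs_of_pos (by positivity), Complex.real_smul]
  push_cast; ring

lemma khl_integrable {l : ℝ} (hl : 0 < l) : Integrable (fun x => kh (l*x)) := kh_integrable.comp_mul_left' hl.ne'

end

section
open Finset MeasureTheory

lemma int_lor {s : ℝ} (hs : 0 < s) : Integrable (fun x : ℝ => (1 + (x/s)^2)⁻¹) ∧ ∫ x : ℝ, (1 + (x/s)^2)⁻¹ = Real.pi * s := by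
  have e : (fun x : ℝ => (1 + (x/s)^2)⁻¹) = fun x => (fun y : ℝ => (1+y^2)⁻¹) (s⁻¹*x) := by
    ext x; simp only; rw [div_eq_inv_mul]
  constructor
  · rw [e]; exact integrable_inv_one_add_sq.comp_mul_left' (by positivity)
  · rw [e]
    refine (Measure.integral_comp_mul_left (fun y : ℝ => (1+y^2)⁻¹) s⁻¹).trans ?_
    rw [integral_univ_inv_one_add_sq, inv_inv, abs_of_pos hs, smul_eq_mul, mul_comm]

set_option maxHeartbeats 2000000 in
lemma typeII_an {FA FB FP : ℝ → ℂ} {M Q δ x1 x2 l0 l1 L : ℝ} (hM : 1 ≤ M)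
    (hAc : Continuous FA) (hBc : Continuous FB) (hPc : Continuous FP)
    (hA : ∀ x, ‖FA x‖ ≤ M) (hB : ∀ x, ‖FB x‖ ≤ M) (hP : ∀ x, ‖FP x‖ ≤ M)
    (hl1 : 0 < l1) (hl01 : l1 ≤ l0) (hx1 : 0 < x1) (hx2 : 0 < x2) (hδ : 0 ≤ δ)
    (hPd : ∀ x, x1 ≤ |x| → |x| ≤ x2 → ‖FP x‖ ≤ δ)
    (hQA1 : ∫ x, kh (l1*x) * ‖FA x‖^2 ≤ Q) (hQA0 : ∫ x, kh (l0*x) * ‖FA x‖^2 ≤ Q)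
    (hQB1 : ∫ x, kh (l1*x) * ‖FB x‖^2 ≤ Q) (hQB0 : ∫ x, kh (l0*x) * ‖FB x‖^2 ≤ Q) :
    ‖∫ x, (((kh (l1*x) - kh (l0*x) : ℝ):ℂ)) * (FA x * FB x * FP x) * ee (-(2*Real.pi*L*x))‖
      ≤ 40*Real.pi*M^3*(l0*x1)^2*x1 + 2*δ*Q + 4*Real.pi*M^3/(l1^2*x2) := by
  have hl0 : 0 < l0 := hl1.trans_le hl01
  have hbi : ∀ (l : ℝ), 0 < l → ∀ F : ℝ → ℂ, Continuous F → (∀ x, ‖F x‖ ≤ M) → Integrable (fun x => kh (l*x) * ‖F x‖^2) := by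
    intro l hl F hF hFM
    refine ((khl_integrable hl).mul_const (M^2)).mono' ?_ (Filter.Eventually.of_forall fun x => ?_)
    · exact ((kh_cont.comp (continuous_const.mul continuous_id)).mul (hF.norm.pow 2)).aestronglyMeasurable
    · rw [Real.norm_of_nonneg (mul_nonneg (kh_nonneg _) (sq_nonneg _))]
      exact mul_le_mul_of_nonneg_left (pow_le_pow_left₀ (norm_nonneg _) (hFM x) 2) (kh_nonneg _)
  obtain ⟨i1, e1⟩ := int_lor hx1
  obtain ⟨i2, e2⟩ := int_lor hx2
  set H : ℝ → ℝ := fun x => (40*M^3*(l0*x1)^2) * (1+(x/x1)^2)⁻¹ + ((δ/2) * (((kh (l1*x) * ‖FA x‖^2) + (kh (l0*x) * ‖FA x‖^2)) + ((kh (l1*x) * ‖FB x‖^2) + (kh (l0*x) * ‖FB x‖^2)))) + (4*M^3/(l1^2*x2^2)) * (1+(x/x2)^2)⁻¹ with hH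
  have jA1 := hbi l1 hl1 FA hAc hA
  have jA0 := hbi l0 hl0 FA hAc hA
  have jB1 := hbi l1 hl1 FB hBc hB
  have jB0 := hbi l0 hl0 FB hBc hB
  have jm := ((jA1.add jA0).add (jB1.add jB0)).const_mul (δ/2)
  have hHi : Integrable H := ((i1.const_mul _).add jm).add (i2.const_mul _)
  have hHe : ∫ x, H x = (40*M^3*(l0*x1)^2) * (Real.pi * x1) + (δ/2) * (((∫ x, kh (l1*x) * ‖FA x‖^2) + (∫ x, kh (l0*x) * ‖FA x‖^2)) + ((∫ x, kh (l1*x) * ‖FB x‖^2) + (∫ x, kh (l0*x) * ‖FB x‖^2))) + (4*M^3/(l1^2*x2^2)) * (Real.pi * x2) := by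
    have := integral_add ((i1.const_mul (40*M^3*(l0*x1)^2)).add jm) (i2.const_mul (4*M^3/(l1^2*x2^2)))
    rw [hH]
    refine this.trans ?_
    rw [integral_const_mul, e2]
    congr 1
    refine (integral_add (i1.const_mul (40*M^3*(l0*x1)^2)) jm).trans ?_
    rw [integral_const_mul, e1]
    congr 1
    rw [integral_const_mul]
    congr 1
    refine (integral_add (jA1.add jA0) (jB1.add jB0)).trans ?_
    exact congrArg₂ (· + ·) (integral_add jA1 jA0) (integral_add jB1 jB0)
  have hb : ∀ x, ‖(((kh (l1*x) - kh (l0*x) : ℝ):ℂ)) * (FA x * FB x * FP x) * ee (-(2*Real.pi*L*x))‖ ≤ H x := by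
    intro x
    rw [norm_mul, norm_mul, norm_mul, norm_mul, norm_ee, mul_one, Complex.norm_real, Real.norm_eq_abs]
    have k1 := kh_nonneg (l1*x)
    have k0 := kh_nonneg (l0*x)
    have k1' := kh_le_one (l1*x)
    have k0' := kh_le_one (l0*x)
    have hA' := hA x
    have hB' := hB x
    have hP' := hP x
    have na := norm_nonneg (FA x)
    have nb := norm_nonneg (FB x)
    have np := norm_nonneg (FP x)
    have hM0 : 0 ≤ M := by linarith
    have t1 : 0 ≤ (40*M^3*(l0*x1)^2) * (1+(x/x1)^2)⁻¹ := by positivity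
    have t2 : 0 ≤ ((δ/2) * (((kh (l1*x) * ‖FA x‖^2) + (kh (l0*x) * ‖FA x‖^2)) + ((kh (l1*x) * ‖FB x‖^2) + (kh (l0*x) * ‖FB x‖^2)))) := by positivity
    have t3 : 0 ≤ (4*M^3/(l1^2*x2^2)) * (1+(x/x2)^2)⁻¹ := by positivity
    have h3 : ‖FA x‖ * ‖FB x‖ * ‖FP x‖ ≤ M^3 := by
      calc _ ≤ M * M * M := by gcongr
        _ = M^3 := by ring
    rw [hH]; simp only
    rcases lt_or_ge |x| x1 with hx | hx
    · -- small
      have hg : |kh (l1*x) - kh (l0*x)| ≤ 20 * (l0*x1)^2 := by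
        have o1 := one_sub_kh (l1*x)
        have o0 := one_sub_kh (l0*x)
        have hxx : x^2 ≤ x1^2 := by rw [← sq_abs x]; exact pow_le_pow_left₀ (abs_nonneg _) hx.le 2
        have hll : l1^2 ≤ l0^2 := pow_le_pow_left₀ hl1.le hl01 2
        have q1 : (l1*x)^2 ≤ (l0*x1)^2 := by rw [mul_pow, mul_pow]; gcongr
        have q0 : (l0*x)^2 ≤ (l0*x1)^2 := by rw [mul_pow, mul_pow]; gcongr
        rw [abs_le]; constructor <;> linarith [sq_nonneg (l0*x1)]
      have hh : (1/2:ℝ) ≤ (1+(x/x1)^2)⁻¹ := by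
        rw [one_div]
        apply inv_anti₀ (by positivity)
        have : (x/x1)^2 ≤ 1 := by
          rw [div_pow, div_le_one (by positivity), ← sq_abs x]
          exact pow_le_pow_left₀ (abs_nonneg _) hx.le 2
        linarith
      have : |kh (l1*x) - kh (l0*x)| * (‖FA x‖ * ‖FB x‖ * ‖FP x‖) ≤ (40*M^3*(l0*x1)^2) * (1+(x/x1)^2)⁻¹ := by
        calc _ ≤ (20 * (l0*x1)^2) * M^3 := by gcongr
          _ = (40*M^3*(l0*x1)^2) * (1/2) := by ring
          _ ≤ _ := by gcongr
      linarith
    · rcases le_or_gt |x| x2 with hx' | hx'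
      · have hd := hPd x hx hx'
        have hg : |kh (l1*x) - kh (l0*x)| ≤ kh (l1*x) + kh (l0*x) := by
          rw [abs_le]; constructor <;> linarith
        have : |kh (l1*x) - kh (l0*x)| * (‖FA x‖ * ‖FB x‖ * ‖FP x‖) ≤ (kh (l1*x) + kh (l0*x)) * (((‖FA x‖^2 + ‖FB x‖^2)/2) * δ) := by
          gcongr
          nlinarith [sq_nonneg (‖FA x‖ - ‖FB x‖)]
        have e : (kh (l1*x) + kh (l0*x)) * (((‖FA x‖^2 + ‖FB x‖^2)/2) * δ) = ((δ/2) * (((kh (l1*x) * ‖FA x‖^2) + (kh (l0*x) * ‖FA x‖^2)) + ((kh (l1*x) * ‖FB x‖^2) + (kh (l0*x) * ‖FB x‖^2)))) := by ring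
        linarith
      · have hx0 : x ≠ 0 := by intro h; rw [h, abs_zero] at hx'; linarith
        have hxx : x2^2 ≤ x^2 := by rw [← sq_abs x]; exact pow_le_pow_left₀ hx2.le hx'.le 2
        have hg : |kh (l1*x) - kh (l0*x)| ≤ 2/(l1^2*x^2) := by
          have o1 := kh_le_inv (x := l1*x) (mul_ne_zero hl1.ne' hx0)
          have o0 := kh_le_inv (x := l0*x) (mul_ne_zero hl0.ne' hx0)
          have p0 : 0 ≤ 1/(l1^2*x^2) := by positivity
          have : 1/(l0*x)^2 ≤ 1/(l1^2*x^2) := by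
            rw [mul_pow]
            have : 0 < x^2 := by positivity
            gcongr
          rw [mul_pow] at o1
          have e : 2/(l1^2*x^2) = 1/(l1^2*x^2) + 1/(l1^2*x^2) := by ring
          rw [e, abs_le]; constructor <;> linarith
        have hxp : 0 < x^2 := by positivity
        have : |kh (l1*x) - kh (l0*x)| * (‖FA x‖ * ‖FB x‖ * ‖FP x‖) ≤ (4*M^3/(l1^2*x2^2)) * (1+(x/x2)^2)⁻¹ := by
          calc _ ≤ 2/(l1^2*x^2) * M^3 := by gcongr
            _ ≤ _ := by
              have : (4*M^3/(l1^2*x2^2)) * (1+(x/x2)^2)⁻¹ = 4*M^3/(l1^2*(x2^2+x^2)) := by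
                field_simp
              rw [this, div_mul_eq_mul_div, div_le_div_iff₀ (by positivity) (by positivity)]
              have : 0 ≤ M^3*l1^2 := by positivity
              nlinarith
        linarith
  refine (norm_integral_le_of_norm_le hHi (Filter.Eventually.of_forall hb)).trans ?_
  rw [hHe]
  have e3 : (4*M^3/(l1^2*x2^2)) * (Real.pi * x2) = 4*Real.pi*M^3/(l1^2*x2) := by field_simp
  rw [e3]
  have : (δ/2) * (((∫ x, kh (l1*x) * ‖FA x‖^2) + (∫ x, kh (l0*x) * ‖FA x‖^2)) + ((∫ x, kh (l1*x) * ‖FB x‖^2) + (∫ x, kh (l0*x) * ‖FB x‖^2))) ≤ (δ/2) * ((Q+Q)+(Q+Q)) := by gcongr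
  linarith

noncomputable def PS (Q : Finset ℕ) (x : ℝ) : ℂ := ∑ p ∈ Q, ((1/(p:ℝ):ℝ):ℂ) * ee (2*Real.pi*x*Real.log p)

lemma ee_cont : Continuous ee := by unfold ee; fun_prop

lemma PS_cont (Q : Finset ℕ) : Continuous (PS Q) := by
  unfold PS
  have := ee_cont
  fun_prop

lemma PS_norm (Q : Finset ℕ) (x : ℝ) : ‖PS Q x‖ ≤ ∑ p ∈ Q, 1/(p:ℝ) := by
  unfold PS
  refine (norm_sum_le _ _).trans (Finset.sum_le_sum fun p _ => ?_)
  rw [norm_mul, norm_ee, mul_one, Complex.norm_real, Real.norm_of_nonneg (by positivity)]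

lemma ee_sum {ι : Type*} (s : Finset ι) (f : ι → ℝ) : ee (∑ i ∈ s, f i) = ∏ i ∈ s, ee (f i) := by
  classical
  induction s using Finset.induction_on with
  | empty => simp [ee_zero]
  | insert a s ha ih => rw [Finset.sum_insert ha, Finset.prod_insert ha, ee_add, ih]

section tup
variable {ι : Type} [Fintype ι] [DecidableEq ι]

lemma prod_PS (Q : ι → Finset ℕ) (x : ℝ) :
    ∏ i, PS (Q i) x = ∑ a ∈ Fintype.piFinset Q, ((∏ i, 1/((a i:ℕ):ℝ) : ℝ):ℂ) * ee (2*Real.pi*x*∑ i, Real.log (a i)) := by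
  unfold PS
  rw [Finset.prod_univ_sum]
  refine Finset.sum_congr rfl fun a _ => ?_
  rw [Finset.prod_mul_distrib, Finset.mul_sum, ee_sum]
  push_cast; rfl

lemma typeII_fourier (Q : ι → Finset ℕ) {l0 l1 : ℝ} (h0 : 0 < l0) (h1 : 0 < l1) (L : ℝ) :
    ((∑ a ∈ Fintype.piFinset Q, (∏ i, 1/((a i:ℕ):ℝ)) * (Wk l1 (∑ i, Real.log (a i) - L) - Wk l0 (∑ i, Real.log (a i) - L)) : ℝ) : ℂ)
     = ∫ x, (((kh (l1*x) - kh (l0*x) : ℝ):ℂ)) * (∏ i, PS (Q i) x) * ee (-(2*Real.pi*L*x)) := by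
  have hi : ∀ l : ℝ, 0 < l → ∀ v : ℝ, Integrable (fun x : ℝ => (kh (l*x) : ℂ) * ee (2*Real.pi*v*x)) := by
    intro l hl v
    refine (khl_integrable hl).mono' ?_ (Filter.Eventually.of_forall fun x => ?_)
    · have := ee_cont
      have := kh_cont
      apply Continuous.aestronglyMeasurable
      fun_prop
    · rw [norm_mul, norm_ee, mul_one, Complex.norm_real, Real.norm_of_nonneg (kh_nonneg _)]
  have hv : ∀ v : ℝ, ((Wk l1 v - Wk l0 v : ℝ):ℂ) = ∫ x, (((kh (l1*x) - kh (l0*x) : ℝ):ℂ)) * ee (2*Real.pi*v*x) := by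
    intro v
    push_cast
    rw [Wk_inv h1, Wk_inv h0, ← integral_sub (hi l1 h1 v) (hi l0 h0 v)]
    congr 1; ext x; ring
  push_cast
  have : ∀ x, (((kh (l1*x) - kh (l0*x) : ℝ):ℂ)) * (∏ i, PS (Q i) x) * ee (-(2*Real.pi*L*x)) = ∑ a ∈ Fintype.piFinset Q, ((∏ i, 1/((a i:ℕ):ℝ) : ℝ):ℂ) * ((((kh (l1*x) - kh (l0*x) : ℝ):ℂ)) * ee (2*Real.pi*(∑ i, Real.log (a i) - L)*x)) := by
    intro x
    rw [prod_PS, Finset.mul_sum, Finset.sum_mul]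
    refine Finset.sum_congr rfl fun a _ => ?_
    rw [show 2*Real.pi*(∑ i, Real.log (a i) - L)*x = 2*Real.pi*x*(∑ i, Real.log (a i)) + -(2*Real.pi*L*x) by ring, ee_add]
    ring
  have hcast : ∀ x : ℝ, ((kh (l1*x) : ℂ) - (kh (l0*x) : ℂ)) = (((kh (l1*x) - kh (l0*x) : ℝ):ℂ)) := by intro x; push_cast; rfl
  simp_rw [hcast, this]
  rw [integral_finset_sum]
  · refine Finset.sum_congr rfl fun a _ => ?_
    rw [integral_const_mul, ← hv]
    push_cast; rfl
  · intro a _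
    apply Integrable.const_mul
    have := (hi l1 h1 (∑ i, Real.log (a i) - L)).sub (hi l0 h0 (∑ i, Real.log (a i) - L))
    refine this.congr (Filter.Eventually.of_forall fun x => ?_)
    simp only [Pi.sub_apply]
    push_cast; ring

lemma tup_count (Q : ι → Finset ℕ) (hQ : ∀ i, ∀ p ∈ Q i, p.Prime) (n : ℕ) :
    ((Fintype.piFinset Q).filter (fun a => ∏ i, a i = n)).card ≤ (Fintype.card ι)^(Fintype.card ι) := by
  rcases Finset.eq_empty_or_nonempty ((Fintype.piFinset Q).filter (fun a => ∏ i, a i = n)) with h | ⟨a, ha⟩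
  · rw [h]; simp
  · rw [Finset.mem_filter, Fintype.mem_piFinset] at ha
    have hn : n.primeFactors ⊆ univ.image a := by
      intro p hp
      rw [Nat.mem_primeFactors] at hp
      rw [← ha.2] at hp
      obtain ⟨i, _, hi⟩ := (hp.1.prime.dvd_finset_prod_iff _).mp hp.2.1
      have := (Nat.prime_dvd_prime_iff_eq hp.1 (hQ i _ (ha.1 i))).mp hi
      rw [this]; simp
    have hc : n.primeFactors.card ≤ Fintype.card ι := (card_le_card hn).trans (card_image_le.trans (by simp))
    have hs : (Fintype.piFinset Q).filter (fun a => ∏ i, a i = n) ⊆ Fintype.piFinset (fun _ : ι => n.primeFactors) := by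
      intro b hb
      rw [Finset.mem_filter, Fintype.mem_piFinset] at hb
      rw [Fintype.mem_piFinset]
      intro i
      rw [Nat.mem_primeFactors]
      refine ⟨hQ i _ (hb.1 i), ?_, ?_⟩
      · rw [← hb.2]; exact Finset.dvd_prod_of_mem _ (mem_univ i)
      · rw [← hb.2]; exact Finset.prod_ne_zero_iff.mpr fun i _ => (hQ i _ (hb.1 i)).ne_zero
    refine (card_le_card hs).trans ?_
    rw [Fintype.card_piFinset]
    simp only [prod_const, card_univ]
    exact Nat.pow_le_pow_left hc _

end tup

end

section
open Finset MeasureTheory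

lemma rho_one {z : ℝ} {n : ℕ} (h : ∀ p : ℕ, p.Prime → p ∣ n → z ≤ p) : rho z n = 1 := by
  unfold rho
  refine Finset.prod_eq_one fun p hp => ?_
  rw [mem_pr] at hp
  have : ¬ p ∣ n := fun hd => absurd (h p hp.1 hd) (not_le.mpr hp.2.2)
  simp [dv, this]

lemma rho_zero {z : ℝ} {n p : ℕ} (hp : p.Prime) (hd : p ∣ n) (hz : (p:ℝ) < z) : rho z n = 0 := by
  unfold rho
  refine Finset.prod_eq_zero (i := p) ?_ ?_
  · rw [mem_pr]; exact ⟨hp, by positivity, hz⟩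
  · simp [dv, hd]

lemma rho_nn (z : ℝ) (n : ℕ) : 0 ≤ rho z n := by
  unfold rho
  refine Finset.prod_nonneg fun p _ => ?_
  linarith [(dv_01 n p).2]

lemma rho_le (z : ℝ) (n : ℕ) : rho z n ≤ 1 := by
  by_cases h : ∀ p : ℕ, p.Prime → p ∣ n → z ≤ p
  · rw [rho_one h]
  · push Not at h
    obtain ⟨p, hp, hd, hz⟩ := h
    rw [rho_zero hp hd hz]; norm_num

lemma SS_monoN {N N' : ℕ} {l y : ℝ} (hl : 0 < l) {f : ℕ → ℝ} (hf : ∀ n, 0 ≤ f n) (h : N ≤ N') : SS N l y f ≤ SS N' l y f := by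
  unfold SS
  refine Finset.sum_le_sum_of_subset_of_nonneg (Icc_subset_Icc_right h) fun n _ _ => ?_
  exact mul_nonneg (hf n) (mul_nonneg (by positivity) (Wk_nonneg hl _))

lemma US' : ∃ c0 : ℕ, ∀ (z l y : ℝ) (N : ℕ), 2 ≤ z → 0 < l → 16 * Real.exp (4*l) * z^c0 ≤ l * Real.exp y → SS N l y (rho z) ≤ 3 / Real.log z := by
  obtain ⟨c0, h⟩ := US
  refine ⟨c0, fun z l y N hz hl hh => ?_⟩
  have := h z l y (max N ⌈Real.exp (y+l)⌉₊) hz hl hh ((Nat.le_ceil _).trans (by exact_mod_cast le_max_right _ _))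
  exact (SS_monoN hl (rho_nn z) (le_max_left _ _)).trans this

section tup
variable {ι : Type} [Fintype ι] [DecidableEq ι]

lemma tup_le_SS (Q : ι → Finset ℕ) {z l y : ℝ} (hl : 0 < l) (hQ : ∀ i, ∀ p ∈ Q i, p.Prime ∧ z ≤ p) :
    ∃ N, ∑ a ∈ Fintype.piFinset Q, (∏ i, 1/((a i:ℕ):ℝ)) * Wk l (∑ i, Real.log (a i) - y) ≤ ((Fintype.card ι : ℝ)^(Fintype.card ι)) * SS N l y (rho z) := by
  set N := (Fintype.piFinset Q).sup (fun a => ∏ i, a i) with hN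
  refine ⟨N, ?_⟩
  have hmem : ∀ a ∈ Fintype.piFinset Q, (∏ i, a i) ∈ Icc 1 N := by
    intro a ha
    rw [mem_Icc]
    refine ⟨?_, Finset.le_sup (f := fun a : ι → ℕ => ∏ i, a i) ha⟩
    rw [Fintype.mem_piFinset] at ha
    exact Nat.one_le_iff_ne_zero.mpr (Finset.prod_ne_zero_iff.mpr fun i _ => (hQ i _ (ha i)).1.ne_zero)
  rw [← Finset.sum_fiberwise_of_maps_to hmem]
  unfold SS
  rw [Finset.mul_sum]
  refine Finset.sum_le_sum fun n hn => ?_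
  have h1 : ∀ a ∈ (Fintype.piFinset Q).filter (fun a => ∏ i, a i = n), (∏ i, 1/((a i:ℕ):ℝ)) * Wk l (∑ i, Real.log (a i) - y) = rho z n * (1/(n:ℝ) * Wk l (Real.log n - y)) := by
    intro a ha
    rw [Finset.mem_filter, Fintype.mem_piFinset] at ha
    have hr : rho z n = 1 := by
      apply rho_one
      intro p hp hd
      rw [← ha.2] at hd
      obtain ⟨i, _, hi⟩ := (hp.prime.dvd_finset_prod_iff _).mp hd
      rw [(Nat.prime_dvd_prime_iff_eq hp (hQ i _ (ha.1 i)).1).mp hi]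
      exact (hQ i _ (ha.1 i)).2
    rw [hr, one_mul, ← ha.2]
    push_cast
    rw [Real.log_prod (fun i _ => by exact_mod_cast (hQ i _ (ha.1 i)).1.ne_zero)]
    simp [Finset.prod_inv_distrib]
  rw [Finset.sum_congr rfl h1, Finset.sum_const, nsmul_eq_mul]
  refine mul_le_mul_of_nonneg_right ?_ (mul_nonneg (rho_nn _ _) (mul_nonneg (by positivity) (Wk_nonneg hl _)))
  exact_mod_cast tup_count Q (fun i p hp => (hQ i p hp).1) n

lemma mv_eq (Q : ι → Finset ℕ) {l : ℝ} (hl : 0 < l) :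
    ∫ x, kh (l*x) * ‖∏ i, PS (Q i) x‖^2 = ∑ b ∈ Fintype.piFinset Q, (∏ i, 1/((b i:ℕ):ℝ)) * ∑ a ∈ Fintype.piFinset Q, (∏ i, 1/((a i:ℕ):ℝ)) * Wk l (∑ i, Real.log (a i) - ∑ i, Real.log (b i)) := by
  have hi : ∀ v : ℝ, Integrable (fun x : ℝ => (kh (l*x) : ℂ) * ee (2*Real.pi*v*x)) := by
    intro v
    refine (khl_integrable hl).mono' ?_ (Filter.Eventually.of_forall fun x => ?_)
    · have := ee_cont
      have := kh_cont
      apply Continuous.aestronglyMeasurable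
      fun_prop
    · rw [norm_mul, norm_ee, mul_one, Complex.norm_real, Real.norm_of_nonneg (kh_nonneg _)]
  have e : ∀ x : ℝ, ((kh (l*x) * ‖∏ i, PS (Q i) x‖^2 : ℝ) : ℂ) = ∑ b ∈ Fintype.piFinset Q, ∑ a ∈ Fintype.piFinset Q, (((∏ i, 1/((b i:ℕ):ℝ)) * (∏ i, 1/((a i:ℕ):ℝ)) : ℝ):ℂ) * ((kh (l*x) : ℂ) * ee (2*Real.pi*(∑ i, Real.log (a i) - ∑ i, Real.log (b i))*x)) := by
    intro x
    push_cast
    rw [← Complex.conj_mul', prod_PS, map_sum, Finset.sum_mul_sum, Finset.mul_sum]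
    refine Finset.sum_congr rfl fun b _ => ?_
    rw [Finset.mul_sum]
    refine Finset.sum_congr rfl fun a _ => ?_
    rw [map_mul, Complex.conj_ofReal, conj_ee, show 2*Real.pi*(∑ i, Real.log (a i) - ∑ i, Real.log (b i))*x = 2*Real.pi*x*(∑ i, Real.log (a i)) + -(2*Real.pi*x*∑ i, Real.log (b i)) by ring, ee_add]
    push_cast; ring
  apply Complex.ofReal_injective
  refine (integral_ofReal (𝕜 := ℂ) (f := fun x => kh (l*x) * ‖∏ i, PS (Q i) x‖^2)).symm.trans ?_
  refine (integral_congr_ae (μ := volume) (Filter.Eventually.of_forall e)).trans ?_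
  rw [integral_finset_sum]
  · push_cast
    refine Finset.sum_congr rfl fun b _ => ?_
    rw [integral_finset_sum, Finset.mul_sum]
    · refine Finset.sum_congr rfl fun a _ => ?_
      rw [integral_const_mul, ← Wk_inv hl]
      push_cast; ring
    · intro a _; exact (hi _).const_mul _
  · intro b _
    exact integrable_finset_sum _ fun a _ => (hi _).const_mul _

lemma mv_le : ∃ c0 : ℕ, ∀ {ι : Type} [Fintype ι] [DecidableEq ι] (Q : ι → Finset ℕ) {z l Y M : ℝ} (_ : 2 ≤ z) (_ : 0 < l) (_ : ∀ i, ∀ p ∈ Q i, p.Prime ∧ z ≤ p)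
    (_ : ∀ a ∈ Fintype.piFinset Q, Y ≤ ∑ i, Real.log (a i)) (_ : 16 * Real.exp (4*l) * z^c0 ≤ l * Real.exp Y) (_ : ∏ i, ∑ p ∈ Q i, 1/(p:ℝ) ≤ M),
    ∫ x, kh (l*x) * ‖∏ i, PS (Q i) x‖^2 ≤ M * (((Fintype.card ι : ℝ)^(Fintype.card ι)) * (3 / Real.log z)) := by
  obtain ⟨c0, hc⟩ := US'
  refine ⟨c0, ?_⟩
  intro ι _ _ Q z l Y M hz hl hQ hY h16 hM
  rw [mv_eq Q hl]
  have hlz : 0 < Real.log z := Real.log_pos (by linarith)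
  calc _ ≤ ∑ b ∈ Fintype.piFinset Q, (∏ i, 1/((b i:ℕ):ℝ)) * (((Fintype.card ι : ℝ)^(Fintype.card ι)) * (3 / Real.log z)) := by
        refine Finset.sum_le_sum fun b hb => ?_
        refine mul_le_mul_of_nonneg_left ?_ (Finset.prod_nonneg fun i _ => by positivity)
        obtain ⟨N, hN⟩ := tup_le_SS Q (y := ∑ i, Real.log (b i)) hl hQ
        refine hN.trans ?_
        refine mul_le_mul_of_nonneg_left ?_ (by positivity)
        refine hc z l _ N hz hl (h16.trans ?_)
        have := hY b hb
        gcongr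
    _ = (∏ i, ∑ p ∈ Q i, 1/(p:ℝ)) * (((Fintype.card ι : ℝ)^(Fintype.card ι)) * (3 / Real.log z)) := by
        rw [← Finset.sum_mul, Finset.prod_univ_sum]
    _ ≤ _ := by gcongr
end tup

end

section
open Finset MeasureTheory Filter

section tup
variable {ι : Type} [Fintype ι] [DecidableEq ι]

lemma ev_small {C c : ℝ} (hc : 0 < c) : ∀ᶠ L : ℝ in atTop, C * Real.exp (-L) ≤ c / L := by
  have h := (Real.tendsto_pow_mul_exp_neg_atTop_nhds_zero 1).const_mul C
  rw [mul_zero] at h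
  filter_upwards [h.eventually (gt_mem_nhds hc), eventually_gt_atTop 0] with L h1 h2
  rw [le_div_iff₀ h2]
  simp only [pow_one] at h1
  nlinarith

set_option maxHeartbeats 2000000 in
theorem typeII (a b : ι → ℝ) (ha : ∀ i, 0 < a i) (hab : ∀ i, a i < b i) (i0 : ι) (A B : Finset ι)
    (hAB : Disjoint A B) (hi0A : i0 ∉ A) (hi0B : i0 ∉ B) (hun : univ = insert i0 (A ∪ B)) {e : ℝ} (he : 0 < e)
    (hA : 1/3 + e ≤ ∑ i ∈ A, a i) (hB : 1/3 + e ≤ ∑ i ∈ B, a i) {η : ℝ} (hη : 0 < η) :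
    ∃ ε0 > 0, ∀ ε, 0 < ε → ε ≤ ε0 → ∀ᶠ L : ℝ in atTop,
    |∑ p ∈ Fintype.piFinset (fun i => pr (Real.exp (a i * L)) (Real.exp (b i * L))), (∏ i, 1/((p i:ℕ):ℝ)) *
      (Wk (Real.exp (-L/3)) (∑ i, Real.log (p i) - L) - Wk (ε*L) (∑ i, Real.log (p i) - L))| ≤ η / L := by
  obtain ⟨c0, hmv⟩ := mv_le
  -- constants
  obtain ⟨s0, hs0, hs0a⟩ : ∃ s : ℝ, 0 < s ∧ ∀ i, s ≤ a i := by
    have hne : (univ : Finset ι).Nonempty := ⟨i0, mem_univ _⟩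
    obtain ⟨j, _, hj⟩ := Finset.exists_min_image univ a hne
    exact ⟨a j, ha j, fun i => hj i (mem_univ _)⟩
  set s := min s0 (e/(4*(c0+1))) with hs
  have hsp : 0 < s := lt_min hs0 (by positivity)
  have hsa : ∀ i, s ≤ a i := fun i => (min_le_left _ _).trans (hs0a i)
  have hsc : s * c0 ≤ e/4 := by
    have h1 : s ≤ e/(4*(c0+1)) := min_le_right _ _
    rw [le_div_iff₀ (by positivity)] at h1
    nlinarith
  set Mi : ι → ℝ := fun i => Real.log (b i / a i) + 2 with hMi
  have hMi1 : ∀ i, 1 ≤ Mi i := by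
    intro i
    have : 0 ≤ Real.log (b i / a i) := Real.log_nonneg (by rw [le_div_iff₀ (ha i)]; linarith [hab i])
    simp only [hMi]; linarith
  set M : ℝ := ∏ i, Mi i with hM
  have hMsub : ∀ S : Finset ι, ∏ i ∈ S, Mi i ≤ M := by
    intro S
    rw [hM, ← Finset.prod_mul_prod_compl S Mi]
    refine le_mul_of_one_le_right (Finset.prod_nonneg fun i _ => by linarith [hMi1 i]) ?_
    exact Finset.one_le_prod fun i _ => hMi1 i
  have hM1 : 1 ≤ M := by simpa using hMsub ∅
  set r : ℝ := (Fintype.card ι : ℝ) with hr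
  have hcard : 1 ≤ Fintype.card ι := Fintype.card_pos_iff.mpr ⟨i0⟩
  have hr1 : 1 ≤ r := by rw [hr]; exact_mod_cast hcard
  set Qc : ℝ := M * (r^(Fintype.card ι) * (3/s)) with hQc
  have hQcp : 0 < Qc := by positivity
  set δ := η/(8*Qc) with hδ
  have hδp : 0 < δ := by positivity
  obtain ⟨K, L1, hK, hL1, hPS⟩ := prime_sums (ha i0) (hab i0) hδp
  choose K' L2 hK' hL2 hPS' using fun i => prime_sums (ha i) (hab i) one_pos
  refine ⟨min (min 1 (e/16)) (η/(4*M^3*K^3)), by positivity, fun ε hε hεle => ?_⟩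
  have hε1 : ε ≤ 1 := hεle.trans ((min_le_left _ _).trans (min_le_left _ _))
  have hεe : ε ≤ e/16 := hεle.trans ((min_le_left _ _).trans (min_le_right _ _))
  have hεη : M^3*K^3*ε^2 ≤ η/4 := by
    have h1 : ε ≤ η/(4*M^3*K^3) := hεle.trans (min_le_right _ _)
    rw [le_div_iff₀ (by positivity)] at h1
    have h2 : 0 ≤ M^3*K^3 := by positivity
    have h3 : ε^2 ≤ ε := by nlinarith
    nlinarith [mul_le_mul_of_nonneg_left h3 h2]
  filter_upwards [eventually_ge_atTop 10, eventually_ge_atTop (10/e), eventually_ge_atTop (1/ε), eventually_ge_atTop (1/s),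
    eventually_ge_atTop L1, eventually_all.mpr (fun i => eventually_ge_atTop (L2 i)), ev_small (C := 8*Real.pi^2*M^3) (c := η/4) (by positivity)] with L hL10 hLe hLε hLs hLL1 hLL2 hsm
  have hL : 0 < L := by linarith
  rw [div_le_iff₀ he] at hLe
  rw [div_le_iff₀ hε] at hLε
  rw [div_le_iff₀ hsp] at hLs
  set Q : ι → Finset ℕ := fun i => pr (Real.exp (a i * L)) (Real.exp (b i * L)) with hQ
  set l1 := Real.exp (-L/3) with hl1
  set l0 := ε*L with hl0
  have hl1p : 0 < l1 := Real.exp_pos _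
  have hl11 : l1 ≤ 1 := Real.exp_le_one_iff.mpr (by linarith)
  have hl0p : 1 ≤ l0 := by rw [hl0]; linarith
  set z := Real.exp (s*L) with hz
  have hz2 : 2 ≤ z := by
    have := Real.add_one_le_exp (s*L)
    linarith
  have hlz : Real.log z = s*L := Real.log_exp _
  have hQz : ∀ i, ∀ p ∈ Q i, p.Prime ∧ z ≤ p := by
    intro i p hp
    rw [hQ, mem_pr] at hp
    refine ⟨hp.1, le_trans ?_ hp.2.1⟩
    rw [hz, Real.exp_le_exp]
    exact mul_le_mul_of_nonneg_right (hsa i) hL.le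
  have hQlog : ∀ i, ∀ p ∈ Q i, a i * L ≤ Real.log p := by
    intro i p hp
    rw [hQ, mem_pr] at hp
    rw [Real.le_log_iff_exp_le (by exact_mod_cast hp.1.pos)]
    exact hp.2.1
  have hQM : ∀ i, ∑ p ∈ Q i, 1/(p:ℝ) ≤ Mi i := by
    intro i
    have := (abs_le.mp (hPS' i L (hLL2 i)).1).2
    simp only [hMi]; linarith
  -- mean value for subset
  have hkey : ∀ S : Finset ι, 1/3 + e ≤ ∑ i ∈ S, a i → ∀ l, l = l1 ∨ l = l0 → ∫ x, kh (l*x) * ‖∏ i ∈ S, PS (Q i) x‖^2 ≤ Qc / L := by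
    intro S hS l hl
    have hlp : 0 < l := by rcases hl with h | h <;> rw [h] <;> linarith
    have := hmv (ι := S) (fun i => Q i) (z := z) (l := l) (Y := (1/3+e)*L) (M := M) hz2 hlp (fun i => hQz i) ?_ ?_ ?_
    · have e1 : ∀ x, ∏ i : S, PS (Q i) x = ∏ i ∈ S, PS (Q i) x := fun x => Finset.prod_coe_sort S (fun i => PS (Q i) x)
      simp only [e1] at this
      refine this.trans ?_
      rw [hlz, hQc]
      have hc : ((Fintype.card S : ℝ)^(Fintype.card S)) ≤ r^(Fintype.card ι) := by
        have h1 : Fintype.card S ≤ Fintype.card ι := by rw [Fintype.card_coe]; exact card_le_univ S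
        calc ((Fintype.card S : ℝ)^(Fintype.card S)) ≤ r^(Fintype.card S) := by
              gcongr
              rw [hr]; exact_mod_cast h1
          _ ≤ _ := pow_le_pow_right₀ hr1 h1
      have e2 : M * (r^(Fintype.card ι) * (3/s)) / L = M * (r^(Fintype.card ι) * (3/(s*L))) := by field_simp
      rw [e2]
      gcongr
    · intro p hp
      rw [Fintype.mem_piFinset] at hp
      calc (1/3+e)*L ≤ (∑ i ∈ S, a i) * L := by gcongr
        _ = ∑ i : S, a i * L := by rw [Finset.sum_mul, Finset.sum_coe_sort S (fun i => a i * L)]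
        _ ≤ _ := Finset.sum_le_sum fun i _ => hQlog i _ (hp i)
    · have h16 : (16:ℝ) ≤ Real.exp 3 := by
        have h2 : (2.7:ℝ) ≤ Real.exp 1 := by linarith [Real.exp_one_gt_d9]
        have h3 := pow_le_pow_left₀ (by norm_num) h2 3
        rw [← Real.exp_nat_mul] at h3
        norm_num at h3 ⊢; linarith
      have hzc : z^c0 ≤ Real.exp (e/4*L) := by
        rw [hz, ← Real.exp_nat_mul, Real.exp_le_exp]
        nlinarith
      rcases hl with h | h
      · rw [h]
        calc 16 * Real.exp (4*l1) * z^c0 ≤ Real.exp 3 * Real.exp 4 * Real.exp (e/4*L) := by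
              gcongr; linarith
          _ = Real.exp (7 + e/4*L) := by rw [← Real.exp_add, ← Real.exp_add]; congr 1; ring
          _ ≤ Real.exp (-L/3 + (1/3+e)*L) := by rw [Real.exp_le_exp]; nlinarith
          _ = _ := by rw [Real.exp_add]
      · rw [h]
        calc 16 * Real.exp (4*l0) * z^c0 ≤ Real.exp 3 * Real.exp (4*(e/16*L)) * Real.exp (e/4*L) := by
              have : l0 ≤ e/16*L := by rw [hl0]; gcongr
              gcongr
          _ = Real.exp (3 + e/2*L) := by rw [← Real.exp_add, ← Real.exp_add]; congr 1; ring
          _ ≤ 1 * Real.exp ((1/3+e)*L) := by rw [one_mul, Real.exp_le_exp]; nlinarith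
          _ ≤ _ := by gcongr
    · rw [Finset.prod_coe_sort S (fun i => ∑ p ∈ Q i, 1/(p:ℝ))]
      exact (Finset.prod_le_prod (fun i _ => Finset.sum_nonneg fun p _ => by positivity) fun i _ => hQM i).trans (hMsub S)
  have hbd : ∀ S : Finset ι, ∀ x, ‖∏ i ∈ S, PS (Q i) x‖ ≤ M := by
    intro S x
    rw [norm_prod]
    exact (Finset.prod_le_prod (fun i _ => norm_nonneg _) fun i _ => (PS_norm _ _).trans (hQM i)).trans (hMsub S)
  have hct : ∀ S : Finset ι, Continuous (fun x => ∏ i ∈ S, PS (Q i) x) := fun S => continuous_finset_prod _ fun i _ => PS_cont _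
  have hF := typeII_fourier Q (l0 := l0) (l1 := l1) (by linarith) hl1p L
  have hprod : ∀ x, ∏ i, PS (Q i) x = (∏ i ∈ A, PS (Q i) x) * (∏ i ∈ B, PS (Q i) x) * PS (Q i0) x := by
    intro x
    rw [hun, Finset.prod_insert (by simp [hi0A, hi0B]), Finset.prod_union hAB]; ring
  have hx1 : 0 < K/(2*Real.pi*L) := by positivity
  have hx2 : 0 < Real.exp (2*L)/(2*Real.pi) := by positivity
  have hmain := typeII_an (L := L) (FA := fun x => ∏ i ∈ A, PS (Q i) x) (FB := fun x => ∏ i ∈ B, PS (Q i) x) (FP := PS (Q i0)) hM1 (hct A) (hct B) (PS_cont _)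
    (hbd A) (hbd B) (fun x => by simpa using hbd {i0} x) hl1p (hl11.trans hl0p) hx1 hx2 hδp.le ?_
    (hkey A hA l1 (Or.inl rfl)) (hkey A hA l0 (Or.inr rfl)) (hkey B hB l1 (Or.inl rfl)) (hkey B hB l0 (Or.inr rfl))
  · have e1 : |∑ p ∈ Fintype.piFinset Q, (∏ i, 1/((p i:ℕ):ℝ)) * (Wk l1 (∑ i, Real.log (p i) - L) - Wk l0 (∑ i, Real.log (p i) - L))| =
        ‖∫ x, (((kh (l1*x) - kh (l0*x) : ℝ):ℂ)) * ((∏ i ∈ A, PS (Q i) x) * (∏ i ∈ B, PS (Q i) x) * PS (Q i0) x) * ee (-(2*Real.pi*L*x))‖ := by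
      rw [← Real.norm_eq_abs, ← Complex.norm_real, hF]
      congr 2; ext x; rw [hprod]
    rw [e1]
    refine hmain.trans ?_
    have b1 : 40*Real.pi*M^3*(l0*(K/(2*Real.pi*L)))^2*(K/(2*Real.pi*L)) ≤ η/2/L := by
      have : 40*Real.pi*M^3*(l0*(K/(2*Real.pi*L)))^2*(K/(2*Real.pi*L)) = (5/Real.pi^2) * (M^3*K^3*ε^2)/L := by
        rw [hl0]; field_simp; ring
      rw [this]
      have hpi : 5/Real.pi^2 ≤ 1 := by rw [div_le_one (by positivity)]; nlinarith [Real.pi_gt_three]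
      have : (5/Real.pi^2) * (M^3*K^3*ε^2) ≤ 1 * (η/4) := by gcongr
      gcongr
      linarith
    have b2 : 2*δ*(Qc/L) = η/4/L := by rw [hδ]; field_simp; ring
    have b3 : 4*Real.pi*M^3/(l1^2*(Real.exp (2*L)/(2*Real.pi))) ≤ η/4/L := by
      refine le_trans ?_ hsm
      have : l1^2 = Real.exp (-(2*L/3)) := by rw [hl1, ← Real.exp_nat_mul]; congr 1; push_cast; ring
      rw [this]
      have : 4*Real.pi*M^3/(Real.exp (-(2*L/3))*(Real.exp (2*L)/(2*Real.pi))) = 8*Real.pi^2*M^3 * (Real.exp (-(2*L/3)) * Real.exp (2*L))⁻¹ := by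
        field_simp; ring
      rw [this, ← Real.exp_add, ← Real.exp_neg]
      gcongr
      linarith
    rw [b2]
    have : η/L = η/2/L + η/4/L + η/4/L := by ring
    linarith
  · intro x hxa hxb
    have := (hPS L hLL1).2 (-(2*Real.pi*x)) ?_ ?_
    · unfold PS
      simpa using this
    · rw [abs_neg, abs_mul, abs_of_pos (by positivity : 0 < 2*Real.pi)]
      rw [div_le_iff₀ (by positivity)] at hxa ⊢
      nlinarith
    · rw [abs_neg, abs_mul, abs_of_pos (by positivity : 0 < 2*Real.pi)]
      rw [le_div_iff₀ (by positivity)] at hxb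
      linarith
end tup

end

section
open Finset Filter

lemma rho_mul (z : ℝ) (m e : ℕ) : rho z (m*e) = rho z m * rho z e := by
  unfold rho
  rw [← Finset.prod_mul_distrib]
  refine Finset.prod_congr rfl fun p hp => ?_
  rw [mem_pr] at hp
  unfold dv
  by_cases h1 : p ∣ m <;> by_cases h2 : p ∣ e <;> simp [hp.1.dvd_mul, h1, h2]

noncomputable def gmu (L : ℝ) (n : ℕ) : ℝ := ∑ m ∈ n.divisors.filter (fun m : ℕ => Real.log m < L/2), (ArithmeticFunction.moebius m : ℝ)
noncomputable def GG (L z : ℝ) (n : ℕ) : ℝ := rho z n * gmu L n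

/-- squarefree rough sum bound -/
lemma sum_rough_le (z X : ℝ) (M : ℕ) (hM : ∀ m ∈ Icc 1 M, (m:ℝ) < X) :
    ∑ m ∈ Icc 1 M, |(ArithmeticFunction.moebius m : ℝ)| * rho z m / m ≤ Real.exp (∑ p ∈ pr z X, 1/(p:ℝ)) := by
  have h1 : ∀ m ∈ Icc 1 M, |(ArithmeticFunction.moebius m : ℝ)| * rho z m / m ≤ if (Squarefree m ∧ m.primeFactors ⊆ pr z X) then 1/(m:ℝ) else 0 := by
    intro m hm
    have hm1 := (mem_Icc.mp hm).1
    split_ifs with h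
    · have h2 : |(ArithmeticFunction.moebius m : ℝ)| ≤ 1 := by exact_mod_cast ArithmeticFunction.abs_moebius_le_one
      have h3 := rho_le z m
      have h4 := rho_nn z m
      gcongr
      calc _ ≤ (1:ℝ) * 1 := by gcongr
        _ = 1 := one_mul _
    · rw [not_and_or] at h
      rcases h with h | h
      · rw [ArithmeticFunction.moebius_eq_zero_of_not_squarefree h]; simp
      · rw [Finset.not_subset] at h
        obtain ⟨p, hp, hp2⟩ := h
        rw [Nat.mem_primeFactors] at hp
        rw [mem_pr] at hp2
        have hlt : (p:ℝ) < X := lt_of_le_of_lt (by exact_mod_cast Nat.le_of_dvd hm1 hp.2.1) (hM m hm)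
        have : (p:ℝ) < z := by
          by_contra hc
          exact hp2 ⟨hp.1, not_lt.mp hc, hlt⟩
        rw [rho_zero hp.1 hp.2.1 this]; simp
  refine (Finset.sum_le_sum h1).trans ?_
  rw [← Finset.sum_filter]
  calc _ ≤ ∑ t ∈ (pr z X).powerset, ∏ p ∈ t, 1/(p:ℝ) := by
        have hinj : Set.InjOn Nat.primeFactors (((Icc 1 M).filter (fun m => Squarefree m ∧ m.primeFactors ⊆ pr z X) : Finset ℕ) : Set ℕ) := by
          intro a ha b hb hab
          rw [mem_coe, Finset.mem_filter] at ha hb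
          rw [← Nat.prod_primeFactors_of_squarefree ha.2.1, ← Nat.prod_primeFactors_of_squarefree hb.2.1, hab]
        have : ∑ m ∈ (Icc 1 M).filter (fun m => Squarefree m ∧ m.primeFactors ⊆ pr z X), 1/(m:ℝ) = ∑ t ∈ ((Icc 1 M).filter (fun m => Squarefree m ∧ m.primeFactors ⊆ pr z X)).image Nat.primeFactors, ∏ p ∈ t, 1/(p:ℝ) := by
          rw [Finset.sum_image hinj]
          refine Finset.sum_congr rfl fun m hm => ?_
          rw [Finset.mem_filter] at hm
          conv_lhs => rw [← Nat.prod_primeFactors_of_squarefree hm.2.1]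
          push_cast
          simp [Finset.prod_inv_distrib]
        rw [this]
        refine Finset.sum_le_sum_of_subset_of_nonneg ?_ fun t _ _ => Finset.prod_nonneg fun p _ => by positivity
        intro t ht
        rw [Finset.mem_image] at ht
        obtain ⟨m, hm, rfl⟩ := ht
        rw [Finset.mem_filter] at hm
        exact mem_powerset.mpr hm.2.2
    _ = ∏ p ∈ pr z X, (1 + 1/(p:ℝ)) := (Finset.prod_one_add _).symm
    _ ≤ ∏ p ∈ pr z X, Real.exp (1/(p:ℝ)) := by
        refine Finset.prod_le_prod (fun p _ => by positivity) fun p _ => ?_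
        linarith [Real.add_one_le_exp (1/(p:ℝ))]
    _ = _ := (Real.exp_sum _ _).symm

/-- expand the sum of GG over divisors -/
lemma SS_GG {N : ℕ} {l L z y : ℝ} (M : ℕ) (hM : ∀ m : ℕ, 1 ≤ m → (Real.log m < L/2 ↔ m ≤ M)) :
    SS N l y (GG L z) = ∑ m ∈ Icc 1 M, (ArithmeticFunction.moebius m : ℝ) * rho z m / m * SS (N/m) l (y - Real.log m) (rho z) := by
  have h1 : ∀ n ∈ Icc 1 N, GG L z n = ∑ m ∈ Icc 1 M, (ArithmeticFunction.moebius m : ℝ) * ((if m ∣ n then 1 else 0) * rho z n) := by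
    intro n hn
    have hn1 := (mem_Icc.mp hn).1
    unfold GG gmu
    have : n.divisors.filter (fun m : ℕ => Real.log m < L/2) = (Icc 1 M).filter (fun m => m ∣ n) := by
      ext m
      simp only [Finset.mem_filter, Nat.mem_divisors, mem_Icc]
      constructor
      · rintro ⟨⟨h1, h2⟩, h3⟩
        have hm1 : 1 ≤ m := Nat.pos_of_dvd_of_pos h1 hn1
        exact ⟨⟨hm1, (hM m hm1).mp h3⟩, h1⟩
      · rintro ⟨⟨h1, h2⟩, h3⟩
        exact ⟨⟨h3, by omega⟩, (hM m h1).mpr h2⟩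
    rw [this, Finset.sum_filter, Finset.mul_sum]
    refine Finset.sum_congr rfl fun m _ => ?_
    split_ifs <;> ring
  unfold SS
  rw [Finset.sum_congr rfl (fun n hn => by rw [h1 n hn, Finset.sum_mul])]
  rw [Finset.sum_comm]
  refine Finset.sum_congr rfl fun m hm => ?_
  have hm1 := (mem_Icc.mp hm).1
  have h2 := SS_dvd (N := N) (l := l) (y := y) hm1 (rho z)
  calc _ = (ArithmeticFunction.moebius m : ℝ) * ∑ n ∈ Icc 1 N, (if m ∣ n then 1 else 0) * (rho z n * (1/(n:ℝ) * Wk l (Real.log n - y))) := by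
        rw [Finset.mul_sum]
        refine Finset.sum_congr rfl fun n _ => ?_
        ring
    _ = _ := by
        rw [h2]
        have : SS (N/m) l (y - Real.log m) (fun e => rho z (m*e)) = rho z m * SS (N/m) l (y - Real.log m) (rho z) := by
          rw [← SS_smul]; congr 1; ext e; exact rho_mul z m e
        rw [this]; unfold SS; ring

lemma exists_b (b0 : ℕ) : ∃ b ≥ b0, 2 * (56*((b:ℝ)+2))^2 * (1/2)^b ≤ 1/200 := by
  have h1 := tendsto_pow_const_mul_const_pow_of_lt_one 2 (r := (1/2:ℝ)) (by norm_num) (by norm_num)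
  have h2 := h1.eventually (gt_mem_nhds (show (0:ℝ) < 1/200/(2*56^2*9) by norm_num))
  obtain ⟨b, hb⟩ := (h2.and (eventually_ge_atTop (max b0 1))).exists
  refine ⟨b, (le_max_left _ _).trans hb.2, ?_⟩
  have hb1 : (1:ℝ) ≤ b := by exact_mod_cast (le_max_right _ _).trans hb.2
  have h3 : ((b:ℝ)+2)^2 ≤ 9 * (b:ℝ)^2 := by nlinarith
  have h4 : (0:ℝ) ≤ (1/2)^b := by positivity
  have h5 := hb.1
  have : 2 * (56*((b:ℝ)+2))^2 * (1/2)^b ≤ 2 * 56^2*9 * ((b:ℝ)^2 * (1/2)^b) := by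
    rw [mul_pow]; nlinarith [mul_le_mul_of_nonneg_right h3 h4]
  rw [lt_div_iff₀ (by norm_num)] at h5
  linarith

set_option maxHeartbeats 1000000 in
theorem typeI : ∃ R : ℕ, 56 ≤ R ∧ ∀ ε : ℝ, 0 < ε → ε ≤ 1/1000 → ∀ᶠ L : ℝ in atTop, ∀ N : ℕ, Real.exp (2*L) ≤ N →
    |SS N (Real.exp (-L/3)) L (GG L (Real.exp (L/R))) - SS N (ε*L) L (GG L (Real.exp (L/R)))| ≤ (1/100) / L := by
  obtain ⟨b0, hFL⟩ := FL
  obtain ⟨b, hb0, hb⟩ := exists_b b0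
  refine ⟨56*(b+2), by omega, fun ε hε hε1 => ?_⟩
  set R : ℝ := ((56*(b+2) : ℕ):ℝ) with hR
  have hRe : R = 56*((b:ℝ)+2) := by rw [hR]; push_cast; ring
  have hR112 : 112 ≤ R := by rw [hRe]; have : (0:ℝ) ≤ b := by positivity
                             linarith
  have hR0 : 0 < R := by linarith
  obtain ⟨_, L1, _, hL1, hps⟩ := prime_sums (a := 1/R) (b := 1/2) (δ := 1/10) (by positivity) (by rw [div_lt_div_iff₀ hR0 (by norm_num)]; linarith) (by norm_num)
  filter_upwards [eventually_ge_atTop 1000, eventually_ge_atTop (1/ε), eventually_ge_atTop L1, eventually_ge_atTop R,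
    (tendsto_id.atTop_div_const (show (0:ℝ) < 84 by norm_num)).eventually (ev_small (C := 4*R) (c := 1/(200*84)) (by norm_num))] with L hL hLε hLL1 hLR hsm N hN
  have hL0 : 0 < L := by linarith
  rw [div_le_iff₀ hε] at hLε
  set z := Real.exp (L/R) with hz
  have hz1 : 1 < z := Real.one_lt_exp_iff.mpr (by positivity)
  obtain ⟨U, E, MU, ME, hU, hE, hrho, hMU0, hME0, hMU, hME⟩ := hFL b hb0 z hz1.le
  have hVz := Vz_le hz1
  rw [hz, Real.log_exp, ← hz] at hVz
  have hME' : ME ≤ (1/2)^b * (R/L) := by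
    refine hME.trans ?_
    have : (1:ℝ)/(L/R) = R/L := by field_simp
    rw [this] at hVz
    gcongr
  -- power bounds
  have hzp : ∀ k : ℕ, k ≤ 4*b+6 → z^k ≤ Real.exp (L/14) := by
    intro k hk
    rw [hz, ← Real.exp_nat_mul, Real.exp_le_exp]
    have hk' : (k:ℝ) ≤ 4*b+6 := by exact_mod_cast hk
    rw [← mul_div_assoc, div_le_div_iff₀ hR0 (by norm_num), hRe]
    nlinarith
  have hexp2 : (16:ℝ) ≤ Real.exp 3 := by
    have h2 : (2.7:ℝ) ≤ Real.exp 1 := by linarith [Real.exp_one_gt_d9]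
    have h3 := pow_le_pow_left₀ (by norm_num) h2 3
    rw [← Real.exp_nat_mul] at h3
    norm_num at h3 ⊢; linarith
  -- inner estimate
  have inner : ∀ l y : ℝ, ∀ N' : ℕ, (l = Real.exp (-L/3) ∨ l = ε*L) → L/2 ≤ y → Real.exp (y+l) ≤ N' →
      |SS N' l y (rho z) - MU| ≤ ME + 2 * Real.exp (-(L/84)) := by
    intro l y N' hl hy hN'
    have hlp : 0 < l := by rcases hl with h | h <;> rw [h] <;> positivity
    have hl16 : 16 * Real.exp (4*l) ≤ Real.exp (L/84) * (l * Real.exp (L/3)) := by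
      rcases hl with h | h
      · have h1 : l * Real.exp (L/3) = 1 := by rw [h, ← Real.exp_add]; simp; ring
        rw [h1, mul_one]
        have h2 : l ≤ 1 := by rw [h]; exact Real.exp_le_one_iff.mpr (by linarith)
        calc 16 * Real.exp (4*l) ≤ Real.exp 3 * Real.exp 4 := by gcongr; linarith
          _ = Real.exp 7 := by rw [← Real.exp_add]; norm_num
          _ ≤ _ := by rw [Real.exp_le_exp]; linarith
      · have h1 : 1 ≤ l := by rw [h]; linarith
        have h2 : l ≤ L/1000 := by rw [h]; nlinarith
        calc 16 * Real.exp (4*l) ≤ Real.exp 3 * Real.exp (L/250) := by gcongr; linarith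
          _ = Real.exp (3+L/250) := by rw [← Real.exp_add]
          _ ≤ Real.exp (L/84 + L/3) := by rw [Real.exp_le_exp]; linarith
          _ = Real.exp (L/84) * (1 * Real.exp (L/3)) := by rw [Real.exp_add]; ring
          _ ≤ _ := by gcongr
    have hey : Real.exp (L/3) * (Real.exp (L/84) * Real.exp (L/14) * Real.exp (L/84)) ≤ Real.exp y := by
      rw [← Real.exp_add, ← Real.exp_add, ← Real.exp_add, Real.exp_le_exp]; linarith
    have hgen : ∀ k : ℕ, k ≤ 4*b+6 → 16 * Real.exp (4*l) * z^k ≤ l * Real.exp y ∧ z^k * (16 * Real.exp (4*l) / (l * Real.exp y)) ≤ Real.exp (-(L/84)) := by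
      intro k hk
      have h1 := hzp k hk
      have h2 : 16 * Real.exp (4*l) * z^k * Real.exp (L/84) ≤ l * Real.exp y := by
        calc 16 * Real.exp (4*l) * z^k * Real.exp (L/84) ≤ (Real.exp (L/84) * (l * Real.exp (L/3))) * Real.exp (L/14) * Real.exp (L/84) := by gcongr
          _ = l * (Real.exp (L/3) * (Real.exp (L/84) * Real.exp (L/14) * Real.exp (L/84))) := by ring
          _ ≤ _ := by gcongr
      have h3 : 1 ≤ Real.exp (L/84) := Real.one_le_exp (by positivity)
      have h4 : 0 ≤ 16 * Real.exp (4*l) * z^k := by positivity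
      refine ⟨by nlinarith, ?_⟩
      rw [Real.exp_neg, ← mul_div_assoc, div_le_iff₀ (by positivity), le_inv_mul_iff₀ (by positivity)]
      linarith
    obtain ⟨g1, g2⟩ := hgen (4*b+4) (by omega)
    obtain ⟨g3, g4⟩ := hgen (4*b+6) le_rfl
    have rU := riem_srep hU hlp g1 hN'
    have rE := riem_srep hE hlp g3 hN'
    have u1 : SS N' l y (rho z) ≤ SS N' l y U := SS_mono hlp fun n _ _ => (hrho n).2.1
    have u2 : SS N' l y U - SS N' l y (rho z) ≤ SS N' l y E := by
      rw [← SS_sub]; exact SS_mono hlp fun n _ _ => (hrho n).2.2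
    have a1 := abs_le.mp (rU.trans g2)
    have a2 := abs_le.mp (rE.trans g4)
    rw [abs_le]; constructor <;> linarith [Real.exp_pos (-(L/84))]
  -- M
  obtain ⟨M, hM⟩ : ∃ M : ℕ, ∀ m : ℕ, 1 ≤ m → (Real.log m < L/2 ↔ m ≤ M) := by
    refine ⟨⌈Real.exp (L/2)⌉₊ - 1, fun m hm => ?_⟩
    have hmp : (0:ℝ) < m := by exact_mod_cast hm
    rw [Real.log_lt_iff_lt_exp hmp, ← Nat.lt_ceil]
    omega
  rw [SS_GG M hM, SS_GG M hM, ← Finset.sum_sub_distrib]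
  refine (Finset.abs_sum_le_sum_abs _ _).trans ?_
  have hterm : ∀ m ∈ Icc 1 M, |(ArithmeticFunction.moebius m : ℝ) * rho z m / m * SS (N/m) (Real.exp (-L/3)) (L - Real.log m) (rho z) - (ArithmeticFunction.moebius m : ℝ) * rho z m / m * SS (N/m) (ε*L) (L - Real.log m) (rho z)| ≤ (|(ArithmeticFunction.moebius m : ℝ)| * rho z m / m) * (2*ME + 4*Real.exp (-(L/84))) := by
    intro m hm
    rw [mem_Icc] at hm
    have hmp : (0:ℝ) < m := by exact_mod_cast hm.1
    have hlog := (hM m hm.1).mpr hm.2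
    have hNm : ∀ l, 0 < l → l ≤ L/2 → Real.exp (L - Real.log m + l) ≤ ((N/m : ℕ):ℝ) := by
      intro l hl0 hl
      have h1 : (N:ℝ)/m < ((N/m:ℕ):ℝ) + 1 := by
        rw [div_lt_iff₀ hmp]
        have := Nat.lt_div_mul_add (a := N) (b := m) hm.1
        have : N < (N/m+1)*m := by linarith
        exact_mod_cast this
      have h2 : Real.exp (2*L) / m ≤ (N:ℝ)/m := by gcongr
      have h3 : Real.exp (2*L) / m = Real.exp (2*L - Real.log m) := by rw [Real.exp_sub, Real.exp_log hmp]
      have h4 : Real.exp (L - Real.log m + l) + 1 ≤ Real.exp (2*L - Real.log m) := by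
        have h5 : Real.exp (2*L - Real.log m) = Real.exp (L - Real.log m + l) * Real.exp (L - l) := by rw [← Real.exp_add]; congr 1; ring
        have h6 := Real.add_one_le_exp (L - l)
        have h7 : 1 ≤ Real.exp (L - Real.log m + l) := Real.one_le_exp (by linarith)
        rw [h5]
        nlinarith
      linarith
    have i1 := inner (Real.exp (-L/3)) (L - Real.log m) (N/m) (Or.inl rfl) (by linarith) (hNm _ (Real.exp_pos _) (by
      have : Real.exp (-L/3) ≤ 1 := Real.exp_le_one_iff.mpr (by linarith)
      linarith))
    have i0 := inner (ε*L) (L - Real.log m) (N/m) (Or.inr rfl) (by linarith) (hNm _ (by positivity) (by nlinarith))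
    rw [← mul_sub, abs_mul, abs_div, abs_mul, abs_of_nonneg (rho_nn z m), abs_of_pos hmp]
    refine mul_le_mul_of_nonneg_left ?_ (by have := rho_nn z m; positivity)
    rw [abs_le] at i1 i0 ⊢
    constructor <;> linarith [i1.1, i1.2, i0.1, i0.2]
  refine (Finset.sum_le_sum hterm).trans ?_
  rw [← Finset.sum_mul]
  have hsum := sum_rough_le z (Real.exp (1/2*L)) M (fun m hm => by
    rw [mem_Icc] at hm
    have hmp : (0:ℝ) < m := by exact_mod_cast hm.1
    rw [← Real.log_lt_iff_lt_exp hmp]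
    linarith [(hM m hm.1).mpr hm.2])
  have hps' := (abs_le.mp (hps L hLL1).1).2
  rw [show (1/R)*L = L/R by ring, ← hz] at hps'
  have hexp : Real.exp (∑ p ∈ pr z (Real.exp (1/2*L)), 1/(p:ℝ)) ≤ R := by
    calc _ ≤ Real.exp (Real.log ((1/2)/(1/R)) + 1/10) := by rw [Real.exp_le_exp]; linarith
      _ = R/2 * Real.exp (1/10) := by
          rw [Real.exp_add, Real.exp_log (by positivity)]; congr 1; field_simp
      _ ≤ R/2 * 2 := by
          gcongr
          have : Real.exp (1/10) ≤ Real.exp (Real.log 2) := by rw [Real.exp_le_exp]; linarith [Real.log_two_gt_d9]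
          rwa [Real.exp_log (by norm_num)] at this
      _ = R := by ring
  have h84 : 4*Real.exp (-(L/84)) * R ≤ (1/200)/L := by
    simp only [id] at hsm
    calc _ = 4*R*Real.exp (-(L/84)) := by ring
      _ ≤ _ := hsm
      _ = _ := by field_simp
  calc _ ≤ R * (2*ME + 4*Real.exp (-(L/84))) := by
        refine mul_le_mul_of_nonneg_right (hsum.trans hexp) (by positivity)
    _ ≤ R * (2*((1/2)^b * (R/L))) + (1/200)/L := by
        have : R*(2*ME) ≤ R * (2*((1/2)^b * (R/L))) := by gcongr
        linarith
    _ = (2 * (56*((b:ℝ)+2))^2 * (1/2)^b)/L + (1/200)/L := by rw [← hRe]; ring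
    _ ≤ (1/200)/L + (1/200)/L := by gcongr
    _ = _ := by ring

end

section
open Finset

noncomputable def GS {r : ℕ} (w : Fin r → ℝ) : ℝ := ∑ T ∈ (univ : Finset (Fin r)).powerset, if ∑ i ∈ T, w i < 1/2 then (-1:ℝ)^(#T) else 0

def Good {r : ℕ} (e : ℝ) (w : Fin r → ℝ) : Prop := ∃ (i0 : Fin r) (A B : Finset (Fin r)), Disjoint A B ∧ i0 ∉ A ∧ i0 ∉ B ∧ univ = insert i0 (A ∪ B) ∧
  1/3 + e ≤ ∑ i ∈ A, w i ∧ 1/3 + e ≤ ∑ i ∈ B, w i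

lemma GS_abs {r : ℕ} (w : Fin r → ℝ) : |GS w| ≤ 2^r := by
  unfold GS
  refine (Finset.abs_sum_le_sum_abs _ _).trans ?_
  calc _ ≤ ∑ T ∈ (univ : Finset (Fin r)).powerset, (1:ℝ) := by
        refine Finset.sum_le_sum fun T _ => ?_
        split_ifs <;> simp
    _ = _ := by simp

lemma GS_even {r : ℕ} (hr : 1 ≤ r) (he : Even r) (u : Fin r → ℝ) (h : ∀ T : Finset (Fin r), ∑ i ∈ T, u i < 1/2 ↔ ¬ ∑ i ∈ Tᶜ, u i < 1/2) : GS u = 0 := by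
  have h1 : GS u = ∑ T ∈ (univ : Finset (Fin r)).powerset, if ¬ ∑ i ∈ T, u i < 1/2 then (-1:ℝ)^(#T) else 0 := by
    unfold GS
    refine Finset.sum_nbij' (fun T => Tᶜ) (fun T => Tᶜ) (by simp) (by simp) (by simp) (by simp) ?_
    intro T _
    have hc : (-1:ℝ)^(#T) = (-1)^(#Tᶜ) := by
      rw [card_compl, Fintype.card_fin]
      have : #T ≤ r := by simpa using card_le_univ T
      obtain ⟨k, hk⟩ := Nat.exists_eq_add_of_le this
      have : r - #T = k := by omega
      rw [this]
      rcases Nat.even_or_odd (#T) with h2 | h2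
      · have : Even k := by rw [hk, Nat.even_add] at he; tauto
        rw [h2.neg_one_pow, this.neg_one_pow]
      · have : Odd k := by
          rw [hk, Nat.even_add] at he
          rw [← Nat.not_even_iff_odd] at h2 ⊢
          tauto
        rw [h2.neg_one_pow, this.neg_one_pow]
    rw [hc]
    by_cases h2 : ∑ i ∈ T, u i < 1/2
    · rw [if_pos h2, if_pos ((h T).mp h2)]
    · rw [if_neg h2, if_neg]
      intro h3; exact h2 ((h T).mpr h3)
  have h2 : GS u + GS u = ∑ T ∈ (univ : Finset (Fin r)).powerset, (-1:ℝ)^(#T) := by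
    nth_rw 2 [h1]
    unfold GS
    rw [← Finset.sum_add_distrib]
    refine Finset.sum_congr rfl fun T _ => ?_
    split_ifs <;> simp
  have h3 : ∑ T ∈ (univ : Finset (Fin r)).powerset, (-1:ℝ)^(#T) = 0 := by
    have := Finset.sum_powerset_neg_one_pow_card_of_nonempty (x := (univ : Finset (Fin r))) ⟨⟨0, hr⟩, mem_univ _⟩
    exact_mod_cast this
  linarith

lemma GS_big {r : ℕ} (hr : 2 ≤ r) (u : Fin r → ℝ) (i : Fin r) (h : ∀ T : Finset (Fin r), ∑ i ∈ T, u i < 1/2 ↔ i ∉ T) : GS u = 0 := by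
  unfold GS
  simp_rw [h]
  rw [← Finset.sum_filter]
  have : (univ : Finset (Fin r)).powerset.filter (fun T => i ∉ T) = (univ.erase i).powerset := by
    ext T
    simp only [Finset.mem_filter, mem_powerset, subset_univ, true_and, subset_erase]
  rw [this]
  have hne : (univ.erase i : Finset (Fin r)).Nonempty := by
    rw [← card_pos, card_erase_of_mem (mem_univ i)]; simp; omega
  have := Finset.sum_powerset_neg_one_pow_card_of_nonempty hne
  exact_mod_cast this

lemma GS_three (u : Fin 3 → ℝ) (h : ∀ T : Finset (Fin 3), ∑ i ∈ T, u i < 1/2 ↔ #T ≤ 1) : GS u = -2 := by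
  unfold GS
  simp_rw [h]
  have : ∑ T ∈ (univ : Finset (Fin 3)).powerset, (if #T ≤ 1 then (-1:ℤ)^(#T) else 0) = -2 := by decide
  exact_mod_cast congrArg (fun x : ℤ => (x:ℝ)) this

lemma GS_one (u : Fin 1 → ℝ) (h : ∀ T : Finset (Fin 1), ∑ i ∈ T, u i < 1/2 ↔ #T ≤ 0) : GS u = 1 := by
  unfold GS
  simp_rw [h]
  have : ∑ T ∈ (univ : Finset (Fin 1)).powerset, (if #T ≤ 0 then (-1:ℤ)^(#T) else 0) = 1 := by decide
  exact_mod_cast congrArg (fun x : ℤ => (x:ℝ)) this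

lemma comb5 {r : ℕ} (hr : 5 ≤ r) (u : Fin r → ℝ) (hu : ∀ i, 0 < u i) {ε : ℝ} (hε : 0 ≤ ε) (hε1 : ε ≤ 1/100) (hS : |∑ i, u i - 1| ≤ ε)
    (hh : ∀ i, u i < 1/2) : ∃ (i0 : Fin r) (A B : Finset (Fin r)), Disjoint A B ∧ i0 ∉ A ∧ i0 ∉ B ∧ univ = insert i0 (A ∪ B) ∧
      1/3 - ε ≤ ∑ i ∈ A, u i ∧ 1/3 - ε ≤ ∑ i ∈ B, u i := by
  rw [abs_le] at hS
  obtain ⟨i0, _, hmin⟩ := Finset.exists_min_image (univ : Finset (Fin r)) u ⟨⟨0, by omega⟩, mem_univ _⟩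
  set m := u i0 with hm
  set T := (univ : Finset (Fin r)).erase i0 with hT
  have hTc : 4 ≤ #T := by rw [hT, card_erase_of_mem (mem_univ _)]; simp; omega
  have hTs : ∑ i ∈ T, u i + m = ∑ i, u i := Finset.sum_erase_add _ _ (mem_univ i0)
  have hmT : ∀ i ∈ T, m ≤ u i := fun i _ => hmin i (mem_univ _)
  have hm0 : 0 < m := hu i0
  -- reduce to choosing A ⊆ T
  suffices h : ∃ A ⊆ T, 1/3 - ε ≤ ∑ i ∈ A, u i ∧ 1/3 - ε ≤ ∑ i ∈ T \ A, u i by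
    obtain ⟨A, hA, h1, h2⟩ := h
    refine ⟨i0, A, T \ A, disjoint_sdiff, fun h => ?_, fun h => ?_, ?_, h1, h2⟩
    · have := hA h; simp [hT] at this
    · have := (mem_sdiff.mp h).1; simp [hT] at this
    · rw [union_sdiff_of_subset hA, hT, insert_erase (mem_univ _)]
  have hcardsum : ∀ V ⊆ T, (#V : ℝ) * m ≤ ∑ i ∈ V, u i := by
    intro V hV
    have := Finset.card_nsmul_le_sum V u m (fun i hi => hmT i (hV hi))
    simpa using this
  by_cases h1 : ∃ a ∈ T, 1/3 ≤ u a
  · obtain ⟨a, ha, ha3⟩ := h1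
    refine ⟨{a}, by simpa using ha, by simp; linarith, ?_⟩
    have e1 : ∑ i ∈ T \ {a}, u i + u a = ∑ i ∈ T, u i := by
      rw [sdiff_singleton_eq_erase]; exact Finset.sum_erase_add _ _ ha
    have h3 := hcardsum (T \ {a}) sdiff_subset
    have h4 : (3:ℝ) ≤ #(T \ {a}) := by
      rw [sdiff_singleton_eq_erase, card_erase_of_mem ha]
      have : 3 ≤ #T - 1 := by omega
      exact_mod_cast this
    have := hh a
    nlinarith
  · push Not at h1
    by_cases h2 : ∃ a ∈ T, ∃ b ∈ T, a ≠ b ∧ 1/3 - m ≤ u a ∧ 1/3 - m ≤ u b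
    · obtain ⟨a, ha, b, hb, hab, ha1, hb1⟩ := h2
      have hc2 : 2 ≤ #((T.erase a).erase b) := by
        rw [card_erase_of_mem (mem_erase.mpr ⟨hab.symm, hb⟩), card_erase_of_mem ha]; omega
      obtain ⟨c, hc, d, hd, hcd⟩ := Finset.one_lt_card.mp hc2
      simp only [mem_erase] at hc hd
      refine ⟨{a, c}, ?_, ?_, ?_⟩
      · intro i hi; simp only [mem_insert, mem_singleton] at hi
        rcases hi with rfl | rfl
        · exact ha
        · exact hc.2.2
      · rw [Finset.sum_pair (Ne.symm hc.2.1)]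
        linarith [hmT c hc.2.2]
      · have hsub : ({b, d} : Finset (Fin r)) ⊆ T \ {a, c} := by
          intro i hi; simp only [mem_insert, mem_singleton] at hi
          rw [mem_sdiff]
          simp only [mem_insert, mem_singleton]
          rcases hi with rfl | rfl
          · exact ⟨hb, by push Not; exact ⟨hab.symm, Ne.symm hc.1⟩⟩
          · exact ⟨hd.2.2, by push Not; exact ⟨hd.2.1, Ne.symm hcd⟩⟩
        have := Finset.sum_le_sum_of_subset_of_nonneg hsub (fun i _ _ => (hu i).le) (f := u)
        rw [Finset.sum_pair (Ne.symm hd.1)] at this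
        linarith [hmT d hd.2.2]
    · push Not at h2
      have hTne : T.Nonempty := card_pos.mp (by omega)
      obtain ⟨a1, ha1, hmax⟩ := Finset.exists_max_image T u hTne
      set T' := T.erase a1 with hT'
      have hT's : ∑ i ∈ T', u i + u a1 = ∑ i ∈ T, u i := Finset.sum_erase_add _ _ ha1
      have hsm : ∀ i ∈ T', u i < 1/3 - m := by
        intro i hi
        rw [hT', mem_erase] at hi
        by_contra hc
        have := h2 a1 ha1 i hi.2 (Ne.symm hi.1) (by linarith [hmax i hi.2])
        linarith
      have ha13 := h1 a1 ha1
      have hm3 := h1 a1 ha1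
      have hT'sum : 1/3 - ε ≤ ∑ i ∈ T', u i := by linarith [hmT a1 ha1]
      have hne : (T'.powerset.filter (fun A => 1/3 - ε ≤ ∑ i ∈ A, u i)).Nonempty := ⟨T', by simp only [Finset.mem_filter, mem_powerset, Subset.refl, true_and]; exact hT'sum⟩
      obtain ⟨A, hA, hAmin⟩ := Finset.exists_min_image _ (fun A => #A) hne
      simp only [Finset.mem_filter, mem_powerset] at hA hAmin
      refine ⟨A, hA.1.trans (erase_subset _ _), hA.2, ?_⟩
      have hAne : A.Nonempty := by
        by_contra hc
        rw [not_nonempty_iff_eq_empty] at hc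
        rw [hc] at hA
        have := hA.2
        simp at this; linarith
      obtain ⟨j, hj⟩ := hAne
      have e1 : ∑ i ∈ A.erase j, u i + u j = ∑ i ∈ A, u i := Finset.sum_erase_add _ _ hj
      have h3 : ∑ i ∈ A.erase j, u i < 1/3 - ε := by
        by_contra hc
        have h4 := hAmin (A.erase j) ⟨(erase_subset _ _).trans hA.1, not_lt.mp hc⟩
        rw [card_erase_of_mem hj] at h4
        have := card_pos.mpr ⟨j, hj⟩
        omega
      have h5 := hsm j (hA.1 hj)
      have h6 := Finset.sum_sdiff (hA.1.trans (erase_subset _ _)) (f := u) (s₂ := T)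
      linarith

/-- main combinatorial dichotomy -/
lemma comb_main {r : ℕ} (u w : Fin r → ℝ) (hu : ∀ i, 0 < u i) {ε e : ℝ} (hε : 0 ≤ ε) (hε1 : ε ≤ 1/100) (hεe : ε < e) (he1 : e ≤ 1/10) (hS : |∑ i, u i - 1| ≤ ε)
    (h2 : ∀ T : Finset (Fin r), e < |∑ i ∈ T, u i - 1/2|) (h3 : ∀ T : Finset (Fin r), e < |∑ i ∈ T, u i - 1/3|)
    (hw : ∀ T : Finset (Fin r), ∑ i ∈ T, w i ≤ ∑ i ∈ T, u i ∧ ∑ i ∈ T, u i ≤ ∑ i ∈ T, w i + e/2) :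
    GS w = GS u ∧ (r = 1 → GS u = 1 ∧ ¬ Good (e/2) w) ∧ (r ≠ 0) ∧
    (2 ≤ r → GS u = 0 ∨ Good (e/2) w ∨ (r = 3 ∧ GS u = -2 ∧ ∃ i j k, i ≠ j ∧ i ≠ k ∧ j ≠ k ∧ univ = {i, j, k} ∧ u i < 1/3 ∧ u j < 1/3 ∧ 1/2 < u i + u j)) := by
  have hS' := abs_le.mp hS
  have hcompl : ∀ T : Finset (Fin r), ∑ i ∈ T, u i + ∑ i ∈ Tᶜ, u i = ∑ i, u i := fun T => Finset.sum_add_sum_compl T u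
  have hsmall : ∀ T : Finset (Fin r), ∑ i ∈ T, u i < 1/2 ↔ ¬ ∑ i ∈ Tᶜ, u i < 1/2 := by
    intro T
    have a := hcompl T
    have b := h2 T
    have c := h2 Tᶜ
    rw [lt_abs] at b c
    constructor
    · intro h h'
      rcases b with b | b <;> rcases c with c | c <;> linarith
    · intro h
      by_contra h'
      rcases b with b | b <;> rcases c with c | c <;> linarith
  refine ⟨?_, ?_, ?_, ?_⟩
  · unfold GS
    refine Finset.sum_congr rfl fun T _ => ?_
    have a := h2 T
    rw [lt_abs] at a
    obtain ⟨b, c⟩ := hw T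
    have : ∑ i ∈ T, w i < 1/2 ↔ ∑ i ∈ T, u i < 1/2 := by
      constructor <;> intro h <;> rcases a with a | a <;> linarith
    simp only [this]
  · intro h
    subst h
    constructor
    · apply GS_one
      intro T
      rcases T.eq_empty_or_nonempty with h | ⟨i, hi⟩
      · subst h; simp
      · have : T = univ := by
          ext j; simp only [mem_univ, iff_true]; rwa [Subsingleton.elim j i]
        rw [this]
        simp only [univ_unique, card_singleton]
        constructor
        · intro h; simp only [univ_unique] at hS'; linarith
        · intro h; omega
    · rintro ⟨i0, A, B, _, hA, _, _, hA1, _⟩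
      have : A = ∅ := by
        rw [eq_empty_iff_forall_notMem]
        intro j hj; rw [Subsingleton.elim j i0] at hj; exact hA hj
      rw [this] at hA1; simp at hA1; linarith
  · intro h; subst h; simp at hS'; linarith
  · intro hr
    by_cases hev : Even r
    · left; exact GS_even (by omega) hev u hsmall
    by_cases hbig : ∃ i, 1/2 ≤ u i
    · left
      obtain ⟨i, hi⟩ := hbig
      apply GS_big hr u i
      intro T
      constructor
      · intro h hT
        have := Finset.single_le_sum (fun j _ => (hu j).le) hT (f := u)
        linarith
      · intro hT
        rw [hsmall]
        have hT' : i ∈ Tᶜ := by simpa using hT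
        have := Finset.single_le_sum (fun j _ => (hu j).le) hT' (f := u)
        linarith
    · push Not at hbig
      right
      have upg : ∀ A : Finset (Fin r), 1/3 - ε ≤ ∑ i ∈ A, u i → 1/3 + e/2 ≤ ∑ i ∈ A, w i := by
        intro A hA
        have a := h3 A
        have b := (hw A).2
        rw [lt_abs] at a
        rcases a with a | a <;> linarith
      by_cases hr5 : 5 ≤ r
      · left
        obtain ⟨i0, A, B, g1, g2, g3, g4, g5, g6⟩ := comb5 hr5 u hu hε hε1 hS hbig
        exact ⟨i0, A, B, g1, g2, g3, g4, upg A g5, upg B g6⟩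
      · have hr3 : r = 3 := by
          rw [Nat.not_even_iff_odd] at hev
          obtain ⟨k, hk⟩ := hev
          omega
        subst hr3
        have hG : GS u = -2 := by
          apply GS_three
          intro T
          constructor
          · intro h
            by_contra hc
            rw [hsmall] at h
            have hcc : #Tᶜ ≤ 1 := by rw [card_compl, Fintype.card_fin]; omega
            rw [card_le_one_iff_subset_singleton] at hcc
            obtain ⟨i, hi⟩ := hcc
            have := Finset.sum_le_sum_of_subset_of_nonneg hi (fun i _ _ => (hu i).le) (f := u)
            simp only [sum_singleton] at this
            linarith [hbig i]
          · intro h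
            rw [card_le_one_iff_subset_singleton] at h
            obtain ⟨i, hi⟩ := h
            have := Finset.sum_le_sum_of_subset_of_nonneg hi (fun i _ _ => (hu i).le) (f := u)
            simp only [sum_singleton] at this
            linarith [hbig i]
        have hgood : ∀ i j k : Fin 3, i ≠ j → i ≠ k → j ≠ k → univ = ({i, j, k} : Finset (Fin 3)) → 1/3 - ε ≤ u j → 1/3 - ε ≤ u k → Good (e/2) w := by
          intro i j k hij hik hjk hun h1 h2
          refine ⟨i, {j}, {k}, by simpa using hjk, by simpa using hij, by simpa using hik, ?_, upg _ (by simpa using h1), upg _ (by simpa using h2)⟩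
          rw [hun]; rfl
        have hlow : ∀ i j k : Fin 3, i ≠ j → i ≠ k → j ≠ k → univ = ({i, j, k} : Finset (Fin 3)) → u i < 1/3 → u j < 1/3 → (3 = 3 ∧ GS u = -2 ∧ ∃ i j k : Fin 3, i ≠ j ∧ i ≠ k ∧ j ≠ k ∧ univ = {i, j, k} ∧ u i < 1/3 ∧ u j < 1/3 ∧ 1/2 < u i + u j) := by
          intro i j k hij hik hjk hun h1' h2'
          refine ⟨rfl, hG, i, j, k, hij, hik, hjk, hun, h1', h2', ?_⟩
          have a := h2 {k}
          have b := hbig k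
          have hs : ∑ l, u l = u i + (u j + u k) := by
            rw [hun, Finset.sum_insert (by simp [hij, hik]), Finset.sum_pair hjk]
          simp only [sum_singleton] at a
          rw [lt_abs] at a
          rcases a with a | a <;> linarith
        by_cases c0 : 1/3 - ε ≤ u 0 <;> by_cases c1 : 1/3 - ε ≤ u 1 <;> by_cases c2 : 1/3 - ε ≤ u 2
        · left; exact hgood 2 0 1 (by decide) (by decide) (by decide) (by decide) c0 c1
        · left; exact hgood 2 0 1 (by decide) (by decide) (by decide) (by decide) c0 c1
        · left; exact hgood 1 0 2 (by decide) (by decide) (by decide) (by decide) c0 c2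
        · right; exact hlow 1 2 0 (by decide) (by decide) (by decide) (by decide) (by linarith) (by linarith)
        · left; exact hgood 0 1 2 (by decide) (by decide) (by decide) (by decide) c1 c2
        · right; exact hlow 0 2 1 (by decide) (by decide) (by decide) (by decide) (by linarith) (by linarith)
        · right; exact hlow 0 1 2 (by decide) (by decide) (by decide) (by decide) (by linarith) (by linarith)
        · right; exact hlow 0 1 2 (by decide) (by decide) (by decide) (by decide) (by linarith) (by linarith)

end

section
open Finset

lemma gmu_GS {L : ℝ} (hL : 0 < L) {r : ℕ} (p : Fin r → ℕ) (hp : ∀ i, (p i).Prime) (hinj : Function.Injective p) :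
    gmu L (∏ i, p i) = GS (fun i => Real.log (p i) / L) := by
  have hn0 : (∏ i, p i) ≠ 0 := Finset.prod_ne_zero_iff.mpr fun i _ => (hp i).ne_zero
  have hdv : ∀ (T : Finset (Fin r)) (i : Fin r), p i ∣ ∏ j ∈ T, p j ↔ i ∈ T := by
    intro T i
    rw [Prime.dvd_finsetProd_iff (hp i).prime]
    constructor
    · rintro ⟨j, hj, h⟩
      have := (Nat.prime_dvd_prime_iff_eq (hp i) (hp j)).mp h
      rwa [hinj this]
    · intro h; exact ⟨i, h, dvd_rfl⟩
  have hpf : ∀ T : Finset (Fin r), ∏ j ∈ T, p j = ∏ q ∈ T.image p, q := fun T => by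
    rw [Finset.prod_image fun a _ b _ h => hinj h]
  have hsq : ∀ T : Finset (Fin r), Squarefree (∏ j ∈ T, p j) := by
    intro T
    induction T using Finset.induction_on with
    | empty => simp
    | insert a s ha ih =>
      rw [Finset.prod_insert ha, Nat.squarefree_mul]
      · exact ⟨(hp a).prime.squarefree, ih⟩
      · rw [(hp a).coprime_iff_not_dvd, hdv]; exact ha
  have hmu : ∀ T : Finset (Fin r), ArithmeticFunction.moebius (∏ j ∈ T, p j) = (-1)^(#T) := by
    intro T
    induction T using Finset.induction_on with
    | empty => simp
    | insert a s ha ih =>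
      rw [Finset.prod_insert ha, ArithmeticFunction.isMultiplicative_moebius.map_mul_of_coprime, ih, ArithmeticFunction.moebius_apply_prime (hp a), card_insert_of_notMem ha, pow_succ]
      · ring
      · exact (hp a).coprime_iff_not_dvd.mpr (by rw [hdv]; exact ha)
  unfold gmu GS
  rw [Finset.sum_filter]
  symm
  refine Finset.sum_bij (fun T _ => ∏ j ∈ T, p j) ?_ ?_ ?_ ?_
  · intro T _
    rw [Nat.mem_divisors]
    exact ⟨Finset.prod_dvd_prod_of_subset _ _ _ (subset_univ T), hn0⟩
  · intro T _ T' _ h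
    ext i
    rw [← hdv T i, ← hdv T' i]
    rw [h]
  · intro m hm
    rw [Nat.mem_divisors] at hm
    refine ⟨univ.filter (fun i => p i ∣ m), by simp, ?_⟩
    have hms : Squarefree m := (hsq univ).squarefree_of_dvd hm.1
    rw [hpf, ← Nat.prod_primeFactors_of_squarefree hms]
    congr 1
    ext q
    simp only [mem_image, mem_filter, mem_univ, true_and, Nat.mem_primeFactors]
    constructor
    · rintro ⟨i, hi, rfl⟩
      rw [Nat.prod_primeFactors_of_squarefree hms] at hi
      exact ⟨hp i, hi, hms.ne_zero⟩
    · rintro ⟨hq, hqm, _⟩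
      obtain ⟨j, _, h⟩ := (Prime.dvd_finsetProd_iff hq.prime _).mp (hqm.trans hm.1)
      have := (Nat.prime_dvd_prime_iff_eq hq (hp j)).mp h
      exact ⟨j, by rw [Nat.prod_primeFactors_of_squarefree hms, ← this]; exact hqm, this.symm⟩
  · intro T _
    have h1 : Real.log ((∏ j ∈ T, p j : ℕ):ℝ) = ∑ j ∈ T, Real.log (p j) := by
      push_cast
      rw [Real.log_prod]
      intro i _; exact_mod_cast (hp i).ne_zero
    rw [h1, hmu, ← Finset.sum_div]
    have : (∑ j ∈ T, Real.log (p j)) / L < 1/2 ↔ ∑ j ∈ T, Real.log (p j) < L/2 := by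
      rw [div_lt_iff₀ hL]; constructor <;> intro h <;> linarith
    simp only [this]
    push_cast
    rfl

def Tup (r n : ℕ) : Finset (Fin r → ℕ) := (Fintype.piFinset (fun _ : Fin r => n.primeFactors)).filter (fun p => ∏ i, p i = n)

lemma mem_Tup {r n : ℕ} (hn : n ≠ 0) {p : Fin r → ℕ} : p ∈ Tup r n ↔ (∀ i, (p i).Prime) ∧ ∏ i, p i = n := by
  unfold Tup
  simp only [mem_filter, Fintype.mem_piFinset, Nat.mem_primeFactors]
  constructor
  · rintro ⟨h1, h2⟩; exact ⟨fun i => (h1 i).1, h2⟩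
  · rintro ⟨h1, h2⟩
    refine ⟨fun i => ⟨h1 i, ?_, hn⟩, h2⟩
    rw [← h2]; exact Finset.dvd_prod_of_mem _ (mem_univ i)

lemma Tup_inj {r n : ℕ} (hn : Squarefree n) {p : Fin r → ℕ} (h : p ∈ Tup r n) : Function.Injective p := by
  rw [mem_Tup hn.ne_zero] at h
  intro i j hij
  by_contra hne
  have h1 : p i * p j ∣ n := by
    rw [← h.2, ← Finset.prod_pair hne]
    exact Finset.prod_dvd_prod_of_subset _ _ _ (subset_univ _)
  rw [← hij] at h1
  exact (h.1 i).not_isUnit (hn _ h1)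

lemma Tup_image {r n : ℕ} (hn : Squarefree n) {p : Fin r → ℕ} (h : p ∈ Tup r n) : univ.image p = n.primeFactors := by
  rw [mem_Tup hn.ne_zero] at h
  ext q
  simp only [mem_image, mem_univ, true_and, Nat.mem_primeFactors]
  constructor
  · rintro ⟨i, rfl⟩
    refine ⟨h.1 i, ?_, hn.ne_zero⟩
    rw [← h.2]; exact Finset.dvd_prod_of_mem _ (mem_univ i)
  · rintro ⟨hq, hd, _⟩
    rw [← h.2, Prime.dvd_finsetProd_iff hq.prime] at hd
    obtain ⟨i, _, hi⟩ := hd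
    exact ⟨i, ((Nat.prime_dvd_prime_iff_eq hq (h.1 i)).mp hi).symm⟩

lemma Tup_r {r n : ℕ} (hn : Squarefree n) {p : Fin r → ℕ} (h : p ∈ Tup r n) : r = #n.primeFactors := by
  rw [← Tup_image hn h, card_image_of_injective _ (Tup_inj hn h)]; simp

lemma Tup_card {n : ℕ} (hn : Squarefree n) : #(Tup (#n.primeFactors) n) = (#n.primeFactors).factorial := by
  have h1 : Fintype.card (Fin (#n.primeFactors) ≃ n.primeFactors) = (#n.primeFactors).factorial := by
    rw [Fintype.card_equiv (n.primeFactors.equivFin.symm)]; simp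
  rw [← h1, ← Finset.card_univ]
  symm
  refine Finset.card_bij (fun e _ => fun i => (e i : ℕ)) ?_ ?_ ?_
  · intro e _
    rw [mem_Tup hn.ne_zero]
    refine ⟨fun i => Nat.prime_of_mem_primeFactors (e i).2, ?_⟩
    rw [e.prod_comp (fun x : n.primeFactors => (x:ℕ))]
    rw [Finset.prod_coe_sort n.primeFactors (fun x => x)]
    exact Nat.prod_primeFactors_of_squarefree hn
  · intro e _ e' _ h
    ext i
    exact congrFun h i
  · intro p hp
    have hm : ∀ i, p i ∈ n.primeFactors := fun i => by rw [← Tup_image hn hp]; exact mem_image_of_mem _ (mem_univ i)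
    refine ⟨Equiv.ofBijective (fun i => (⟨p i, hm i⟩ : n.primeFactors)) ?_, mem_univ _, rfl⟩
    rw [Fintype.bijective_iff_injective_and_card]
    refine ⟨fun i j h => Tup_inj hn hp (by simpa using h), by simp⟩

noncomputable def cel (η L : ℝ) (j : ℕ) : Finset ℕ := pr (Real.exp (((j:ℝ)*η)*L)) (Real.exp ((((j:ℝ)+1)*η)*L))

open Classical in
noncomputable def IIr (e η L : ℝ) (q K r n : ℕ) : ℝ :=
  ∑ c ∈ (Fintype.piFinset (fun _ : Fin r => Ico q K)).filter (fun c => Good e (fun i => (c i : ℝ)*η)),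
    GS (fun i => (c i : ℝ)*η) * #((Fintype.piFinset (fun i => cel η L (c i))).filter (fun p => ∏ i, p i = n))

noncomputable def IIs (e η L : ℝ) (q K M n : ℕ) : ℝ := ∑ r ∈ range M, (1/(r.factorial:ℝ)) * IIr e η L q K r n

noncomputable def fl (η L : ℝ) (p : ℕ) : ℕ := ⌊Real.log p / L / η⌋₊

lemma mem_cel {η L : ℝ} (hη : 0 < η) (hL : 0 < L) {j p : ℕ} : p ∈ cel η L j ↔ p.Prime ∧ fl η L p = j := by
  unfold cel fl
  rw [mem_pr_log hL]
  refine and_congr_right fun hp => ?_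
  have h0 : 0 ≤ Real.log p / L / η := div_nonneg (div_nonneg (Real.log_natCast_nonneg p) hL.le) hη.le
  rw [Nat.floor_eq_iff h0, le_div_iff₀ hη, div_lt_iff₀ hη]

open Classical in
lemma IIr_tup {e η L : ℝ} (hη : 0 < η) (hL : 0 < L) {q K r n : ℕ} (hn : n ≠ 0) (h : ∀ p ∈ n.primeFactors, fl η L p ∈ Ico q K) :
    IIr e η L q K r n = ∑ p ∈ Tup r n, if Good e (fun i => (fl η L (p i) : ℝ)*η) then GS (fun i => (fl η L (p i) : ℝ)*η) else 0 := by
  unfold IIr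
  rw [Finset.sum_filter]
  rw [← Finset.sum_fiberwise_of_maps_to (s := Tup r n) (t := Fintype.piFinset (fun _ : Fin r => Ico q K)) (g := fun p => fun i => fl η L (p i))]
  · refine Finset.sum_congr rfl fun c hc => ?_
    have h1 : (Fintype.piFinset (fun i => cel η L (c i))).filter (fun p => ∏ i, p i = n) = (Tup r n).filter (fun p => (fun i => fl η L (p i)) = c) := by
      ext p
      simp only [mem_filter, Fintype.mem_piFinset, mem_Tup hn, mem_cel hη hL, funext_iff]
      constructor
      · rintro ⟨h1, h2⟩; exact ⟨⟨fun i => (h1 i).1, h2⟩, fun i => (h1 i).2⟩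
      · rintro ⟨⟨h1, h2⟩, h3⟩; exact ⟨fun i => ⟨h1 i, h3 i⟩, h2⟩
    rw [h1]
    have h2 : ∑ p ∈ (Tup r n).filter (fun p => (fun i => fl η L (p i)) = c), (if Good e (fun i => (fl η L (p i) : ℝ)*η) then GS (fun i => (fl η L (p i) : ℝ)*η) else 0)
      = ∑ p ∈ (Tup r n).filter (fun p => (fun i => fl η L (p i)) = c), (if Good e (fun i => (c i : ℝ)*η) then GS (fun i => (c i : ℝ)*η) else 0) := by
      refine Finset.sum_congr rfl fun p hp => ?_
      rw [mem_filter] at hp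
      have : ∀ i, fl η L (p i) = c i := fun i => congrFun hp.2 i
      simp only [this]
    rw [h2, Finset.sum_const, nsmul_eq_mul]
    split_ifs <;> ring
  · intro p hp
    rw [Fintype.mem_piFinset]
    intro i
    unfold Tup at hp
    rw [mem_filter, Fintype.mem_piFinset] at hp
    exact h _ (hp.1 i)

def Bad (e L : ℝ) (n : ℕ) : Prop := ¬ Squarefree n ∨ ∃ d, d ∣ n ∧ (|Real.log d / L - 1/2| ≤ e ∨ |Real.log d / L - 1/3| ≤ e)

def E3 (L : ℝ) (n : ℕ) : Prop := ∃ p1 p2 p3 : ℕ, p1.Prime ∧ p2.Prime ∧ p3.Prime ∧ n = p1*p2*p3 ∧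
  Real.log p1 / L < 1/3 ∧ Real.log p2 / L < 1/3 ∧ 1/2 < Real.log p1 / L + Real.log p2 / L

end

section
open Finset

lemma pt_good {R q : ℕ} (hR : 1 ≤ R) (hq : 1 ≤ q) {e ε L : ℝ} (hL : 0 < L) (hε : 0 ≤ ε) (hε1 : ε ≤ 1/100) (hεe : ε < e) (he1 : e ≤ 1/10) (hqe : 4 ≤ q * e)
    {n : ℕ} (hbad : ¬ Bad e L n) (hw : |Real.log n / L - 1| ≤ ε) (hr : ∀ p : ℕ, p.Prime → p ∣ n → 1/(R:ℝ) ≤ Real.log p / L) :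
    (n.Prime ∧ gmu L n - IIs (e/2) (1/((R:ℝ)*q)) L q (2*R*q) (2*R) n = 1) ∨
    (¬ n.Prime ∧ ((gmu L n - IIs (e/2) (1/((R:ℝ)*q)) L q (2*R*q) (2*R) n = 0) ∨ (E3 L n ∧ -2 ≤ gmu L n - IIs (e/2) (1/((R:ℝ)*q)) L q (2*R*q) (2*R) n ∧
      gmu L n - IIs (e/2) (1/((R:ℝ)*q)) L q (2*R*q) (2*R) n ≤ 0))) := by
  classical
  have hR0 : (0:ℝ) < R := by exact_mod_cast hR
  have hq0 : (0:ℝ) < q := by exact_mod_cast hq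
  set η : ℝ := 1/((R:ℝ)*q) with hη
  have hη0 : 0 < η := by positivity
  unfold Bad at hbad
  push Not at hbad
  obtain ⟨hsq, hbad⟩ := hbad
  have hn0 := hsq.ne_zero
  set r := #n.primeFactors with hrdef
  have hlogn : ∑ p ∈ n.primeFactors, Real.log p = Real.log n := by
    conv_rhs => rw [← Nat.prod_primeFactors_of_squarefree hsq]
    push_cast
    rw [Real.log_prod]
    intro p hp; exact_mod_cast (Nat.prime_of_mem_primeFactors hp).ne_zero
  have hlt : Real.log n / L < 2 := by linarith [(abs_le.mp hw).2]
  have hu : ∀ p ∈ n.primeFactors, 1/(R:ℝ) ≤ Real.log p / L ∧ Real.log p / L < 2 := by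
    intro p hp
    refine ⟨hr p (Nat.prime_of_mem_primeFactors hp) (Nat.dvd_of_mem_primeFactors hp), ?_⟩
    refine lt_of_le_of_lt ?_ hlt
    rw [← hlogn]
    have := Finset.single_le_sum (f := fun p : ℕ => Real.log p) (fun j _ => Real.log_natCast_nonneg j) hp
    gcongr
  have hr2 : r < 2*R := by
    have h1 : ∑ p ∈ n.primeFactors, 1/(R:ℝ) ≤ ∑ p ∈ n.primeFactors, Real.log p / L := Finset.sum_le_sum fun p hp => (hu p hp).1
    rw [Finset.sum_const, nsmul_eq_mul, ← Finset.sum_div, hlogn] at h1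
    have h2 : (r:ℝ) * (1/(R:ℝ)) < 2 := lt_of_le_of_lt h1 hlt
    rw [mul_one_div, div_lt_iff₀ hR0] at h2
    exact_mod_cast h2
  have hfl : ∀ p ∈ n.primeFactors, fl η L p ∈ Ico q (2*R*q) := by
    intro p hp
    obtain ⟨h1, h2⟩ := hu p hp
    unfold fl
    rw [mem_Ico]
    constructor
    · apply Nat.le_floor
      rw [le_div_iff₀ hη0]
      calc (q:ℝ) * η = 1/R := by rw [hη]; field_simp
        _ ≤ _ := h1
    · rw [Nat.floor_lt (div_nonneg (div_nonneg (Real.log_natCast_nonneg p) hL.le) hη0.le), div_lt_iff₀ hη0]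
      calc _ < (2:ℝ) := h2
        _ = _ := by rw [hη]; push_cast; field_simp
  set h : (Fin r → ℕ) → ℝ := fun p => if Good (e/2) (fun i => (fl η L (p i) : ℝ)*η) then GS (fun i => (fl η L (p i) : ℝ)*η) else 0 with hh
  have hII : IIs (e/2) η L q (2*R*q) (2*R) n = 1/(r.factorial:ℝ) * ∑ p ∈ Tup r n, h p := by
    unfold IIs
    rw [Finset.sum_eq_single r]
    · rw [IIr_tup hη0 hL hn0 hfl]
    · intro s _ hs
      rw [IIr_tup hη0 hL hn0 hfl]
      have : Tup s n = ∅ := by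
        by_contra hne
        obtain ⟨p, hp⟩ := Finset.nonempty_iff_ne_empty.mpr hne
        exact hs (Tup_r hsq hp)
      rw [this]; simp
    · intro hs; exact absurd (mem_range.mpr hr2) hs
  have hcard : (#(Tup r n) : ℝ) = r.factorial := by exact_mod_cast Tup_card hsq
  have hf0 : (0:ℝ) < r.factorial := by exact_mod_cast Nat.factorial_pos r
  have hdiff : gmu L n - IIs (e/2) η L q (2*R*q) (2*R) n = 1/(r.factorial:ℝ) * ∑ p ∈ Tup r n, (gmu L n - h p) := by
    rw [hII, Finset.sum_sub_distrib, Finset.sum_const, nsmul_eq_mul, hcard]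
    field_simp
  -- key
  have key : ∀ p ∈ Tup r n, r ≠ 0 ∧ (r = 1 → gmu L n - h p = 1) ∧ (2 ≤ r → (gmu L n - h p = 0) ∨ (E3 L n ∧ gmu L n - h p = -2)) := by
    intro p hp
    have hp' := (mem_Tup hn0).mp hp
    have hmem : ∀ i, p i ∈ n.primeFactors := fun i => by rw [← Tup_image hsq hp]; exact mem_image_of_mem _ (mem_univ i)
    have hg : gmu L n = GS (fun i => Real.log (p i) / L) := by
      rw [← gmu_GS hL p hp'.1 (Tup_inj hsq hp), hp'.2]
    have hT : ∀ T : Finset (Fin r), ∑ i ∈ T, Real.log (p i) / L = Real.log ((∏ i ∈ T, p i : ℕ):ℝ) / L := by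
      intro T
      push_cast
      rw [Real.log_prod, Finset.sum_div]
      intro i _; exact_mod_cast (hp'.1 i).ne_zero
    have hTd : ∀ T : Finset (Fin r), ∏ i ∈ T, p i ∣ n := by
      intro T
      rw [← hp'.2]
      exact Finset.prod_dvd_prod_of_subset _ _ _ (subset_univ _)
    have hi : ∀ i, (fl η L (p i) : ℝ)*η ≤ Real.log (p i) / L ∧ Real.log (p i) / L ≤ (fl η L (p i) : ℝ)*η + η := by
      intro i
      have h0 : 0 ≤ Real.log (p i) / L / η := div_nonneg (div_nonneg (Real.log_natCast_nonneg _) hL.le) hη0.le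
      have h1 := Nat.floor_le h0
      have h2 := (Nat.lt_floor_add_one (Real.log (p i) / L / η)).le
      rw [le_div_iff₀ hη0] at h1
      rw [div_le_iff₀ hη0] at h2
      unfold fl
      exact ⟨h1, by linarith⟩
    obtain ⟨k1, k2, k3, k4⟩ := comb_main (fun i => Real.log (p i) / L) (fun i => (fl η L (p i) : ℝ)*η)
      (fun i => lt_of_lt_of_le (by positivity) (hu _ (hmem i)).1) hε hε1 hεe he1
      (by rw [hT, hp'.2]; exact hw) (fun T => by rw [hT]; exact (hbad _ (hTd T)).1) (fun T => by rw [hT]; exact (hbad _ (hTd T)).2)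
      (fun T => by
        refine ⟨Finset.sum_le_sum fun i _ => (hi i).1, ?_⟩
        calc ∑ i ∈ T, Real.log (p i) / L ≤ ∑ i ∈ T, ((fl η L (p i) : ℝ)*η + η) := Finset.sum_le_sum fun i _ => (hi i).2
          _ = ∑ i ∈ T, (fl η L (p i) : ℝ)*η + #T * η := by rw [Finset.sum_add_distrib, Finset.sum_const, nsmul_eq_mul]
          _ ≤ ∑ i ∈ T, (fl η L (p i) : ℝ)*η + e/2 := by
            have h1 : (#T:ℝ) ≤ 2*R := by
              have := card_le_univ T
              rw [Fintype.card_fin] at this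
              exact_mod_cast this.trans hr2.le
            have h2 : (#T:ℝ) * η ≤ 2*R*η := by gcongr
            have h3 : 2*R*η = 2/q := by rw [hη]; field_simp
            have h4 : 2/(q:ℝ) ≤ e/2 := by
              rw [div_le_div_iff₀ hq0 (by norm_num)]; linarith
            linarith)
    refine ⟨k3, ?_, ?_⟩
    · intro h1
      obtain ⟨a, b⟩ := k2 h1
      rw [hh]; simp only
      rw [if_neg b, hg, a]; ring
    · intro h2
      rw [hg]
      by_cases hG : Good (e/2) (fun i => (fl η L (p i) : ℝ)*η)
      · left
        rw [hh]; simp only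
        rw [if_pos hG, k1]; ring
      · have hz : h p = 0 := by rw [hh]; simp only; rw [if_neg hG]
        rw [hz, sub_zero]
        rcases k4 h2 with k | k | ⟨_, k, i, j, l, hij, hil, hjl, huniv, b1, b2, b3⟩
        · left; exact k
        · exact absurd k hG
        · right
          refine ⟨⟨p i, p j, p l, hp'.1 i, hp'.1 j, hp'.1 l, ?_, b1, b2, b3⟩, k⟩
          rw [← hp'.2, huniv, Finset.prod_insert (by simp [hij, hil]), Finset.prod_pair hjl, mul_assoc]
  have hne : (Tup r n).Nonempty := by
    rw [← Finset.card_pos]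
    have := Tup_card hsq
    rw [← hrdef] at this
    rw [this]; exact Nat.factorial_pos r
  obtain ⟨p0, hp0⟩ := hne
  have hr0 := (key p0 hp0).1
  rw [hdiff]
  by_cases hr1 : r = 1
  · left
    constructor
    · have hp' := (mem_Tup hn0).mp hp0
      rw [← hp'.2]
      clear_value r
      subst hr1
      simpa using hp'.1 0
    · rw [Finset.sum_congr rfl (fun p hp => (key p hp).2.1 hr1), Finset.sum_const, nsmul_eq_mul, hcard]
      field_simp
  · have hr2' : 2 ≤ r := by omega
    right
    constructor
    · intro hp
      rw [hrdef, hp.primeFactors] at hr1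
      simp at hr1
    · by_cases hE : E3 L n
      · right
        refine ⟨hE, ?_, ?_⟩
        · have : ∑ p ∈ Tup r n, (-2:ℝ) ≤ ∑ p ∈ Tup r n, (gmu L n - h p) := by
            refine Finset.sum_le_sum fun p hp => ?_
            rcases (key p hp).2.2 hr2' with k | k
            · rw [k]; norm_num
            · rw [k.2]
          rw [Finset.sum_const, nsmul_eq_mul, hcard] at this
          rw [one_div, inv_mul_eq_div, le_div_iff₀ hf0]
          linarith
        · refine mul_nonpos_of_nonneg_of_nonpos (by positivity) (Finset.sum_nonpos fun p hp => ?_)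
          rcases (key p hp).2.2 hr2' with k | k
          · rw [k]
          · rw [k.2]; norm_num
      · left
        rw [Finset.sum_eq_zero, mul_zero]
        intro p hp
        rcases (key p hp).2.2 hr2' with k | k
        · exact k
        · exact absurd k.1 hE

end

section
open Finset

lemma gmu_abs (L : ℝ) {n : ℕ} (hn : n ≠ 0) : |gmu L n| ≤ 2^(#n.primeFactors) := by
  unfold gmu
  refine (Finset.abs_sum_le_sum_abs _ _).trans ?_
  calc ∑ m ∈ n.divisors.filter (fun m : ℕ => Real.log m < L/2), |(ArithmeticFunction.moebius m : ℝ)| ≤ ∑ m ∈ n.divisors, |(ArithmeticFunction.moebius m : ℝ)| :=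
        Finset.sum_le_sum_of_subset_of_nonneg (filter_subset _ _) fun _ _ _ => abs_nonneg _
    _ ≤ ∑ m ∈ n.divisors, if Squarefree m then (1:ℝ) else 0 := by
        refine Finset.sum_le_sum fun m _ => ?_
        split_ifs with h
        · have := ArithmeticFunction.abs_moebius_le_one (n := m)
          exact_mod_cast this
        · rw [ArithmeticFunction.moebius_eq_zero_of_not_squarefree h]; simp
    _ = _ := by
        rw [← Finset.sum_filter, Nat.sum_divisors_filter_squarefree hn, Finset.sum_const, card_powerset]
        have : (UniqueFactorizationMonoid.normalizedFactors n).toFinset = n.primeFactors := by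
          rw [Nat.factors_eq]; rfl
        rw [this]; simp

lemma omega_lt {R n : ℕ} (hR : 1 ≤ R) {L : ℝ} (hL : 0 < L) (hn : n ≠ 0) (hlt : Real.log n / L < 2) (hr : ∀ p : ℕ, p.Prime → p ∣ n → 1/(R:ℝ) ≤ Real.log p / L) : #n.primeFactors < 2*R := by
  have hR0 : (0:ℝ) < R := by exact_mod_cast hR
  have h0 : ∑ p ∈ n.primeFactors, Real.log p ≤ Real.log n := by
    rw [← Real.log_prod]
    · have h := Nat.le_of_dvd (Nat.pos_of_ne_zero hn) (Nat.prod_primeFactors_dvd n)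
      have h' : (∏ p ∈ n.primeFactors, (p:ℝ)) ≤ n := by
        rw [← Nat.cast_prod]; exact_mod_cast h
      refine Real.log_le_log ?_ h'
      exact Finset.prod_pos fun p hp => by exact_mod_cast (Nat.prime_of_mem_primeFactors hp).pos
    · intro p hp; exact_mod_cast (Nat.prime_of_mem_primeFactors hp).ne_zero
  have h1 : ∑ p ∈ n.primeFactors, 1/(R:ℝ) ≤ ∑ p ∈ n.primeFactors, Real.log p / L := Finset.sum_le_sum fun p hp => hr p (Nat.prime_of_mem_primeFactors hp) (Nat.dvd_of_mem_primeFactors hp)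
  rw [Finset.sum_const, nsmul_eq_mul, ← Finset.sum_div] at h1
  have h2 : ((#n.primeFactors:ℕ):ℝ) * (1/(R:ℝ)) < 2 := lt_of_le_of_lt (h1.trans (by gcongr)) hlt
  rw [mul_one_div, div_lt_iff₀ hR0] at h2
  exact_mod_cast h2

lemma Tup_le (r n : ℕ) : #(Tup r n) ≤ r^r := by
  have := tup_count (fun _ : Fin r => n.primeFactors) (fun _ p hp => Nat.prime_of_mem_primeFactors hp) n
  rw [Fintype.card_fin] at this
  unfold Tup
  convert this

lemma IIs_abs {R q n : ℕ} (hR : 1 ≤ R) (hq : 1 ≤ q) {e L : ℝ} (hL : 0 < L) (hn : n ≠ 0) (hlt : Real.log n / L < 2) (hr : ∀ p : ℕ, p.Prime → p ∣ n → 1/(R:ℝ) ≤ Real.log p / L) :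
    |IIs e (1/((R:ℝ)*q)) L q (2*R*q) (2*R) n| ≤ ∑ r ∈ range (2*R), (r:ℝ)^r * 2^r := by
  classical
  have hR0 : (0:ℝ) < R := by exact_mod_cast hR
  have hq0 : (0:ℝ) < q := by exact_mod_cast hq
  set η : ℝ := 1/((R:ℝ)*q) with hη
  have hη0 : 0 < η := by positivity
  have hfl : ∀ p ∈ n.primeFactors, fl η L p ∈ Ico q (2*R*q) := by
    intro p hp
    have hpp := Nat.prime_of_mem_primeFactors hp
    have h1 := hr p hpp (Nat.dvd_of_mem_primeFactors hp)
    have h2 : Real.log p / L < 2 := by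
      refine lt_of_le_of_lt ?_ hlt
      have h3 : p ≤ n := Nat.le_of_dvd (Nat.pos_of_ne_zero hn) (Nat.dvd_of_mem_primeFactors hp)
      have : Real.log p ≤ Real.log n := Real.log_le_log (by exact_mod_cast hpp.pos) (by exact_mod_cast h3)
      gcongr
    unfold fl
    rw [mem_Ico]
    constructor
    · apply Nat.le_floor
      rw [le_div_iff₀ hη0]
      calc (q:ℝ) * η = 1/R := by rw [hη]; field_simp
        _ ≤ _ := h1
    · rw [Nat.floor_lt (div_nonneg (div_nonneg (Real.log_natCast_nonneg p) hL.le) hη0.le), div_lt_iff₀ hη0]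
      calc _ < (2:ℝ) := h2
        _ = _ := by rw [hη]; push_cast; field_simp
  unfold IIs
  refine (Finset.abs_sum_le_sum_abs _ _).trans (Finset.sum_le_sum fun r _ => ?_)
  rw [IIr_tup hη0 hL hn hfl, abs_mul]
  have h1 : |1/(r.factorial:ℝ)| ≤ 1 := by
    rw [abs_of_nonneg (by positivity), div_le_one (by positivity)]
    exact_mod_cast Nat.factorial_pos r
  have h2 : |∑ p ∈ Tup r n, if Good e (fun i => (fl η L (p i) : ℝ)*η) then GS (fun i => (fl η L (p i) : ℝ)*η) else 0| ≤ (r:ℝ)^r * 2^r := by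
    refine (Finset.abs_sum_le_sum_abs _ _).trans ?_
    calc _ ≤ ∑ p ∈ Tup r n, (2:ℝ)^r := by
          refine Finset.sum_le_sum fun p _ => ?_
          split_ifs
          · exact GS_abs _
          · simp
      _ = #(Tup r n) * 2^r := by simp
      _ ≤ _ := by
          gcongr
          exact_mod_cast Tup_le r n
  calc _ ≤ 1 * ((r:ℝ)^r * 2^r) := mul_le_mul h1 h2 (abs_nonneg _) (by norm_num)
    _ = _ := one_mul _

lemma IIs_zero {R q n p : ℕ} (hR : 1 ≤ R) (hq : 1 ≤ q) {e L : ℝ} (hL : 0 < L) (hn : n ≠ 0) (hp : p.Prime) (hd : p ∣ n) (hz : (p:ℝ) < Real.exp (L/R)) :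
    IIs e (1/((R:ℝ)*q)) L q (2*R*q) (2*R) n = 0 := by
  classical
  have hR0 : (0:ℝ) < R := by exact_mod_cast hR
  have hq0 : (0:ℝ) < q := by exact_mod_cast hq
  unfold IIs IIr
  refine Finset.sum_eq_zero fun r _ => ?_
  rw [Finset.sum_eq_zero, mul_zero]
  intro c hc
  rw [mem_filter, Fintype.mem_piFinset] at hc
  rw [Finset.filter_eq_empty_iff.mpr, card_empty]
  · simp
  · intro a ha hprod
    rw [Fintype.mem_piFinset] at ha
    rw [← hprod, Prime.dvd_finsetProd_iff hp.prime] at hd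
    obtain ⟨i, _, hi⟩ := hd
    have h1 := ha i
    unfold cel at h1
    rw [mem_pr] at h1
    have h2 := (Nat.prime_dvd_prime_iff_eq hp h1.1).mp hi
    rw [← h2] at h1
    have h3 : (q:ℝ) ≤ c i := by exact_mod_cast (mem_Ico.mp (hc.1 i)).1
    have h4 : L/R ≤ (c i:ℝ) * (1/((R:ℝ)*q)) * L := by
      calc L/R = (q:ℝ) * (1/((R:ℝ)*q)) * L := by field_simp
        _ ≤ _ := by gcongr
    have := Real.exp_le_exp.mpr h4
    linarith [h1.2.1]

noncomputable def PP (n : ℕ) : ℝ := if n.Prime then 1 else 0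
open Classical in
noncomputable def EE (L : ℝ) (n : ℕ) : ℝ := if E3 L n then 1 else 0
open Classical in
noncomputable def BB (e L z : ℝ) (n : ℕ) : ℝ := if Bad e L n then rho z n else 0

lemma pt_all (R : ℕ) (hR : 2 ≤ R) : ∃ C : ℝ, 0 ≤ C ∧ ∀ (q n : ℕ) (e ε L : ℝ), 1 ≤ q → 0 < L → 0 ≤ ε → ε ≤ 1/100 → ε < e → e ≤ 1/10 → 4 ≤ q * e → n ≠ 0 →
    |Real.log n / L - 1| ≤ ε →
    GG L (Real.exp (L/R)) n - IIs (e/2) (1/((R:ℝ)*q)) L q (2*R*q) (2*R) n ≤ PP n + C * BB e L (Real.exp (L/R)) n ∧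
    PP n - 2 * EE L n - (C+1) * BB e L (Real.exp (L/R)) n ≤ GG L (Real.exp (L/R)) n - IIs (e/2) (1/((R:ℝ)*q)) L q (2*R*q) (2*R) n := by
  classical
  refine ⟨2^(2*R) + ∑ r ∈ range (2*R), (r:ℝ)^r * 2^r, by positivity, ?_⟩
  set C : ℝ := 2^(2*R) + ∑ r ∈ range (2*R), (r:ℝ)^r * 2^r with hC
  have hC0 : 0 ≤ C := by positivity
  intro q n e ε L hq hL hε hε1 hεe he1 hqe hn hw
  have hR1 : 1 ≤ R := by omega
  have hR0 : (0:ℝ) < R := by exact_mod_cast hR1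
  set z := Real.exp (L/R) with hz
  have hlt : Real.log n / L < 2 := by linarith [(abs_le.mp hw).2]
  have hPP : 0 ≤ PP n ∧ PP n ≤ 1 := by unfold PP; split_ifs <;> simp
  have hEE : 0 ≤ EE L n := by unfold EE; split_ifs <;> simp
  by_cases hrough : ∀ p : ℕ, p.Prime → p ∣ n → z ≤ p
  · have hr1 : rho z n = 1 := rho_one hrough
    have hr : ∀ p : ℕ, p.Prime → p ∣ n → 1/(R:ℝ) ≤ Real.log p / L := by
      intro p hp hd
      have := (Real.le_log_iff_exp_le (by exact_mod_cast hp.pos)).mpr (hrough p hp hd)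
      rw [le_div_iff₀ hL]
      calc 1/(R:ℝ)*L = L/R := by ring
        _ ≤ _ := this
    have hG : GG L z n = gmu L n := by unfold GG; rw [hr1, one_mul]
    rw [hG]
    by_cases hbad : Bad e L n
    · have hB : BB e L z n = 1 := by unfold BB; rw [if_pos hbad, hr1]
      rw [hB]
      have h1 : |gmu L n| ≤ 2^(2*R) := (gmu_abs L hn).trans (pow_le_pow_right₀ (by norm_num) (omega_lt hR1 hL hn hlt hr).le)
      have h2 := IIs_abs (e := e/2) hR1 hq hL hn hlt hr
      rw [abs_le] at h1 h2
      constructor <;> linarith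
    · have hB : BB e L z n = 0 := by unfold BB; rw [if_neg hbad]
      rw [hB]
      rcases pt_good hR1 hq hL hε hε1 hεe he1 hqe hbad hw hr with ⟨h1, h2⟩ | ⟨h1, h2 | ⟨h3, h4, h5⟩⟩
      · have : PP n = 1 := by unfold PP; rw [if_pos h1]
        constructor <;> linarith
      · have : PP n = 0 := by unfold PP; rw [if_neg h1]
        constructor <;> linarith
      · have : PP n = 0 := by unfold PP; rw [if_neg h1]
        have : EE L n = 1 := by unfold EE; rw [if_pos h3]
        constructor <;> linarith
  · push Not at hrough
    obtain ⟨p, hp, hd, hpz⟩ := hrough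
    have hr1 : rho z n = 0 := rho_zero hp hd hpz
    have hP : PP n = 0 := by
      unfold PP
      rw [if_neg]
      intro hnp
      have := (Nat.prime_dvd_prime_iff_eq hp hnp).mp hd
      subst this
      have h1 : Real.log p < L/R := by
        rw [← Real.log_exp (L/R)]
        exact Real.log_lt_log (by exact_mod_cast hp.pos) hpz
      have h2 : L/R ≤ L/2 := by
        have : (2:ℝ) ≤ R := by exact_mod_cast hR
        gcongr
      have h3 := (abs_le.mp hw).1
      have h4 : 99/100 ≤ Real.log p / L := by linarith
      rw [le_div_iff₀ hL] at h4
      linarith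
    have hB : BB e L z n = 0 := by unfold BB; rw [hr1]; simp
    have hG : GG L z n = 0 := by unfold GG; rw [hr1, zero_mul]
    rw [hP, hB, hG, IIs_zero hR1 hq hL hn hp hd hpz]
    constructor <;> linarith

end

section
open Finset Filter

lemma SS_tup {r N : ℕ} (Q : Fin r → Finset ℕ) (hQ : ∀ i, ∀ p ∈ Q i, p.Prime) {l L : ℝ} (hl : 0 < l) (hlL : l ≤ L) (hN : Real.exp (2*L) ≤ N) :
    SS N l L (fun n => (#((Fintype.piFinset Q).filter (fun p => ∏ i, p i = n)) : ℝ)) =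
      ∑ p ∈ Fintype.piFinset Q, (∏ i, 1/((p i:ℕ):ℝ)) * Wk l (∑ i, Real.log (p i) - L) := by
  unfold SS
  have h1 : ∀ n ∈ Icc 1 N, (#((Fintype.piFinset Q).filter (fun p => ∏ i, p i = n)) : ℝ) * (1/(n:ℝ) * Wk l (Real.log n - L)) =
      ∑ p ∈ Fintype.piFinset Q, if ∏ i, p i = n then (1/(n:ℝ) * Wk l (Real.log n - L)) else 0 := by
    intro n _
    rw [← Finset.sum_filter, Finset.sum_const, nsmul_eq_mul]
  rw [Finset.sum_congr rfl h1, Finset.sum_comm]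
  refine Finset.sum_congr rfl fun p hp => ?_
  rw [Fintype.mem_piFinset] at hp
  have hpp : ∀ i, (p i).Prime := fun i => hQ i _ (hp i)
  rw [Finset.sum_ite_eq]
  have h2 : (1:ℝ)/((∏ i, p i : ℕ):ℝ) = ∏ i, 1/((p i:ℕ):ℝ) := by
    push_cast; simp
  have h3 : Real.log ((∏ i, p i : ℕ):ℝ) = ∑ i, Real.log (p i) := by
    push_cast
    rw [Real.log_prod]
    intro i _; exact_mod_cast (hpp i).ne_zero
  have h4 : 1 ≤ ∏ i, p i := Nat.one_le_iff_ne_zero.mpr (Finset.prod_ne_zero_iff.mpr fun i _ => (hpp i).ne_zero)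
  rw [h2, h3]
  split_ifs with h
  · rfl
  · have h5 : N < ∏ i, p i := by
      by_contra h6
      exact h (mem_Icc.mpr ⟨h4, by omega⟩)
    have h6 : 2*L ≤ ∑ i, Real.log (p i) := by
      rw [← h3, Real.le_log_iff_exp_le (by exact_mod_cast h4)]
      refine hN.trans ?_
      exact_mod_cast h5.le
    rw [Wk_zero hl, mul_zero]
    rw [abs_of_nonneg (by linarith)]
    linarith

lemma SS_zero (N : ℕ) (l y : ℝ) : SS N l y (fun _ => 0) = 0 := by unfold SS; simp

lemma SS_sum {α : Type*} (S : Finset α) (N : ℕ) (l y : ℝ) (f : α → ℕ → ℝ) : SS N l y (fun n => ∑ a ∈ S, f a n) = ∑ a ∈ S, SS N l y (f a) := by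
  unfold SS
  rw [Finset.sum_comm]
  refine Finset.sum_congr rfl fun n _ => ?_
  rw [Finset.sum_mul]

lemma fin_min {α : Type*} (S : Finset α) (P : α → ℝ → Prop) (h : ∀ a ∈ S, ∃ ε0 : ℝ, 0 < ε0 ∧ ∀ ε, 0 < ε → ε ≤ ε0 → P a ε) :
    ∃ ε0 : ℝ, 0 < ε0 ∧ ∀ ε, 0 < ε → ε ≤ ε0 → ∀ a ∈ S, P a ε := by
  classical
  induction S using Finset.induction_on with
  | empty => exact ⟨1, one_pos, by simp⟩
  | insert a s ha ih =>
    obtain ⟨e1, h1, h1'⟩ := ih fun b hb => h b (mem_insert_of_mem hb)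
    obtain ⟨e2, h2, h2'⟩ := h a (mem_insert_self _ _)
    refine ⟨min e1 e2, lt_min h1 h2, fun ε hε hε' b hb => ?_⟩
    rcases mem_insert.mp hb with rfl | hb
    · exact h2' ε hε (hε'.trans (min_le_right _ _))
    · exact h1' ε hε (hε'.trans (min_le_left _ _)) b hb

open Classical in
theorem II_diff {R q : ℕ} (hR : 1 ≤ R) (hq : 1 ≤ q) {e : ℝ} (he : 0 < e) : ∃ ε0 : ℝ, 0 < ε0 ∧ ∀ ε, 0 < ε → ε ≤ ε0 → ∀ᶠ L : ℝ in atTop, ∀ N : ℕ, Real.exp (2*L) ≤ N →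
    |SS N (Real.exp (-L/3)) L (IIs e (1/((R:ℝ)*q)) L q (2*R*q) (2*R)) - SS N (ε*L) L (IIs e (1/((R:ℝ)*q)) L q (2*R*q) (2*R))| ≤ (1/100)/L := by
  have hR0 : (0:ℝ) < R := by exact_mod_cast hR
  have hq0 : (0:ℝ) < q := by exact_mod_cast hq
  set η : ℝ := 1/((R:ℝ)*q) with hη
  have hη0 : 0 < η := by positivity
  set K := 2*R*q with hK
  obtain ⟨CS, hCS⟩ : ∃ CS : (r : ℕ) → Finset (Fin r → ℕ), CS = fun r => (Fintype.piFinset (fun _ : Fin r => Ico q K)).filter (fun c => Good e (fun i => (c i : ℝ)*η)) := ⟨_, rfl⟩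
  set M : ℝ := 1 + ∑ r ∈ range (2*R), (1/(r.factorial:ℝ)) * ∑ c ∈ CS r, (2:ℝ)^r with hM
  have hM0 : 0 < M := by
    have : 0 ≤ ∑ r ∈ range (2*R), (1/(r.factorial:ℝ)) * ∑ c ∈ CS r, (2:ℝ)^r :=
      Finset.sum_nonneg fun r _ => mul_nonneg (by positivity) (Finset.sum_nonneg fun c _ => by positivity)
    linarith
  clear_value M
  obtain ⟨δ, hδ⟩ : ∃ δ : ℝ, δ = (1/100)/M := ⟨_, rfl⟩
  have hδ0 : 0 < δ := by rw [hδ]; positivity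
  obtain ⟨TT, hTT⟩ : ∃ TT : (r : ℕ) → (Fin r → ℕ) → ℝ → ℝ → ℝ, TT = fun r c L l => ∑ p ∈ Fintype.piFinset (fun i => cel η L (c i)), (∏ i, 1/((p i:ℕ):ℝ)) * Wk l (∑ i, Real.log (p i) - L) := ⟨_, rfl⟩
  have hall : ∃ ε0 : ℝ, 0 < ε0 ∧ ∀ ε, 0 < ε → ε ≤ ε0 → ∀ r ∈ range (2*R), ∀ c ∈ CS r, ∀ᶠ L : ℝ in atTop, |TT r c L (Real.exp (-L/3)) - TT r c L (ε*L)| ≤ δ/L := by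
    refine fin_min _ _ fun r _ => fin_min _ _ fun c hc => ?_
    rw [hCS, mem_filter, Fintype.mem_piFinset] at hc
    obtain ⟨hc1, i0, A, B, hAB, hA, hB, hun, sA, sB⟩ := hc
    have hcpos : ∀ i, (0:ℝ) < c i := fun i => by
      have := (mem_Ico.mp (hc1 i)).1
      exact_mod_cast lt_of_lt_of_le hq this
    obtain ⟨ε0, h0, h1⟩ := typeII (fun i => (c i : ℝ)*η) (fun i => ((c i : ℝ)+1)*η) (fun i => mul_pos (hcpos i) hη0) (fun i => by nlinarith) i0 A B hAB hA hB hun he sA sB hδ0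
    refine ⟨ε0, h0, fun ε hε hε' => ?_⟩
    filter_upwards [h1 ε hε hε'] with L hL
    simp only [hTT]
    rw [← Finset.sum_sub_distrib]
    simp only [cel]
    refine le_trans (le_of_eq ?_) hL
    congr 1
    exact Finset.sum_congr rfl fun p _ => by ring
  obtain ⟨ε0, h0, hε0⟩ := hall
  refine ⟨min ε0 1, lt_min h0 one_pos, fun ε hε hε' => ?_⟩
  have hev : ∀ᶠ L : ℝ in atTop, ∀ r ∈ range (2*R), ∀ c ∈ CS r, |TT r c L (Real.exp (-L/3)) - TT r c L (ε*L)| ≤ δ/L := by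
    rw [Filter.eventually_all_finset]
    intro r hr
    rw [Filter.eventually_all_finset]
    intro c hc
    exact hε0 ε hε (hε'.trans (min_le_left _ _)) r hr c hc
  filter_upwards [hev, eventually_ge_atTop 1] with L hL hL1 N hN
  have hL0 : 0 < L := by linarith
  have hexp : ∀ l, 0 < l → l ≤ L → SS N l L (IIs e η L q K (2*R)) = ∑ r ∈ range (2*R), (1/(r.factorial:ℝ)) * ∑ c ∈ CS r, GS (fun i => (c i : ℝ)*η) * TT r c L l := by
    intro l hl hlL
    have : IIs e η L q K (2*R) = fun n => ∑ r ∈ range (2*R), (1/(r.factorial:ℝ)) * ∑ c ∈ CS r, GS (fun i => (c i : ℝ)*η) * (#((Fintype.piFinset (fun i => cel η L (c i))).filter (fun p => ∏ i, p i = n)) : ℝ) := by rw [hCS]; rfl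
    rw [this, SS_sum]
    refine Finset.sum_congr rfl fun r _ => ?_
    rw [SS_smul, SS_sum]
    congr 1
    refine Finset.sum_congr rfl fun c _ => ?_
    rw [SS_smul, SS_tup _ _ hl hlL hN, hTT]
    intro i p hp
    exact ((mem_cel hη0 hL0).mp hp).1
  have hl1 : Real.exp (-L/3) ≤ L := (Real.exp_le_one_iff.mpr (by linarith)).trans hL1
  have hl2 : ε * L ≤ L := by
    have := hε'.trans (min_le_right _ _)
    nlinarith
  rw [hexp _ (Real.exp_pos _) hl1, hexp _ (by positivity) hl2, ← Finset.sum_sub_distrib]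
  calc _ ≤ ∑ r ∈ range (2*R), (1/(r.factorial:ℝ)) * ∑ c ∈ CS r, (2:ℝ)^r * (δ/L) := by
        refine (Finset.abs_sum_le_sum_abs _ _).trans (Finset.sum_le_sum fun r hr => ?_)
        rw [← mul_sub, ← Finset.sum_sub_distrib, abs_mul, abs_of_nonneg (by positivity : (0:ℝ) ≤ 1/(r.factorial:ℝ))]
        refine mul_le_mul_of_nonneg_left ?_ (by positivity)
        refine (Finset.abs_sum_le_sum_abs _ _).trans (Finset.sum_le_sum fun c hc => ?_)
        rw [← mul_sub, abs_mul]
        exact mul_le_mul (GS_abs _) (hL r hr c hc) (abs_nonneg _) (by positivity)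
    _ = (M-1) * (δ/L) := by
        rw [hM, add_sub_cancel_left, Finset.sum_mul]
        refine Finset.sum_congr rfl fun r _ => ?_
        rw [← Finset.sum_mul]; ring
    _ ≤ M * (δ/L) := by
        refine mul_le_mul_of_nonneg_right (by linarith) (by positivity)
    _ = _ := by rw [hδ]; field_simp

end

section
open Finset Filter

lemma ev_small' {C c a : ℝ} (hc : 0 < c) (ha : 0 < a) : ∀ᶠ L : ℝ in atTop, C * Real.exp (-(a*L)) ≤ c / L := by
  have h := ev_small (C := C) (c := c*a) (by positivity)
  have ht : Tendsto (fun L : ℝ => a * L) atTop atTop := tendsto_id.const_mul_atTop ha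
  filter_upwards [ht.eventually h, eventually_gt_atTop 0] with L hL hL0
  refine hL.trans (le_of_eq ?_)
  field_simp

lemma T_small {l y : ℝ} {N : ℕ} (hl : 0 < l) (hl1 : l ≤ 1) : SS N l y (fun _ => 1) ≤ 9 + 3 * (Real.exp (-y) / l) := by
  set I := Icc ⌈Real.exp (y-l)⌉₊ ⌊Real.exp (y+l)⌋₊ with hI
  have he1 : Real.exp l ≤ 3 := by
    have := Real.exp_le_exp.mpr hl1
    linarith [Real.exp_one_lt_d9]
  have h1 : SS N l y (fun _ => 1) ≤ ∑ n ∈ I, Real.exp (l-y)/l := by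
    unfold SS
    calc _ ≤ ∑ n ∈ Icc 1 N, if n ∈ I then Real.exp (l-y)/l else 0 := by
          refine Finset.sum_le_sum fun n hn => ?_
          have hn1 : (1:ℝ) ≤ n := by exact_mod_cast (mem_Icc.mp hn).1
          have hn0 : (0:ℝ) < n := by linarith
          by_cases h : |Real.log n - y| < l
          · rw [abs_lt] at h
            have ha : Real.exp (y-l) ≤ n := by
              rw [← Real.le_log_iff_exp_le hn0]; linarith
            have hb : (n:ℝ) ≤ Real.exp (y+l) := by
              rw [← Real.log_le_iff_le_exp hn0]; linarith
            rw [if_pos (mem_Icc.mpr ⟨Nat.ceil_le.mpr ha, Nat.le_floor hb⟩)]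
            have hc : 1/(n:ℝ) ≤ Real.exp (l-y) := by
              rw [show l - y = -(y-l) by ring, Real.exp_neg, one_div]
              exact inv_anti₀ (Real.exp_pos _) ha
            calc 1 * (1/(n:ℝ) * Wk l (Real.log n - y)) = 1/(n:ℝ) * Wk l (Real.log n - y) := one_mul _
              _ ≤ Real.exp (l-y) * (1/l) := mul_le_mul hc (Wk_le hl _) (Wk_nonneg hl _) (Real.exp_pos _).le
              _ = _ := by ring
          · rw [Wk_zero hl (not_lt.mp h)]
            simp only [mul_zero]
            split_ifs
            · positivity
            · exact le_rfl
      _ = ∑ n ∈ (Icc 1 N).filter (fun n => n ∈ I), Real.exp (l-y)/l := by rw [Finset.sum_filter]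
      _ ≤ _ := Finset.sum_le_sum_of_subset_of_nonneg (fun n hn => (mem_filter.mp hn).2) fun _ _ _ => by positivity
  rw [Finset.sum_const, nsmul_eq_mul] at h1
  have h2 : (#I:ℝ) ≤ 3*l*Real.exp y + 1 := by
    have ha : (#I:ℝ) ≤ Real.exp (y+l) - Real.exp (y-l) + 1 := by
      rw [hI, Nat.card_Icc]
      have hf := Nat.floor_le (Real.exp_pos (y+l)).le
      have hc := Nat.le_ceil (Real.exp (y-l))
      rcases le_total ⌈Real.exp (y-l)⌉₊ (⌊Real.exp (y+l)⌋₊ + 1) with h | h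
      · rw [Nat.cast_sub h]; push_cast; linarith
      · rw [Nat.sub_eq_zero_of_le h]
        have := Real.exp_le_exp.mpr (by linarith : y - l ≤ y + l)
        push_cast; linarith
    have hb : Real.exp l ≤ 1 + 2*l := by
      have := (abs_le.mp (Real.abs_exp_sub_one_sub_id_le (x := l) (by rw [abs_of_pos hl]; exact hl1))).2
      nlinarith
    have hc : 1 - l ≤ Real.exp (-l) := by linarith [Real.add_one_le_exp (-l)]
    rw [Real.exp_add, sub_eq_add_neg y l, Real.exp_add] at ha
    have := Real.exp_pos y
    nlinarith
  calc _ ≤ _ := h1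
    _ ≤ (3*l*Real.exp y + 1) * (3 * Real.exp (-y) / l) := by
        refine mul_le_mul h2 ?_ (by positivity) (by positivity)
        rw [sub_eq_add_neg, Real.exp_add]
        gcongr
    _ = 9 * (Real.exp y * Real.exp (-y)) + 3 * (Real.exp (-y) / l) := by field_simp; ring
    _ = _ := by rw [← Real.exp_add]; simp

lemma T_big {ε L y : ℝ} {N : ℕ} (hε : 0 < ε) (hε1 : ε ≤ 1) (hL : 1 ≤ L) (hy : y ≤ L) : SS N (ε*L) y (fun _ => 1) ≤ 3/ε := by
  have hL0 : 0 < L := by linarith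
  set I := Icc 1 ⌊Real.exp (2*L)⌋₊ with hI
  have h1 : SS N (ε*L) y (fun _ => 1) ≤ ∑ n ∈ I, (1/(n:ℝ)) * (1/(ε*L)) := by
    unfold SS
    calc _ ≤ ∑ n ∈ Icc 1 N, if n ∈ I then (1/(n:ℝ)) * (1/(ε*L)) else 0 := by
          refine Finset.sum_le_sum fun n hn => ?_
          have hn1 : (1:ℝ) ≤ n := by exact_mod_cast (mem_Icc.mp hn).1
          have hn0 : (0:ℝ) < n := by linarith
          by_cases h : |Real.log n - y| < ε*L
          · rw [abs_lt] at h
            have hb : (n:ℝ) ≤ Real.exp (2*L) := by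
              rw [← Real.log_le_iff_le_exp hn0]; nlinarith
            rw [if_pos (mem_Icc.mpr ⟨(mem_Icc.mp hn).1, Nat.le_floor hb⟩), one_mul]
            exact mul_le_mul_of_nonneg_left (Wk_le (by positivity) _) (by positivity)
          · rw [Wk_zero (by positivity) (not_lt.mp h)]
            simp only [mul_zero]
            split_ifs
            · positivity
            · exact le_rfl
      _ = ∑ n ∈ (Icc 1 N).filter (fun n => n ∈ I), (1/(n:ℝ)) * (1/(ε*L)) := by rw [Finset.sum_filter]
      _ ≤ _ := Finset.sum_le_sum_of_subset_of_nonneg (fun n hn => (mem_filter.mp hn).2) fun _ _ _ => by positivity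
  rw [← Finset.sum_mul] at h1
  have h2 : ∑ n ∈ I, 1/(n:ℝ) ≤ 1 + 2*L := by
    have := harmonic_floor_le_one_add_log (Real.exp (2*L)) (Real.one_le_exp (by linarith))
    rw [Real.log_exp, harmonic_eq_sum_Icc] at this
    push_cast at this
    simpa [one_div] using this
  calc _ ≤ _ := h1
    _ ≤ (3*L) * (1/(ε*L)) := mul_le_mul_of_nonneg_right (by linarith) (by positivity)
    _ = _ := by field_simp

open Classical in
lemma bad1 {R : ℕ} (hR : 1 ≤ R) {ε c : ℝ} (hε : 0 < ε) (hε1 : ε ≤ 1/1000) (hc : 0 < c) : ∀ᶠ L : ℝ in atTop, ∀ (N : ℕ) (l : ℝ), (l = Real.exp (-L/3) ∨ l = ε*L) →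
    SS N l L (fun n => if Squarefree n then 0 else rho (Real.exp (L/R)) n) ≤ c/L := by
  have hR0 : (0:ℝ) < R := by exact_mod_cast hR
  have e1 := ev_small' (C := (9+3/ε)*2) (c := c/2) (a := 1/R) (by positivity) (by positivity)
  have e2 := ev_small' (C := 3) (c := c/2) (a := 1/10) (by positivity) (by positivity)
  filter_upwards [e1, e2, eventually_ge_atTop 1000] with L h1 h2 hL N l hl
  have hL0 : 0 < L := by linarith
  have hlpos : 0 < l := by rcases hl with rfl | rfl <;> positivity
  have hlL : l ≤ L/1000 := by
    rcases hl with rfl | rfl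
    · have := Real.exp_le_one_iff.mpr (by linarith : -L/3 ≤ 0)
      linarith
    · nlinarith
  set z := Real.exp (L/R) with hz
  have hz1 : 1 ≤ z := Real.one_le_exp (by positivity)
  set Y := Real.exp (51/100*L) with hY
  have hY1 : 1 ≤ Y := Real.one_le_exp (by positivity)
  have hT : ∀ p ∈ pr z Y, SS (N/(p*p)) l (L - Real.log ((p*p : ℕ):ℝ)) (fun _ => 1) ≤ (9+3/ε) + 3 * ((p:ℝ)^2 * Real.exp (-(2/3*L))) := by
    intro p hp
    rw [mem_pr] at hp
    have hp0 : (0:ℝ) < p := by exact_mod_cast hp.1.pos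
    rcases hl with rfl | rfl
    · refine (T_small hlpos (Real.exp_le_one_iff.mpr (by linarith))).trans ?_
      have : Real.exp (-(L - Real.log ((p*p:ℕ):ℝ))) / Real.exp (-L/3) = (p:ℝ)^2 * Real.exp (-(2/3*L)) := by
        rw [neg_sub, sub_eq_add_neg, Real.exp_add, Real.exp_log (by exact_mod_cast Nat.mul_pos hp.1.pos hp.1.pos), mul_div_assoc, ← Real.exp_sub]
        push_cast
        congr 1
        · ring
        · congr 1; ring
      rw [this]
      have : 0 < 3/ε := by positivity
      linarith
    · have hlog : 0 ≤ Real.log ((p*p:ℕ):ℝ) := Real.log_natCast_nonneg _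
      refine (T_big hε (by linarith) (by linarith) (by linarith)).trans ?_
      have : 0 ≤ 3 * ((p:ℝ)^2 * Real.exp (-(2/3*L))) := by positivity
      linarith
  have hsq : ∑ p ∈ pr z Y, 1/(p:ℝ)^2 ≤ 2/z := by
    have hsub : pr z Y ⊆ Ioo (⌈z⌉₊ - 1) ⌈Y⌉₊ := by
      intro p hp
      rw [mem_pr] at hp
      rw [mem_Ioo]
      have ha := Nat.ceil_le.mpr hp.2.1
      have hb : 0 < ⌈z⌉₊ := Nat.ceil_pos.mpr (by linarith)
      exact ⟨by omega, Nat.lt_ceil.mpr hp.2.2⟩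
    calc _ ≤ ∑ p ∈ Ioo (⌈z⌉₊ - 1) ⌈Y⌉₊, 1/(p:ℝ)^2 := Finset.sum_le_sum_of_subset_of_nonneg hsub fun _ _ _ => by positivity
      _ ≤ 2/(((⌈z⌉₊ - 1 : ℕ):ℝ)+1) := by
          simpa [one_div] using sum_Ioo_inv_sq_le (α := ℝ) (⌈z⌉₊ - 1) ⌈Y⌉₊
      _ ≤ 2/z := by
          have hb : 1 ≤ ⌈z⌉₊ := Nat.ceil_pos.mpr (by linarith)
          rw [Nat.cast_sub hb]
          push_cast
          have := Nat.le_ceil z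
          gcongr
          linarith
  have hcard : (#(pr z Y):ℝ) ≤ Y := by linarith [pr_card z Y hY1]
  calc _ ≤ SS N l L (fun n => ∑ p ∈ pr z Y, (if p*p ∣ n then 1 else 0)) := by
        refine SS_mono hlpos fun n hn hwin => ?_
        have hnn : ∀ p ∈ pr z Y, (0:ℝ) ≤ (if p*p ∣ n then 1 else 0) := fun p _ => by split_ifs <;> norm_num
        split_ifs with hs
        · exact Finset.sum_nonneg hnn
        · rw [Nat.squarefree_iff_prime_squarefree] at hs
          push Not at hs
          obtain ⟨p, hp, hd⟩ := hs
          by_cases hpz : (p:ℝ) < z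
          · rw [rho_zero hp ((dvd_mul_right p p).trans hd) hpz]
            exact Finset.sum_nonneg hnn
          · push Not at hpz
            have hn1 := (mem_Icc.mp hn).1
            have hn0 : (0:ℝ) < n := by exact_mod_cast hn1
            have hp0 : (0:ℝ) < p := by exact_mod_cast hp.pos
            have hpY : (p:ℝ) < Y := by
              rw [hY, ← Real.log_lt_iff_lt_exp hp0]
              have h3 : Real.log ((p:ℝ)*p) ≤ Real.log n := Real.log_le_log (by positivity) (by exact_mod_cast Nat.le_of_dvd hn1 hd)
              rw [Real.log_mul hp0.ne' hp0.ne'] at h3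
              rw [abs_lt] at hwin
              linarith
            refine (rho_le z n).trans ?_
            have := Finset.single_le_sum hnn (mem_pr.mpr ⟨hp, hpz, hpY⟩)
            rw [if_pos hd] at this
            exact this
    _ = ∑ p ∈ pr z Y, 1/((p*p:ℕ):ℝ) * SS (N/(p*p)) l (L - Real.log ((p*p : ℕ):ℝ)) (fun _ => 1) := by
        rw [SS_sum]
        refine Finset.sum_congr rfl fun p hp => ?_
        rw [mem_pr] at hp
        rw [← SS_dvd (Nat.mul_pos hp.1.pos hp.1.pos) (fun _ => 1)]
        unfold SS
        refine Finset.sum_congr rfl fun n _ => ?_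
        rw [one_mul]
    _ ≤ ∑ p ∈ pr z Y, ((9+3/ε) * (1/(p:ℝ)^2) + 3 * Real.exp (-(2/3*L))) := by
        refine Finset.sum_le_sum fun p hp => ?_
        have hp' := mem_pr.mp hp
        have hp0 : (0:ℝ) < p := by exact_mod_cast hp'.1.pos
        calc _ ≤ 1/((p*p:ℕ):ℝ) * ((9+3/ε) + 3 * ((p:ℝ)^2 * Real.exp (-(2/3*L)))) := mul_le_mul_of_nonneg_left (hT p hp) (by positivity)
          _ = _ := by push_cast; field_simp
    _ = (9+3/ε) * ∑ p ∈ pr z Y, (1/(p:ℝ)^2) + #(pr z Y) * (3 * Real.exp (-(2/3*L))) := by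
        rw [Finset.sum_add_distrib, ← Finset.mul_sum, Finset.sum_const, nsmul_eq_mul]
    _ ≤ (9+3/ε) * (2/z) + Y * (3 * Real.exp (-(2/3*L))) := by gcongr
    _ = (9+3/ε)*2 * Real.exp (-(1/R*L)) + 3 * Real.exp (51/100*L + -(2/3*L)) := by
        rw [hz, hY, Real.exp_add, div_eq_mul_inv 2, ← Real.exp_neg]
        rw [show L/(R:ℝ) = 1/R*L by ring]; ring
    _ ≤ (9+3/ε)*2 * Real.exp (-(1/R*L)) + 3 * Real.exp (-(1/10*L)) := by
        gcongr
        linarith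
    _ ≤ c/2/L + c/2/L := add_le_add h1 h2
    _ = _ := by ring

end

section
open Finset Filter

lemma rho_anti {z z' : ℝ} (h : z' ≤ z) (n : ℕ) : rho z n ≤ rho z' n := by
  by_cases hr : ∀ p : ℕ, p.Prime → p ∣ n → z' ≤ p
  · rw [rho_one hr]; exact rho_le z n
  · push Not at hr
    obtain ⟨p, hp, hd, hz⟩ := hr
    rw [rho_zero hp hd (lt_of_lt_of_le hz h)]
    exact rho_nn _ _

/-- divisors near a given scale -/
noncomputable def DD (α e L : ℝ) (N : ℕ) : Finset ℕ := (Icc 1 N).filter (fun d : ℕ => |Real.log d / L - α| ≤ e)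

lemma bad2 {R : ℕ} (hR : 1 ≤ R) : ∃ C : ℝ, 0 ≤ C ∧ ∀ (α e ε : ℝ), 1/3 ≤ α → α ≤ 1/2 → 0 < e → e ≤ 1/100 → 0 < ε → ε ≤ 1/1000 →
    ∀ᶠ L : ℝ in atTop, ∀ (N : ℕ) (l : ℝ), (l = Real.exp (-L/3) ∨ l = ε*L) →
    SS N l L (fun n => ∑ d ∈ DD α e L N, (if d ∣ n then 1 else 0) * rho (Real.exp (L/R)) n) ≤ C*e/L := by
  obtain ⟨c0, hc0⟩ := US'
  set R' : ℕ := R + 12*c0 with hR'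
  have hR1 : 1 ≤ R' := by omega
  have hR0 : (0:ℝ) < R' := by exact_mod_cast hR1
  have hcR : (c0:ℝ)/R' ≤ 1/12 := by
    rw [div_le_div_iff₀ hR0 (by norm_num)]
    have : c0*12 ≤ 1*R' := by omega
    exact_mod_cast this
  refine ⟨36*(R':ℝ)^2, by positivity, fun α e ε hα hα2 he he1 hε hε1 => ?_⟩
  have e1 := ev_small' (C := 16*Real.exp 4) (c := 1) (a := 1/20) (by positivity) (by positivity)
  have e2 := ev_small' (C := 16) (c := 1) (a := 1/20) (by positivity) (by positivity)
  filter_upwards [e1, e2, eventually_ge_atTop 1000, eventually_ge_atTop (R':ℝ), eventually_ge_atTop (1/ε), eventually_ge_atTop (1/e)] with L h1 h2 hL hLR hLε hLe N l hl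
  have hL0 : 0 < L := by linarith
  have hLε' : 1 ≤ ε * L := by rw [div_le_iff₀ hε] at hLε; linarith
  have hLe' : 1 ≤ e * L := by rw [div_le_iff₀ he] at hLe; linarith
  have hi : 1/L ≤ 1 := by rw [div_le_one hL0]; linarith
  have h1' : 16*Real.exp 4 ≤ Real.exp (1/20*L) := by
    have := h1.trans hi
    rw [Real.exp_neg, ← div_eq_mul_inv, div_le_one (Real.exp_pos _)] at this
    exact this
  have h2' : 16 ≤ Real.exp (1/20*L) := by
    have := h2.trans hi
    rw [Real.exp_neg, ← div_eq_mul_inv, div_le_one (Real.exp_pos _)] at this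
    exact this
  have hlpos : 0 < l := by rcases hl with rfl | rfl <;> positivity
  set z := Real.exp (L/R) with hz
  set z' := Real.exp (L/R') with hz'
  have hRR : (R:ℝ) ≤ R' := by exact_mod_cast (by omega : R ≤ R')
  have hRp : (0:ℝ) < R := by exact_mod_cast hR
  have hzz : z' ≤ z := Real.exp_le_exp.mpr (by gcongr)
  have hz2 : 2 ≤ z' := by
    have : 1 ≤ L/R' := by rw [le_div_iff₀ hR0]; linarith
    have := Real.exp_le_exp.mpr this
    linarith [Real.exp_one_gt_d9]
  have hlz : Real.log z' = L/R' := Real.log_exp _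
  have hzc : z'^c0 ≤ Real.exp (1/12*L) := by
    rw [hz', ← Real.exp_nat_mul]
    apply Real.exp_le_exp.mpr
    calc (c0:ℝ)*(L/R') = (c0/R')*L := by ring
      _ ≤ _ := by gcongr
  -- inner
  have hin : ∀ d ∈ DD α e L N, SS (N/d) l (L - Real.log d) (rho z') ≤ 3*R'/L := by
    intro d hd
    unfold DD at hd
    rw [mem_filter, abs_le] at hd
    have hdl : Real.log d ≤ (α+e)*L := by
      have : Real.log d / L ≤ α+e := by linarith [hd.2.2]
      rwa [div_le_iff₀ hL0] at this
    refine (hc0 z' l _ _ hz2 hlpos ?_).trans (le_of_eq ?_)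
    · have hy : 49/100*L ≤ L - Real.log d := by nlinarith
      rcases hl with rfl | rfl
      · have hl1 : Real.exp (-L/3) ≤ 1 := Real.exp_le_one_iff.mpr (by linarith)
        calc 16 * Real.exp (4*Real.exp (-L/3)) * z'^c0 ≤ 16 * Real.exp 4 * Real.exp (1/12*L) := by
              gcongr
              linarith
          _ ≤ Real.exp (1/20*L) * Real.exp (1/12*L) := by gcongr
          _ ≤ Real.exp (-L/3) * Real.exp (L - Real.log d) := by
              rw [← Real.exp_add, ← Real.exp_add]
              apply Real.exp_le_exp.mpr; linarith
      · have hx : Real.exp (4*(ε*L)) ≤ Real.exp (1/100*L) := Real.exp_le_exp.mpr (by nlinarith)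
        calc 16 * Real.exp (4*(ε*L)) * z'^c0 ≤ Real.exp (1/20*L) * Real.exp (1/100*L) * Real.exp (1/12*L) := by
              gcongr
          _ ≤ 1 * Real.exp (L - Real.log d) := by
              rw [← Real.exp_add, ← Real.exp_add, one_mul]
              apply Real.exp_le_exp.mpr; linarith
          _ ≤ _ := by gcongr
    · rw [hlz]; field_simp
  have hout : ∑ d ∈ DD α e L N, 1/(d:ℝ) * rho z' d ≤ 12*e*R' := by
    have hb : SS N (2*e*L) (α*L) (rho z') ≤ 3*R'/L := by
      refine (hc0 z' _ _ _ hz2 (by positivity) ?_).trans (le_of_eq ?_)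
      · have hx : Real.exp (4*(2*e*L)) ≤ Real.exp (8/100*L) := Real.exp_le_exp.mpr (by nlinarith)
        calc 16 * Real.exp (4*(2*e*L)) * z'^c0 ≤ Real.exp (1/20*L) * Real.exp (8/100*L) * Real.exp (1/12*L) := by
              gcongr
          _ ≤ 1 * Real.exp (α*L) := by
              rw [← Real.exp_add, ← Real.exp_add, one_mul]
              apply Real.exp_le_exp.mpr; nlinarith
          _ ≤ _ := by
              gcongr
              linarith
      · rw [hlz]; field_simp
    calc _ ≤ ∑ d ∈ DD α e L N, (4*e*L) * (rho z' d * (1/(d:ℝ) * Wk (2*e*L) (Real.log d - α*L))) := by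
          refine Finset.sum_le_sum fun d hd => ?_
          unfold DD at hd
          rw [mem_filter] at hd
          have hv : |Real.log d - α*L| ≤ e*L := by
            have : Real.log d - α*L = (Real.log d / L - α)*L := by field_simp
            rw [this, abs_mul, abs_of_pos hL0]
            exact mul_le_mul_of_nonneg_right hd.2 hL0.le
          have hw : 1 ≤ (4*e*L) * Wk (2*e*L) (Real.log d - α*L) := by
            unfold Wk
            have hel : 0 < 2*e*L := by positivity
            have ha : |(Real.log d - α*L)/(2*e*L)| ≤ 1/2 := by
              rw [abs_div, abs_of_pos hel, div_le_iff₀ hel]; linarith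
            have hb : 1/2 ≤ kk ((Real.log d - α*L)/(2*e*L)) := by
              rw [kk_eq (by linarith)]; linarith
            calc (1:ℝ) = (4*e*L) * ((1/2)/(2*e*L)) := by field_simp; norm_num
              _ ≤ _ := by gcongr
          have h0 : 0 ≤ 1/(d:ℝ) * rho z' d := mul_nonneg (by positivity) (rho_nn _ _)
          calc 1/(d:ℝ) * rho z' d = 1/(d:ℝ) * rho z' d * 1 := (mul_one _).symm
            _ ≤ 1/(d:ℝ) * rho z' d * ((4*e*L) * Wk (2*e*L) (Real.log d - α*L)) := mul_le_mul_of_nonneg_left hw h0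
            _ = _ := by ring
      _ ≤ (4*e*L) * SS N (2*e*L) (α*L) (rho z') := by
          rw [← Finset.mul_sum]
          refine mul_le_mul_of_nonneg_left ?_ (by positivity)
          unfold SS
          refine Finset.sum_le_sum_of_subset_of_nonneg (filter_subset _ _) fun d _ _ => ?_
          exact mul_nonneg (rho_nn _ _) (mul_nonneg (by positivity) (Wk_nonneg (by positivity) _))
      _ ≤ (4*e*L) * (3*R'/L) := by gcongr
      _ = _ := by field_simp; norm_num
  calc _ = ∑ d ∈ DD α e L N, 1/(d:ℝ) * SS (N/d) l (L - Real.log d) (fun k => rho z (d*k)) := by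
        rw [SS_sum]
        refine Finset.sum_congr rfl fun d hd => ?_
        unfold DD at hd
        rw [mem_filter, mem_Icc] at hd
        rw [← SS_dvd hd.1.1]
        unfold SS
        refine Finset.sum_congr rfl fun n _ => ?_
        ring
    _ ≤ ∑ d ∈ DD α e L N, 1/(d:ℝ) * (rho z' d * (3*R'/L)) := by
        refine Finset.sum_le_sum fun d hd => mul_le_mul_of_nonneg_left ?_ (by positivity)
        calc SS (N/d) l (L - Real.log d) (fun k => rho z (d*k)) ≤ SS (N/d) l (L - Real.log d) (fun k => rho z' d * rho z' k) := by
              refine SS_mono hlpos fun n _ _ => ?_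
              rw [← rho_mul]
              exact rho_anti hzz _
          _ = rho z' d * SS (N/d) l (L - Real.log d) (rho z') := SS_smul _ _ _ _ _
          _ ≤ _ := mul_le_mul_of_nonneg_left (hin d hd) (rho_nn _ _)
    _ = (∑ d ∈ DD α e L N, 1/(d:ℝ) * rho z' d) * (3*R'/L) := by
        rw [Finset.sum_mul]
        exact Finset.sum_congr rfl fun d _ => by ring
    _ ≤ (12*e*R') * (3*R'/L) := by gcongr
    _ = _ := by ring

theorem bad_sum {R : ℕ} (hR : 1 ≤ R) : ∃ C : ℝ, 0 ≤ C ∧ ∀ (e ε : ℝ), 0 < e → e ≤ 1/100 → 0 < ε → ε ≤ 1/1000 →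
    ∀ᶠ L : ℝ in atTop, ∀ (N : ℕ) (l : ℝ), (l = Real.exp (-L/3) ∨ l = ε*L) → SS N l L (BB e L (Real.exp (L/R))) ≤ C*e/L := by
  classical
  obtain ⟨C, hC, h⟩ := bad2 hR
  refine ⟨2*C+1, by positivity, fun e ε he he1 hε hε1 => ?_⟩
  filter_upwards [h (1/2) e ε (by norm_num) le_rfl he he1 hε hε1, h (1/3) e ε le_rfl (by norm_num) he he1 hε hε1, bad1 hR hε hε1 he, eventually_gt_atTop 0] with L h2 h3 h1 hL N l hl
  have hlpos : 0 < l := by rcases hl with rfl | rfl <;> positivity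
  set z := Real.exp (L/R)
  calc SS N l L (BB e L z) ≤ SS N l L (fun n => (fun n => (if Squarefree n then 0 else rho z n)) n + (fun n => (fun n => ∑ d ∈ DD (1/2) e L N, (if d ∣ n then 1 else 0) * rho z n) n
        + (fun n => ∑ d ∈ DD (1/3) e L N, (if d ∣ n then 1 else 0) * rho z n) n) n) := by
        refine SS_mono hlpos fun n hn _ => ?_
        simp only
        rw [mem_Icc] at hn
        have hr0 := rho_nn z n
        have hs : ∀ α, ∀ d ∈ DD α e L N, 0 ≤ (if d ∣ n then 1 else 0) * rho z n := fun α d _ => by split_ifs <;> simp [hr0]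
        have p2 := Finset.sum_nonneg (hs (1/2))
        have p3 := Finset.sum_nonneg (hs (1/3))
        unfold BB
        by_cases hb : Bad e L n
        · rw [if_pos hb]
          by_cases hsq : Squarefree n
          · rw [if_pos hsq]
            unfold Bad at hb
            have hb' := hb.resolve_left (not_not.mpr hsq)
            obtain ⟨d, hd, hd'⟩ := hb'
            have hd1 : 1 ≤ d := Nat.pos_of_dvd_of_pos hd hn.1
            have hdN : d ≤ N := (Nat.le_of_dvd hn.1 hd).trans hn.2
            rcases hd' with hd' | hd'
            · have := Finset.single_le_sum (hs (1/2)) (mem_filter.mpr ⟨mem_Icc.mpr ⟨hd1, hdN⟩, hd'⟩ : d ∈ DD (1/2) e L N)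
              rw [if_pos hd, one_mul] at this
              linarith
            · have := Finset.single_le_sum (hs (1/3)) (mem_filter.mpr ⟨mem_Icc.mpr ⟨hd1, hdN⟩, hd'⟩ : d ∈ DD (1/3) e L N)
              rw [if_pos hd, one_mul] at this
              linarith
          · rw [if_neg hsq]; linarith
        · rw [if_neg hb]
          have : (0:ℝ) ≤ if Squarefree n then 0 else rho z n := by split_ifs <;> simp [hr0]
          linarith
    _ = _ := by rw [SS_add, SS_add]
    _ ≤ e/L + (C*e/L + C*e/L) := add_le_add (h1 N l hl) (add_le_add (h2 N l hl) (h3 N l hl))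
    _ = _ := by ring

end

section
open Finset Filter

lemma SS_cells {ε η L y : ℝ} {N Ja Jb : ℕ} (hε : 0 < ε) (hη : 0 < η) (hL : 0 < L) (hN : ∀ j ∈ Ico Ja Jb, ∀ p ∈ cel η L j, p ≤ N)
    (h : ∀ p : ℕ, |Real.log p - y| < ε*L → fl η L p ∈ Ico Ja Jb) :
    SS N (ε*L) y PP = ∑ j ∈ Ico Ja Jb, ∑ p ∈ cel η L j, (1/(p:ℝ)) * Wk (ε*L) (Real.log p - y) := by
  classical
  have h1 : SS N (ε*L) y PP = ∑ n ∈ (Icc 1 N).filter (fun n => n.Prime ∧ fl η L n ∈ Ico Ja Jb), (1/(n:ℝ)) * Wk (ε*L) (Real.log n - y) := by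
    unfold SS
    rw [Finset.sum_filter]
    refine Finset.sum_congr rfl fun n _ => ?_
    unfold PP
    by_cases hp : n.Prime
    · rw [if_pos hp, one_mul]
      by_cases hf : fl η L n ∈ Ico Ja Jb
      · rw [if_pos ⟨hp, hf⟩]
      · rw [if_neg (fun h => hf h.2), Wk_zero (by positivity), mul_zero]
        by_contra hlt
        exact hf (h n (not_le.mp hlt))
    · rw [if_neg hp, if_neg (fun h => hp h.1), zero_mul]
  rw [h1, ← Finset.sum_fiberwise_of_maps_to (t := Ico Ja Jb) (g := fun n => fl η L n)]
  · refine Finset.sum_congr rfl fun j hj => Finset.sum_congr ?_ fun _ _ => rfl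
    ext p
    simp only [mem_filter, mem_Icc]
    constructor
    · rintro ⟨⟨_, hp, _⟩, hf⟩; exact (mem_cel hη hL).mpr ⟨hp, hf⟩
    · intro hp
      have hp' := (mem_cel hη hL).mp hp
      exact ⟨⟨⟨hp'.1.one_le, hN j hj p hp⟩, hp'.1, by rw [hp'.2]; exact hj⟩, hp'.2⟩
  · intro n hn
    exact (mem_filter.mp hn).2.2

lemma PW {ε : ℝ} (hε : 0 < ε) (hε1 : ε ≤ 1/1000) : ∀ᶠ L : ℝ in atTop, ∀ N : ℕ, Real.exp (2*L) ≤ N → ∀ y : ℝ, L/4 ≤ y → y ≤ L →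
    SS N (ε*L) y PP ≤ (1/(y/L - 2*ε) + 1/1000) * (1 + 1/1000) / L ∧ (1/(y/L + 2*ε) - 2/1000) / L ≤ SS N (ε*L) y PP := by
  obtain ⟨η, hη⟩ : ∃ η : ℝ, η = ε^2/1000 := ⟨_, rfl⟩
  have hη0 : 0 < η := by rw [hη]; positivity
  have hηε : η ≤ ε/1000 := by rw [hη]; nlinarith
  set J1 := ⌈2/η⌉₊ with hJ1
  have hev : ∀ᶠ L : ℝ in atTop, ∀ j ∈ Ico 1 J1, |∑ p ∈ cel η L j, 1/(p:ℝ) - Real.log ((((j:ℝ)+1)*η)/((j:ℝ)*η))| ≤ η/1000 := by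
    rw [Filter.eventually_all_finset]
    intro j hj
    have hj0 : (0:ℝ) < j := by exact_mod_cast (mem_Ico.mp hj).1
    obtain ⟨K, L0, _, _, h⟩ := prime_sums (a := (j:ℝ)*η) (b := ((j:ℝ)+1)*η) (δ := η/1000) (by positivity) (by nlinarith) (by positivity)
    filter_upwards [eventually_ge_atTop L0] with L hL
    exact (h L hL).1
  filter_upwards [hev, eventually_ge_atTop 1] with L hm hL1 N hN y hy1 hy2
  have hL0 : 0 < L := by linarith
  obtain ⟨β, hβ⟩ : ∃ β : ℝ, β = y/L := ⟨_, rfl⟩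
  have hyβ : y = β*L := by rw [hβ]; field_simp
  have hβ1 : 1/4 ≤ β := by rw [hβ, le_div_iff₀ hL0]; linarith
  have hβ2 : β ≤ 1 := by rw [hβ, div_le_iff₀ hL0]; linarith
  rw [← hβ]
  set Ja := ⌊(β-ε)/η⌋₊ with hJa
  set Jb := ⌊(β+ε)/η⌋₊ + 1 with hJb
  have hJa1 : (Ja:ℝ) * η ≤ β - ε := by
    have := Nat.floor_le (div_nonneg (by linarith : 0 ≤ β-ε) hη0.le)
    rwa [le_div_iff₀ hη0] at this
  have hJa2 : β - ε - η ≤ (Ja:ℝ) * η := by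
    have := Nat.lt_floor_add_one ((β-ε)/η)
    rw [div_lt_iff₀ hη0] at this
    linarith
  have hJb1 : β + ε ≤ (Jb:ℝ) * η := by
    have := Nat.lt_floor_add_one ((β+ε)/η)
    rw [div_lt_iff₀ hη0] at this
    rw [hJb]; push_cast; linarith
  have hJb2 : (Jb:ℝ) * η ≤ β + ε + η := by
    have := Nat.floor_le (div_nonneg (by linarith : 0 ≤ β+ε) hη0.le)
    rw [le_div_iff₀ hη0] at this
    rw [hJb]; push_cast; linarith
  have hJab : Ja ≤ Jb := by
    have : (Ja:ℝ) * η ≤ (Jb:ℝ) * η := by linarith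
    exact_mod_cast le_of_mul_le_mul_right this hη0
  have hj : ∀ j ∈ Ico Ja Jb, β - 2*ε ≤ (j:ℝ)*η ∧ ((j:ℝ)+1)*η ≤ β + 2*ε := by
    intro j hj
    rw [mem_Ico] at hj
    have h1 : (Ja:ℝ) ≤ j := by exact_mod_cast hj.1
    have h2 : (j:ℝ) + 1 ≤ Jb := by exact_mod_cast hj.2
    have h3 := mul_le_mul_of_nonneg_right h1 hη0.le
    have h4 := mul_le_mul_of_nonneg_right h2 hη0.le
    constructor <;> linarith
  have hjJ : ∀ j ∈ Ico Ja Jb, j ∈ Ico 1 J1 := by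
    intro j hj'
    obtain ⟨h1, h2⟩ := hj j hj'
    rw [mem_Ico]
    constructor
    · by_contra h
      have : j = 0 := by omega
      rw [this] at h1; norm_num at h1; linarith
    · have : (j:ℝ) < 2/η := by rw [lt_div_iff₀ hη0]; linarith
      exact_mod_cast lt_of_lt_of_le this (Nat.le_ceil _)
  obtain ⟨m, hmdef⟩ : ∃ m : ℕ → ℝ, m = fun j => ∑ p ∈ cel η L j, 1/(p:ℝ) := ⟨_, rfl⟩
  obtain ⟨U, hU⟩ : ∃ U : ℝ, U = 1/(β-2*ε) + 1/1000 := ⟨_, rfl⟩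
  obtain ⟨V, hV⟩ : ∃ V : ℝ, V = 1/(β+2*ε) - 1/1000 := ⟨_, rfl⟩
  have hm0 : ∀ j, 0 ≤ m j := fun j => by rw [hmdef]; exact Finset.sum_nonneg fun p _ => by positivity
  have hmU : ∀ j ∈ Ico Ja Jb, m j ≤ η * U := by
    intro j hj'
    obtain ⟨h1, h2⟩ := hj j hj'
    have hj1 := (mem_Ico.mp (hjJ j hj')).1
    have hj0 : (0:ℝ) < j := by exact_mod_cast hj1
    have h3 := (abs_le.mp (hm j (hjJ j hj'))).2
    have h4 := Real.log_le_sub_one_of_pos (x := (((j:ℝ)+1)*η)/((j:ℝ)*η)) (by positivity)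
    have h5 : (((j:ℝ)+1)*η)/((j:ℝ)*η) - 1 = η * (1/((j:ℝ)*η)) := by field_simp; ring
    have h6 : 1/((j:ℝ)*η) ≤ 1/(β-2*ε) := one_div_le_one_div_of_le (by linarith) h1
    have h7 := mul_le_mul_of_nonneg_left h6 hη0.le
    rw [hmdef, hU]; simp only
    linarith
  have hmV : ∀ j ∈ Ico Ja Jb, η * V ≤ m j := by
    intro j hj'
    obtain ⟨h1, h2⟩ := hj j hj'
    have hj1 := (mem_Ico.mp (hjJ j hj')).1
    have hj0 : (0:ℝ) < j := by exact_mod_cast hj1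
    have h3 := (abs_le.mp (hm j (hjJ j hj'))).1
    have h4 := Real.one_sub_inv_le_log_of_pos (x := (((j:ℝ)+1)*η)/((j:ℝ)*η)) (by positivity)
    have h5 : 1 - ((((j:ℝ)+1)*η)/((j:ℝ)*η))⁻¹ = η * (1/(((j:ℝ)+1)*η)) := by field_simp; ring
    have h6 : 1/(β+2*ε) ≤ 1/(((j:ℝ)+1)*η) := one_div_le_one_div_of_le (by positivity) h2
    have h7 := mul_le_mul_of_nonneg_left h6 hη0.le
    rw [hmdef, hV]; simp only
    linarith
  have hU0 : 0 ≤ U := by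
    rw [hU]
    have : 0 ≤ 1/(β-2*ε) := one_div_nonneg.mpr (by linarith)
    linarith
  have hU6 : U ≤ 6 := by
    rw [hU]
    have : 1/(β-2*ε) ≤ 5 := by rw [div_le_iff₀ (by linarith)]; linarith
    linarith
  have hV0 : 0 ≤ V := by
    rw [hV]
    have : 1/2 ≤ 1/(β+2*ε) := one_div_le_one_div_of_le (by linarith) (by linarith)
    linarith
  -- number of cells
  have hcard : (#(Ico Ja Jb) : ℝ) * η ≤ 3*ε := by
    rw [Nat.card_Ico, Nat.cast_sub hJab, sub_mul]
    linarith
  have hlpos : 0 < ε*L := by positivity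
  -- integrals
  obtain ⟨I, hI⟩ : ∃ I : ℕ → ℝ, I = fun j : ℕ => ∫ t in ((j:ℝ)*η*L)..(((j+1:ℕ):ℝ)*η*L), Wk (ε*L) (t - y) := ⟨_, rfl⟩
  have hcont : Continuous fun t : ℝ => Wk (ε*L) (t - y) := (Wk_cont _).comp (by fun_prop)
  have hI0 : ∀ j, 0 ≤ I j := by
    intro j
    rw [hI]
    refine intervalIntegral.integral_nonneg ?_ fun t _ => Wk_nonneg hlpos _
    push_cast
    have : (j:ℝ) ≤ j+1 := by linarith
    gcongr
  have hIsum : ∑ j ∈ Ico Ja Jb, I j = 1 := by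
    rw [hI, intervalIntegral.sum_integral_adjacent_intervals_Ico (a := fun j : ℕ => (j:ℝ)*η*L) hJab (fun k _ => hcont.intervalIntegrable _ _)]
    rw [intervalIntegral.integral_comp_sub_right (fun t => Wk (ε*L) t)]
    refine int_Wk hlpos ?_ ?_
    · rw [hyβ]; nlinarith
    · rw [hyβ]; nlinarith
  have hav : ∀ j, ∀ p ∈ cel η L j, |Wk (ε*L) (Real.log p - y) - I j/(η*L)| ≤ (1/1000)/L := by
    intro j p hp
    obtain ⟨hpp, hpf⟩ := (mem_cel hη0 hL0).mp hp
    have h0 : 0 ≤ Real.log p / L / η := div_nonneg (div_nonneg (Real.log_natCast_nonneg _) hL0.le) hη0.le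
    have h1 := Nat.floor_le h0
    have h2 := (Nat.lt_floor_add_one (Real.log p / L / η)).le
    unfold fl at hpf
    rw [hpf, le_div_iff₀ hη0, le_div_iff₀ hL0] at h1
    rw [hpf, div_le_iff₀ hη0, div_le_iff₀ hL0] at h2
    have hconst : ∫ t in ((j:ℝ)*η*L)..(((j+1:ℕ):ℝ)*η*L), Wk (ε*L) (Real.log p - y) = η*L * Wk (ε*L) (Real.log p - y) := by
      rw [intervalIntegral.integral_const, smul_eq_mul]; push_cast; ring
    have hdiff : η*L * Wk (ε*L) (Real.log p - y) - I j = ∫ t in ((j:ℝ)*η*L)..(((j+1:ℕ):ℝ)*η*L), (Wk (ε*L) (Real.log p - y) - Wk (ε*L) (t - y)) := by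
      rw [intervalIntegral.integral_sub (continuous_const.intervalIntegrable _ _) (hcont.intervalIntegrable _ _), hconst, hI]
    have hle : ((j:ℝ)*η*L) ≤ (((j+1:ℕ):ℝ)*η*L) := by
      push_cast
      have : (j:ℝ) ≤ j+1 := by linarith
      gcongr
    have hb : ‖∫ t in ((j:ℝ)*η*L)..(((j+1:ℕ):ℝ)*η*L), (Wk (ε*L) (Real.log p - y) - Wk (ε*L) (t - y))‖ ≤ ((1/1000)/L) * |(((j+1:ℕ):ℝ)*η*L) - ((j:ℝ)*η*L)| := by
      refine intervalIntegral.norm_integral_le_of_norm_le_const fun t ht => ?_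
      rw [Set.uIoc_of_le hle, Set.mem_Ioc] at ht
      push_cast at ht
      rw [Real.norm_eq_abs]
      refine (Wk_lip hlpos _ _).trans ?_
      have h3 : |Real.log p - y - (t - y)| ≤ η*L := by
        rw [abs_le]
        constructor <;> linarith [ht.1, ht.2]
      calc _ ≤ η*L/(ε*L)^2 := by gcongr
        _ = _ := by rw [hη]; field_simp
    rw [← hdiff, Real.norm_eq_abs, abs_of_nonneg (by linarith : 0 ≤ (((j+1:ℕ):ℝ)*η*L) - ((j:ℝ)*η*L))] at hb
    have h4 : (((j+1:ℕ):ℝ)*η*L) - ((j:ℝ)*η*L) = η*L := by push_cast; ring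
    rw [h4] at hb
    have h5 : Wk (ε*L) (Real.log p - y) - I j/(η*L) = (η*L * Wk (ε*L) (Real.log p - y) - I j)/(η*L) := by field_simp
    rw [h5, abs_div, abs_of_pos (by positivity : 0 < η*L), div_le_iff₀ (by positivity)]
    exact hb
  have hSS : SS N (ε*L) y PP = ∑ j ∈ Ico Ja Jb, ∑ p ∈ cel η L j, (1/(p:ℝ)) * Wk (ε*L) (Real.log p - y) := by
    refine SS_cells hε hη0 hL0 ?_ ?_
    · intro j hj' p hp
      unfold cel at hp
      have h1 := (mem_pr.mp hp).2.2
      have h2 := (hj j hj').2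
      have h3 : Real.exp (((j:ℝ)+1)*η*L) ≤ Real.exp (2*L) := by
        apply Real.exp_le_exp.mpr
        have : ((j:ℝ)+1)*η ≤ 2 := by linarith
        gcongr
      exact_mod_cast (h1.le.trans h3).trans hN
    · intro p hp
      rw [abs_lt, hyβ] at hp
      unfold fl
      rw [mem_Ico]
      have h1 : β - ε ≤ Real.log p / L := by rw [le_div_iff₀ hL0]; linarith
      have h2 : Real.log p / L ≤ β + ε := by rw [div_le_iff₀ hL0]; linarith
      constructor
      · exact Nat.floor_le_floor (by gcongr)
      · exact Nat.lt_succ_of_le (Nat.floor_le_floor (by gcongr))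
  have hxu : ∀ j, ∑ p ∈ cel η L j, (1/(p:ℝ)) * Wk (ε*L) (Real.log p - y) ≤ m j * (I j/(η*L) + (1/1000)/L) := by
    intro j
    rw [hmdef, Finset.sum_mul]
    refine Finset.sum_le_sum fun p hp => mul_le_mul_of_nonneg_left ?_ (by positivity)
    linarith [(abs_le.mp (hav j p hp)).2]
  have hxl : ∀ j, m j * (I j/(η*L) - (1/1000)/L) ≤ ∑ p ∈ cel η L j, (1/(p:ℝ)) * Wk (ε*L) (Real.log p - y) := by
    intro j
    rw [hmdef, Finset.sum_mul]
    refine Finset.sum_le_sum fun p hp => mul_le_mul_of_nonneg_left ?_ (by positivity)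
    linarith [(abs_le.mp (hav j p hp)).1]
  rw [hSS]
  obtain ⟨w, hw⟩ : ∃ w : ℝ, w = (#(Ico Ja Jb) : ℝ) := ⟨_, rfl⟩
  rw [← hw] at hcard
  have hq1 : η * U * (1/(η*L) + w * ((1/1000)/L)) = U * (1 + (w * η) * (1/1000)) / L := by
    clear_value Ja Jb
    clear * - hη0 hL0
    field_simp
  have hq2 : η * V * (1/(η*L)) - w * (η * U * ((1/1000)/L)) = (V - (w * η) * U * (1/1000)) / L := by
    clear_value Ja Jb
    clear * - hη0 hL0
    field_simp
  constructor
  · calc _ ≤ ∑ j ∈ Ico Ja Jb, η * U * (I j/(η*L) + (1/1000)/L) := by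
          refine Finset.sum_le_sum fun j hj' => (hxu j).trans ?_
          refine mul_le_mul_of_nonneg_right (hmU j hj') ?_
          have := hI0 j
          positivity
      _ = η * U * (1/(η*L) + w * ((1/1000)/L)) := by
          rw [hw, ← Finset.mul_sum, Finset.sum_add_distrib, ← Finset.sum_div, hIsum, Finset.sum_const, nsmul_eq_mul]
      _ = U * (1 + (w * η) * (1/1000)) / L := hq1
      _ ≤ U * (1 + 1/1000) / L := by
          gcongr
          linarith
      _ = _ := by rw [hU]
  · have h1 : ∑ j ∈ Ico Ja Jb, (η * V * (I j/(η*L)) - η * U * ((1/1000)/L)) ≤ ∑ j ∈ Ico Ja Jb, ∑ p ∈ cel η L j, (1/(p:ℝ)) * Wk (ε*L) (Real.log p - y) := by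
      refine Finset.sum_le_sum fun j hj' => le_trans ?_ (hxl j)
      rw [mul_sub]
      have a1 : η * V * (I j/(η*L)) ≤ m j * (I j/(η*L)) := mul_le_mul_of_nonneg_right (hmV j hj') (div_nonneg (hI0 j) (by positivity))
      have a2 : m j * ((1/1000)/L) ≤ η * U * ((1/1000)/L) := mul_le_mul_of_nonneg_right (hmU j hj') (by positivity)
      linarith
    refine le_trans ?_ h1
    have h2 : ∑ j ∈ Ico Ja Jb, (η * V * (I j/(η*L)) - η * U * ((1/1000)/L)) = (V - (w * η) * U * (1/1000)) / L := by
      rw [← hq2, hw, Finset.sum_sub_distrib, ← Finset.mul_sum, ← Finset.sum_div, hIsum, Finset.sum_const, nsmul_eq_mul]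
    rw [h2]
    refine div_le_div_of_nonneg_right ?_ hL0.le
    have h3 : (w * η) * U ≤ (3*ε)*6 := mul_le_mul hcard hU6 hU0 (by positivity)
    rw [hV]
    linarith

end

section
open Finset Filter

lemma PP_nonneg (n : ℕ) : 0 ≤ PP n := by unfold PP; split_ifs <;> norm_num

noncomputable def bx (L a b c d : ℝ) (n : ℕ) : ℝ :=
  ∑ P ∈ pr (Real.exp (a*L)) (Real.exp (b*L)) ×ˢ pr (Real.exp (c*L)) (Real.exp (d*L)), (if P.1*P.2 ∣ n then 1 else 0) * PP (n/(P.1*P.2))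

lemma bx_nonneg (L a b c d : ℝ) (n : ℕ) : 0 ≤ bx L a b c d n := by
  unfold bx
  refine Finset.sum_nonneg fun P _ => mul_nonneg ?_ (PP_nonneg _)
  split_ifs <;> norm_num

lemma bx_ge {L a b c d : ℝ} {n p q r : ℕ} (hL : 0 < L) (hp : p.Prime) (hq : q.Prime) (hr : r.Prime) (hn : n = p*q*r)
    (h1 : a ≤ Real.log p / L) (h2 : Real.log p / L < b) (h3 : c ≤ Real.log q / L) (h4 : Real.log q / L < d) : 1 ≤ bx L a b c d n := by
  unfold bx
  have hm : (p, q) ∈ pr (Real.exp (a*L)) (Real.exp (b*L)) ×ˢ pr (Real.exp (c*L)) (Real.exp (d*L)) :=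
    mem_product.mpr ⟨(mem_pr_log hL).mpr ⟨hp, h1, h2⟩, (mem_pr_log hL).mpr ⟨hq, h3, h4⟩⟩
  refine le_trans ?_ (Finset.single_le_sum (f := fun P : ℕ × ℕ => (if P.1*P.2 ∣ n then (1:ℝ) else 0) * PP (n/(P.1*P.2))) (fun P _ => mul_nonneg (by split_ifs <;> norm_num) (PP_nonneg _)) hm)
  have h5 : n / (p*q) = r := by rw [hn]; exact Nat.mul_div_cancel_left _ (Nat.mul_pos hp.pos hq.pos)
  simp only
  rw [h5, if_pos (Dvd.intro _ hn.symm)]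
  unfold PP
  rw [if_pos hr]; norm_num

lemma EE_le {L : ℝ} {n : ℕ} (hL : 0 < L) : EE L n ≤ bx L (1/4) (7/24) (5/24) (7/24) n + bx L (7/24) (1/3) (1/6) (1/3) n := by
  classical
  have b1 := bx_nonneg L (1/4) (7/24) (5/24) (7/24) n
  have b2 := bx_nonneg L (7/24) (1/3) (1/6) (1/3) n
  unfold EE
  split_ifs with h
  · have key : ∀ p q r : ℕ, p.Prime → q.Prime → r.Prime → n = p*q*r → Real.log p / L < 1/3 → Real.log q / L < 1/3 →
        1/2 < Real.log p / L + Real.log q / L → Real.log q / L ≤ Real.log p / L →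
        1 ≤ bx L (1/4) (7/24) (5/24) (7/24) n + bx L (7/24) (1/3) (1/6) (1/3) n := by
      intro p q r hp hq hr hn h1 h2 h3 h4
      by_cases h5 : Real.log p / L < 7/24
      · have := bx_ge (a := 1/4) (b := 7/24) (c := 5/24) (d := 7/24) hL hp hq hr hn (by linarith) h5 (by linarith) (by linarith)
        linarith
      · have := bx_ge (a := 7/24) (b := 1/3) (c := 1/6) (d := 1/3) hL hp hq hr hn (by linarith) h1 (by linarith) h2
        linarith
    obtain ⟨p, q, r, hp, hq, hr, hn, h1, h2, h3⟩ := h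
    rcases le_total (Real.log q / L) (Real.log p / L) with h4 | h4
    · exact key p q r hp hq hr hn h1 h2 h3 h4
    · exact key q p r hq hp hr (by rw [hn]; ring) h2 h1 (by linarith) h4
  · linarith

lemma bx_sum {ε a b c d : ℝ} (hε : 0 < ε) (hε1 : ε ≤ 1/1000) (ha : 0 < a) (hab : a < b) (hb : b ≤ 1/3) (hc : 0 < c) (hcd : c < d) (hd : d ≤ 1/3) :
    ∀ᶠ L : ℝ in atTop, ∀ N : ℕ, Real.exp (2*L) ≤ N →
      SS N (ε*L) L (bx L a b c d) ≤ (Real.log (b/a) + 1/1000) * (Real.log (d/c) + 1/1000) * ((304/100)/L) := by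
  obtain ⟨K1, L1, _, _, H1⟩ := prime_sums (δ := 1/1000) ha hab (by norm_num)
  obtain ⟨K2, L2, _, _, H2⟩ := prime_sums (δ := 1/1000) hc hcd (by norm_num)
  filter_upwards [PW hε hε1, eventually_ge_atTop L1, eventually_ge_atTop L2, eventually_ge_atTop 1] with L hPW hL1 hL2 hL N hN
  have hL0 : 0 < L := by linarith
  have hlpos : 0 < ε*L := by positivity
  have s1 := (abs_le.mp (H1 L hL1).1).2
  have s2 := (abs_le.mp (H2 L hL2).1).2
  unfold bx
  rw [SS_sum]
  have hterm : ∀ P ∈ pr (Real.exp (a*L)) (Real.exp (b*L)) ×ˢ pr (Real.exp (c*L)) (Real.exp (d*L)),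
      SS N (ε*L) L (fun n => (if P.1*P.2 ∣ n then 1 else 0) * PP (n/(P.1*P.2))) ≤ (1/(P.1:ℝ)) * (1/(P.2:ℝ)) * ((304/100)/L) := by
    intro P hP
    obtain ⟨hP1, hP2⟩ := mem_product.mp hP
    obtain ⟨p1, u1, u2⟩ := (mem_pr_log hL0).mp hP1
    obtain ⟨p2, v1, v2⟩ := (mem_pr_log hL0).mp hP2
    have hpos : 0 < P.1*P.2 := Nat.mul_pos p1.pos p2.pos
    have e1 : SS N (ε*L) L (fun n => (if P.1*P.2 ∣ n then 1 else 0) * PP (n/(P.1*P.2))) =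
        (1/((P.1*P.2:ℕ):ℝ)) * SS (N/(P.1*P.2)) (ε*L) (L - Real.log ((P.1*P.2:ℕ):ℝ)) PP := by
      have := SS_dvd (N := N) (l := ε*L) (y := L) (Nat.succ_le_of_lt hpos) (fun n => PP (n/(P.1*P.2)))
      simp only [Nat.mul_div_cancel_left _ hpos] at this
      rw [show (fun e => PP e) = PP from rfl] at this
      rw [← this]
      unfold SS
      exact Finset.sum_congr rfl fun n _ => by ring
    have hlog : Real.log ((P.1*P.2:ℕ):ℝ) = Real.log P.1 + Real.log P.2 := by
      push_cast
      exact Real.log_mul (by exact_mod_cast p1.ne_zero) (by exact_mod_cast p2.ne_zero)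
    rw [div_lt_iff₀ hL0] at u2 v2
    rw [le_div_iff₀ hL0] at u1 v1
    obtain ⟨y, hy⟩ : ∃ y : ℝ, y = L - Real.log ((P.1*P.2:ℕ):ℝ) := ⟨_, rfl⟩
    have hbL : b*L ≤ 1/3*L := by gcongr
    have hdL : d*L ≤ 1/3*L := by gcongr
    have haL : 0 < a*L := by positivity
    have hcL : 0 < c*L := by positivity
    have y1 : L/3 ≤ y := by rw [hy, hlog]; linarith
    have y2 : y ≤ L := by rw [hy, hlog]; linarith
    have h3 := (hPW N hN y (by linarith) y2).1
    have h4 : 1/3 ≤ y/L := by rw [le_div_iff₀ hL0]; linarith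
    have h5 : 1/(y/L - 2*ε) ≤ 302/100 := by
      rw [div_le_iff₀ (by linarith)]; linarith
    have h6 : (1/(y/L - 2*ε) + 1/1000) * (1 + 1/1000) / L ≤ (304/100)/L := by
      refine div_le_div_of_nonneg_right ?_ hL0.le
      linarith
    have h7 : SS (N/(P.1*P.2)) (ε*L) y PP ≤ (304/100)/L :=
      (SS_monoN hlpos PP_nonneg (Nat.div_le_self _ _)).trans (h3.trans h6)
    rw [e1, ← hy]
    have h8 : (1/((P.1*P.2:ℕ):ℝ)) = (1/(P.1:ℝ)) * (1/(P.2:ℝ)) := by push_cast; rw [one_div_mul_one_div]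
    rw [h8]
    exact mul_le_mul_of_nonneg_left h7 (by positivity)
  refine (Finset.sum_le_sum hterm).trans ?_
  rw [← Finset.sum_mul, Finset.sum_product]
  dsimp only
  rw [← Finset.sum_mul_sum]
  refine mul_le_mul_of_nonneg_right ?_ (by positivity)
  refine mul_le_mul (by linarith) (by linarith) (Finset.sum_nonneg fun p _ => by positivity) ?_
  have := Real.log_nonneg ((one_le_div ha).mpr hab.le)
  linarith

lemma log_le_of_quad {x t : ℝ} (hx : 0 < x) (ht : 0 ≤ t) (h : x ≤ 1 + t + t^2/2) : Real.log x ≤ t := by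
  rw [Real.log_le_iff_le_exp hx]
  exact h.trans (Real.quadratic_le_exp_of_nonneg ht)

lemma EE_sum {ε : ℝ} (hε : 0 < ε) (hε1 : ε ≤ 1/1000) : ∀ᶠ L : ℝ in atTop, ∀ N : ℕ, Real.exp (2*L) ≤ N →
    SS N (ε*L) L (EE L) ≤ (46/100)/L := by
  filter_upwards [bx_sum (a := 1/4) (b := 7/24) (c := 5/24) (d := 7/24) hε hε1 (by norm_num) (by norm_num) (by norm_num) (by norm_num) (by norm_num) (by norm_num),
    bx_sum (a := 7/24) (b := 1/3) (c := 1/6) (d := 1/3) hε hε1 (by norm_num) (by norm_num) (by norm_num) (by norm_num) (by norm_num) (by norm_num),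
    eventually_ge_atTop 1] with L H1 H2 hL N hN
  have hL0 : 0 < L := by linarith
  have hlpos : 0 < ε*L := by positivity
  have h1 := H1 N hN
  have h2 := H2 N hN
  have h0 := SS_mono (N := N) (y := L) hlpos (f := EE L) (g := fun n => bx L (1/4) (7/24) (5/24) (7/24) n + bx L (7/24) (1/3) (1/6) (1/3) n) (fun n _ _ => EE_le hL0)
  rw [SS_add] at h0
  norm_num only at h1 h2
  have l1 : Real.log (7/6) ≤ 155/1000 := log_le_of_quad (by norm_num) (by norm_num) (by norm_num)
  have l2 : Real.log (8/7) ≤ 135/1000 := log_le_of_quad (by norm_num) (by norm_num) (by norm_num)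
  have l3 : Real.log (7/5) ≤ 342/1000 := log_le_of_quad (by norm_num) (by norm_num) (by norm_num)
  have l4 := Real.log_two_lt_d9
  have n1 : 0 ≤ Real.log (7/6) := Real.log_nonneg (by norm_num)
  have n2 : 0 ≤ Real.log (8/7) := Real.log_nonneg (by norm_num)
  have n3 : 0 ≤ Real.log (7/5) := Real.log_nonneg (by norm_num)
  have n4 : 0 ≤ Real.log 2 := Real.log_nonneg (by norm_num)
  have m1 : (Real.log (7/6) + 1/1000) * (Real.log (7/5) + 1/1000) ≤ (156/1000)*(343/1000) :=
    mul_le_mul (by linarith) (by linarith) (by linarith) (by norm_num)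
  have m2 : (Real.log (8/7) + 1/1000) * (Real.log 2 + 1/1000) ≤ (136/1000)*(695/1000) :=
    mul_le_mul (by linarith) (by linarith) (by linarith) (by norm_num)
  have hq : 0 ≤ (304/100)/L := by positivity
  have m1' := mul_le_mul_of_nonneg_right m1 hq
  have m2' := mul_le_mul_of_nonneg_right m2 hq
  have : (46/100)/L = (46/304) * ((304/100)/L) := by ring
  norm_num only at m1' m2' hq this ⊢ h0
  have hfin : ((13377:ℝ) / 250000 + 2363/25000) * (76/25/L) ≤ 23/50/L := by
    rw [this]
    refine mul_le_mul_of_nonneg_right (by norm_num) hq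
  linarith

end

section
open Finset Filter

lemma short_primes : ∀ᶠ L : ℝ in atTop, ∃ p : ℕ, p.Prime ∧ |Real.log p - L| < Real.exp (-L/3) := by
  obtain ⟨R, hR, hI⟩ := typeI
  obtain ⟨C, hC, hpt⟩ := pt_all R (by omega)
  obtain ⟨CB, hCB, hbad⟩ := bad_sum (R := R) (by omega)
  obtain ⟨e, he⟩ : ∃ e : ℝ, e = (1/100)/((2*C+1)*CB+1) := ⟨_, rfl⟩
  have hden : 0 < (2*C+1)*CB+1 := by positivity
  have he0 : 0 < e := by rw [he]; positivity
  have he1 : e ≤ 1/100 := by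
    rw [he]
    refine div_le_self (by norm_num) ?_
    have : 0 ≤ (2*C+1)*CB := by positivity
    linarith
  have heC : (2*C+1)*CB*e ≤ 1/100 := by
    have : ((2*C+1)*CB+1)*e = 1/100 := by rw [he]; field_simp
    linarith
  obtain ⟨q, hq⟩ := exists_nat_ge (4/e)
  rw [div_le_iff₀ he0] at hq
  have hq1 : 1 ≤ q := by
    by_contra h
    have : q = 0 := by omega
    rw [this] at hq; norm_num at hq
  obtain ⟨ε0, hε0, hII⟩ := II_diff (R := R) (q := q) (e := e/2) (by omega) hq1 (by positivity)
  obtain ⟨ε, hε⟩ : ∃ ε : ℝ, ε = min ε0 (min (1/1000) (e/2)) := ⟨_, rfl⟩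
  have hεp : 0 < ε := by rw [hε]; positivity
  have hε1 : ε ≤ ε0 := by rw [hε]; exact min_le_left _ _
  have hε2 : ε ≤ 1/1000 := by rw [hε]; exact (min_le_right _ _).trans (min_le_left _ _)
  have hε3 : ε ≤ e/2 := by rw [hε]; exact (min_le_right _ _).trans (min_le_right _ _)
  have hsm : ∀ᶠ L : ℝ in atTop, Real.exp (-L/3) ≤ ε*L := by
    filter_upwards [eventually_ge_atTop (1/ε), eventually_ge_atTop 0] with L h1 h2
    rw [div_le_iff₀ hεp] at h1
    have : Real.exp (-L/3) ≤ 1 := Real.exp_le_one_iff.mpr (by linarith)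
    linarith
  filter_upwards [hI ε hεp hε2, hII ε hεp hε1, hbad e ε he0 he1 hεp hε2, PW hεp hε2, EE_sum hεp hε2, hsm, eventually_ge_atTop 1] with L gI gII gB gP gE gs hL
  have hL0 : 0 < L := by linarith
  by_contra hno
  push Not at hno
  obtain ⟨N, hN⟩ := exists_nat_ge (Real.exp (2*L))
  obtain ⟨D, hD⟩ : ∃ D : ℕ → ℝ, D = fun n => GG L (Real.exp (L/R)) n - IIs (e/2) (1/((R:ℝ)*q)) L q (2*R*q) (2*R) n := ⟨_, rfl⟩
  have hwin : ∀ n : ℕ, ∀ l : ℝ, l ≤ ε*L → |Real.log n - L| < l → |Real.log n / L - 1| ≤ ε := by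
    intro n l hl h
    have : Real.log n / L - 1 = (Real.log n - L)/L := by field_simp
    rw [this, abs_div, abs_of_pos hL0, div_le_iff₀ hL0]
    linarith
  have hpos1 : 0 < Real.exp (-L/3) := Real.exp_pos _
  have hpos0 : 0 < ε*L := by positivity
  have hpw : ∀ n ∈ Icc 1 N, ∀ l : ℝ, l ≤ ε*L → |Real.log n - L| < l → D n ≤ PP n + C * BB e L (Real.exp (L/R)) n ∧
      PP n - 2 * EE L n - (C+1) * BB e L (Real.exp (L/R)) n ≤ D n := by
    intro n hn l hl h
    rw [hD]
    have hn0 : n ≠ 0 := by have := (mem_Icc.mp hn).1; omega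
    exact hpt q n e ε L hq1 hL0 hεp.le (by linarith) (by linarith) (by linarith) hq hn0 (hwin n l hl h)
  have up : SS N (Real.exp (-L/3)) L D ≤ SS N (Real.exp (-L/3)) L PP + C * SS N (Real.exp (-L/3)) L (BB e L (Real.exp (L/R))) := by
    have := SS_mono (N := N) (y := L) hpos1 (f := D) (g := fun n => PP n + C * BB e L (Real.exp (L/R)) n) (fun n hn h => (hpw n hn _ gs h).1)
    rwa [SS_add N _ L PP (fun n => C * BB e L (Real.exp (L/R)) n), SS_smul] at this
  have lo : SS N (ε*L) L PP - 2 * SS N (ε*L) L (EE L) - (C+1) * SS N (ε*L) L (BB e L (Real.exp (L/R))) ≤ SS N (ε*L) L D := by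
    have := SS_mono (N := N) (y := L) hpos0 (g := D) (f := fun n => PP n - 2 * EE L n - (C+1) * BB e L (Real.exp (L/R)) n) (fun n hn h => (hpw n hn _ le_rfl h).2)
    rwa [SS_sub N _ L (fun n => PP n - 2 * EE L n) (fun n => (C+1) * BB e L (Real.exp (L/R)) n), SS_sub N _ L PP (fun n => 2 * EE L n), SS_smul, SS_smul] at this
  have hP0 : SS N (Real.exp (-L/3)) L PP = 0 := by
    unfold SS
    refine Finset.sum_eq_zero fun n _ => ?_
    unfold PP
    split_ifs with h
    · rw [Wk_zero hpos1 (hno n h)]; ring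
    · ring
  have d1 : SS N (Real.exp (-L/3)) L D = SS N (Real.exp (-L/3)) L (GG L (Real.exp (L/R))) - SS N (Real.exp (-L/3)) L (IIs (e/2) (1/((R:ℝ)*q)) L q (2*R*q) (2*R)) := by
    rw [hD, SS_sub]
  have d0 : SS N (ε*L) L D = SS N (ε*L) L (GG L (Real.exp (L/R))) - SS N (ε*L) L (IIs (e/2) (1/((R:ℝ)*q)) L q (2*R*q) (2*R)) := by
    rw [hD, SS_sub]
  have i1 := (abs_le.mp (gI N hN)).1
  have i2 := (abs_le.mp (gII N hN)).2
  have b1 := gB N _ (Or.inl rfl)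
  have b0 := gB N _ (Or.inr rfl)
  have c1 := mul_le_mul_of_nonneg_left b1 hC
  have c0 := mul_le_mul_of_nonneg_left b0 (by linarith : 0 ≤ C+1)
  have hE := gE N hN
  have hP := (gP N hN L (by linarith) le_rfl).2
  have hP' : (99/100)/L ≤ SS N (ε*L) L PP := by
    refine le_trans ?_ hP
    refine div_le_div_of_nonneg_right ?_ hL0.le
    rw [div_self hL0.ne']
    have : 995/1000 ≤ 1/(1+2*ε) := by rw [le_div_iff₀ (by linarith)]; linarith
    linarith
  have hBt : C * (CB*e/L) + (C+1)*(CB*e/L) ≤ (1/100)/L := by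
    have : C * (CB*e/L) + (C+1)*(CB*e/L) = ((2*C+1)*CB*e)/L := by ring
    rw [this]
    exact div_le_div_of_nonneg_right heC hL0.le
  have hfin : (99/100)/L ≤ 2*((46/100)/L) + (1/100)/L + 2*((1/100)/L) := by linarith
  have hLi : 0 < 1/L := by positivity
  have : (99/100)/L - (2*((46/100)/L) + (1/100)/L + 2*((1/100)/L)) = (4/100)*(1/L) := by ring
  linarith

lemma prime_gaps : ∃ X0 : ℝ, ∀ x : ℝ, X0 ≤ x → ∃ p : ℕ, p.Prime ∧ |(p:ℝ) - x| ≤ 2 * x ^ ((2:ℝ)/3) := by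
  obtain ⟨L0, h⟩ := eventually_atTop.mp short_primes
  refine ⟨max 1 (Real.exp L0), fun x hx => ?_⟩
  have hx1 : 1 ≤ x := (le_max_left _ _).trans hx
  have hx0 : 0 < x := by linarith
  have hxL : L0 ≤ Real.log x := (Real.le_log_iff_exp_le hx0).mpr ((le_max_right _ _).trans hx)
  obtain ⟨p, hp, hpl⟩ := h _ hxL
  refine ⟨p, hp, ?_⟩
  have hp0 : (0:ℝ) < p := by exact_mod_cast hp.pos
  have hlx : 0 ≤ Real.log x := Real.log_nonneg hx1
  obtain ⟨d, hd⟩ : ∃ d : ℝ, d = Real.log p - Real.log x := ⟨_, rfl⟩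
  rw [← hd] at hpl
  have hpx : (p:ℝ) = x * Real.exp d := by
    rw [hd, Real.exp_sub, Real.exp_log hp0, Real.exp_log hx0]; field_simp
  have hd1 : |d| ≤ 1 := hpl.le.trans (Real.exp_le_one_iff.mpr (by linarith))
  have h1 := Real.abs_exp_sub_one_le hd1
  have h2 : (p:ℝ) - x = x * (Real.exp d - 1) := by rw [hpx]; ring
  rw [h2, abs_mul, abs_of_pos hx0]
  have h3 : x ^ ((2:ℝ)/3) = x * Real.exp (-Real.log x/3) := by
    rw [Real.rpow_def_of_pos hx0]
    nth_rewrite 2 [← Real.exp_log hx0]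
    rw [← Real.exp_add]
    congr 1; ring
  rw [h3]
  have h4 : x * |Real.exp d - 1| ≤ x * (2 * Real.exp (-Real.log x/3)) := by
    refine mul_le_mul_of_nonneg_left ?_ hx0.le
    linarith
  linarith

end

/-- `F₂(n) = n^{1/2} + O(n^{1/3})`. -/
theorem F2_eq_sqrt_add_bigO_cbrt :
    ∃ C : ℝ, 0 < C ∧ ∀ n : ℕ, 0 < n →
      |(F2 n : ℝ) - Real.sqrt n| ≤ C * (n : ℝ) ^ ((1 : ℝ) / 3) := by
  obtain ⟨X0, h⟩ := prime_gaps
  exact F2_of_gaps 2 X0 h
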